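/- Let 2 < λ ≤ 8 (equivalently λ = 2/α with 1/4 ≤ α < 1) and let u be a solution of the mean field equation Δu = λ(1−e^u) on S² with u(−x) = u(x) for all x ∈ S². If P ∈ S² is a critical point of u (i.e. the total derivative of the chart representation of u vanishes at the point of ℝ² corresponding to P, in the north-pole chart if P ≠ (0,0,1) and in the south-pole chart if P = (0,0,1)), then u is evenly symmetric about the plane through the origin orthogonal to P: u(x − 2⟨x,P⟩P) = u(x) for all x ∈ S². -/

import Mathlib

open Real MeasureTheory

noncomputable section

/-- Euclidean Laplacian on ℝ² via the second iterated derivative. -/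
def lap (w : ℝ × ℝ → ℝ) (y : ℝ × ℝ) : ℝ :=
  iteratedFDeriv ℝ 2 w y ![(1, 0), (1, 0)] + iteratedFDeriv ℝ 2 w y ![(0, 1), (0, 1)]

/-- The unit sphere S² ⊂ ℝ³ (vectors encoded as functions `Fin 3 → ℝ`). -/
def sphere3 : Set (Fin 3 → ℝ) := {x | x 0 ^ 2 + x 1 ^ 2 + x 2 ^ 2 = 1}

/-- Inverse stereographic projection from the north pole. -/
def stereoN (y : ℝ × ℝ) : Fin 3 → ℝ :=
  ![2 * y.1 / (1 + y.1 ^ 2 + y.2 ^ 2), 2 * y.2 / (1 + y.1 ^ 2 + y.2 ^ 2),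
    (y.1 ^ 2 + y.2 ^ 2 - 1) / (1 + y.1 ^ 2 + y.2 ^ 2)]

/-- South-pole parametrization of the sphere. -/
def stereoS (y : ℝ × ℝ) : Fin 3 → ℝ :=
  ![2 * y.1 / (1 + y.1 ^ 2 + y.2 ^ 2), 2 * y.2 / (1 + y.1 ^ 2 + y.2 ^ 2),
    (1 - y.1 ^ 2 - y.2 ^ 2) / (1 + y.1 ^ 2 + y.2 ^ 2)]

/-- `u` is a solution of the mean field equation `Δu = lam (1 - e^u)` on `S²`,
expressed in the two stereographic charts. -/
def IsMFSolution (lam : ℝ) (u : (Fin 3 → ℝ) → ℝ) : Prop :=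
  ContinuousOn u sphere3 ∧
  ContDiff ℝ 2 (fun y => u (stereoN y)) ∧
  ContDiff ℝ 2 (fun y => u (stereoS y)) ∧
  (∀ y : ℝ × ℝ, lap (fun z => u (stereoN z)) y =
    4 * lam * (1 - Real.exp (u (stereoN y))) / (1 + y.1 ^ 2 + y.2 ^ 2) ^ 2) ∧
  (∀ y : ℝ × ℝ, lap (fun z => u (stereoS z)) y =
    4 * lam * (1 - Real.exp (u (stereoS y))) / (1 + y.1 ^ 2 + y.2 ^ 2) ^ 2)

/-- `u` is axially symmetric on `S²`: constant on the level sets of `⟨·, e⟩`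
for some unit vector `e`. -/
def AxiallySymmetric (u : (Fin 3 → ℝ) → ℝ) : Prop :=
  ∃ e : Fin 3 → ℝ, e 0 ^ 2 + e 1 ^ 2 + e 2 ^ 2 = 1 ∧
    ∀ x ∈ sphere3, ∀ x' ∈ sphere3,
      x 0 * e 0 + x 1 * e 1 + x 2 * e 2 = x' 0 * e 0 + x' 1 * e 1 + x' 2 * e 2 →
      u x = u x'

/-- Surface integral over `S²`, written in the north-pole stereographic chart. -/
def sphereIntegral (f : (Fin 3 → ℝ) → ℝ) : ℝ :=
  ∫ y : ℝ × ℝ, f (stereoN y) * (4 / (1 + y.1 ^ 2 + y.2 ^ 2) ^ 2)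

namespace MF

open Set Filter Topology Complex Metric

/-- The Cauchy-Riemann operator. -/
def dbar (f : ℂ → ℂ) (z : ℂ) : ℂ := (fderiv ℝ f z 1 + I * fderiv ℝ f z I) / 2

lemma clm_apply_complex (L : ℂ →L[ℝ] ℂ) (w : ℂ) : L w = w.re * L 1 + w.im * L I := by
  have h : w = w.re • (1 : ℂ) + w.im • I := by
    simp [Complex.re_add_im]
  conv_lhs => rw [h]
  rw [map_add, map_smul, map_smul]
  simp

/-- polar map -/
def pol (p : ℝ × ℝ) : ℂ := p.1 * exp (p.2 * I)

lemma pol_eq (p : ℝ × ℝ) : Complex.polarCoord.symm p = pol p := by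
  rw [Complex.polarCoord_symm_apply, pol, Complex.exp_mul_I]
  simp

lemma continuous_pol : Continuous pol := by unfold pol; fun_prop

lemma norm_pol (p : ℝ × ℝ) : ‖pol p‖ = |p.1| := by
  simp [pol]

lemma hasDerivAt_pol_r (r θ : ℝ) : HasDerivAt (fun r : ℝ => pol (r, θ)) (exp (θ * I)) r := by
  simpa [pol] using (Complex.ofRealCLM.hasDerivAt (x := r)).mul_const (exp (θ * I))

lemma hasDerivAt_pol_th (r θ : ℝ) : HasDerivAt (fun θ : ℝ => pol (r, θ)) (r * (I * exp (θ * I))) θ := by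
  have h1 : HasDerivAt (fun θ : ℝ => ((θ : ℂ) * I)) I θ := by
    simpa using (Complex.ofRealCLM.hasDerivAt (x := θ)).mul_const I
  simpa [pol, mul_comm, mul_left_comm] using (h1.cexp).const_mul (r : ℂ)

lemma polar_integrableOn {E : Type*} [NormedAddCommGroup E] {F : ℝ × ℝ → E} (hF : Continuous F)
    (R : ℝ) (h0 : ∀ r θ, R < r → F (r, θ) = 0) :
    IntegrableOn F (Ioi (0:ℝ) ×ˢ Ioo (-π) π) := by
  have h1 : IntegrableOn F (Icc 0 R ×ˢ Icc (-π) π) :=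
    (hF.continuousOn).integrableOn_compact (isCompact_Icc.prod isCompact_Icc)
  have h2 : IntegrableOn F ((Icc 0 R ×ˢ Icc (-π) π) ∩ (Ioi (0:ℝ) ×ˢ Ioo (-π) π)) :=
    h1.mono_set inter_subset_left
  refine IntegrableOn.of_forall_sdiff_eq_zero h2 (measurableSet_Ioi.prod measurableSet_Ioo) ?_
  rintro ⟨r, θ⟩ ⟨⟨hr, hθ⟩, hn⟩
  apply h0
  by_contra hc
  exact hn ⟨⟨⟨le_of_lt hr, not_lt.1 hc⟩, ⟨hθ.1.le, hθ.2.le⟩⟩, hr, hθ⟩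

lemma polar_integral {E : Type*} [NormedAddCommGroup E] [NormedSpace ℝ E] (f : ℂ → E) :
    ∫ z, f z = ∫ p in Ioi (0:ℝ) ×ˢ Ioo (-π) π, p.1 • f (pol p) := by
  rw [← Complex.integral_comp_polarCoord_symm]
  simp only [pol_eq]
  rfl

lemma setIntegral_prod_polar {E : Type*} [NormedAddCommGroup E] [NormedSpace ℝ E] 
    {F : ℝ × ℝ → E} (hF : IntegrableOn F (Ioi (0:ℝ) ×ˢ Ioo (-π) π)) :
    ∫ p in Ioi (0:ℝ) ×ˢ Ioo (-π) π, F p = ∫ r in Ioi (0:ℝ), ∫ θ in Ioo (-π) π, F (r, θ) := by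
  rw [Measure.volume_eq_prod] at *
  exact setIntegral_prod _ hF

lemma setIntegral_prod_polar_swap {E : Type*} [NormedAddCommGroup E] [NormedSpace ℝ E] 
    {F : ℝ × ℝ → E} (hF : IntegrableOn F (Ioi (0:ℝ) ×ˢ Ioo (-π) π)) :
    ∫ p in Ioi (0:ℝ) ×ˢ Ioo (-π) π, F p = ∫ θ in Ioo (-π) π, ∫ r in Ioi (0:ℝ), F (r, θ) := by
  rw [Measure.volume_eq_prod] at *
  rw [← Measure.prod_restrict, integral_prod_symm]
  rwa [Measure.prod_restrict]

lemma integral_circle_deriv {E : Type*} [NormedAddCommGroup E] [NormedSpace ℝ E] [CompleteSpace E]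
    {g g' : ℝ → E} (h : ∀ θ, HasDerivAt g (g' θ) θ) (hc : Continuous g') (hp : g (-π) = g π) :
    ∫ θ in Ioo (-π) π, g' θ = 0 := by
  rw [← integral_Ioc_eq_integral_Ioo, ← intervalIntegral.integral_of_le (by linarith [Real.pi_pos])]
  rw [intervalIntegral.integral_eq_sub_of_hasDerivAt (fun x _ => h x) (hc.intervalIntegrable _ _)]
  simp [hp]

lemma pol_neg_pi (r : ℝ) : pol (r, -π) = pol (r, π) := by
  simp [pol, Complex.exp_neg]

theorem cauchy_pompeiu {b : ℂ → ℂ} (hb : ContDiff ℝ 1 b) (hs : HasCompactSupport b) :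
    ∫ z, dbar b z / z = - π * b 0 := by
  have hd : ∀ z, HasFDerivAt b (fderiv ℝ b z) z := fun z =>
    (hb.differentiable one_ne_zero z).hasFDerivAt
  have hcd : Continuous (fderiv ℝ b) := hb.continuous_fderiv one_ne_zero
  obtain ⟨R, hRs⟩ := hs.isCompact.isBounded.subset_closedBall 0
  have hR0 : ∀ z, R < ‖z‖ → b z = 0 := fun z hz => by
    by_contra h
    have := hRs (subset_tsupport b h)
    simp at this; linarith
  have hR1 : ∀ z, R < ‖z‖ → fderiv ℝ b z = 0 := fun z hz => by
    by_contra h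
    have := hRs (tsupport_fderiv_subset ℝ (subset_tsupport _ h))
    simp at this; linarith
  set Rf : ℝ × ℝ → ℂ := fun p => fderiv ℝ b (pol p) (exp (p.2 * I)) with hRf
  set Tf : ℝ × ℝ → ℂ := fun p => fderiv ℝ b (pol p) (I * exp (p.2 * I)) with hTf
  have cR : Continuous Rf := (hcd.comp continuous_pol).clm_apply (by fun_prop)
  have cT : Continuous Tf := (hcd.comp continuous_pol).clm_apply (by fun_prop)
  have zR : ∀ r θ, |R| < r → Rf (r, θ) = 0 := fun r θ h => by
    have : fderiv ℝ b (pol (r, θ)) = 0 := hR1 _ (by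
      rw [norm_pol]; exact lt_of_le_of_lt (le_abs_self R) (h.trans_le (le_abs_self r)))
    simp [hRf, this]
  have zT : ∀ r θ, |R| < r → Tf (r, θ) = 0 := fun r θ h => by
    have : fderiv ℝ b (pol (r, θ)) = 0 := hR1 _ (by
      rw [norm_pol]; exact lt_of_le_of_lt (le_abs_self R) (h.trans_le (le_abs_self r)))
    simp [hTf, this]
  have iR := polar_integrableOn cR |R| zR
  have iT := polar_integrableOn cT |R| zT
  rw [polar_integral]
  have e1 : ∫ p in Ioi (0:ℝ) ×ˢ Ioo (-π) π, p.1 • (dbar b (pol p) / pol p)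
      = ∫ p in Ioi (0:ℝ) ×ˢ Ioo (-π) π, ((1/2 : ℂ) * Rf p + (I/2) * Tf p) := by
    apply setIntegral_congr_fun (measurableSet_Ioi.prod measurableSet_Ioo)
    rintro ⟨r, θ⟩ ⟨hr, -⟩
    have hr0 : (r : ℂ) ≠ 0 := by exact_mod_cast (ne_of_gt hr)
    have he : exp ((θ:ℂ) * I) ≠ 0 := Complex.exp_ne_zero _
    have hE : exp ((θ:ℂ) * I) = Real.cos θ + Real.sin θ * I := by
      rw [Complex.exp_mul_I]; simp
    have hinv : (exp ((θ:ℂ) * I))⁻¹ = Real.cos θ - Real.sin θ * I := by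
      rw [← Complex.exp_neg, ← neg_mul, Complex.exp_mul_I]; simp [sub_eq_add_neg]
    have : dbar b (pol (r, θ)) / pol (r, θ) = (r:ℂ)⁻¹ * (dbar b (pol (r, θ)) * (exp ((θ:ℂ) * I))⁻¹) := by
      simp only [pol]; field_simp
    simp only [hRf, hTf]
    rw [this, Complex.real_smul, ← mul_assoc, mul_inv_cancel₀ hr0, one_mul, hinv, dbar,
      clm_apply_complex _ (Complex.exp _), clm_apply_complex _ (I * Complex.exp _), hE]
    set A := fderiv ℝ b (pol (r, θ)) 1
    set B := fderiv ℝ b (pol (r, θ)) I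
    have h1 : ((Real.cos θ : ℂ) + Real.sin θ * I).re = Real.cos θ := by simp [-Complex.ofReal_cos, -Complex.ofReal_sin]
    have h2 : ((Real.cos θ : ℂ) + Real.sin θ * I).im = Real.sin θ := by simp [-Complex.ofReal_cos, -Complex.ofReal_sin]
    have h3 : (I * ((Real.cos θ : ℂ) + Real.sin θ * I)).re = -Real.sin θ := by simp [-Complex.ofReal_cos, -Complex.ofReal_sin]
    have h4 : (I * ((Real.cos θ : ℂ) + Real.sin θ * I)).im = Real.cos θ := by simp [-Complex.ofReal_cos, -Complex.ofReal_sin]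
    rw [h1, h2, h3, h4]
    push_cast
    ring_nf
    rw [Complex.I_sq]; ring
  rw [e1, integral_add (iR.integrable.const_mul _) (iT.integrable.const_mul _), integral_const_mul, integral_const_mul,
    setIntegral_prod_polar_swap iR, setIntegral_prod_polar iT]
  have e2 : ∀ θ, ∫ r in Ioi (0:ℝ), Rf (r, θ) = - b 0 := by
    intro θ
    have hD : ∀ r : ℝ, HasDerivAt (fun r => b (pol (r, θ))) (Rf (r, θ)) r := fun r => by
      have := (hd (pol (r, θ))).comp_hasDerivAt r (hasDerivAt_pol_r r θ)
      exact this
    have hI : IntegrableOn (fun r => Rf (r, θ)) (Ioi 0) := by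
      have h1 : IntegrableOn (fun r => Rf (r, θ)) (Icc 0 |R|) :=
        (Continuous.continuousOn (by fun_prop)).integrableOn_compact isCompact_Icc
      refine IntegrableOn.of_forall_sdiff_eq_zero h1 measurableSet_Ioi ?_
      rintro r ⟨hr, hn⟩
      apply zR
      by_contra hc
      exact hn ⟨le_of_lt hr, not_lt.1 hc⟩
    have := integral_Ioi_of_hasDerivAt_of_tendsto' (m := 0) (fun r _ => hD r) hI ?_
    · rw [this]; simp [pol]
    · apply tendsto_const_nhds.congr'
      filter_upwards [eventually_gt_atTop |R|] with r hr
      exact (hR0 _ (by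
        rw [norm_pol]; exact lt_of_le_of_lt (le_abs_self R) (hr.trans_le (le_abs_self r)))).symm
  have e3 : ∀ r ∈ Ioi (0:ℝ), ∫ θ in Ioo (-π) π, Tf (r, θ) = 0 := by
    intro r hr
    have hr0 : (r : ℂ) ≠ 0 := by exact_mod_cast (ne_of_gt hr)
    have hD : ∀ θ : ℝ, HasDerivAt (fun θ => (r:ℂ)⁻¹ * b (pol (r, θ))) (Tf (r, θ)) θ := fun θ => by
      have := ((hd (pol (r, θ))).comp_hasDerivAt θ (hasDerivAt_pol_th r θ)).const_mul (r:ℂ)⁻¹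
      have e : Tf (r, θ) = (r:ℂ)⁻¹ * (fderiv ℝ b (pol (r, θ))) (r * (I * Complex.exp (θ * I))) := by
        rw [← Complex.real_smul (x := r), map_smul, Complex.real_smul, ← mul_assoc,
          inv_mul_cancel₀ hr0, one_mul]
      rw [e]
      exact this
    apply integral_circle_deriv hD (by fun_prop)
    rw [pol_neg_pi]
  rw [setIntegral_congr_fun measurableSet_Ioi e3]
  simp only [e2]
  simp
  rw [max_eq_left (by linarith [Real.pi_pos])]
  push_cast
  ring

end MF

namespace MF

open Set Filter Topology Complex Metric

lemma locInt_inv : LocallyIntegrable (fun z : ℂ => z⁻¹) := by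
  refine locallyIntegrable_of_norm_le_rpow (C := 1) (α := 1) (by simp) (by simp) ?_ ?_
  · filter_upwards with x
    rw [norm_inv, one_mul, Real.rpow_neg_one]
  · exact (measurable_inv).aestronglyMeasurable

lemma integral_pos_part (k c : ℝ) (hc : 0 < c) :
    ∫ r in Ioi (0:ℝ), max (k - c * r) 0 = (max k 0) ^ 2 / (2 * c) := by
  rcases le_or_gt k 0 with hk | hk
  · rw [max_eq_right hk]
    rw [setIntegral_congr_fun (g := fun _ => (0:ℝ)) measurableSet_Ioi]
    · simp
    · intro r hr
      simp only [mem_Ioi] at hr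
      exact max_eq_right (by nlinarith)
  · rw [max_eq_left hk.le]
    have h1 : ∫ r in Ioi (0:ℝ), max (k - c * r) 0 = ∫ r in Ioc (0:ℝ) (k/c), (k - c * r) := by
      rw [← integral_indicator measurableSet_Ioi, ← integral_indicator measurableSet_Ioc]
      congr 1
      ext r
      by_cases h0 : 0 < r
      · by_cases h2 : r ≤ k / c
        · rw [indicator_of_mem (by exact h0), indicator_of_mem (by exact ⟨h0, h2⟩)]
          rw [le_div_iff₀ hc] at h2
          exact max_eq_left (by linarith)
        · rw [indicator_of_mem (by exact h0), indicator_of_notMem (fun h => h2 h.2)]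
          rw [le_div_iff₀ hc] at h2
          exact max_eq_right (by linarith)
      · rw [indicator_of_notMem (by exact h0), indicator_of_notMem (fun h => h0 h.1)]
    rw [h1, ← intervalIntegral.integral_of_le (by positivity)]
    rw [intervalIntegral.integral_eq_sub_of_hasDerivAt (f := fun r => k * r - c * r ^ 2 / 2)]
    · field_simp; ring
    · intro x _
      have h3 : HasDerivAt (fun r => k * r - c * r ^ 2 / 2) _ x :=
        ((hasDerivAt_id x).const_mul k).sub ((((hasDerivAt_pow 2 x).const_mul c)).div_const 2)
      exact h3.congr_deriv (by simp; ring)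
    · exact Continuous.intervalIntegrable (by fun_prop) _ _

lemma integral_cos_pos_sq (α : ℝ) :
    ∫ θ in Ioo (-π) π, (max (Real.cos (α - θ)) 0) ^ 2 = π / 2 := by
  rw [← integral_Ioc_eq_integral_Ioo, ← intervalIntegral.integral_of_le (by linarith [Real.pi_pos])]
  rw [intervalIntegral.integral_comp_sub_left (fun x => (max (Real.cos x) 0) ^ 2) α]
  have hi : ∀ a b : ℝ, IntervalIntegrable (fun x => (max (Real.cos x) 0) ^ 2) volume a b := fun a b =>
    Continuous.intervalIntegrable (by fun_prop) _ _
  rw [← intervalIntegral.integral_add_adjacent_intervals (hi (α - π) α) (hi α (α - -π))]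
  have : ∫ x in α..(α - -π), (max (Real.cos x) 0) ^ 2 =
      ∫ x in (α - π)..α, (max (Real.cos (x + π)) 0) ^ 2 := by
    rw [intervalIntegral.integral_comp_add_right (fun x => (max (Real.cos x) 0) ^ 2) π]
    simp
  rw [this, ← intervalIntegral.integral_add (hi _ _) (Continuous.intervalIntegrable (by fun_prop) _ _)]
  have h2 : ∀ x : ℝ, (max (Real.cos x) 0) ^ 2 + (max (Real.cos (x + π)) 0) ^ 2 = Real.cos x ^ 2 := by
    intro x
    rw [Real.cos_add_pi]
    rcases le_total (Real.cos x) 0 with h | h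
    · rw [max_eq_right h, max_eq_left (by linarith)]; ring
    · rw [max_eq_left h, max_eq_right (by linarith)]; ring
  simp only [h2]
  rw [integral_cos_sq]
  simp [Real.cos_sub, Real.sin_sub]

theorem ahlfors_beurling {b : ℂ → ℝ} (hb : Continuous b) (hs : HasCompactSupport b)
    (h0 : ∀ z, 0 ≤ b z) (h1 : ∀ z, b z ≤ 1) {B : ℝ} (hB : 0 < B) (hBi : ∫ z, b z ≤ B) :
    ‖∫ z, (b z : ℂ) / z‖ ≤ √(π * B) := by
  set J := ∫ z, (b z : ℂ) / z with hJ
  have hI : Integrable (fun z => (b z : ℂ) / z) := by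
    have := locInt_inv.integrable_smul_left_of_hasCompactSupport hb hs
    refine this.congr (ae_of_all _ fun z => ?_)
    simp [div_eq_mul_inv]
  obtain ⟨R, hRs⟩ := hs.isCompact.isBounded.subset_closedBall 0
  have hR0 : ∀ z, R < ‖z‖ → b z = 0 := fun z hz => by
    by_contra h
    have := hRs (subset_tsupport b h)
    simp at this; linarith
  set α := -Complex.arg J with hα
  have hJn : (‖J‖ : ℝ) = (Complex.exp (α * I) * J).re := by
    have h2 := Complex.norm_mul_exp_arg_mul_I J
    have h3 : Complex.exp (α * I) * J = (‖J‖ : ℂ) := by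
      conv_lhs => rw [← h2]
      rw [hα, mul_left_comm, ← Complex.exp_add]
      simp
    rw [h3]; simp
  have key : ∀ c : ℝ, 0 < c → ‖J‖ ≤ c * B + π / (4 * c) := by
    intro c hc
    rw [hJn, hJ, ← integral_const_mul]
    have h4 : (∫ z, Complex.exp (α * I) * ((b z : ℂ) / z)).re =
        ∫ z, (Complex.exp (α * I) * ((b z : ℂ) / z)).re := by
      have := integral_re (𝕜 := ℂ) (hI.const_mul (Complex.exp (α * I)))
      exact this.symm
    rw [h4, polar_integral]
    have c1 : Continuous (fun p : ℝ × ℝ => c * (p.1 * b (pol p))) :=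
      continuous_const.mul (continuous_fst.mul (hb.comp continuous_pol))
    have c2 : Continuous (fun p : ℝ × ℝ => max (Real.cos (α - p.2) - c * p.1) 0) := by fun_prop
    have c3 : Continuous (fun p : ℝ × ℝ => b (pol p) * Real.cos (α - p.2)) :=
      (hb.comp continuous_pol).mul (by fun_prop)
    have hbp : ∀ r θ, |R| < r → b (pol (r, θ)) = 0 := fun r θ h => hR0 _ (by
      rw [norm_pol]; exact lt_of_le_of_lt (le_abs_self R) (h.trans_le (le_abs_self r)))
    have i1 := polar_integrableOn c1 |R| (fun r θ h => by simp [hbp r θ h])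
    have i2 := polar_integrableOn c2 (1 / c) (fun r θ h => by
      apply max_eq_right
      rw [div_lt_iff₀ hc] at h
      have := Real.cos_le_one (α - θ)
      simp only
      linarith)
    have i3 := polar_integrableOn c3 |R| (fun r θ h => by simp [hbp r θ h])
    have e1 : ∫ p in Ioi (0:ℝ) ×ˢ Ioo (-π) π, p.1 • (Complex.exp (α * I) * ((b (pol p) : ℂ) / pol p)).re
      = ∫ p in Ioi (0:ℝ) ×ˢ Ioo (-π) π, b (pol p) * Real.cos (α - p.2) := by
      apply setIntegral_congr_fun (measurableSet_Ioi.prod measurableSet_Ioo)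
      rintro ⟨r, θ⟩ ⟨hr, -⟩
      have hr0 : (r : ℂ) ≠ 0 := by exact_mod_cast (ne_of_gt hr)
      have : Complex.exp (α * I) * ((b (pol (r, θ)) : ℂ) / pol (r, θ)) =
          ((r⁻¹ * b (pol (r, θ)) : ℝ) : ℂ) * Complex.exp (((α - θ : ℝ) : ℂ) * I) := by
        push_cast
        rw [sub_mul, Complex.exp_sub]
        simp only [pol]
        field_simp
      simp only
      rw [this, Complex.re_ofReal_mul, Complex.exp_ofReal_mul_I_re, smul_eq_mul]
      have : r ≠ 0 := ne_of_gt hr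
      field_simp
    rw [e1]
    have e2 : ∫ p in Ioi (0:ℝ) ×ˢ Ioo (-π) π, b (pol p) * Real.cos (α - p.2) ≤
        ∫ p in Ioi (0:ℝ) ×ˢ Ioo (-π) π, (c * (p.1 * b (pol p)) + max (Real.cos (α - p.2) - c * p.1) 0) := by
      apply setIntegral_mono_on i3 (i1.add i2) (measurableSet_Ioi.prod measurableSet_Ioo)
      rintro ⟨r, θ⟩ -
      show b (pol (r, θ)) * Real.cos (α - θ) ≤ c * (r * b (pol (r, θ))) + max (Real.cos (α - θ) - c * r) 0
      have ha := h0 (pol (r, θ))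
      have hb' := h1 (pol (r, θ))
      have hm := le_max_left (Real.cos (α - θ) - c * r) 0
      have hm0 := le_max_right (Real.cos (α - θ) - c * r) 0
      nlinarith
    refine e2.trans ?_
    rw [integral_add i1 i2, integral_const_mul]
    have e3 : ∫ p in Ioi (0:ℝ) ×ˢ Ioo (-π) π, p.1 * b (pol p) = ∫ z, b z := by
      rw [polar_integral]; rfl
    rw [e3, setIntegral_prod_polar_swap i2]
    simp only [integral_pos_part _ c hc]
    rw [integral_div, integral_cos_pos_sq]
    have : π / 2 / (2 * c) = π / (4 * c) := by field_simp; ring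
    rw [this]
    gcongr
  have hc : 0 < √(π / B) / 2 := by positivity
  refine (key _ hc).trans (le_of_eq ?_)
  have hs1 : √(π * B) = √π * √B := Real.sqrt_mul Real.pi_pos.le B
  have hs2 : √(π / B) = √π / √B := Real.sqrt_div Real.pi_pos.le B
  have hp : √π ^ 2 = π := Real.sq_sqrt Real.pi_pos.le
  have hq : √B ^ 2 = B := Real.sq_sqrt hB.le
  have hB' : √B ≠ 0 := by positivity
  have hP' : √π ≠ 0 := by positivity
  rw [hs1, hs2]
  conv_lhs => rw [← hp, ← hq]
  rw [Real.sqrt_sq (by positivity), Real.sqrt_sq (by positivity)]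
  field_simp
  ring

/-- Cauchy transform of a smooth bump: a primitive for dbar with uniform bound. -/
theorem exists_cauchy_transform {b : ℂ → ℝ} (hb : ContDiff ℝ 1 b) (hs : HasCompactSupport b)
    (h0 : ∀ z, 0 ≤ b z) (h1 : ∀ z, b z ≤ 1) {B : ℝ} (hB : 0 < B) (hBi : ∫ z, b z ≤ B) :
    ∃ g : ℂ → ℂ, ContDiff ℝ 1 g ∧ (∀ z, dbar g z = b z) ∧ ∀ z, ‖g z‖ ≤ √(B / π) := by
  set bc : ℂ → ℂ := fun z => (b z : ℂ) with hbc
  have hbcc : ContDiff ℝ 1 bc := Complex.ofRealCLM.contDiff.comp hb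
  have hbcs : HasCompactSupport bc := hs.comp_left (g := fun x : ℝ => (x : ℂ)) (by simp)
  have hli : LocallyIntegrable (fun z : ℂ => (π : ℂ)⁻¹ * z⁻¹) := by
    have := locInt_inv.smul ((π : ℂ)⁻¹)
    exact this
  refine ⟨convolution (fun z : ℂ => (π : ℂ)⁻¹ * z⁻¹) bc (ContinuousLinearMap.mul ℝ ℂ) volume, ?_, ?_, ?_⟩
  · exact hbcs.contDiff_convolution_right _ hli hbcc
  · intro z
    have hfd := (hbcs.hasFDerivAt_convolution_right (ContinuousLinearMap.mul ℝ ℂ) hli hbcc z).fderiv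
    have ap : ∀ v : ℂ, fderiv ℝ (convolution (fun z : ℂ => (π : ℂ)⁻¹ * z⁻¹) bc (ContinuousLinearMap.mul ℝ ℂ) volume) z v
        = ∫ t, (π : ℂ)⁻¹ * t⁻¹ * fderiv ℝ bc (z - t) v := by
      intro v
      rw [hfd, convolution_precompR_apply _ hli (hbcs.fderiv ℝ) (hbcc.continuous_fderiv one_ne_zero)]
      simp [convolution]
    have ii : ∀ v : ℂ, Integrable (fun t => (π : ℂ)⁻¹ * t⁻¹ * fderiv ℝ bc (z - t) v) := by
      intro v
      have := (hbcs.fderiv_apply ℝ v).convolutionExists_right (ContinuousLinearMap.mul ℝ ℂ) hli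
        ((hbcc.continuous_fderiv one_ne_zero).clm_apply continuous_const) z
      exact this
    have hcp := cauchy_pompeiu (b := fun t => bc (z - t)) (hbcc.comp (contDiff_const.sub contDiff_id)) (by
      exact hbcs.comp_homeomorph (Homeomorph.subLeft z))
    have hdb : ∀ t, dbar (fun t => bc (z - t)) t = - dbar bc (z - t) := by
      intro t
      have : fderiv ℝ (fun t => bc (z - t)) t = - fderiv ℝ bc (z - t) := by
        have h5 : HasFDerivAt (fun t => bc (z - t)) ((fderiv ℝ bc (z - t)).comp (-ContinuousLinearMap.id ℝ ℂ)) t :=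
          ((hbcc.differentiable one_ne_zero (z - t)).hasFDerivAt).comp t ((hasFDerivAt_id t).const_sub z)
        rw [h5.fderiv]; ext <;> simp
      simp only [dbar, this]
      simp; ring
    rw [dbar, ap, ap, ← integral_const_mul, ← integral_add (ii 1) ((ii I).const_mul I)]
    have e : ∀ t : ℂ, (π : ℂ)⁻¹ * t⁻¹ * (fderiv ℝ bc (z - t)) 1 + I * ((π : ℂ)⁻¹ * t⁻¹ * (fderiv ℝ bc (z - t)) I)
       = -(2 / π) * (dbar (fun t => bc (z - t)) t / t) := by
      intro t
      rw [hdb, dbar]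
      field_simp
    simp only [e]
    rw [integral_const_mul, hcp]
    have : (π : ℂ) ≠ 0 := by exact_mod_cast Real.pi_ne_zero
    simp [hbc]
    field_simp
  · intro z
    simp only [convolution, ContinuousLinearMap.mul_apply']
    have e : ∀ t : ℂ, (π : ℂ)⁻¹ * t⁻¹ * bc (z - t) = (π : ℂ)⁻¹ * ((b (z - t) : ℂ) / t) := by
      intro t; simp only [hbc]; ring
    simp only [e]
    rw [integral_const_mul, norm_mul]
    have := ahlfors_beurling (b := fun t => b (z - t)) (hb.continuous.comp (by fun_prop)) 
      (hs.comp_homeomorph (Homeomorph.subLeft z)) (fun t => h0 _) (fun t => h1 _) hB (by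
        rw [integral_sub_left_eq_self b volume z]; exact hBi)
    calc _ ≤ ‖(π : ℂ)⁻¹‖ * √(π * B) := by gcongr
      _ = √(B / π) := by
        have hp : √π ^ 2 = π := Real.sq_sqrt Real.pi_pos.le
        rw [Real.sqrt_mul Real.pi_pos.le, Real.sqrt_div hB.le, norm_inv]
        simp [abs_of_pos Real.pi_pos]
        have : √π ≠ 0 := by positivity
        field_simp
        rw [hp]

end MF

namespace MF

open Set Filter Topology Complex Metric
open scoped Manifold ContDiff

lemma exists_bump {K V : Set ℂ} (hK : IsCompact K) (hV : IsOpen V) (hKV : K ⊆ V) :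
    ∃ b : ℂ → ℝ, ContDiff ℝ ∞ b ∧ HasCompactSupport b ∧ tsupport b ⊆ V ∧ (∀ z, 0 ≤ b z) ∧ (∀ z, b z ≤ 1)
      ∧ ∀ᶠ z in 𝓝ˢ K, b z = 1 := by
  obtain ⟨K', hK', h1, h2⟩ := exists_compact_between hK hV hKV
  obtain ⟨f, hf1, hf0, hfi⟩ := exists_contMDiffMap_one_nhds_of_subset_interior (n := ⊤) 𝓘(ℝ, ℂ) hK.isClosed h1
  have hts : tsupport f ⊆ K' := by
    apply closure_minimal _ hK'.isClosed
    intro z hz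
    by_contra h
    exact hz (hf0 z h)
  exact ⟨f, f.contMDiff.contDiff, HasCompactSupport.of_support_subset_isCompact hK' (fun z hz => hts (subset_tsupport _ hz)), hts.trans h2,
    fun z => (hfi z).1, fun z => (hfi z).2, hf1⟩

lemma integral_fderiv_zero {E : Type*} [NormedAddCommGroup E] [NormedSpace ℝ E]
    {F : ℂ → E} (hF : ContDiff ℝ 1 F) (hs : HasCompactSupport F) (v : ℂ) :
    ∫ z, fderiv ℝ F z v = 0 := by
  obtain ⟨b, hb, hbs, -, -, -, hb1⟩ := exists_bump hs.isCompact isOpen_univ (subset_univ _)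
  have hb' : ContDiff ℝ 1 b := hb.of_le (by exact_mod_cast le_top)
  have cF := hF.continuous_fderiv one_ne_zero
  have cb := hb'.continuous_fderiv one_ne_zero
  have h1 := integral_smul_fderiv_eq_neg_fderiv_smul_of_integrable (μ := (volume : Measure ℂ)) (f := b) (g := F) (v := v)
    (Continuous.integrable_of_hasCompactSupport ((cb.clm_apply continuous_const).smul hF.continuous)
      hs.smul_left)
    (Continuous.integrable_of_hasCompactSupport (hb'.continuous.smul (cF.clm_apply continuous_const))
      hbs.smul_right)
    (Continuous.integrable_of_hasCompactSupport (hb'.continuous.smul hF.continuous)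
      hs.smul_left)
    (fun x _ => hb'.differentiable one_ne_zero x) (fun x _ => hF.differentiable one_ne_zero x)
  have hb2 : ∀ z ∈ tsupport F, b =ᶠ[𝓝 z] fun _ => 1 := fun z hz => by
    rw [eventually_nhdsSet_iff_forall] at hb1
    exact hb1 z hz
  have h2 : ∀ z, b z • fderiv ℝ F z v = fderiv ℝ F z v := fun z => by
    by_cases hz : z ∈ tsupport F
    · rw [(hb2 z hz).eq_of_nhds, one_smul]
    · have : fderiv ℝ F z = 0 := by
        by_contra h
        exact hz (tsupport_fderiv_subset ℝ (subset_tsupport _ h))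
      simp [this]
  have h3 : ∀ z, fderiv ℝ b z v • F z = 0 := fun z => by
    by_cases hz : z ∈ tsupport F
    · rw [(hb2 z hz).fderiv_eq]; simp
    · rw [image_eq_zero_of_notMem_tsupport hz, smul_zero]
  simp only [h2, h3] at h1
  simpa using h1

lemma integral_dbar_zero {F : ℂ → ℂ} (hF : ContDiff ℝ 1 F) (hs : HasCompactSupport F) :
    ∫ z, dbar F z = 0 := by
  have cF := hF.continuous_fderiv one_ne_zero
  have ii : ∀ v, Integrable (fun z => fderiv ℝ F z v) := fun v =>
    Continuous.integrable_of_hasCompactSupport (cF.clm_apply continuous_const) (hs.fderiv_apply ℝ v)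
  simp only [dbar]
  rw [integral_div, integral_add (ii 1) ((ii I).const_mul I), integral_const_mul,
    integral_fderiv_zero hF hs, integral_fderiv_zero hF hs]
  simp

lemma norm_dbar_real {f : ℂ → ℝ} {z : ℂ} (hf : DifferentiableAt ℝ f z) :
    ‖dbar (fun w => (f w : ℂ)) z‖ ≤ ‖fderiv ℝ f z‖ / 2 := by
  have h1 : fderiv ℝ (fun w => (f w : ℂ)) z = Complex.ofRealCLM.comp (fderiv ℝ f z) :=
    (Complex.ofRealCLM.hasFDerivAt.comp z hf.hasFDerivAt).fderiv
  set L := fderiv ℝ f z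
  simp only [dbar, h1]
  simp only [ContinuousLinearMap.comp_apply, Complex.ofRealCLM_apply]
  set w : ℂ := (L 1 : ℂ) + I * (L I : ℂ) with hw
  have hre : w.re = L 1 := by simp [hw]
  have him : w.im = L I := by simp [hw]
  have h2 : L w = ‖w‖ ^ 2 := by
    have h : w = w.re • (1 : ℂ) + w.im • I := by
      simp [Complex.re_add_im]
    conv_lhs => rw [h]
    rw [map_add, map_smul, map_smul, ← Complex.normSq_eq_norm_sq, Complex.normSq_apply, hre, him]
    simp
  rw [norm_div]
  have h3 : ‖w‖ ≤ ‖L‖ := by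
    by_cases h0 : ‖w‖ = 0
    · rw [h0]; positivity
    · have h4 := L.le_opNorm w
      rw [h2, Real.norm_of_nonneg (by positivity)] at h4
      have : 0 < ‖w‖ := lt_of_le_of_ne (norm_nonneg _) (Ne.symm h0)
      nlinarith
  simpa using by linarith

lemma det_mul_complex (c : ℂ) :
    ((ContinuousLinearMap.toSpanSingleton ℂ c).restrictScalars ℝ : ℂ →L[ℝ] ℂ).det = ‖c‖ ^ 2 := by
  simp [ContinuousLinearMap.det, LinearMap.det_restrictScalars]
  rw [← Complex.normSq_eq_norm_sq]
  simp [Algebra.norm_complex_apply]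


lemma hasFDerivAt_real_of_complex {G : ℂ → ℂ} {D z : ℂ} (h : HasDerivAt G D z) :
    HasFDerivAt G ((ContinuousLinearMap.toSpanSingleton ℂ D).restrictScalars ℝ) z :=
  h.hasFDerivAt.restrictScalars ℝ

lemma dbar_product {f : ℂ → ℝ} {D g : ℂ → ℂ} {G : ℂ → ℂ} {z : ℂ} (hf : DifferentiableAt ℝ f z)
    (hG : HasDerivAt G (D z) z) (hD : DifferentiableAt ℂ D z) (hg : DifferentiableAt ℝ g (G z)) :
    dbar (fun w => (f w : ℂ) * D w * g (G w)) z =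
      dbar (fun w => (f w : ℂ)) z * D z * g (G z) + f z * ‖D z‖ ^ 2 * dbar g (G z) := by
  have h1 : HasFDerivAt (fun w => (f w : ℂ)) (Complex.ofRealCLM.comp (fderiv ℝ f z)) z :=
    (Complex.ofRealCLM.hasFDerivAt.comp z hf.hasFDerivAt)
  have h2 := hasFDerivAt_real_of_complex hD.hasDerivAt
  have h3 : HasFDerivAt (fun w => g (G w)) ((fderiv ℝ g (G z)).comp _) z :=
    hg.hasFDerivAt.comp z (hasFDerivAt_real_of_complex hG)
  have h4 := (h1.mul h2).mul h3
  have h5 : fderiv ℝ (fun w => (f w : ℂ) * D w * g (G w)) z = _ := h4.fderiv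
  simp only [dbar, h5, h1.fderiv]
  simp
  rw [clm_apply_complex (fderiv ℝ g (G z)) (D z), clm_apply_complex (fderiv ℝ g (G z)) (I * D z)]
  have hn : ((‖D z‖ : ℝ) : ℂ) ^ 2 = (D z).re ^ 2 + (D z).im ^ 2 := by
    rw [← Complex.ofReal_pow, ← Complex.normSq_eq_norm_sq, Complex.normSq_apply]; push_cast; ring
  rw [hn]
  have hd : D z = (D z).re + (D z).im * I := (Complex.re_add_im _).symm
  simp
  set a := (D z).re
  set b := (D z).im
  rw [hd]
  ring_nf
  simp only [Complex.I_sq]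
  ring

theorem isop {A : Set ℂ} (hA : IsOpen A) {G : ℂ → ℂ} (hG : DifferentiableOn ℂ G A) {f : ℂ → ℝ}
    (hf : ContDiff ℝ 1 f) (hs : HasCompactSupport f) (hsA : tsupport f ⊆ A) (h0 : ∀ z, 0 ≤ f z)
    {a : ℝ} (ha : ∫ z in tsupport f, ‖deriv G z‖ ^ 2 ≤ a) :
    ∫ z, f z * ‖deriv G z‖ ^ 2 ≤ √(a / π) / 2 * ∫ z, ‖fderiv ℝ f z‖ * ‖deriv G z‖ := by
  set K := tsupport f with hKd
  have hK : IsCompact K := hs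
  have hGd : DifferentiableOn ℂ (deriv G) A := hG.deriv hA
  have hGc : ContinuousOn (deriv G) A := hGd.continuousOn
  have hGA : ∀ z ∈ A, HasDerivAt G (deriv G z) z := fun z hz =>
    (hG.differentiableAt (hA.mem_nhds hz)).hasDerivAt
  suffices H : ∀ a' > a, ∫ z, f z * ‖deriv G z‖ ^ 2 ≤
      √(a' / π) / 2 * ∫ z, ‖fderiv ℝ f z‖ * ‖deriv G z‖ by
    have ht : Tendsto (fun a' => √(a' / π) / 2 * ∫ z, ‖fderiv ℝ f z‖ * ‖deriv G z‖) (𝓝[>] a)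
        (𝓝 (√(a / π) / 2 * ∫ z, ‖fderiv ℝ f z‖ * ‖deriv G z‖)) :=
      (Continuous.tendsto (by fun_prop) a).mono_left nhdsWithin_le_nhds
    exact ge_of_tendsto ht (by filter_upwards [self_mem_nhdsWithin] with a' ha' using H a' ha')
  intro a' ha'
  have hIntg : IntegrableOn (fun z => ‖deriv G z‖ ^ 2) K :=
    ((hGc.mono hsA).norm.pow 2).integrableOn_compact hK
  have hvol : volume (G '' K) ≤ ENNReal.ofReal a := by
    have h1 := addHaar_image_le_lintegral_abs_det_fderiv (volume : Measure ℂ) hK.measurableSet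
      (f := G) (f' := fun z => (ContinuousLinearMap.toSpanSingleton ℂ (deriv G z)).restrictScalars ℝ)
      (fun z hz => (hasFDerivAt_real_of_complex (hGA z (hsA hz))).hasFDerivWithinAt)
    refine h1.trans ?_
    simp only [det_mul_complex, abs_pow, abs_norm]
    rw [← ofReal_integral_eq_lintegral_ofReal hIntg (ae_of_all _ fun z => by positivity)]
    exact ENNReal.ofReal_le_ofReal ha
  have ha0 : 0 ≤ a := le_trans (integral_nonneg fun z => by positivity) ha
  have hGK : IsCompact (G '' K) := hK.image_of_continuousOn (hG.continuousOn.mono hsA)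
  obtain ⟨V, hKV, hV, hVv⟩ := hGK.exists_isOpen_lt_add (μ := volume) (ε := ENNReal.ofReal (a' - a))
    (by simpa using ha')
  have hVv' : volume V ≤ ENNReal.ofReal a' := by
    refine hVv.le.trans ((add_le_add_left hvol _).trans ?_)
    rw [← ENNReal.ofReal_add ha0 (by linarith)]; simp
  obtain ⟨b, hb, hbs, hbV, hb0, hb1, hbK⟩ := exists_bump hGK hV hKV
  have hb' : ContDiff ℝ 1 b := hb.of_le (by exact_mod_cast le_top)
  have hbi : ∫ z, b z ≤ a' := by
    have e : ∫ z, b z = ∫ z in V, b z := by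
      rw [setIntegral_eq_integral_of_forall_compl_eq_zero]
      intro z hz
      exact image_eq_zero_of_notMem_tsupport (fun h => hz (hbV h))
    have hfin : volume V < ⊤ := lt_of_le_of_lt hVv' ENNReal.ofReal_lt_top
    have : IsFiniteMeasure (volume.restrict V) := ⟨by simpa using hfin⟩
    rw [e]
    calc ∫ z in V, b z ≤ ∫ z in V, (1:ℝ) := by
          apply integral_mono ((hb'.continuous.integrable_of_hasCompactSupport hbs).integrableOn) (integrable_const _)
          exact hb1
      _ = (volume V).toReal := by simp [Measure.real]
      _ ≤ a' := ENNReal.toReal_le_of_le_ofReal (by linarith) hVv'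
  obtain ⟨g, hg, hgd, hgb⟩ := exists_cauchy_transform hb' hbs hb0 hb1 (lt_of_le_of_lt ha0 ha') hbi
  set F : ℂ → ℂ := fun w => (f w : ℂ) * deriv G w * g (G w) with hF
  have hfK : ∀ z ∉ K, f =ᶠ[𝓝 z] 0 := fun z hz => notMem_tsupport_iff_eventuallyEq.1 hz
  have hFK : ∀ z ∉ K, F =ᶠ[𝓝 z] 0 := fun z hz => by
    filter_upwards [hfK z hz] with w hw
    simp [hF, hw]
  have hFs : HasCompactSupport F := by
    apply HasCompactSupport.of_support_subset_isCompact hK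
    intro z hz
    by_contra h
    exact hz (hFK z h).eq_of_nhds
  have hFc : ContDiff ℝ 1 F := by
    rw [contDiff_iff_contDiffAt]
    intro z
    by_cases hz : z ∈ K
    · have hzA := hA.mem_nhds (hsA hz)
      have c1 : ContDiffAt ℝ 1 (fun w => (f w : ℂ)) z :=
        (Complex.ofRealCLM.contDiff.comp hf).contDiffAt
      have c2 : ContDiffAt ℝ 1 (deriv G) z := ((hGd.contDiffOn hA).contDiffAt hzA).restrict_scalars ℝ
      have c3 : ContDiffAt ℝ 1 G z := ((hG.contDiffOn hA).contDiffAt hzA).restrict_scalars ℝ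
      exact (c1.mul c2).mul (hg.contDiffAt.comp z c3)
    · exact (contDiffAt_const (c := (0:ℂ))).congr_of_eventuallyEq (hFK z hz)
  have hI := integral_dbar_zero hFc hFs
  have hdb : ∀ z, dbar F z = dbar (fun w => (f w : ℂ)) z * deriv G z * g (G z) + ((f z * ‖deriv G z‖ ^ 2 : ℝ) : ℂ) := by
    intro z
    by_cases hz : z ∈ K
    · have hzA := hA.mem_nhds (hsA hz)
      rw [hF, dbar_product (hf.differentiable one_ne_zero z) (hGA z (hsA hz))
        (hGd.differentiableAt hzA) (hg.differentiable one_ne_zero _), hgd]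
      have : b (G z) = 1 := hbK.self_of_nhdsSet _ (mem_image_of_mem G hz)
      rw [this]; push_cast; ring
    · have h1 : fderiv ℝ F z = 0 := by rw [(hFK z hz).fderiv_eq]; simp
      have h2 : (fun w => (f w : ℂ)) =ᶠ[𝓝 z] 0 := by
        filter_upwards [hfK z hz] with w hw
        simp [hw]
      have h3 : f z = 0 := (hfK z hz).eq_of_nhds
      have h4 : fderiv ℝ (fun w => (f w : ℂ)) z = 0 := by rw [h2.fderiv_eq]; simp
      simp [dbar, h1, h3, h4]
  have hL : Continuous (fun z => f z * ‖deriv G z‖ ^ 2) := by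
    rw [continuous_iff_continuousAt]
    intro z
    by_cases hz : z ∈ K
    · have hzA := hA.mem_nhds (hsA hz)
      exact hf.continuous.continuousAt.mul ((hGc.continuousAt hzA).norm.pow 2)
    · apply (continuousAt_const (y := (0:ℝ))).congr
      filter_upwards [hfK z hz] with w hw
      simp [hw]
  have hLi : Integrable (fun z => f z * ‖deriv G z‖ ^ 2) :=
    hL.integrable_of_hasCompactSupport hs.mul_right
  have hfd : ∀ z ∉ K, fderiv ℝ f =ᶠ[𝓝 z] 0 := fun z hz => by
    have := (hfK z hz).fderiv (𝕜 := ℝ)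
    filter_upwards [this] with w hw
    rw [hw]; simp
  have hR : Continuous (fun z => ‖fderiv ℝ f z‖ * ‖deriv G z‖) := by
    rw [continuous_iff_continuousAt]
    intro z
    by_cases hz : z ∈ K
    · have hzA := hA.mem_nhds (hsA hz)
      exact (hf.continuous_fderiv one_ne_zero).norm.continuousAt.mul ((hGc.continuousAt hzA).norm)
    · apply (continuousAt_const (y := (0:ℝ))).congr
      filter_upwards [hfd z hz] with w hw
      simp [hw]
  have hRi : Integrable (fun z => ‖fderiv ℝ f z‖ * ‖deriv G z‖) :=
    hR.integrable_of_hasCompactSupport (hs.fderiv ℝ).norm.mul_right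
  have hdi : Integrable (dbar F) := by
    have cF := hFc.continuous_fderiv one_ne_zero
    have ii : ∀ v, Integrable (fun z => fderiv ℝ F z v) := fun v =>
      Continuous.integrable_of_hasCompactSupport (cF.clm_apply continuous_const) (hFs.fderiv_apply ℝ v)
    exact ((ii 1).add ((ii I).const_mul I)).div_const 2
  have hXi : Integrable (fun z => dbar (fun w => (f w : ℂ)) z * deriv G z * g (G z)) := by
    have := hdi.sub hLi.ofReal
    refine this.congr (ae_of_all _ fun z => ?_)
    simp only [Pi.sub_apply]
    rw [hdb]; simp
  have hfin : ((∫ z, f z * ‖deriv G z‖ ^ 2 : ℝ) : ℂ) = - ∫ z, dbar (fun w => (f w : ℂ)) z * deriv G z * g (G z) := by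
    have : ∫ z, dbar F z = (∫ z, dbar (fun w => (f w : ℂ)) z * deriv G z * g (G z)) + ((∫ z, f z * ‖deriv G z‖ ^ 2 : ℝ) : ℂ) := by
      simp only [hdb]
      have hLi' : Integrable (fun z => ((f z * ‖deriv G z‖ ^ 2 : ℝ) : ℂ)) := hLi.ofReal
      rw [integral_add hXi hLi']
      congr 1
      exact integral_ofReal
    rw [hI] at this
    linear_combination -this
  have hnn : 0 ≤ ∫ z, f z * ‖deriv G z‖ ^ 2 := integral_nonneg fun z => mul_nonneg (h0 z) (by positivity)
  calc ∫ z, f z * ‖deriv G z‖ ^ 2 = ‖((∫ z, f z * ‖deriv G z‖ ^ 2 : ℝ) : ℂ)‖ := by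
        rw [Complex.norm_real, Real.norm_of_nonneg hnn]
    _ = ‖∫ z, dbar (fun w => (f w : ℂ)) z * deriv G z * g (G z)‖ := by rw [hfin, norm_neg]
    _ ≤ ∫ z, √(a' / π) / 2 * (‖fderiv ℝ f z‖ * ‖deriv G z‖) := by
        apply norm_integral_le_of_norm_le (hRi.const_mul _)
        apply ae_of_all
        intro z
        rw [norm_mul, norm_mul]
        have h1 := norm_dbar_real (hf.differentiable one_ne_zero z)
        have h2 := hgb (G z)
        calc _ ≤ ‖fderiv ℝ f z‖ / 2 * ‖deriv G z‖ * √(a' / π) := by gcongr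
          _ = _ := by ring
    _ = _ := integral_const_mul _ _

end MF

namespace MF

open Set Filter Topology Complex Metric
open scoped Manifold ContDiff

/-- The Laplacian on ℂ. -/
def lapl (f : ℂ → ℝ) (z : ℂ) : ℝ :=
  fderiv ℝ (fun w => fderiv ℝ f w 1) z 1 + fderiv ℝ (fun w => fderiv ℝ f w I) z I

lemma clm_real_apply (L : ℂ →L[ℝ] ℝ) (w : ℂ) : L w = w.re * L 1 + w.im * L I := by
  have h : w = w.re • (1 : ℂ) + w.im • I := by
    simp [Complex.re_add_im]
  conv_lhs => rw [h]
  rw [map_add, map_smul, map_smul]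
  simp

lemma norm_clm_sq (L : ℂ →L[ℝ] ℝ) : ‖L‖ ^ 2 = L 1 ^ 2 + L I ^ 2 := by
  set w : ℂ := ⟨L 1, L I⟩ with hw
  have hww : ‖w‖ ^ 2 = L 1 ^ 2 + L I ^ 2 := by
    rw [← Complex.normSq_eq_norm_sq, Complex.normSq_apply]; simp [hw]; ring
  have h2 : L w = ‖w‖ ^ 2 := by
    rw [clm_real_apply, hww]; simp [hw]; ring
  have h3 : ‖w‖ ≤ ‖L‖ := by
    by_cases h0 : ‖w‖ = 0
    · rw [h0]; positivity
    · have h4 := L.le_opNorm w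
      rw [h2, Real.norm_of_nonneg (by positivity)] at h4
      have : 0 < ‖w‖ := lt_of_le_of_ne (norm_nonneg _) (Ne.symm h0)
      nlinarith
  have h4 : ‖L‖ ≤ ‖w‖ := by
    apply L.opNorm_le_bound (norm_nonneg _)
    intro x
    rw [clm_real_apply]
    have : x.re * L 1 + x.im * L I = (x * (starRingEnd ℂ) w).re := by simp [hw]
    rw [this, Real.norm_eq_abs]
    refine (Complex.abs_re_le_norm _).trans ?_
    rw [norm_mul, Complex.norm_conj, mul_comm]
  rw [← hww, le_antisymm h4 h3]

lemma fderiv_zero_ae_on_level {A : Set ℂ} (hA : IsOpen A) {g : ℂ → ℝ} (hg : ∀ z ∈ A, DifferentiableAt ℝ g z)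
    (s : ℝ) : volume {z ∈ A | g z = s ∧ fderiv ℝ g z ≠ 0} = 0 := by
  set S : Set ℂ := {z ∈ A | g z = s} with hS
  have hgc : ContinuousOn g A := fun z hz => (hg z hz).continuousAt.continuousWithinAt
  have hSm : MeasurableSet S := by
    have : S = A ∩ g ⁻¹' {s} := rfl
    rw [this]
    obtain ⟨u, hu, hu2⟩ := (continuousOn_iff_isClosed.1 hgc {s} isClosed_singleton)
    rw [inter_comm, hu2]
    exact hu.measurableSet.inter hA.measurableSet
  have h1 : ApproximatesLinearOn (fun z => (g z : ℂ)) (0 : ℂ →L[ℝ] ℂ) S 0 := by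
    intro x hx y hy
    simp [hx.2, hy.2]
  have h2 := h1.norm_fderiv_sub_le (volume : Measure ℂ) hSm (fun z => Complex.ofRealCLM.comp (fderiv ℝ g z))
    (fun z hz => (Complex.ofRealCLM.hasFDerivAt.comp z (hg z hz.1).hasFDerivAt).hasFDerivWithinAt)
  rw [ae_restrict_iff' hSm, ae_iff] at h2
  refine measure_mono_null ?_ h2
  intro z hz
  simp only [mem_setOf_eq, not_forall]
  refine ⟨⟨hz.1, hz.2.1⟩, ?_⟩
  intro h
  apply hz.2.2
  simp only [sub_zero, NNReal.coe_zero] at h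
  have h3 : Complex.ofRealCLM.comp (fderiv ℝ g z) = 0 := norm_le_zero_iff.1 h
  ext x
  have := congrArg (fun L : ℂ →L[ℝ] ℂ => L x) h3
  simpa using this

lemma diff_fderiv_apply {A : Set ℂ} (hA : IsOpen A) {q : ℂ → ℝ} (hq : ContDiffOn ℝ 2 q A) (v : ℂ) :
    ContDiffOn ℝ 1 (fun w => fderiv ℝ q w v) A :=
  (hq.fderiv_of_isOpen hA (by norm_num)).clm_apply contDiffOn_const

lemma cont_lapl {A : Set ℂ} (hA : IsOpen A) {q : ℂ → ℝ} (hq : ContDiffOn ℝ 2 q A) :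
    ContinuousOn (lapl q) A := by
  have h : ∀ v : ℂ, ContinuousOn (fun z => fderiv ℝ (fun w => fderiv ℝ q w v) z v) A := fun v =>
    ((diff_fderiv_apply hA hq v).continuousOn_fderiv_of_isOpen hA le_rfl).clm_apply continuousOn_const
  exact (h 1).add (h I)

lemma level_null {A : Set ℂ} (hA : IsOpen A) {q : ℂ → ℝ} (hq : ContDiffOn ℝ 2 q A) (s : ℝ) :
    volume {z ∈ A | q z = s ∧ lapl q z ≠ 0} = 0 := by
  have hd : ∀ z ∈ A, DifferentiableAt ℝ q z := fun z hz =>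
    (hq.contDiffAt (hA.mem_nhds hz)).differentiableAt two_ne_zero
  have hd2 : ∀ v, ∀ z ∈ A, DifferentiableAt ℝ (fun w => fderiv ℝ q w v) z := fun v z hz =>
    ((diff_fderiv_apply hA hq v).contDiffAt (hA.mem_nhds hz)).differentiableAt one_ne_zero
  have n1 := fderiv_zero_ae_on_level hA hd s
  have n2 := fderiv_zero_ae_on_level hA (hd2 1) 0
  have n3 := fderiv_zero_ae_on_level hA (hd2 I) 0
  refine measure_mono_null ?_ (measure_union_null n1 (measure_union_null n2 n3))
  rintro z ⟨hz, hzs, hl⟩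
  by_cases h : fderiv ℝ q z = 0
  · right
    by_cases h2 : fderiv ℝ (fun w => fderiv ℝ q w 1) z = 0
    · right
      refine ⟨hz, by simp [h], ?_⟩
      intro h3
      exact hl (by simp [lapl, h2, h3])
    · left
      exact ⟨hz, by simp [h], h2⟩
  · left
    exact ⟨hz, hzs, h⟩

/-- A cutoff profile. -/
structure Chi (s s' ε : ℝ) where
  χ : ℝ → ℝ
  χ' : ℝ → ℝ
  δ : ℝ
  δpos : 0 < δ
  hd : ∀ x, HasDerivAt χ (χ' x) x
  hc : Continuous χ'
  nn : ∀ x, 0 ≤ χ' x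
  le : ∀ x, χ' x ≤ (1 + ε) / (s' - s)
  off : ∀ x, s' ≤ x → χ' x = 0
  off' : ∀ x, x ≤ s + δ → χ' x = 0
  zero : ∀ x, x ≤ s + δ → χ x = 0
  one : ∀ x, s' ≤ x → χ x = 1
  nonneg : ∀ x, 0 ≤ χ x
  le_one : ∀ x, χ x ≤ 1

lemma exists_chi {s s' ε : ℝ} (h : s < s') (hε : 0 < ε) : Nonempty (Chi s s' ε) := by
  set d := s' - s with hd
  have hd0 : 0 < d := by linarith
  set δ := d * ε / (4 * (1 + ε)) with hδ
  have hδ0 : 0 < δ := by positivity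
  have hδ1 : 4 * δ * (1 + ε) = d * ε := by rw [hδ]; field_simp
  have hδ2 : 4 * δ < d := by nlinarith
  set τ : ℝ → ℝ := fun x => max 0 (min 1 (min ((x - s - δ) / δ) ((s' - x) / δ))) with hτ
  have hτc : Continuous τ := by fun_prop
  have hτ0 : ∀ x, 0 ≤ τ x := fun x => le_max_left _ _
  have hτ1 : ∀ x, τ x ≤ 1 := fun x => max_le zero_le_one (min_le_left _ _)
  have hτoff : ∀ x, s' ≤ x → τ x = 0 := fun x hx => by
    apply max_eq_left
    refine (min_le_right _ _).trans ((min_le_right _ _).trans ?_)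
    exact div_nonpos_of_nonpos_of_nonneg (by linarith) hδ0.le
  have hτoff' : ∀ x, x ≤ s + δ → τ x = 0 := fun x hx => by
    apply max_eq_left
    refine (min_le_right _ _).trans ((min_le_left _ _).trans ?_)
    exact div_nonpos_of_nonpos_of_nonneg (by linarith) hδ0.le
  have hτon : ∀ x, s + 2 * δ ≤ x → x ≤ s' - δ → τ x = 1 := fun x h1 h2 => by
    have : min 1 (min ((x - s - δ) / δ) ((s' - x) / δ)) = 1 := by
      apply min_eq_left
      apply le_min
      · rw [le_div_iff₀ hδ0]; linarith
      · rw [le_div_iff₀ hδ0]; linarith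
    simp [hτ, this]
  have hτi : ∀ a b : ℝ, IntervalIntegrable τ volume a b := fun a b => hτc.intervalIntegrable _ _
  set T := ∫ x in s..s', τ x with hT
  have hTge : d - 3 * δ ≤ T := by
    have h1 : ∫ x in (s + 2 * δ)..(s' - δ), τ x = d - 3 * δ := by
      rw [intervalIntegral.integral_congr (g := fun _ => (1:ℝ))]
      · simp; ring
      · intro x hx
        rw [uIcc_of_le (by linarith)] at hx
        exact hτon x hx.1 hx.2
    rw [← h1]
    apply intervalIntegral.integral_mono_interval (by linarith) (by linarith) (by linarith) _ (hτi _ _)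
    exact ae_of_all _ hτ0
  have hT0 : 0 < T := by linarith
  have hTinv : 1 / T ≤ (1 + ε) / d := by
    rw [div_le_div_iff₀ hT0 hd0]
    nlinarith
  have hdv : ∀ x, HasDerivAt (fun x => (∫ t in s..x, τ t) / T) (τ x / T) x := fun x =>
    (intervalIntegral.integral_hasDerivAt_right (hτi _ _)
      (hτc.stronglyMeasurableAtFilter _ _) hτc.continuousAt).div_const T
  have hmono : Monotone (fun x => (∫ t in s..x, τ t) / T) := by
    apply monotone_of_deriv_nonneg (fun x => (hdv x).differentiableAt)
    intro x
    rw [(hdv x).deriv]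
    exact div_nonneg (hτ0 x) hT0.le
  have hz : ∀ x, x ≤ s + δ → (∫ t in s..x, τ t) / T = 0 := fun x hx => by
    rw [intervalIntegral.integral_congr (g := fun _ => (0:ℝ))]
    · simp
    · intro y hy
      apply hτoff'
      rcases le_total s x with h2 | h2
      · rw [uIcc_of_le h2] at hy; linarith [hy.2]
      · rw [uIcc_of_ge h2] at hy; linarith [hy.2]
  have ho : ∀ x, s' ≤ x → (∫ t in s..x, τ t) / T = 1 := fun x hx => by
    rw [← intervalIntegral.integral_add_adjacent_intervals (hτi s s') (hτi s' x)]
    rw [intervalIntegral.integral_congr (a := s') (b := x) (g := fun _ => (0:ℝ))]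
    · simp [← hT, hT0.ne']
    · intro y hy
      rw [uIcc_of_le hx] at hy
      exact hτoff _ hy.1
  refine ⟨⟨fun x => (∫ t in s..x, τ t) / T, fun x => τ x / T, δ, hδ0, hdv, hτc.div_const T,
    fun x => div_nonneg (hτ0 x) hT0.le, fun x => ?_, fun x hx => by simp [hτoff x hx],
    fun x hx => by simp [hτoff' x hx], hz, ho, fun x => ?_, fun x => ?_⟩⟩
  · refine le_trans ?_ hTinv
    gcongr
    exact hτ1 x
  · have := hmono (min_le_left x s)
    rw [show (fun x => (∫ t in s..x, τ t) / T) (min x s) = 0 from hz _ ((min_le_right _ _).trans (by linarith))] at this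
    exact this
  · have := hmono (le_max_left x s')
    rw [show (fun x => (∫ t in s..x, τ t) / T) (max x s') = 1 from ho _ (le_max_right _ _)] at this
    exact this

end MF

namespace MF

open Set Filter Topology Complex Metric
open scoped Manifold ContDiff

lemma zext_contDiff {E : Type*} [NormedAddCommGroup E] [NormedSpace ℝ E] {A K : Set ℂ} (hA : IsOpen A)
    (hK : IsCompact K) {g : ℂ → E} (hg : ContDiffOn ℝ 1 g A)
    (hKA : K ⊆ A) (h0 : ∀ z ∈ A, z ∉ K → g z = 0) : ContDiff ℝ 1 (A.indicator g) := by
  rw [contDiff_iff_contDiffAt]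
  intro z
  by_cases hz : z ∈ A
  · refine (hg.contDiffAt (hA.mem_nhds hz)).congr_of_eventuallyEq ?_
    filter_upwards [hA.mem_nhds hz] with w hw
    simp [hw]
  · by_cases hzK : z ∈ K
    · exact absurd (hKA hzK) hz
    · have : A.indicator g =ᶠ[𝓝 z] fun _ => 0 := by
        filter_upwards [hK.isClosed.isOpen_compl.mem_nhds hzK] with w hw
        by_cases hwA : w ∈ A
        · simp [hwA, h0 w hwA hw]
        · simp [hwA]
      exact contDiffAt_const.congr_of_eventuallyEq this


lemma zext_tsupport {E : Type*} [NormedAddCommGroup E] [NormedSpace ℝ E] {A K : Set ℂ}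
    (hK : IsCompact K) {g : ℂ → E} (h0 : ∀ z ∈ A, z ∉ K → g z = 0) :
    tsupport (A.indicator g) ⊆ K := by
  apply closure_minimal _ hK.isClosed
  intro z hz
  by_contra h
  apply hz
  by_cases hzA : z ∈ A
  · simp [hzA, h0 z hzA h]
  · simp [hzA]

lemma zext_compact {E : Type*} [NormedAddCommGroup E] [NormedSpace ℝ E] {A K : Set ℂ}
    (hK : IsCompact K) {g : ℂ → E} (h0 : ∀ z ∈ A, z ∉ K → g z = 0) :
    HasCompactSupport (A.indicator g) :=
  hK.of_isClosed_subset (isClosed_tsupport _) (zext_tsupport hK h0)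

/-- cutoff of `q` on `A` -/
def cut (A : Set ℂ) (q : ℂ → ℝ) {s s' ε : ℝ} (c : Chi s s' ε) : ℂ → ℝ := A.indicator (fun z => c.χ (q z))

section cutsec
variable {A : Set ℂ} {q : ℂ → ℝ} {s s' ε : ℝ}

lemma chi_contDiff {s s' ε : ℝ} (c : Chi s s' ε) : ContDiff ℝ 1 c.χ := by
  rw [contDiff_one_iff_deriv]
  refine ⟨fun x => (c.hd x).differentiableAt, ?_⟩
  have : deriv c.χ = c.χ' := funext fun x => (c.hd x).deriv
  rw [this]; exact c.hc

lemma cut_contDiff (hA : IsOpen A) (hq : ContDiffOn ℝ 2 q A) (hK : ∀ s1 > s, IsCompact {z ∈ A | s1 ≤ q z})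
    (c : Chi s s' ε) : ContDiff ℝ 1 (cut A q c) := by
  refine zext_contDiff hA (hK (s + c.δ) (by linarith [c.δpos])) ?_ (fun z hz => hz.1) ?_
  · exact (chi_contDiff c).comp_contDiffOn (hq.of_le (by norm_num))
  · intro z hz h
    apply c.zero
    by_contra h2
    exact h ⟨hz, by linarith⟩

lemma cut_tsupport (hK : ∀ s1 > s, IsCompact {z ∈ A | s1 ≤ q z})
    (c : Chi s s' ε) : tsupport (cut A q c) ⊆ {z ∈ A | s + c.δ ≤ q z} := by
  refine zext_tsupport (hK (s + c.δ) (by linarith [c.δpos])) ?_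
  intro z hz h
  apply c.zero
  by_contra h2
  exact h ⟨hz, by linarith⟩

lemma cut_compact (hK : ∀ s1 > s, IsCompact {z ∈ A | s1 ≤ q z})
    (c : Chi s s' ε) : HasCompactSupport (cut A q c) :=
  (hK (s + c.δ) (by linarith [c.δpos])).of_isClosed_subset (isClosed_tsupport _) (cut_tsupport hK c)

lemma cut_fderiv (hA : IsOpen A) (hq : ContDiffOn ℝ 2 q A)
    (c : Chi s s' ε) {z : ℂ} (hz : z ∈ A) : fderiv ℝ (cut A q c) z = c.χ' (q z) • fderiv ℝ q z := by
  have h1 : cut A q c =ᶠ[𝓝 z] fun z => c.χ (q z) := by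
    filter_upwards [hA.mem_nhds hz] with w hw
    simp [cut, hw]
  rw [h1.fderiv_eq]
  have h2 := ((hq.contDiffAt (hA.mem_nhds hz)).differentiableAt two_ne_zero).hasFDerivAt
  exact ((c.hd (q z)).comp_hasFDerivAt z h2).fderiv

lemma cut_fderiv_off (hK : ∀ s1 > s, IsCompact {z ∈ A | s1 ≤ q z})
    (c : Chi s s' ε) {z : ℂ} (hz : z ∉ A) : fderiv ℝ (cut A q c) z = 0 := by
  by_contra h
  exact hz (cut_tsupport hK c (tsupport_fderiv_subset ℝ (subset_tsupport _ h))).1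

lemma cut_nonneg (c : Chi s s' ε) (z : ℂ) : 0 ≤ cut A q c z := indicator_nonneg (fun z _ => c.nonneg _) z

lemma cut_le_one (c : Chi s s' ε) (z : ℂ) : cut A q c z ≤ 1 := by
  by_cases h : z ∈ A
  · simp [cut, h, c.le_one]
  · simp [cut, h]

lemma green (hA : IsOpen A) (hq : ContDiffOn ℝ 2 q A) (hK : ∀ s1 > s, IsCompact {z ∈ A | s1 ≤ q z})
    (c : Chi s s' ε) : ∫ z in A, c.χ (q z) * (-lapl q z) = ∫ z in A, c.χ' (q z) * ‖fderiv ℝ q z‖ ^ 2 := by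
  set K := {z ∈ A | s + c.δ ≤ q z} with hKd
  have hKc : IsCompact K := hK (s + c.δ) (by linarith [c.δpos])
  have hKA : K ⊆ A := fun z hz => hz.1
  have hq1 : ∀ z ∈ A, DifferentiableAt ℝ q z := fun z hz =>
    (hq.contDiffAt (hA.mem_nhds hz)).differentiableAt two_ne_zero
  have hqv : ∀ v, ContDiffOn ℝ 1 (fun w => fderiv ℝ q w v) A := diff_fderiv_apply hA hq
  have hqv1 : ∀ v, ∀ z ∈ A, DifferentiableAt ℝ (fun w => fderiv ℝ q w v) z := fun v z hz =>
    ((hqv v).contDiffAt (hA.mem_nhds hz)).differentiableAt one_ne_zero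
  have hχ : ∀ z ∈ A, z ∉ K → c.χ (q z) = 0 := by
    intro z hz h
    apply c.zero
    by_contra h2
    exact h ⟨hz, by linarith⟩
  have hχ' : ∀ z ∈ A, z ∉ K → c.χ' (q z) = 0 := by
    intro z hz h
    apply c.off'
    by_contra h2
    exact h ⟨hz, by linarith⟩
  have key : ∀ v : ℂ, IntegrableOn (fun z => c.χ' (q z) * (fderiv ℝ q z v) ^ 2) A ∧
      IntegrableOn (fun z => c.χ (q z) * fderiv ℝ (fun w => fderiv ℝ q w v) z v) A ∧
      (∫ z in A, c.χ' (q z) * (fderiv ℝ q z v) ^ 2) +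
        ∫ z in A, c.χ (q z) * fderiv ℝ (fun w => fderiv ℝ q w v) z v = 0 := by
    intro v
    have i1 : IntegrableOn (fun z => c.χ' (q z) * (fderiv ℝ q z v) ^ 2) A := by
      refine IntegrableOn.of_forall_sdiff_eq_zero (s := K) ?_ hA.measurableSet ?_
      · refine ContinuousOn.integrableOn_compact hKc ?_
        exact ((c.hc.comp_continuousOn hq.continuousOn).mul ((hqv v).continuousOn.pow 2)).mono hKA
      · intro z hz; rw [hχ' z hz.1 hz.2, zero_mul]
    have i2 : IntegrableOn (fun z => c.χ (q z) * fderiv ℝ (fun w => fderiv ℝ q w v) z v) A := by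
      refine IntegrableOn.of_forall_sdiff_eq_zero (s := K) ?_ hA.measurableSet ?_
      · refine ContinuousOn.integrableOn_compact hKc ?_
        exact (((chi_contDiff c).continuous.comp_continuousOn hq.continuousOn).mul
          (((hqv v).continuousOn_fderiv_of_isOpen hA le_rfl).clm_apply continuousOn_const)).mono hKA
      · intro z hz; rw [hχ z hz.1 hz.2, zero_mul]
    refine ⟨i1, i2, ?_⟩
    have hc1 : ContDiff ℝ 1 (A.indicator fun z => c.χ (q z) * fderiv ℝ q z v) := by
      refine zext_contDiff hA hKc ?_ hKA ?_
      · exact ((chi_contDiff c).comp_contDiffOn (hq.of_le (by norm_num))).mul (hqv v)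
      · intro z hz h; rw [hχ z hz h, zero_mul]
    have hc2 : HasCompactSupport (A.indicator fun z => c.χ (q z) * fderiv ℝ q z v) := by
      refine zext_compact hKc ?_
      intro z hz h; rw [hχ z hz h, zero_mul]
    have h0 := integral_fderiv_zero hc1 hc2 v
    have h1 : ∫ z in A, fderiv ℝ (A.indicator fun z => c.χ (q z) * fderiv ℝ q z v) z v = 0 := by
      rw [← h0]
      apply setIntegral_eq_integral_of_forall_compl_eq_zero
      intro z hz
      have : fderiv ℝ (A.indicator fun z => c.χ (q z) * fderiv ℝ q z v) z = 0 := by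
        by_contra h
        refine hz (hKA (zext_tsupport hKc ?_ (tsupport_fderiv_subset ℝ (subset_tsupport _ h))))
        intro z hz h; rw [hχ z hz h, zero_mul]
      rw [this]; simp
    rw [← integral_add i1 i2, ← h1]
    refine setIntegral_congr_fun hA.measurableSet ?_
    intro z hz
    have e1 : (A.indicator fun z => c.χ (q z) * fderiv ℝ q z v) =ᶠ[𝓝 z]
        fun z => c.χ (q z) * fderiv ℝ q z v := by
      filter_upwards [hA.mem_nhds hz] with w hw
      simp [hw]
    simp only
    rw [e1.fderiv_eq]
    have e2 := ((c.hd (q z)).comp_hasFDerivAt z (hq1 z hz).hasFDerivAt).mul (hqv1 v z hz).hasFDerivAt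
    have e3 : fderiv ℝ (fun z => c.χ (q z) * fderiv ℝ q z v) z = _ := e2.fderiv
    rw [e3]
    simp
    ring
  obtain ⟨i1, j1, k1⟩ := key 1
  obtain ⟨i2, j2, k2⟩ := key I
  have e1 : ∀ z, c.χ (q z) * (-lapl q z) = -(c.χ (q z) * fderiv ℝ (fun w => fderiv ℝ q w 1) z 1 +
      c.χ (q z) * fderiv ℝ (fun w => fderiv ℝ q w I) z I) := fun z => by
    rw [lapl]; ring
  have e2 : ∀ z, c.χ' (q z) * ‖fderiv ℝ q z‖ ^ 2 = c.χ' (q z) * (fderiv ℝ q z 1) ^ 2 +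
      c.χ' (q z) * (fderiv ℝ q z I) ^ 2 := fun z => by
    rw [norm_clm_sq]; ring
  simp_rw [e1, e2]
  rw [integral_neg, integral_add i1 i2, integral_add j1 j2]
  linarith

lemma energy (hA : IsOpen A) (hq : ContDiffOn ℝ 2 q A) (hK : ∀ s1 > s, IsCompact {z ∈ A | s1 ≤ q z})
    (c : Chi s s' ε) (hss : s < s') (hε : 0 < ε) {g : ℂ → ℝ} (hg : ContinuousOn g A) (hg0 : ∀ z ∈ A, 0 ≤ g z)
    (hgi : IntegrableOn (fun z => g z ^ 2) {z ∈ A | s < q z ∧ q z < s'}) :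
    (∫ z, ‖fderiv ℝ (cut A q c) z‖ * g z) ^ 2 ≤ (∫ z in A, c.χ (q z) * (-lapl q z)) *
      ((1 + ε) / (s' - s) * ∫ z in {z ∈ A | s < q z ∧ q z < s'}, g z ^ 2) := by
  set K := {z ∈ A | s + c.δ ≤ q z} with hKd
  have hKc : IsCompact K := hK (s + c.δ) (by linarith [c.δpos])
  have hKA : K ⊆ A := fun z hz => hz.1
  have hχ' : ∀ z ∈ A, z ∉ K → c.χ' (q z) = 0 := by
    intro z hz h
    apply c.off'
    by_contra h2
    exact h ⟨hz, by linarith⟩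
  have cD : ContinuousOn (fun z => ‖fderiv ℝ q z‖) A :=
    (hq.continuousOn_fderiv_of_isOpen hA (by norm_num)).norm
  have cχ : ContinuousOn (fun z => c.χ' (q z)) A := c.hc.comp_continuousOn hq.continuousOn
  have cint : ∀ F : ℂ → ℝ, ContinuousOn F A → (∀ z ∈ A, z ∉ K → F z = 0) → IntegrableOn F A := by
    intro F hF h0
    refine IntegrableOn.of_forall_sdiff_eq_zero (s := K)
      (ContinuousOn.integrableOn_compact hKc (hF.mono hKA)) hA.measurableSet ?_
    intro z hz; exact h0 z hz.1 hz.2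
  have e0 : ∫ z, ‖fderiv ℝ (cut A q c) z‖ * g z = ∫ z in A, c.χ' (q z) * ‖fderiv ℝ q z‖ * g z := by
    rw [← setIntegral_eq_integral_of_forall_compl_eq_zero (s := A)]
    · refine setIntegral_congr_fun hA.measurableSet fun z hz => ?_
      rw [cut_fderiv hA hq c hz, norm_smul, Real.norm_of_nonneg (c.nn _)]
    · intro z hz
      rw [cut_fderiv_off hK c hz]; simp
  have iX : IntegrableOn (fun z => c.χ' (q z) * ‖fderiv ℝ q z‖ ^ 2) A :=
    cint _ (cχ.mul (cD.pow 2)) fun z hz h => by rw [hχ' z hz h, zero_mul]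
  have iZ : IntegrableOn (fun z => c.χ' (q z) * ‖fderiv ℝ q z‖ * g z) A :=
    cint _ ((cχ.mul cD).mul hg) fun z hz h => by rw [hχ' z hz h, zero_mul, zero_mul]
  have iY : IntegrableOn (fun z => c.χ' (q z) * g z ^ 2) A :=
    cint _ (cχ.mul (hg.pow 2)) fun z hz h => by rw [hχ' z hz h, zero_mul]
  have cs : (∫ z in A, c.χ' (q z) * ‖fderiv ℝ q z‖ * g z) ^ 2 ≤
      (∫ z in A, c.χ' (q z) * ‖fderiv ℝ q z‖ ^ 2) * ∫ z in A, c.χ' (q z) * g z ^ 2 := by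
    have hp : ∀ t : ℝ, 0 ≤ (∫ z in A, c.χ' (q z) * g z ^ 2) * (t * t) +
        (-2 * ∫ z in A, c.χ' (q z) * ‖fderiv ℝ q z‖ * g z) * t +
        ∫ z in A, c.χ' (q z) * ‖fderiv ℝ q z‖ ^ 2 := by
      intro t
      have : 0 ≤ ∫ z in A, c.χ' (q z) * (t * g z - ‖fderiv ℝ q z‖) ^ 2 :=
        integral_nonneg fun z => mul_nonneg (c.nn _) (sq_nonneg _)
      have e : ∀ z, c.χ' (q z) * (t * g z - ‖fderiv ℝ q z‖) ^ 2 = (t * t) * (c.χ' (q z) * g z ^ 2)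
          + (-2 * t) * (c.χ' (q z) * ‖fderiv ℝ q z‖ * g z) + c.χ' (q z) * ‖fderiv ℝ q z‖ ^ 2 := by
        intro z; ring
      simp_rw [e] at this
      have i12 : IntegrableOn (fun z => (t * t) * (c.χ' (q z) * g z ^ 2)
          + (-2 * t) * (c.χ' (q z) * ‖fderiv ℝ q z‖ * g z)) A := (iY.const_mul _).add (iZ.const_mul _)
      rw [integral_add i12 iX,
        integral_add (iY.const_mul _) (iZ.const_mul _), integral_const_mul, integral_const_mul] at this
      linarith
    have := discrim_le_zero hp
    rw [discrim] at this
    nlinarith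
  rw [e0]
  refine cs.trans ?_
  rw [green hA hq hK c]
  have hX0 : 0 ≤ ∫ z in A, c.χ' (q z) * ‖fderiv ℝ q z‖ ^ 2 :=
    integral_nonneg fun z => mul_nonneg (c.nn _) (sq_nonneg _)
  refine mul_le_mul_of_nonneg_left ?_ hX0
  have hqc : ContinuousOn q A := hq.continuousOn
  have hB : MeasurableSet {z ∈ A | s < q z ∧ q z < s'} :=
    (hqc.isOpen_inter_preimage hA isOpen_Ioo).measurableSet
  have e3 : ∫ z in A, c.χ' (q z) * g z ^ 2 = ∫ z in {z ∈ A | s < q z ∧ q z < s'}, c.χ' (q z) * g z ^ 2 := by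
    apply setIntegral_eq_of_subset_of_forall_sdiff_eq_zero hA.measurableSet (fun z hz => hz.1)
    rintro z ⟨hz, h⟩
    have : c.χ' (q z) = 0 := by
      by_cases h2 : s < q z
      · apply c.off
        by_contra h3
        exact h ⟨hz, h2, by linarith⟩
      · apply c.off'
        linarith [c.δpos]
    rw [this, zero_mul]
  rw [e3, ← integral_const_mul]
  refine setIntegral_mono_on (iY.mono_set fun z hz => hz.1) (hgi.const_mul _) hB ?_
  intro z hz
  exact mul_le_mul_of_nonneg_right (c.le _) (sq_nonneg _)

end cutsec

/-- telescoping -/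
lemma telescope {F a : ℝ → ℝ} {S C ε0 : ℝ} (hS : 0 ≤ S) (hε : 0 < ε0) (e : ℝ → ℝ)
    (he : Tendsto (fun x => e x / x) (𝓝[>] 0) (𝓝 0))
    (h : ∀ s s', 0 ≤ s → s < s' → s' ≤ S → s' - s ≤ ε0 →
      F s - F s' ≥ -(e (s' - s)) - C * (s' - s) * (a s - a s')) : F S ≤ F 0 := by
  rcases hS.eq_or_lt with h0 | hS
  · rw [← h0]
  have step : ∀ n : ℕ, 0 < n → S / n ≤ ε0 →
      F 0 - F S ≥ -(n * e (S / n)) - C * (S / n) * (a 0 - a S) := by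
    intro n hn hne
    have hn' : (0:ℝ) < n := by exact_mod_cast hn
    have ind : ∀ k : ℕ, k ≤ n → F 0 - F (k * (S / n)) ≥ -(k * e (S / n)) - C * (S / n) * (a 0 - a (k * (S / n))) := by
      intro k
      induction k with
      | zero => intro _; simp
      | succ k ih =>
        intro hk
        have h1 := ih (by omega)
        have hd : 0 < S / n := by positivity
        have hk' : (((k + 1 : ℕ) : ℝ)) ≤ n := by exact_mod_cast hk
        have e1 : ((k + 1 : ℕ) : ℝ) * (S / n) - k * (S / n) = S / n := by push_cast; ring
        have h2 := h (k * (S / n)) ((k + 1 : ℕ) * (S / n)) (by positivity) (by linarith) ?_ (by linarith)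
        · rw [e1] at h2
          push_cast at h2 ⊢
          nlinarith
        · calc ((k + 1 : ℕ) : ℝ) * (S / n) ≤ n * (S / n) := by gcongr
            _ = S := by field_simp
    have := ind n le_rfl
    have e2 : (n : ℝ) * (S / n) = S := by field_simp
    rwa [e2] at this
  have t1 : Tendsto (fun n : ℕ => S / (n : ℝ)) atTop (𝓝[>] 0) := by
    rw [tendsto_nhdsWithin_iff]
    refine ⟨tendsto_const_div_atTop_nhds_zero_nat S, ?_⟩
    filter_upwards [eventually_gt_atTop 0] with n hn
    have hn' : (0:ℝ) < n := by exact_mod_cast hn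
    exact div_pos hS hn'
  have t2 : Tendsto (fun n : ℕ => -(S * (e (S / n) / (S / n))) - C * (S / n) * (a 0 - a S)) atTop (𝓝 0) := by
    have u1 := (he.comp t1).const_mul S
    have u2 := ((t1.mono_right nhdsWithin_le_nhds).const_mul C).mul_const (a 0 - a S)
    simpa using u1.neg.sub u2
  have : 0 ≤ F 0 - F S := by
    refine le_of_tendsto t2 ?_
    have hev : ∀ᶠ n : ℕ in atTop, S / (n:ℝ) ≤ ε0 :=
      (t1.mono_right nhdsWithin_le_nhds).eventually (eventually_le_nhds hε)
    filter_upwards [hev, eventually_gt_atTop 0] with n h1 hn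
    have hn' : (0:ℝ) < n := by exact_mod_cast hn
    have := step n hn h1
    have e3 : S * (e (S / n) / (S / n)) = n * e (S / n) := by field_simp
    rw [e3]; exact this
  linarith

end MF

namespace MF

open Set Filter Topology Complex Metric
open scoped Manifold ContDiff

lemma lapl_eq2 {f : ℂ → ℝ} {z : ℂ} (hf : ContDiffAt ℝ 2 f z) :
    lapl f z = fderiv ℝ (fderiv ℝ f) z 1 1 + fderiv ℝ (fderiv ℝ f) z I I := by
  have h1 : DifferentiableAt ℝ (fderiv ℝ f) z :=
    (hf.fderiv_right (m := 1) (by norm_num)).differentiableAt one_ne_zero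
  have h : ∀ v : ℂ, fderiv ℝ (fun w => fderiv ℝ f w v) z = (fderiv ℝ (fderiv ℝ f) z).flip v := by
    intro v
    have := h1.hasFDerivAt.clm_apply (hasFDerivAt_const v z)
    rw [this.fderiv]
    ext x; simp
  simp [lapl, h]

lemma lapl_congr {f g : ℂ → ℝ} {z : ℂ} (h : f =ᶠ[𝓝 z] g) : lapl f z = lapl g z := by
  have : ∀ v : ℂ, fderiv ℝ (fun w => fderiv ℝ f w v) z = fderiv ℝ (fun w => fderiv ℝ g w v) z := by
    intro v
    apply Filter.EventuallyEq.fderiv_eq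
    filter_upwards [h.fderiv (𝕜 := ℝ)] with w hw
    rw [hw]
  simp [lapl, this]

lemma lapl_add {f g : ℂ → ℝ} {z : ℂ} (hf : ContDiffAt ℝ 2 f z) (hg : ContDiffAt ℝ 2 g z) :
    lapl (fun w => f w + g w) z = lapl f z + lapl g z := by
  rw [lapl_eq2 hf, lapl_eq2 hg, lapl_eq2 (hf.add hg)]
  have h1 : fderiv ℝ (fun w => f w + g w) =ᶠ[𝓝 z] fun w => fderiv ℝ f w + fderiv ℝ g w := by
    filter_upwards [hf.eventually (by norm_num), hg.eventually (by norm_num)] with w h1 h2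
    exact fderiv_fun_add (h1.differentiableAt two_ne_zero) (h2.differentiableAt two_ne_zero)
  rw [h1.fderiv_eq, fderiv_fun_add ((hf.fderiv_right (m := 1) (by norm_num)).differentiableAt one_ne_zero)
    ((hg.fderiv_right (m := 1) (by norm_num)).differentiableAt one_ne_zero)]
  simp
  ring

lemma lapl_const_mul {f : ℂ → ℝ} {z : ℂ} (c : ℝ) (hf : ContDiffAt ℝ 2 f z) :
    lapl (fun w => c * f w) z = c * lapl f z := by
  rw [lapl_eq2 hf, lapl_eq2 (contDiffAt_const.mul hf)]
  have h1 : fderiv ℝ (fun w => c * f w) =ᶠ[𝓝 z] fun w => c • fderiv ℝ f w := by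
    filter_upwards [hf.eventually (by norm_num)] with w h1
    exact fderiv_const_mul (h1.differentiableAt two_ne_zero) c
  rw [h1.fderiv_eq, fderiv_fun_const_smul ((hf.fderiv_right (m := 1) (by norm_num)).differentiableAt one_ne_zero)]
  simp
  ring

lemma lapl_const (c : ℝ) (z : ℂ) : lapl (fun _ => c) z = 0 := by simp [lapl]

lemma lapl_sub {f g : ℂ → ℝ} {z : ℂ} (hf : ContDiffAt ℝ 2 f z) (hg : ContDiffAt ℝ 2 g z) :
    lapl (fun w => f w - g w) z = lapl f z - lapl g z := by
  have := lapl_add hf (contDiffAt_const (c := (-1:ℝ)) |>.mul hg)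
  rw [lapl_const_mul _ hg] at this
  have e : (fun w => f w - g w) = fun w => f w + -1 * g w := by ext w; ring
  rw [e, this]; ring

lemma contDiffAt_real_of_hol {g : ℂ → ℂ} {z : ℂ} (hg : AnalyticAt ℂ g z) {n : WithTop ℕ∞} : ContDiffAt ℝ n g z :=
  (hg.contDiffAt (n := n)).restrict_scalars ℝ

lemma lapl_comp {f : ℂ → ℝ} {g : ℂ → ℂ} {z : ℂ} (hg : AnalyticAt ℂ g z) (hf : ContDiffAt ℝ 2 f (g z)) :
    lapl (fun w => f (g w)) z = ‖deriv g z‖ ^ 2 * lapl f (g z) := by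
  have hgR : ∀ {n : WithTop ℕ∞}, ContDiffAt ℝ n g z := contDiffAt_real_of_hol hg
  have hev : ∀ᶠ w in 𝓝 z, AnalyticAt ℂ g w := hg.eventually_analyticAt
  have hfev : ∀ᶠ w in 𝓝 z, ContDiffAt ℝ 2 f (g w) :=
    hg.continuousAt.eventually (hf.eventually (by norm_num))
  have h1 : ∀ v : ℂ, (fun w => fderiv ℝ (fun w => f (g w)) w v) =ᶠ[𝓝 z]
      fun w => fderiv ℝ f (g w) (deriv g w * v) := by
    intro v
    filter_upwards [hev, hfev] with w h1 h2
    have e1 := (hasFDerivAt_real_of_complex h1.differentiableAt.hasDerivAt)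
    have e2 := (h2.differentiableAt two_ne_zero).hasFDerivAt.comp w e1
    rw [show fderiv ℝ (fun w => f (g w)) w = _ from e2.fderiv]
    simp [mul_comm]
  have hd2 : HasFDerivAt (fderiv ℝ f) (fderiv ℝ (fderiv ℝ f) (g z)) (g z) :=
    ((hf.fderiv_right (m := 1) (by norm_num)).differentiableAt one_ne_zero).hasFDerivAt
  have hgz := hasFDerivAt_real_of_complex hg.differentiableAt.hasDerivAt
  have hg'z := hasFDerivAt_real_of_complex hg.deriv.differentiableAt.hasDerivAt
  have h2 : ∀ v : ℂ, fderiv ℝ (fun w => fderiv ℝ (fun w => f (g w)) w v) z v =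
      fderiv ℝ (fderiv ℝ f) (g z) (deriv g z * v) (deriv g z * v) +
      fderiv ℝ f (g z) (deriv (deriv g) z * v * v) := by
    intro v
    rw [(h1 v).fderiv_eq]
    have := (hd2.comp z hgz).clm_apply (hg'z.mul_const v)
    rw [show fderiv ℝ (fun w => fderiv ℝ f (g w) (deriv g w * v)) z = _ from this.fderiv]
    simp
    ring_nf
  rw [lapl, h2, h2, lapl_eq2 hf]
  set a := deriv g z
  set B := fderiv ℝ (fderiv ℝ f) (g z)
  have ea : a * 1 = a.re • (1:ℂ) + a.im • I := by
    simp [Complex.re_add_im]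
  have eb : a * I = (-a.im) • (1:ℂ) + a.re • I := by
    apply Complex.ext <;> simp
  have ec : deriv (deriv g) z * I * I = -(deriv (deriv g) z * 1 * 1) := by
    rw [mul_assoc, I_mul_I]; ring
  rw [ec, ea, eb, map_neg, ← Complex.normSq_eq_norm_sq, Complex.normSq_apply]
  simp only [map_add, map_smul, ContinuousLinearMap.add_apply, ContinuousLinearMap.smul_apply, smul_eq_mul]
  ring

lemma lapl_re {g : ℂ → ℂ} {z : ℂ} (hg : AnalyticAt ℂ g z) : lapl (fun w => (g w).re) z = 0 := by
  rw [lapl_comp (f := fun w => w.re) hg Complex.reCLM.contDiff.contDiffAt]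
  have : lapl (fun w => w.re) (g z) = 0 := by
    have h : ∀ w : ℂ, fderiv ℝ (fun w : ℂ => w.re) w = Complex.reCLM := fun w => Complex.reCLM.fderiv
    simp [lapl, h]
  rw [this, mul_zero]

lemma contDiff_normSq : ContDiff ℝ 2 (fun w : ℂ => ‖w‖ ^ 2) := contDiff_norm_sq ℝ

lemma lapl_normSq (z : ℂ) : lapl (fun w : ℂ => ‖w‖ ^ 2) z = 4 := by
  have h : ∀ w v : ℂ, fderiv ℝ (fun w : ℂ => ‖w‖ ^ 2) w v = 2 * (w.re * v.re + w.im * v.im) := by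
    intro w v
    rw [fderiv_norm_sq_apply]
    simp [Complex.inner]
    ring
  have h2 : ∀ v : ℂ, fderiv ℝ (fun w : ℂ => 2 * (w.re * v.re + w.im * v.im)) z v = 2 * (v.re * v.re + v.im * v.im) := by
    intro v
    have := ((Complex.reCLM.hasFDerivAt (x := z)).mul_const v.re).add ((Complex.imCLM.hasFDerivAt (x := z)).mul_const v.im)
      |>.const_mul 2
    rw [show fderiv ℝ (fun w : ℂ => 2 * (w.re * v.re + w.im * v.im)) z = _ from this.fderiv]
    simp
    ring
  simp only [lapl, h, h2]
  simp
  norm_num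

lemma second_nonneg_of_min {f : ℂ → ℝ} {z : ℂ} (hf : ContDiffAt ℝ 2 f z) (hm : IsLocalMin f z) (v : ℂ) :
    0 ≤ fderiv ℝ (fun w => fderiv ℝ f w v) z v := by
  by_contra hneg
  push Not at hneg
  set l : ℝ → ℂ := fun t => z + t * v
  have hl0 : l 0 = z := by simp [l]
  have hlc : Continuous l := by fun_prop
  have hl : ∀ t, HasDerivAt l v t := by
    intro t
    have : HasDerivAt (fun t : ℝ => z + (t : ℂ) * v) (1 * v) t :=
      ((Complex.ofRealCLM.hasDerivAt (x := t)).mul_const v).const_add z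
    rwa [one_mul] at this
  have hlt : Tendsto l (𝓝 0) (𝓝 z) := by
    have := hlc.tendsto 0
    rwa [hl0] at this
  have h1 : deriv (fun t => f (l t)) =ᶠ[𝓝 0] fun t => fderiv ℝ f (l t) v := by
    filter_upwards [hlt.eventually (hf.eventually (by norm_num))] with t ht
    exact ((ht.differentiableAt two_ne_zero).hasFDerivAt.comp_hasDerivAt t (hl t)).deriv
  have hdv : DifferentiableAt ℝ (fun w => fderiv ℝ f w v) z :=
    (hf.fderiv_right (m := 1) (by norm_num)).differentiableAt one_ne_zero |>.clm_apply (differentiableAt_const v)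
  have h2 : deriv (deriv (fun t => f (l t))) 0 = fderiv ℝ (fun w => fderiv ℝ f w v) z v := by
    rw [h1.deriv_eq]
    have hdv' : HasFDerivAt (fun w => fderiv ℝ f w v) (fderiv ℝ (fun w => fderiv ℝ f w v) z) (l 0) := by
      rw [hl0]; exact hdv.hasFDerivAt
    exact (hdv'.comp_hasDerivAt 0 (hl 0)).deriv
  have hmin : IsLocalMin (fun t => f (l t)) 0 := by
    have := hlt.eventually hm
    rw [IsLocalMin, IsMinFilter, hl0]
    exact this
  have hca : ContinuousAt (fun t => f (l t)) 0 := by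
    apply ContinuousAt.comp _ hlc.continuousAt
    rw [hl0]; exact hf.continuousAt
  have hmax := isLocalMax_of_deriv_deriv_neg (h2 ▸ hneg) hmin.deriv_eq_zero hca
  have hconst : (fun t => f (l t)) =ᶠ[𝓝 0] fun _ => f (l 0) := by
    filter_upwards [hmin, hmax] with t h3 h4
    exact le_antisymm h4 h3
  have h5 : deriv (deriv (fun t => f (l t))) 0 = 0 := by
    rw [hconst.deriv.deriv_eq]; simp
  linarith

lemma min_principle {A : Set ℂ} (hA : IsOpen A) (hAb : Bornology.IsBounded A) {v : ℂ → ℝ}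
    (hc : ContinuousOn v (closure A)) (hv : ContDiffOn ℝ 2 v A) (hl : ∀ z ∈ A, lapl v z ≤ 0) {c : ℝ}
    (hb : ∀ z ∈ frontier A, c ≤ v z) : ∀ z ∈ A, c ≤ v z := by
  intro z hz
  have hK : IsCompact (closure A) := hAb.isCompact_closure
  obtain ⟨R, hR⟩ := hK.isBounded.exists_norm_le
  have key : ∀ ε > 0, c - ε * R ^ 2 ≤ v z := by
    intro ε hε
    obtain ⟨z0, hz0, hmin⟩ := hK.exists_isMinOn (f := fun w => v w - ε * ‖w‖ ^ 2) ⟨z, subset_closure hz⟩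
      (hc.sub (by fun_prop))
    have h1 := hmin (subset_closure hz)
    simp only [mem_setOf_eq] at h1
    by_cases h0 : z0 ∈ A
    · exfalso
      have hca : ContDiffAt ℝ 2 v z0 := hv.contDiffAt (hA.mem_nhds h0)
      have hcb : ContDiffAt ℝ 2 (fun w : ℂ => ε * ‖w‖ ^ 2) z0 := contDiffAt_const.mul contDiff_normSq.contDiffAt
      have hlm : IsLocalMin (fun w => v w - ε * ‖w‖ ^ 2) z0 :=
        hmin.isLocalMin (mem_of_superset (hA.mem_nhds h0) subset_closure)
      have h3 := second_nonneg_of_min (hca.sub hcb) hlm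
      have h4 : 0 ≤ lapl (fun w => v w - ε * ‖w‖ ^ 2) z0 := add_nonneg (h3 1) (h3 I)
      rw [lapl_sub hca hcb, lapl_const_mul _ contDiff_normSq.contDiffAt, lapl_normSq] at h4
      linarith [hl z0 h0]
    · have h2 : z0 ∈ frontier A := ⟨hz0, by rwa [hA.interior_eq]⟩
      have h3 := hb z0 h2
      have h4 := hR z0 hz0
      have h5 : ‖z0‖ ^ 2 ≤ R ^ 2 := by gcongr
      have : ε * ‖z0‖ ^ 2 ≤ ε * R ^ 2 := by gcongr
      have : 0 ≤ ε * ‖z‖ ^ 2 := by positivity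
      linarith
  have ht : Tendsto (fun ε : ℝ => c - ε * R ^ 2) (𝓝[>] 0) (𝓝 c) := by
    have : Tendsto (fun ε : ℝ => c - ε * R ^ 2) (𝓝 0) (𝓝 (c - 0 * R ^ 2)) := by
      apply Continuous.tendsto; fun_prop
    simp at this
    exact this.mono_left nhdsWithin_le_nhds
  exact le_of_tendsto ht (eventually_mem_nhdsWithin.mono key)

end MF

namespace MF

open Set Filter Topology Complex Metric
open scoped Manifold ContDiff

lemma dirichlet_approx {r : ℝ} (hr : 0 < r) {W : ℂ → ℝ} (hW : ContinuousOn W (sphere 0 r)) {η : ℝ} (hη : 0 < η) :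
    ∃ P : ℂ → ℂ, Differentiable ℂ P ∧ ∀ z ∈ sphere (0:ℂ) r, |(P z).re - W z| ≤ η := by
  haveI : Fact (0 < 2 * π) := ⟨by positivity⟩
  set pt : AddCircle (2 * π) → ℂ := fun x => r * (AddCircle.toCircle x : ℂ) with hpt
  have hptc : Continuous pt := by
    have := (AddCircle.continuous_toCircle (T := 2 * π))
    fun_prop
  have hpts : ∀ x, pt x ∈ sphere (0:ℂ) r := fun x => by
    have : ‖(AddCircle.toCircle x : ℂ)‖ = 1 := Circle.norm_coe _
    simp [hpt, abs_of_pos hr, this]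
  let F : C(AddCircle (2 * π), ℂ) := ⟨fun x => (W (pt x) : ℂ), by
    apply Complex.continuous_ofReal.comp
    exact hW.comp_continuous hptc hpts⟩
  have hF : F ∈ (Submodule.span ℂ (range (@fourier (2 * π)))).topologicalClosure := by
    rw [span_fourier_closure_eq_top]; trivial
  have hF2 : F ∈ closure ((Submodule.span ℂ (range (@fourier (2 * π)))) : Set C(AddCircle (2 * π), ℂ)) := hF
  obtain ⟨g, hg, hgF⟩ := Metric.mem_closure_iff.1 hF2 η hη
  have key : ∀ g ∈ Submodule.span ℂ (range (@fourier (2 * π))), ∃ P Q : ℂ → ℂ, Differentiable ℂ P ∧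
      Differentiable ℂ Q ∧ ∀ x, g x = P (pt x) + (starRingEnd ℂ) (Q (pt x)) := by
    intro g hg
    induction hg using Submodule.span_induction with
    | mem g hg =>
      obtain ⟨n, rfl⟩ := hg
      have hnat : ∀ (m : ℕ) x, (fourier (m:ℤ) x : ℂ) = (pt x / r) ^ m := by
        intro m x
        rw [hpt]
        simp only
        rw [mul_div_cancel_left₀ _ (by exact_mod_cast hr.ne'), fourier_apply]
        rw [AddCircle.toCircle_zsmul]
        simp
      obtain ⟨m, hm | hm⟩ := n.eq_nat_or_neg
      · refine ⟨fun z => (z / r) ^ m, fun _ => 0, by fun_prop, by fun_prop, fun x => ?_⟩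
        rw [hm, hnat]; simp
      · refine ⟨fun _ => 0, fun z => (z / r) ^ m, by fun_prop, by fun_prop, fun x => ?_⟩
        rw [hm, fourier_neg, hnat]; simp
    | zero => exact ⟨fun _ => 0, fun _ => 0, by fun_prop, by fun_prop, by simp⟩
    | add g1 g2 _ _ h1 h2 =>
      obtain ⟨P1, Q1, a1, b1, c1⟩ := h1
      obtain ⟨P2, Q2, a2, b2, c2⟩ := h2
      refine ⟨fun z => P1 z + P2 z, fun z => Q1 z + Q2 z, a1.add a2, b1.add b2, fun x => ?_⟩
      rw [ContinuousMap.add_apply, c1, c2, map_add]; ring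
    | smul c g _ h =>
      obtain ⟨P1, Q1, a1, b1, c1⟩ := h
      refine ⟨fun z => c * P1 z, fun z => (starRingEnd ℂ) c * Q1 z, a1.const_mul c, b1.const_mul _, fun x => ?_⟩
      rw [ContinuousMap.smul_apply, c1, map_mul, smul_eq_mul]; simp; ring
  obtain ⟨P, Q, hP, hQ, hPQ⟩ := key g hg
  refine ⟨fun z => P z + Q z, hP.add hQ, fun z hz => ?_⟩
  obtain ⟨x, rfl⟩ : ∃ x, pt x = z := by
    refine ⟨((arg z : ℝ) : AddCircle (2 * π)), ?_⟩
    rw [hpt]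
    simp only
    rw [AddCircle.toCircle_apply_mk, Circle.coe_exp]
    have : ‖z‖ = r := by simpa using hz
    conv_rhs => rw [← Complex.norm_mul_exp_arg_mul_I z, this]
    congr 3
    push_cast
    field_simp
  have h1 : dist (F x) (g x) < η := (ContinuousMap.dist_apply_le_dist x).trans_lt hgF
  rw [Complex.dist_eq, hPQ] at h1
  have h2 := Complex.abs_re_le_norm (F x - (P (pt x) + (starRingEnd ℂ) (Q (pt x))))
  have h3 : (F x - (P (pt x) + (starRingEnd ℂ) (Q (pt x)))).re = -((P (pt x) + Q (pt x)).re - W (pt x)) := by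
    simp [F]
  rw [h3, abs_neg] at h2
  linarith

lemma exists_prim_ball {r : ℝ} {f : ℂ → ℂ} (hf : DifferentiableOn ℂ f (ball 0 r)) :
    ∃ G : ℂ → ℂ, ∀ z ∈ ball (0:ℂ) r, HasDerivAt G (f z) z := by
  obtain ⟨G, hG⟩ := hf.isExactOn_ball
  exact ⟨G, hG⟩

set_option maxHeartbeats 1000000 in
/-- arithmetic of a Bandle step -/
lemma bandle_arith {a a' m m' ε E E' κ A0 Em : ℝ} (ha' : 0 ≤ a') (haa : a' ≤ a) (haA : a ≤ A0)
    (hm' : 0 ≤ m') (hE : 1 ≤ E) (hEm : E ≤ Em) (hε : 0 < ε) (hε1 : ε ≤ 1) (hE' : E' ≤ E * (1 + ε + ε ^ 2))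
    (hκ : 0 < κ) (hlow : E * (a - a') ≤ m - m') (hup : m - m' ≤ E' * (a - a')) (ham : a ≤ m)
    (hEE : E ≤ E')
    (hmain : 4 * π * ε * a' ^ 2 ≤ (1 + ε) * (κ * a * m * (a - a'))) :
    (8 * π * (E * a) - 8 * π * m + κ * m ^ 2) - (8 * π * (E' * a') - 8 * π * m' + κ * m' ^ 2) ≥
      -((24 * π * Em * A0 + 64 * π ^ 2 * Em ^ 2 / κ) * (ε * √ε)) - 16 * π * Em * ε * (a - a') := by
  have hpi := Real.pi_pos
  have hs : 0 < √ε := Real.sqrt_pos.2 hε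
  have hs1 : √ε ≤ 1 := Real.sqrt_le_one.2 hε1
  have hss : √ε * √ε = ε := Real.mul_self_sqrt hε.le
  have hεs : ε ≤ √ε := by nlinarith
  have ha : 0 ≤ a := ha'.trans haa
  have hA0 : 0 ≤ A0 := ha.trans haA
  have hEm0 : 0 < Em := by linarith
  have hd : 0 ≤ a - a' := by linarith
  have hΔm : 0 ≤ m - m' := (mul_nonneg (by linarith) hd).trans hlow
  have hm : 0 ≤ m := by linarith
  have b1 : (8 * π * (E * a) - 8 * π * m + κ * m ^ 2) - (8 * π * (E' * a') - 8 * π * m' + κ * m' ^ 2) ≥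
      -(8 * π * (E * (ε + ε ^ 2)) * a) + κ * (m + m') * (m - m') := by
    have : 8 * π * (m - m') ≤ 8 * π * (E' * (a - a')) := by gcongr
    have h2 : 8 * π * (E' * a) ≤ 8 * π * ((E * (1 + ε + ε ^ 2)) * a) := by gcongr
    have h3 : κ * (m + m') * (m - m') = κ * m ^ 2 - κ * m' ^ 2 := by ring
    have h4 : 8 * π * ((E * (1 + ε + ε ^ 2)) * a) = 8 * π * (E * a) + 8 * π * (E * (ε + ε ^ 2)) * a := by ring
    have h5 : 8 * π * (E' * (a - a')) = 8 * π * (E' * a) - 8 * π * (E' * a') := by ring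
    rw [h3]
    linarith
  refine ge_trans b1 ?_
  by_cases hc : m - m' ≤ √ε * m
  · rcases ha.eq_or_lt with h0 | hapos
    · have : a' = 0 := by linarith
      rw [← h0, this]
      have : 0 ≤ κ * (m + m') * (m - m') := by positivity
      have : 0 ≤ ((24 * π * Em * A0 + 64 * π ^ 2 * Em ^ 2 / κ) * (ε * √ε)) := by positivity
      simp only [mul_zero, sub_zero, neg_zero]
      linarith
    · have c1 : 4 * π * ε * (1 - ε) * (a - 2 * (a - a')) ≤ κ * m * (a - a') := by
        have e1 : a * (a - 2 * (a - a')) ≤ a' ^ 2 := by nlinarith [sq_nonneg (a - a')]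
        have e2 : (1 - ε) * (4 * π * ε * a' ^ 2) ≤ κ * a * m * (a - a') := by
          have : (1 - ε) * (4 * π * ε * a' ^ 2) ≤ (1 - ε) * ((1 + ε) * (κ * a * m * (a - a'))) :=
            mul_le_mul_of_nonneg_left hmain (by linarith)
          have h3 : 0 ≤ κ * a * m * (a - a') := by positivity
          have h4 := mul_nonneg h3 (sq_nonneg ε)
          have h5 : (1 - ε) * ((1 + ε) * (κ * a * m * (a - a'))) =
            κ * a * m * (a - a') - κ * a * m * (a - a') * ε ^ 2 := by ring
          linarith
        have e3 : (1 - ε) * (4 * π * ε) * (a * (a - 2 * (a - a'))) ≤ (1 - ε) * (4 * π * ε) * a' ^ 2 :=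
          mul_le_mul_of_nonneg_left e1 (mul_nonneg (by linarith) (by positivity))
        have e4 : a * (4 * π * ε * (1 - ε) * (a - 2 * (a - a'))) ≤ a * (κ * m * (a - a')) := by
          have h6 : a * (4 * π * ε * (1 - ε) * (a - 2 * (a - a'))) =
            (1 - ε) * (4 * π * ε) * (a * (a - 2 * (a - a'))) := by ring
          have h7 : (1 - ε) * (4 * π * ε * a' ^ 2) = (1 - ε) * (4 * π * ε) * a' ^ 2 := by ring
          have h8 : κ * a * m * (a - a') = a * (κ * m * (a - a')) := by ring
          rw [h6, ← h8]
          linarith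
        exact le_of_mul_le_mul_left e4 hapos
      have c2 : E * (κ * m * (a - a')) ≤ κ * m * (m - m') := by
        have := mul_le_mul_of_nonneg_left hlow (mul_nonneg hκ.le hm)
        have h6 : E * (κ * m * (a - a')) = κ * m * (E * (a - a')) := by ring
        rw [h6]; exact this
      have c3 : (2 - √ε) * (κ * m * (m - m')) ≤ κ * (m + m') * (m - m') := by
        have h1 : (2 - √ε) * m ≤ m + m' := by
          have : (2 - √ε) * m = 2 * m - √ε * m := by ring
          linarith
        have := mul_le_mul_of_nonneg_right h1 (mul_nonneg hκ.le hΔm)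
        have h6 : (2 - √ε) * (κ * m * (m - m')) = (2 - √ε) * m * (κ * (m - m')) := by ring
        have h7 : κ * (m + m') * (m - m') = (m + m') * (κ * (m - m')) := by ring
        rw [h6, h7]; exact this
      have c4 : (2 - √ε) * (E * (4 * π * ε * (1 - ε) * (a - 2 * (a - a')))) ≤ κ * (m + m') * (m - m') := by
        refine le_trans ?_ c3
        refine mul_le_mul_of_nonneg_left ?_ (by linarith)
        refine le_trans ?_ c2
        exact mul_le_mul_of_nonneg_left c1 (by linarith)
      -- expand
      have c5 : (2 - √ε) * (E * (4 * π * ε * (1 - ε) * (a - 2 * (a - a')))) ≥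
          8 * π * E * ε * (a - (√ε / 2 + ε) * a - 2 * (a - a')) := by
        have h1 : 0 ≤ 8 * π * E * ε := by positivity
        have h2 : (1 - √ε / 2) * (1 - ε) * (a - 2 * (a - a')) ≥ a - (√ε / 2 + ε) * a - 2 * (a - a') := by
          have k0 : 0 ≤ (1 - √ε / 2) * (1 - ε) := mul_nonneg (by linarith) (by linarith)
          have k1 : (1 - √ε / 2) * (1 - ε) ≤ 1 := by nlinarith
          have k2 : (1 - √ε / 2) * (1 - ε) ≥ 1 - (√ε / 2 + ε) := by nlinarith
          have k3 := mul_le_mul_of_nonneg_right k1 hd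
          have k4 := mul_le_mul_of_nonneg_right k2 ha
          have k5 : (1 - √ε / 2) * (1 - ε) * (a - 2 * (a - a')) =
            (1 - √ε / 2) * (1 - ε) * a - 2 * ((1 - √ε / 2) * (1 - ε) * (a - a')) := by ring
          have k6 : (1 - (√ε / 2 + ε)) * a = a - (√ε / 2 + ε) * a := by ring
          rw [k5]
          linarith
        have := mul_le_mul_of_nonneg_left h2 h1
        have k7 : (2 - √ε) * (E * (4 * π * ε * (1 - ε) * (a - 2 * (a - a')))) =
          8 * π * E * ε * ((1 - √ε / 2) * (1 - ε) * (a - 2 * (a - a'))) := by ring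
        rw [k7]; exact this
      have c6 : 8 * π * E * ε * ((√ε / 2 + ε) * a + 2 * (a - a')) + 8 * π * E * ε ^ 2 * a ≤
          (24 * π * Em * A0 + 64 * π ^ 2 * Em ^ 2 / κ) * (ε * √ε) + 16 * π * Em * ε * (a - a') := by
        have h1 : 8 * π * E * ε * ((√ε / 2 + ε) * a) + 8 * π * E * ε ^ 2 * a ≤ 24 * π * Em * A0 * (ε * √ε) := by
          have : (√ε / 2 + ε) * a + ε * a ≤ 3 * (√ε * A0) := by
            have : √ε * a ≤ √ε * A0 := by gcongr
            have : ε * a ≤ √ε * A0 := by gcongr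
            have k8 : (√ε / 2 + ε) * a + ε * a = √ε * a / 2 + 2 * (ε * a) := by ring
            have : 0 ≤ √ε * A0 := by positivity
            rw [k8]
            linarith
          calc 8 * π * E * ε * ((√ε / 2 + ε) * a) + 8 * π * E * ε ^ 2 * a
              = 8 * π * E * ε * ((√ε / 2 + ε) * a + ε * a) := by ring
            _ ≤ 8 * π * Em * ε * (3 * (√ε * A0)) := by gcongr
            _ = _ := by ring
        have h2 : 0 ≤ 64 * π ^ 2 * Em ^ 2 / κ * (ε * √ε) := by positivity
        have h3 : 8 * π * E * ε * (2 * (a - a')) ≤ 16 * π * Em * ε * (a - a') := by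
          calc 8 * π * E * ε * (2 * (a - a')) ≤ 8 * π * Em * ε * (2 * (a - a')) := by gcongr
            _ = _ := by ring
        have k9 : 8 * π * E * ε * ((√ε / 2 + ε) * a + 2 * (a - a')) =
          8 * π * E * ε * ((√ε / 2 + ε) * a) + 8 * π * E * ε * (2 * (a - a')) := by ring
        have k10 : (24 * π * Em * A0 + 64 * π ^ 2 * Em ^ 2 / κ) * (ε * √ε) =
          24 * π * Em * A0 * (ε * √ε) + 64 * π ^ 2 * Em ^ 2 / κ * (ε * √ε) := by ring
        rw [k9, k10]
        linarith
      have c7 : 8 * π * E * ε * (a - (√ε / 2 + ε) * a - 2 * (a - a')) = 8 * π * (E * (ε + ε ^ 2)) * a -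
        (8 * π * E * ε * ((√ε / 2 + ε) * a + 2 * (a - a')) + 8 * π * E * ε ^ 2 * a) := by ring
      linarith
  · push Not at hc
    have d1 : κ * √ε * m ^ 2 ≤ κ * (m + m') * (m - m') := by
      have : m * (√ε * m) ≤ (m + m') * (m - m') := mul_le_mul (by linarith) hc.le (by positivity) (by positivity)
      have := mul_le_mul_of_nonneg_left this hκ.le
      have k1 : κ * √ε * m ^ 2 = κ * (m * (√ε * m)) := by ring
      have k2 : κ * (m + m') * (m - m') = κ * ((m + m') * (m - m')) := by ring
      rw [k1, k2]; exact this
    have d2 : 8 * π * (E * (ε + ε ^ 2)) * a ≤ 16 * π * Em * ε * m := by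
      calc 8 * π * (E * (ε + ε ^ 2)) * a ≤ 8 * π * (Em * (ε + ε)) * m := by
            gcongr
            nlinarith
        _ = _ := by ring
    have d3 : 16 * π * Em * ε * m ≤ κ * √ε * m ^ 2 + 64 * π ^ 2 * Em ^ 2 / κ * (ε * √ε) := by
      have e : κ * √ε * m ^ 2 + 64 * π ^ 2 * Em ^ 2 / κ * (ε * √ε) - 16 * π * Em * ε * m =
          √ε / κ * (κ * m - 8 * π * Em * √ε) ^ 2 := by
        have hε' : ε = √ε * √ε := hss.symm
        have : ∀ x : ℝ, κ * x * m ^ 2 + 64 * π ^ 2 * Em ^ 2 / κ * (x * x * x) - 16 * π * Em * (x * x) * m =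
          x / κ * (κ * m - 8 * π * Em * x) ^ 2 := by intro x; field_simp; ring
        have h := this (√ε)
        rw [hss] at h
        exact h
      have : 0 ≤ √ε / κ * (κ * m - 8 * π * Em * √ε) ^ 2 := by positivity
      linarith
    have d4 : 0 ≤ 24 * π * Em * A0 * (ε * √ε) := by positivity
    have d5 : 0 ≤ 16 * π * Em * ε * (a - a') := by positivity
    have k10 : (24 * π * Em * A0 + 64 * π ^ 2 * Em ^ 2 / κ) * (ε * √ε) =
      24 * π * Em * A0 * (ε * √ε) + 64 * π ^ 2 * Em ^ 2 / κ * (ε * √ε) := by ring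
    rw [k10]
    linarith

end MF

namespace MF

open Set Filter Topology Complex Metric
open scoped Manifold ContDiff

lemma exp_sub_le {ε : ℝ} (h0 : 0 < ε) (h1 : ε ≤ 1) : Real.exp ε ≤ 1 + ε + ε ^ 2 := by
  have := Real.abs_exp_sub_one_sub_id_le (x := ε) (by rw [abs_of_pos h0]; exact h1)
  have := (abs_le.1 this).2
  linarith

section bandlesec
variable {A : Set ℂ} {W h : ℂ → ℝ} {G : ℂ → ℂ} {κ : ℝ}

lemma bandle_step_main (hA : IsOpen A) (hW : ContDiffOn ℝ 2 W A)
    (hh : ContDiffOn ℝ 2 h A) (hhl : ∀ z ∈ A, lapl h z = 0)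
    (hG : DifferentiableOn ℂ G A) (hGh : ∀ z ∈ A, ‖deriv G z‖ ^ 2 = Real.exp (h z))
    (hb : ∀ s > 0, IsCompact {z ∈ A | s ≤ W z - h z}) (hκ : 0 < κ)
    (ih : IntegrableOn (fun z => Real.exp (h z)) A) (iW : IntegrableOn (fun z => Real.exp (W z)) A)
    (il : IntegrableOn (lapl W) A)
    (hWl : ∀ z ∈ A, -lapl W z ≤ κ * Real.exp (W z)) {s s' : ℝ} (hs : 0 ≤ s) (hss : s < s') :
    4 * π * (s' - s) * (∫ z in {z ∈ A | s' < W z - h z}, Real.exp (h z)) ^ 2 ≤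
      (1 + (s' - s)) * (κ * (∫ z in {z ∈ A | s < W z - h z}, Real.exp (h z)) *
        (∫ z in {z ∈ A | s < W z - h z}, Real.exp (W z)) *
        ((∫ z in {z ∈ A | s < W z - h z}, Real.exp (h z)) -
          ∫ z in {z ∈ A | s' < W z - h z}, Real.exp (h z))) := by
  set q : ℂ → ℝ := fun z => W z - h z with hq
  set ε := s' - s with hεd
  have hε : 0 < ε := by linarith
  have hqA : ContDiffOn ℝ 2 q A := hW.sub hh
  have hK : ∀ s1 > s, IsCompact {z ∈ A | s1 ≤ q z} := by
    exact fun s1 hs1 => hb s1 (lt_of_le_of_lt hs hs1)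
  obtain ⟨c⟩ := exists_chi hss hε
  set As : ℝ → Set ℂ := fun s => {z ∈ A | s < q z} with hAs
  have hAsm : ∀ s, MeasurableSet (As s) := fun s =>
    (hqA.continuousOn.isOpen_inter_preimage hA isOpen_Ioi).measurableSet
  have hAsA : ∀ s, As s ⊆ A := fun s z hz => hz.1
  change 4 * π * ε * (∫ z in As s', Real.exp (h z)) ^ 2 ≤ (1 + ε) * (κ * (∫ z in As s, Real.exp (h z)) *
    (∫ z in As s, Real.exp (W z)) * ((∫ z in As s, Real.exp (h z)) - ∫ z in As s', Real.exp (h z)))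
  set a := ∫ z in As s, Real.exp (h z) with ha
  set a' := ∫ z in As s', Real.exp (h z) with ha'
  set m := ∫ z in As s, Real.exp (W z) with hm
  have ha0 : 0 ≤ a := integral_nonneg fun z => (Real.exp_pos _).le
  have ha'0 : 0 ≤ a' := integral_nonneg fun z => (Real.exp_pos _).le
  have hm0 : 0 ≤ m := integral_nonneg fun z => (Real.exp_pos _).le
  have hts := cut_tsupport hK c
  have htsA : tsupport (cut A q c) ⊆ A := hts.trans fun z hz => hz.1
  have htsAs : tsupport (cut A q c) ⊆ As s := hts.trans fun z hz => ⟨hz.1, by linarith [hz.2, c.δpos]⟩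
  have hta : ∫ z in tsupport (cut A q c), ‖deriv G z‖ ^ 2 ≤ a := by
    rw [setIntegral_congr_fun (isClosed_tsupport _).measurableSet (fun z hz => hGh z (htsA hz))]
    exact setIntegral_mono_set (ih.mono_set (hAsA s)) (ae_of_all _ fun z => (Real.exp_pos _).le)
      (HasSubset.Subset.eventuallyLE htsAs)
  have hiso := isop hA hG (cut_contDiff hA hqA hK c) (cut_compact hK c) htsA (cut_nonneg c) hta
  have hgc : ContinuousOn (fun z => ‖deriv G z‖) A := (hG.deriv hA).continuousOn.norm
  have hband : IntegrableOn (fun z => ‖deriv G z‖ ^ 2) {z ∈ A | s < q z ∧ q z < s'} := by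
    have hBm : MeasurableSet {z ∈ A | s < q z ∧ q z < s'} :=
      (hqA.continuousOn.isOpen_inter_preimage hA isOpen_Ioo).measurableSet
    exact (ih.mono_set (fun z hz => hz.1)).congr_fun (fun z hz => (hGh z hz.1).symm) hBm
  have hen := energy hA hqA hK c hss hε hgc (fun z _ => norm_nonneg _) hband
  set L := ∫ z, ‖fderiv ℝ (cut A q c) z‖ * ‖deriv G z‖ with hL
  have hL0 : 0 ≤ L := integral_nonneg fun z => by positivity
  -- lower bound of the left side
  have l1 : a' ≤ ∫ z, cut A q c z * ‖deriv G z‖ ^ 2 := by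
    have e1 : ∫ z, cut A q c z * ‖deriv G z‖ ^ 2 = ∫ z in A, c.χ (q z) * Real.exp (h z) := by
      rw [← setIntegral_eq_integral_of_forall_compl_eq_zero (s := A)]
      · refine setIntegral_congr_fun hA.measurableSet fun z hz => ?_
        simp only [cut]
        rw [indicator_of_mem hz, hGh z hz]
      · intro z hz; simp [cut, hz]
    rw [e1]
    have i1 : IntegrableOn (fun z => c.χ (q z) * Real.exp (h z)) A := by
      refine Integrable.mono' ih (ContinuousOn.aestronglyMeasurable ?_ hA.measurableSet) ?_
      · exact ((chi_contDiff c).continuous.comp_continuousOn hqA.continuousOn).mul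
          (Real.continuous_exp.comp_continuousOn hh.continuousOn)
      · refine ae_of_all _ fun z => ?_
        rw [Real.norm_of_nonneg (mul_nonneg (c.nonneg _) (Real.exp_pos _).le)]
        exact mul_le_of_le_one_left (Real.exp_pos _).le (c.le_one _)
    calc a' = ∫ z in As s', c.χ (q z) * Real.exp (h z) := by
          refine setIntegral_congr_fun (hAsm s') fun z hz => ?_
          rw [c.one _ hz.2.le, one_mul]
      _ ≤ _ := setIntegral_mono_set i1 (ae_of_all _ fun z => mul_nonneg (c.nonneg _) (Real.exp_pos _).le)
          (HasSubset.Subset.eventuallyLE (hAsA s'))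
  -- upper bound of the energy
  have l2 : ∫ z in A, c.χ (q z) * (-lapl q z) ≤ κ * m := by
    have e2 : ∫ z in A, c.χ (q z) * (-lapl q z) = ∫ z in As s, c.χ (q z) * (-lapl q z) := by
      apply setIntegral_eq_of_subset_of_forall_sdiff_eq_zero hA.measurableSet (hAsA s)
      rintro z ⟨hz, h1⟩
      have : c.χ (q z) = 0 := c.zero _ (by
        by_contra h3
        exact h1 ⟨hz, by linarith [c.δpos]⟩)
      rw [this, zero_mul]
    have hlq : ∀ z ∈ A, -lapl q z ≤ κ * Real.exp (W z) := by
      intro z hz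
      rw [hq, lapl_sub (hW.contDiffAt (hA.mem_nhds hz)) (hh.contDiffAt (hA.mem_nhds hz)), hhl z hz]
      simpa using hWl z hz
    have clap : ContinuousOn (lapl q) A := cont_lapl hA hqA
    have hlq2 : ∀ z ∈ A, lapl q z = lapl W z := by
      intro z hz
      rw [hq, lapl_sub (hW.contDiffAt (hA.mem_nhds hz)) (hh.contDiffAt (hA.mem_nhds hz)), hhl z hz, sub_zero]
    have i2 : IntegrableOn (fun z => c.χ (q z) * (-lapl q z)) A := by
      refine Integrable.mono' il.norm (ContinuousOn.aestronglyMeasurable ?_ hA.measurableSet) ?_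
      · exact ((chi_contDiff c).continuous.comp_continuousOn hqA.continuousOn).mul clap.neg
      · refine (ae_restrict_iff' hA.measurableSet).2 (ae_of_all _ fun z hz => ?_)
        rw [norm_mul, norm_neg, hlq2 z hz, Real.norm_of_nonneg (c.nonneg _)]
        exact mul_le_of_le_one_left (norm_nonneg _) (c.le_one _)
    rw [e2, hm, ← integral_const_mul]
    refine setIntegral_mono_on (i2.mono_set (hAsA s)) ((iW.mono_set (hAsA s)).const_mul _) (hAsm s) ?_
    intro z hz
    have h1 := hlq z hz.1
    have h2 : 0 ≤ κ * Real.exp (W z) := by positivity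
    calc c.χ (q z) * (-lapl q z) ≤ c.χ (q z) * (κ * Real.exp (W z)) :=
          mul_le_mul_of_nonneg_left h1 (c.nonneg _)
      _ ≤ _ := mul_le_of_le_one_left h2 (c.le_one _)
  have l3 : ∫ z in {z ∈ A | s < q z ∧ q z < s'}, ‖deriv G z‖ ^ 2 ≤ a - a' := by
    have e3 : a - a' = ∫ z in As s \ As s', Real.exp (h z) := by
      rw [ha, ha', setIntegral_sdiff (hAsm s') (ih.mono_set (hAsA s))]
      intro z hz; exact ⟨hz.1, hss.trans hz.2⟩
    have hBm : MeasurableSet {z ∈ A | s < q z ∧ q z < s'} :=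
      (hqA.continuousOn.isOpen_inter_preimage hA isOpen_Ioo).measurableSet
    rw [e3, setIntegral_congr_fun hBm (fun z hz => hGh z hz.1)]
    refine setIntegral_mono_set (ih.mono_set (sdiff_subset.trans (hAsA s))) (ae_of_all _ fun z => (Real.exp_pos _).le)
      (HasSubset.Subset.eventuallyLE ?_)
    intro z hz
    exact ⟨⟨hz.1, hz.2.1⟩, fun h4 => by linarith [h4.2, hz.2.2]⟩
  have hεpos : 0 ≤ (1 + ε) / ε := by positivity
  have l4 : L ^ 2 ≤ κ * m * ((1 + ε) / ε * (a - a')) := by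
    refine hen.trans ?_
    have h5 : 0 ≤ ∫ z in {z ∈ A | s < q z ∧ q z < s'}, ‖deriv G z‖ ^ 2 := integral_nonneg fun z => by positivity
    refine mul_le_mul l2 (mul_le_mul_of_nonneg_left l3 hεpos) (mul_nonneg hεpos h5) (by positivity)
  have l5 : a' ≤ √(a / π) / 2 * L := l1.trans hiso
  have l6 : a' ^ 2 ≤ a / π / 4 * L ^ 2 := by
    have := pow_le_pow_left₀ ha'0 l5 2
    rw [mul_pow, div_pow, Real.sq_sqrt (by positivity)] at this
    norm_num at this ⊢
    exact this
  have hpi := Real.pi_pos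
  calc 4 * π * ε * a' ^ 2 ≤ 4 * π * ε * (a / π / 4 * (κ * m * ((1 + ε) / ε * (a - a')))) := by
        gcongr
        exact l6.trans (by gcongr)
    _ = _ := by field_simp

lemma bandle (hA : IsOpen A) (hW : ContDiffOn ℝ 2 W A)
    (hh : ContDiffOn ℝ 2 h A) (hhl : ∀ z ∈ A, lapl h z = 0)
    (hG : DifferentiableOn ℂ G A) (hGh : ∀ z ∈ A, ‖deriv G z‖ ^ 2 = Real.exp (h z))
    (hb : ∀ s > 0, IsCompact {z ∈ A | s ≤ W z - h z}) (hκ : 0 < κ)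
    (ih : IntegrableOn (fun z => Real.exp (h z)) A) (iW : IntegrableOn (fun z => Real.exp (W z)) A)
    (il : IntegrableOn (lapl W) A)
    (hWl : ∀ z ∈ A, -lapl W z ≤ κ * Real.exp (W z)) :
    (∫ z in A, Real.exp (W z)) - (∫ z in A, Real.exp (h z)) ≤
      κ * (∫ z in A, Real.exp (W z)) ^ 2 / (8 * π) := by
  set q : ℂ → ℝ := fun z => W z - h z with hq
  have hqA : ContDiffOn ℝ 2 q A := hW.sub hh
  set As : ℝ → Set ℂ := fun s => {z ∈ A | s < q z} with hAs
  have hAsm : ∀ s, MeasurableSet (As s) := fun s =>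
    (hqA.continuousOn.isOpen_inter_preimage hA isOpen_Ioi).measurableSet
  have hAsA : ∀ s, As s ⊆ A := fun s z hz => hz.1
  set a : ℝ → ℝ := fun s => ∫ z in As s, Real.exp (h z) with ha
  set m : ℝ → ℝ := fun s => ∫ z in As s, Real.exp (W z) with hm
  have ha0 : ∀ s, 0 ≤ a s := fun s => integral_nonneg fun z => (Real.exp_pos _).le
  have hm0 : ∀ s, 0 ≤ m s := fun s => integral_nonneg fun z => (Real.exp_pos _).le
  obtain ⟨S, hS0, hS⟩ : ∃ S : ℝ, 0 ≤ S ∧ ∀ z ∈ A, q z ≤ S := by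
    obtain ⟨S, hS⟩ := (hb 1 one_pos).bddAbove_image (hqA.continuousOn.mono fun z hz => hz.1)
    refine ⟨max S 1, le_max_of_le_right one_pos.le, fun z hz => ?_⟩
    by_cases h1 : 1 ≤ q z
    · exact (hS (mem_image_of_mem _ ⟨hz, h1⟩)).trans (le_max_left _ _)
    · exact (not_le.1 h1).le.trans (le_max_right _ _)
  have hsub : ∀ s s', s < s' → As s' ⊆ As s := fun s s' h z hz => ⟨hz.1, h.trans hz.2⟩
  have hda : ∀ s s', s < s' → a s - a s' = ∫ z in As s \ As s', Real.exp (h z) := fun s s' hss => by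
    simp only [ha]
    rw [setIntegral_sdiff (hAsm s') (ih.mono_set (hAsA s)) (hsub s s' hss)]
  have hdm : ∀ s s', s < s' → m s - m s' = ∫ z in As s \ As s', Real.exp (W z) := fun s s' hss => by
    simp only [hm]
    rw [setIntegral_sdiff (hAsm s') (iW.mono_set (hAsA s)) (hsub s s' hss)]
  set F : ℝ → ℝ := fun s => 8 * π * (Real.exp s * a s) - 8 * π * m s + κ * m s ^ 2 with hF
  have hAe : As S = ∅ := by
    ext z; simp only [hAs, mem_setOf_eq, mem_empty_iff_false, iff_false, not_and, not_lt]
    exact hS z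
  have hFS : F S = 0 := by simp [hF, ha, hm, hAe]
  have htel : F S ≤ F 0 := by
    refine telescope (a := a) (C := 16 * π * Real.exp S) (ε0 := 1) hS0 one_pos
      (fun ε => (24 * π * Real.exp S * a 0 + 64 * π ^ 2 * Real.exp S ^ 2 / κ) * (ε * √ε)) ?_ ?_
    · have : Tendsto (fun x : ℝ => (24 * π * Real.exp S * a 0 + 64 * π ^ 2 * Real.exp S ^ 2 / κ) * √x)
          (𝓝[>] 0) (𝓝 0) := by
        have : Tendsto (fun x : ℝ => (24 * π * Real.exp S * a 0 + 64 * π ^ 2 * Real.exp S ^ 2 / κ) * √x)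
          (𝓝 0) (𝓝 ((24 * π * Real.exp S * a 0 + 64 * π ^ 2 * Real.exp S ^ 2 / κ) * √0)) := by
          apply Continuous.tendsto; fun_prop
        simp at this
        exact this.mono_left nhdsWithin_le_nhds
      refine this.congr' ?_
      filter_upwards [self_mem_nhdsWithin] with x hx
      have hx0 : x ≠ 0 := (mem_Ioi.1 hx).ne'
      field_simp
    · intro s s' hs hss hsS hss1
      have hd0 : ∀ z ∈ As s \ As s', s < q z ∧ q z ≤ s' := fun z hz =>
        ⟨hz.1.2, not_lt.1 fun h1 => hz.2 ⟨hz.1.1, h1⟩⟩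
      have hdms : MeasurableSet (As s \ As s') := (hAsm s).diff (hAsm s')
      have hdA : As s \ As s' ⊆ A := sdiff_subset.trans (hAsA s)
      have hmain := bandle_step_main hA hW hh hhl hG hGh hb hκ ih iW il hWl hs hss
      have heq : ∀ z, Real.exp (W z) = Real.exp (q z) * Real.exp (h z) := fun z => by
        rw [← Real.exp_add]; simp [hq]
      have hss0 : 0 ≤ a s - a s' := by rw [hda s s' hss]; exact integral_nonneg fun z => (Real.exp_pos _).le
      have := bandle_arith (a := a s) (a' := a s') (m := m s) (m' := m s') (ε := s' - s) (E := Real.exp s)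
        (E' := Real.exp s') (κ := κ) (A0 := a 0) (Em := Real.exp S) (ha0 s') (by linarith) ?_ (hm0 s')
        (Real.one_le_exp hs) (Real.exp_le_exp.2 (by linarith)) (by linarith) hss1 ?_ hκ ?_ ?_ ?_
        (Real.exp_le_exp.2 hss.le) hmain
      · exact this
      · exact setIntegral_mono_set (ih.mono_set (hAsA 0)) (ae_of_all _ fun z => (Real.exp_pos _).le)
          (HasSubset.Subset.eventuallyLE fun z hz => ⟨hz.1, lt_of_le_of_lt hs hz.2⟩)
      · have e : Real.exp s' = Real.exp s * Real.exp (s' - s) := by rw [← Real.exp_add]; congr 1; ring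
        rw [e]
        gcongr
        exact exp_sub_le (by linarith) hss1
      · rw [hda s s' hss, hdm s s' hss, ← integral_const_mul]
        refine setIntegral_mono_on ((ih.mono_set hdA).const_mul _) (iW.mono_set hdA) hdms fun z hz => ?_
        rw [heq]
        gcongr
        exact (hd0 z hz).1.le
      · rw [hda s s' hss, hdm s s' hss, ← integral_const_mul]
        refine setIntegral_mono_on (iW.mono_set hdA) ((ih.mono_set hdA).const_mul _) hdms fun z hz => ?_
        rw [heq]
        gcongr
        exact (hd0 z hz).2
      · refine setIntegral_mono_on (ih.mono_set (hAsA s)) (iW.mono_set (hAsA s)) (hAsm s) fun z hz => ?_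
        apply Real.exp_le_exp.2
        have : s < W z - h z := hz.2
        linarith
  have hpi := Real.pi_pos
  have f0 : m 0 - a 0 ≤ κ * m 0 ^ 2 / (8 * π) := by
    rw [le_div_iff₀ (by positivity)]
    rw [hFS] at htel
    simp only [hF, Real.exp_zero, one_mul] at htel
    linarith
  have f1 : (∫ z in A, Real.exp (W z)) - m 0 = ∫ z in A \ As 0, Real.exp (W z) := by
    simp only [hm]
    rw [setIntegral_sdiff (hAsm 0) iW (hAsA 0)]
  have f2 : (∫ z in A, Real.exp (h z)) - a 0 = ∫ z in A \ As 0, Real.exp (h z) := by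
    simp only [ha]
    rw [setIntegral_sdiff (hAsm 0) ih (hAsA 0)]
  have f3 : ∫ z in A \ As 0, Real.exp (W z) ≤ ∫ z in A \ As 0, Real.exp (h z) := by
    refine setIntegral_mono_on (iW.mono_set sdiff_subset) (ih.mono_set sdiff_subset)
      (hA.measurableSet.diff (hAsm 0)) fun z hz => ?_
    apply Real.exp_le_exp.2
    by_contra h1
    exact hz.2 ⟨hz.1, by simp only [hq]; linarith⟩
  have f4 : m 0 ≤ ∫ z in A, Real.exp (W z) :=
    setIntegral_mono_set iW (ae_of_all _ fun z => (Real.exp_pos _).le) (HasSubset.Subset.eventuallyLE (hAsA 0))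
  have f5 : κ * m 0 ^ 2 / (8 * π) ≤ κ * (∫ z in A, Real.exp (W z)) ^ 2 / (8 * π) := by
    have := hm0 0
    gcongr
  linarith

end bandlesec

end MF

namespace MF

open Set Filter Topology Complex Metric
open scoped Manifold ContDiff


lemma comparison {Ω : Set ℂ} (hA : IsOpen Ω) (hAb : Bornology.IsBounded Ω) {g1 g2 : ℂ → ℝ}
    (hc1 : ContinuousOn g1 (closure Ω)) (hc2 : ContinuousOn g2 (closure Ω))
    (h1 : ContDiffOn ℝ 2 g1 Ω) (h2 : ContDiffOn ℝ 2 g2 Ω)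
    (hl : ∀ z ∈ Ω, lapl g2 z ≤ lapl g1 z) (hb : ∀ z ∈ frontier Ω, g1 z ≤ g2 z) : ∀ z ∈ Ω, g1 z ≤ g2 z := by
  intro z hz
  have := min_principle hA hAb (v := fun z => g2 z - g1 z) (hc2.sub hc1) (h2.sub h1) (fun z hz => by
    rw [lapl_sub (h2.contDiffAt (hA.mem_nhds hz)) (h1.contDiffAt (hA.mem_nhds hz))]
    linarith [hl z hz]) (c := 0) (fun z hz => by linarith [hb z hz]) z hz
  linarith

/-- Poisson integral on the disc of radius r around zero -/
def PI (g : ℂ → ℝ) (r : ℝ) (w : ℂ) : ℝ := circleAverage ((Complex.re ∘ herglotzRieszKernel 0 w) • g) 0 r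

lemma PI_hol {g : ℂ → ℝ} {r : ℝ} (hg : CircleIntegrable g 0 r) :
    ∃ F : ℂ → ℂ, DifferentiableOn ℂ F (ball 0 r) ∧ ∀ w ∈ ball (0:ℂ) r, PI g r w = (F w).re := by
  have h₁ : CircleIntegrable (fun ζ ↦ (g ζ : ℂ)) 0 r := by
    simp only [CircleIntegrable, intervalIntegrable_iff] at hg ⊢
    exact Complex.ofRealCLM.integrable_comp hg
  exact ⟨_, differentiableOn_circleAverage_herglotzRieszKernel_smul h₁, fun w hw =>
    (re_circleAverage_herglotzRieszKernel_smul hg hw).symm⟩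

lemma kernel_ci {g : ℂ → ℝ} {r : ℝ} {w : ℂ} (hg : CircleIntegrable g 0 r) (hw : w ∈ ball (0:ℂ) r) :
    CircleIntegrable ((Complex.re ∘ herglotzRieszKernel 0 w) • g) 0 r := by
  have : ContinuousOn (Complex.re ∘ herglotzRieszKernel 0 w) (sphere 0 |r|) :=
    Complex.continuous_re.comp_continuousOn (continuousOn_herglotzRieszKernel_sphere hw)
  exact hg.continuousOn_smul this

lemma kernel_nonneg {r : ℝ} {w z : ℂ} (hw : w ∈ ball (0:ℂ) r) (hz : z ∈ sphere (0:ℂ) r) :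
    0 ≤ (herglotzRieszKernel 0 w z).re := by
  have h1 := le_re_herglotzRieszKernel hz hw
  rw [herglotzRieszKernel_def]
  refine le_trans ?_ h1
  have : ‖w‖ < r := by simpa using hw
  have : 0 < r := pos_of_mem_ball hw
  simp only [sub_zero]
  have := norm_nonneg w
  apply div_nonneg <;> linarith

lemma PI_mono {g1 g2 : ℂ → ℝ} {r : ℝ} (h1 : CircleIntegrable g1 0 r) (h2 : CircleIntegrable g2 0 r)
    {w : ℂ} (hw : w ∈ ball (0:ℂ) r) (h : ∀ z ∈ sphere (0:ℂ) r, g1 z ≤ g2 z) : PI g1 r w ≤ PI g2 r w := by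
  have hr : 0 < r := pos_of_mem_ball hw
  refine circleAverage_mono (kernel_ci h1 hw) (kernel_ci h2 hw) fun z hz => ?_
  rw [abs_of_pos hr] at hz
  exact mul_le_mul_of_nonneg_left (h z hz) (kernel_nonneg hw hz)

lemma PI_re {P : ℂ → ℂ} (hP : Differentiable ℂ P) {r : ℝ} {w : ℂ} (hw : w ∈ ball (0:ℂ) r) :
    PI (fun z => (P z).re) r w = (P w).re := by
  have h1 := DiffContOnCl.circleAverage_re_herglotzRieszKernel_smul (hP.diffContOnCl (s := ball 0 r)) hw
  have hc : CircleIntegrable ((re ∘ herglotzRieszKernel 0 w) • P) 0 r := by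
    have : ContinuousOn (Complex.re ∘ herglotzRieszKernel 0 w) (sphere 0 |r|) :=
      Complex.continuous_re.comp_continuousOn (continuousOn_herglotzRieszKernel_sphere hw)
    have hPi : CircleIntegrable P 0 r := hP.continuous.continuousOn.circleIntegrable'
    exact hPi.continuousOn_smul this
  have h2 := Complex.reCLM.circleAverage_comp_comm hc
  rw [h1] at h2
  simp only [reCLM_apply] at h2
  rw [← h2, PI]
  congr 1
  ext z
  simp

lemma PI_approx {g : ℂ → ℝ} {r : ℝ} (hg : CircleIntegrable g 0 r) {P : ℂ → ℂ} (hP : Differentiable ℂ P)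
    {η : ℝ} (h : ∀ z ∈ sphere (0:ℂ) r, |(P z).re - g z| ≤ η) {w : ℂ} (hw : w ∈ ball (0:ℂ) r) :
    |(P w).re - PI g r w| ≤ η := by
  have hci : ∀ a : ℝ, CircleIntegrable (fun z => ((P z + a)).re) 0 r := fun a =>
    Continuous.continuousOn (by have := hP.continuous; fun_prop) |>.circleIntegrable'
  have e : ∀ a : ℝ, PI (fun z => ((P z + a)).re) r w = (P w).re + a := fun a => by
    rw [PI_re (P := fun z => P z + a) (hP.add_const _) hw]; simp
  have h1 := PI_mono hg (hci η) hw (fun z hz => by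
    have := abs_le.1 (h z hz); simp; linarith)
  have h2 := PI_mono (hci (-η)) hg hw (fun z hz => by
    have := abs_le.1 (h z hz); simp; linarith)
  rw [e] at h1 h2
  rw [abs_le]; constructor <;> linarith

open Classical in
/-- Poisson modification -/
def pmod (v : ℂ → ℝ) (c : ℂ) (r : ℝ) (z : ℂ) : ℝ :=
  if z ∈ ball c r then PI (fun w => v (w + c)) r (z - c) else v z

lemma ci_shift {v : ℂ → ℝ} {c : ℂ} {r : ℝ} (hr : 0 < r) (hv : ContinuousOn v (sphere c r)) :
    ContinuousOn (fun w => v (w + c)) (sphere 0 r) ∧ CircleIntegrable (fun w => v (w + c)) 0 r := by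
  have : ContinuousOn (fun w => v (w + c)) (sphere 0 r) :=
    hv.comp (by fun_prop) (fun z hz => by simpa using hz)
  exact ⟨this, this.circleIntegrable hr.le⟩

lemma pmod_cont_closedBall {v : ℂ → ℝ} {c : ℂ} {r : ℝ} (hr : 0 < r) (hv : ContinuousOn v (sphere c r)) :
    ContinuousOn (pmod v c r) (closedBall c r) := by
  obtain ⟨h1, h2⟩ := ci_shift hr hv
  refine continuousOn_of_uniform_approx_of_continuousOn fun u hu => ?_
  obtain ⟨ε, hε, hu⟩ := Metric.mem_uniformity_dist.1 hu
  obtain ⟨P, hP, hPa⟩ := dirichlet_approx hr h1 (half_pos hε)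
  refine ⟨fun z => (P (z - c)).re, Continuous.continuousOn (by have := hP.continuous; fun_prop), fun z hz => hu ?_⟩
  rw [dist_comm, Real.dist_eq]
  refine lt_of_le_of_lt ?_ (half_lt_self hε)
  by_cases hzb : z ∈ ball c r
  · rw [pmod, if_pos hzb]
    exact PI_approx h2 hP hPa (by simpa [dist_eq_norm] using hzb)
  · rw [pmod, if_neg hzb]
    have : z - c ∈ sphere (0:ℂ) r := by
      simp only [mem_ball, not_lt, mem_closedBall] at hzb hz
      simp [← dist_eq_norm]; linarith
    simpa using hPa _ this

lemma pmod_re {v : ℂ → ℝ} {c : ℂ} {r : ℝ} (hr : 0 < r) (hv : CircleIntegrable (fun w => v (w + c)) 0 r) :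
    ∃ F : ℂ → ℂ, DifferentiableOn ℂ F (ball c r) ∧ ∀ z ∈ ball c r, pmod v c r z = (F z).re := by
  obtain ⟨F, hF, hFe⟩ := PI_hol hv
  refine ⟨fun z => F (z - c), hF.comp (by fun_prop) (fun z hz => by simpa [dist_eq_norm] using hz), fun z hz => ?_⟩
  rw [pmod, if_pos hz]
  exact hFe _ (by simpa [dist_eq_norm] using hz)

lemma harm_of_re {f : ℂ → ℝ} {F : ℂ → ℂ} {B : Set ℂ} (hB : IsOpen B) (hF : DifferentiableOn ℂ F B)
    (h : ∀ z ∈ B, f z = (F z).re) : ContDiffOn ℝ 2 f B ∧ ∀ z ∈ B, lapl f z = 0 := by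
  have hF1 := hF.analyticOnNhd hB
  constructor
  · intro z hz
    have : ContDiffAt ℝ 2 (fun w => (F w).re) z :=
      Complex.reCLM.contDiff.contDiffAt.comp z (contDiffAt_real_of_hol (hF1 z hz))
    exact this.contDiffWithinAt.congr h (h z hz)
  · intro z hz
    rw [← lapl_re (hF1 z hz)]
    exact lapl_congr (by filter_upwards [hB.mem_nhds hz] with w hw using h w hw)

/-- continuous superharmonic functions -/
def SH (A : Set ℂ) (v : ℂ → ℝ) : Prop := ContinuousOn v A ∧ ∀ Ω : Set ℂ, IsOpen Ω → Bornology.IsBounded Ω →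
  closure Ω ⊆ A → ∀ g : ℂ → ℝ, ContinuousOn g (closure Ω) → ContDiffOn ℝ 2 g Ω → (∀ z ∈ Ω, lapl g z = 0) →
  (∀ z ∈ frontier Ω, g z ≤ v z) → ∀ z ∈ Ω, g z ≤ v z

lemma SH_of_lapl {A : Set ℂ} {v : ℂ → ℝ} (hA : IsOpen A) (hv : ContDiffOn ℝ 2 v A) (hl : ∀ z ∈ A, lapl v z ≤ 0) :
    SH A v := by
  refine ⟨hv.continuousOn, fun Ω ho hb hs g hg hg2 hgl hf => ?_⟩
  have hs' : Ω ⊆ A := subset_closure.trans hs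
  exact comparison ho hb hg (hv.continuousOn.mono hs) hg2 (hv.mono hs') (fun z hz => by
    rw [hgl z hz]; exact hl z (hs' hz)) hf

lemma pmod_le {A : Set ℂ} {v : ℂ → ℝ} {c : ℂ} {r : ℝ} (hr : 0 < r) (hB : closedBall c r ⊆ A) (hv : SH A v) :
    ∀ z, pmod v c r z ≤ v z := by
  intro z
  by_cases hz : z ∈ ball c r
  · have hvs := hv.1.mono (sphere_subset_closedBall.trans hB)
    obtain ⟨F, hF, hFe⟩ := pmod_re hr (ci_shift hr hvs).2
    obtain ⟨h1, h2⟩ := harm_of_re isOpen_ball hF hFe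
    refine hv.2 (ball c r) isOpen_ball isBounded_ball ?_ _ ?_ h1 h2 ?_ z hz
    · rw [closure_ball _ hr.ne']; exact hB
    · rw [closure_ball _ hr.ne']; exact pmod_cont_closedBall hr hvs
    · rw [frontier_ball _ hr.ne']
      intro w hw
      rw [pmod, if_neg]
      simp only [mem_sphere] at hw
      simp [hw]
  · rw [pmod, if_neg hz]

lemma pmod_SH {A : Set ℂ} {v : ℂ → ℝ} {c : ℂ} {r : ℝ} (hr : 0 < r) (hB : closedBall c r ⊆ A) (hv : SH A v) :
    SH A (pmod v c r) := by
  have hvs := hv.1.mono (sphere_subset_closedBall.trans hB)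
  have hcb := pmod_cont_closedBall hr hvs
  have hcont : ContinuousOn (pmod v c r) A := by
    have hc2 : ContinuousOn (pmod v c r) (A \ ball c r) :=
      (hv.1.mono sdiff_subset).congr fun z hz => by rw [pmod, if_neg hz.2]
    intro z hz
    by_cases hzb : z ∈ ball c r
    · exact (hcb.continuousAt (mem_of_superset (isOpen_ball.mem_nhds hzb) ball_subset_closedBall)).continuousWithinAt
    · have hU : A ⊆ closedBall c r ∪ A \ ball c r := fun w hw => by
        by_cases h : w ∈ ball c r
        · exact Or.inl (ball_subset_closedBall h)
        · exact Or.inr ⟨hw, h⟩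
      refine ContinuousWithinAt.mono ?_ hU
      refine ContinuousWithinAt.union ?_ (hc2 z ⟨hz, hzb⟩)
      by_cases h : z ∈ closedBall c r
      · exact hcb z h
      · apply continuousWithinAt_of_notMem_closure
        rwa [isClosed_closedBall.closure_eq]
  refine ⟨hcont, fun Ω ho hb hs g hg hg2 hgl hf => ?_⟩
  have hgv : ∀ z ∈ Ω, g z ≤ v z := hv.2 Ω ho hb hs g hg hg2 hgl
    fun z hz => (hf z hz).trans (pmod_le hr hB hv z)
  have hgv' : ∀ z ∈ closure Ω, g z ≤ v z := fun z hz =>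
    le_on_closure hgv hg (hv.1.mono hs) hz
  obtain ⟨F, hF, hFe⟩ := pmod_re hr (ci_shift hr hvs).2
  obtain ⟨h1, h2⟩ := harm_of_re isOpen_ball hF hFe
  intro z hz
  by_cases hzb : z ∈ ball c r
  · have hcl : closure (Ω ∩ ball c r) ⊆ closure Ω := closure_mono inter_subset_left
    have hcl2 : closure (Ω ∩ ball c r) ⊆ closedBall c r :=
      (closure_mono inter_subset_right).trans closure_ball_subset_closedBall
    refine comparison (ho.inter isOpen_ball) (hb.subset inter_subset_left) (hg.mono hcl) (hcb.mono hcl2)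
      (hg2.mono inter_subset_left) (h1.mono inter_subset_right)
      (fun w hw => by rw [hgl w hw.1, h2 w hw.2]) ?_ z ⟨hz, hzb⟩
    intro w hw
    have hwc := frontier_subset_closure hw
    by_cases hwb : w ∈ ball c r
    · apply hf
      refine ⟨hcl hwc, fun hwi => ?_⟩
      rw [(ho.inter isOpen_ball).frontier_eq] at hw
      rw [ho.interior_eq] at hwi
      exact hw.2 ⟨hwi, hwb⟩
    · rw [pmod, if_neg hwb]
      exact hgv' w (hcl hwc)
  · rw [pmod, if_neg hzb]; exact hgv z hz

lemma le_pmod {A : Set ℂ} {v u : ℂ → ℝ} {c : ℂ} {r : ℝ} (hr : 0 < r) (hB : closedBall c r ⊆ A) (hv : SH A v)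
    (hA : IsOpen A) (hu : ContDiffOn ℝ 2 u A) (hul : ∀ z ∈ A, 0 ≤ lapl u z) (huv : ∀ z ∈ A, u z ≤ v z) :
    ∀ z ∈ A, u z ≤ pmod v c r z := by
  intro z hzA
  have hvs := hv.1.mono (sphere_subset_closedBall.trans hB)
  obtain ⟨F, hF, hFe⟩ := pmod_re hr (ci_shift hr hvs).2
  obtain ⟨h1, h2⟩ := harm_of_re isOpen_ball hF hFe
  have hBA := ball_subset_closedBall.trans hB
  by_cases hz : z ∈ ball c r
  · refine comparison isOpen_ball isBounded_ball ?_ ?_ (hu.mono hBA) h1 ?_ ?_ z hz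
    · rw [closure_ball _ hr.ne']; exact hu.continuousOn.mono hB
    · rw [closure_ball _ hr.ne']; exact pmod_cont_closedBall hr hvs
    · intro w hw; rw [h2 w hw]; exact hul w (hBA hw)
    · rw [frontier_ball _ hr.ne']
      intro w hw
      rw [pmod, if_neg]
      · exact huv w (hB (sphere_subset_closedBall hw))
      simp only [mem_sphere] at hw
      simp [hw]
  · rw [pmod, if_neg hz]; exact huv z hzA

lemma perron {A : Set ℂ} (hA : IsOpen A) {u v : ℂ → ℝ} (hu : ContDiffOn ℝ 2 u A) (hv : ContDiffOn ℝ 2 v A)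
    (hul : ∀ z ∈ A, 0 ≤ lapl u z) (hvl : ∀ z ∈ A, lapl v z ≤ 0) (huv : ∀ z ∈ A, u z ≤ v z) :
    ∃ h : ℂ → ℝ, (∀ z ∈ A, u z ≤ h z ∧ h z ≤ v z) ∧
      ∀ z ∈ A, ∃ F : ℂ → ℂ, AnalyticAt ℂ F z ∧ h =ᶠ[𝓝 z] fun w => (F w).re := by
  rcases A.eq_empty_or_nonempty with rfl | hne
  · exact ⟨fun _ => 0, by simp, by simp⟩
  have hball : ∀ z : ℂ, ∃ r > 0, z ∈ A → closedBall z r ⊆ A := by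
    intro z
    by_cases hz : z ∈ A
    · obtain ⟨r, hr, h⟩ := Metric.nhds_basis_closedBall.mem_iff.1 (hA.mem_nhds hz)
      exact ⟨r, hr, fun _ => h⟩
    · exact ⟨1, one_pos, fun h => absurd h hz⟩
  choose rad hrad hsub using hball
  obtain ⟨t, htA, htc, htU⟩ := TopologicalSpace.countable_cover_nhdsWithin (s := A)
    (f := fun z => ball z (rad z)) (fun z hz => mem_nhdsWithin_of_mem_nhds (ball_mem_nhds z (hrad z)))
  have htne : t.Nonempty := by
    obtain ⟨z, hz⟩ := hne
    obtain ⟨x, hx, _⟩ := mem_iUnion₂.1 (htU hz)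
    exact ⟨x, hx⟩
  obtain ⟨ctr, hctr⟩ := htc.exists_eq_range htne
  have hctrA : ∀ n, ctr n ∈ A := fun n => htA (hctr ▸ mem_range_self n)
  set cn : ℕ → ℂ := fun n => ctr (Nat.unpair n).1 with hcn
  let V : ℕ → ℂ → ℝ := fun n => Nat.rec v (fun n w => pmod w (cn n) (rad (cn n))) n
  have hVs : ∀ n, V (n+1) = pmod (V n) (cn n) (rad (cn n)) := fun n => rfl
  have hcB : ∀ n, closedBall (cn n) (rad (cn n)) ⊆ A := fun n => hsub _ (hctrA _)
  have hSH : ∀ n, SH A (V n) := by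
    intro n
    induction n with
    | zero => exact SH_of_lapl hA hv hvl
    | succ n ih => rw [hVs]; exact pmod_SH (hrad _) (hcB n) ih
  have hlow : ∀ n, ∀ z ∈ A, u z ≤ V n z := by
    intro n
    induction n with
    | zero => exact huv
    | succ n ih => rw [hVs]; exact le_pmod (hrad _) (hcB n) (hSH n) hA hu hul ih
  have hanti : ∀ z, Antitone fun n => V n z := fun z => antitone_nat_of_succ_le fun n => by
    rw [hVs]; exact pmod_le (hrad _) (hcB n) (hSH n) z
  set h : ℂ → ℝ := fun z => ⨅ n, V n z with hh
  have hbdd : ∀ z ∈ A, BddBelow (range fun n => V n z) := fun z hz => ⟨u z, by rintro _ ⟨n, rfl⟩; exact hlow n z hz⟩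
  have htend : ∀ z ∈ A, Tendsto (fun n => V n z) atTop (𝓝 (h z)) := fun z hz =>
    tendsto_atTop_ciInf (hanti z) (hbdd z hz)
  refine ⟨h, fun z hz => ⟨le_ciInf fun n => hlow n z hz, ciInf_le (hbdd z hz) 0⟩, ?_⟩
  intro z hz
  obtain ⟨x, hx, hzx⟩ := mem_iUnion₂.1 (htU hz)
  obtain ⟨j, rfl⟩ : x ∈ range ctr := hctr ▸ hx
  set c := ctr j with hc
  set r := rad c with hr
  have hr0 : 0 < r := hrad c
  have hcA : closedBall c r ⊆ A := hsub _ (hctrA j)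
  have hsA : sphere c r ⊆ A := sphere_subset_closedBall.trans hcA
  have hmapA : ∀ θ, circleMap 0 r θ + c ∈ A := fun θ => hsA (by simp [abs_of_pos hr0])
  -- bounds on the sphere
  obtain ⟨C1, hC1⟩ := (isCompact_sphere c r).exists_bound_of_continuousOn (hu.continuousOn.mono hsA)
  obtain ⟨C2, hC2⟩ := (isCompact_sphere c r).exists_bound_of_continuousOn (hv.continuousOn.mono hsA)
  have hVb : ∀ n, ∀ w ∈ sphere c r, ‖V n w‖ ≤ max C1 C2 := by
    intro n w hw
    have h1 := (abs_le.1 (hC1 w hw)).1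
    have h2 := (abs_le.1 (hC2 w hw)).2
    have h3 := hlow n w (hsA hw)
    have h4 : V n w ≤ v w := hanti w (Nat.zero_le n)
    rw [Real.norm_eq_abs, abs_le]
    constructor
    · linarith [le_max_left C1 C2]
    · exact h4.trans (h2.trans (le_max_right _ _))
  have hVci : ∀ n, CircleIntegrable (fun w => V n (w + c)) 0 r := fun n =>
    (ci_shift hr0 ((hSH n).1.mono hsA)).2
  have hms : ∀ n, AEStronglyMeasurable (fun θ => V n (circleMap 0 r θ + c)) (volume.restrict (uIoc 0 (2 * π))) :=
    fun n => (intervalIntegrable_iff.1 (hVci n)).aestronglyMeasurable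
  have hhm : AEStronglyMeasurable (fun θ => h (circleMap 0 r θ + c)) (volume.restrict (uIoc 0 (2 * π))) :=
    aestronglyMeasurable_of_tendsto_ae atTop hms (ae_of_all _ fun θ => htend _ (hmapA θ))
  have hhci : CircleIntegrable (fun w => h (w + c)) 0 r := by
    rw [CircleIntegrable, intervalIntegrable_iff]
    haveI : IsFiniteMeasure (volume.restrict (uIoc 0 (2 * π))) := ⟨by rw [Measure.restrict_apply_univ, uIoc_of_le Real.two_pi_pos.le]; exact measure_Ioc_lt_top⟩
    refine Integrable.of_bound hhm (max C1 C2) (ae_of_all _ fun θ => ?_)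
    have hw : circleMap 0 r θ + c ∈ sphere c r := by simp [abs_of_pos hr0]
    exact le_of_tendsto (htend _ (hmapA θ)).norm (Eventually.of_forall fun n => hVb n _ hw)
  have hconv : ∀ w ∈ ball c r, h w = pmod h c r w := by
    intro w hw
    have hw' : w - c ∈ ball (0:ℂ) r := by simpa [dist_eq_norm] using hw
    have t1 : Tendsto (fun n => PI (fun y => V n (y + c)) r (w - c)) atTop (𝓝 (PI (fun y => h (y + c)) r (w - c))) := by
      unfold PI circleAverage
      refine Tendsto.const_smul ?_ _
      have kc : ContinuousOn (Complex.re ∘ herglotzRieszKernel 0 (w - c)) (sphere 0 |r|) :=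
        Complex.continuous_re.comp_continuousOn (continuousOn_herglotzRieszKernel_sphere hw')
      obtain ⟨K, hK⟩ := (isCompact_sphere (0:ℂ) |r|).exists_bound_of_continuousOn kc
      refine intervalIntegral.tendsto_integral_filter_of_dominated_convergence (fun _ => K * max C1 C2)
        (Eventually.of_forall fun n => ?_) (Eventually.of_forall fun n => ae_of_all _ fun θ _ => ?_) (by simp)
        (ae_of_all _ fun θ _ => ?_)
      · exact (intervalIntegrable_iff.1 (kernel_ci (hVci n) hw')).aestronglyMeasurable
      · have hw : circleMap 0 r θ + c ∈ sphere c r := by simp [abs_of_pos hr0]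
        have k1 := hK (circleMap 0 r θ) (by simp)
        simp only [Pi.smul_apply', smul_eq_mul, norm_mul]
        exact mul_le_mul k1 (hVb n _ hw) (norm_nonneg _) ((norm_nonneg _).trans k1)
      · exact (htend _ (hmapA θ)).const_mul _
    have t2 : Tendsto (fun i => V (Nat.pair j i + 1) w) atTop (𝓝 (h w)) := by
      refine (htend w (hcA (ball_subset_closedBall hw))).comp (g := fun n => V n w)
        (f := fun i => Nat.pair j i + 1) ?_
      refine tendsto_atTop_mono (f := id) (fun i => ?_) tendsto_id
      exact (Nat.right_le_pair j i).trans (Nat.le_succ _)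
    have t3 : Tendsto (fun i => PI (fun y => V (Nat.pair j i) (y + c)) r (w - c)) atTop
        (𝓝 (PI (fun y => h (y + c)) r (w - c))) := by
      refine t1.comp ?_
      exact tendsto_atTop_mono (f := id) (fun i => Nat.right_le_pair j i) tendsto_id
    rw [pmod, if_pos hw]
    refine tendsto_nhds_unique t2 (t3.congr fun i => ?_)
    have e : cn (Nat.pair j i) = c := by simp [hcn, hc]
    rw [hVs, e, pmod, if_pos hw]
  obtain ⟨F, hF, hFe⟩ := pmod_re hr0 hhci
  exact ⟨F, hF.analyticAt (isOpen_ball.mem_nhds hzx), by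
    filter_upwards [isOpen_ball.mem_nhds hzx] with w hw
    rw [hconv w hw, hFe w hw]⟩

end MF

namespace MF

open Set Filter Topology Complex Metric
open scoped Manifold ContDiff


lemma inv_mem_poly {K : Set ℂ} [CompactSpace K] {ζ : ℂ} (hζ : ζ ∉ K)
    (hub : ¬ Bornology.IsBounded (connectedComponentIn Kᶜ ζ)) {f : C(K, ℂ)} (hf : ∀ z : K, f z = (ζ - z)⁻¹) :
    f ∈ (polynomialFunctions K).topologicalClosure := by
  set S := (polynomialFunctions K).topologicalClosure with hS
  have hcl : IsClosed (S : Set C(K, ℂ)) := Subalgebra.isClosed_topologicalClosure _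
  set x0 : C(K, ℂ) := Polynomial.toContinuousMapOnAlgHom K Polynomial.X with hx0
  have hx0z : ∀ z : K, x0 z = z := fun z => by simp [hx0]
  have hx0S : x0 ∈ S := by
    apply Subalgebra.le_topologicalClosure
    have : x0 ∈ (polynomialFunctions K : Set C(K, ℂ)) := by
      rw [polynomialFunctions_coe]; exact ⟨_, rfl⟩
    exact this
  have hrange : spectrum ℂ x0 = K := by
    rw [ContinuousMap.spectrum_eq_range]
    ext z
    constructor
    · rintro ⟨w, rfl⟩; rw [hx0z]; exact w.2
    · intro hz; exact ⟨⟨z, hz⟩, hx0z _⟩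
  have hns : ζ ∉ spectrum ℂ (⟨x0, hx0S⟩ : S) := by
    intro h
    haveI : IsClosed (S : Set C(K, ℂ)) := hcl
    have := Subalgebra.spectrum_isBounded_connectedComponentIn S (⟨x0, hx0S⟩ : S) h
    simp only [hrange] at this
    exact hub this
  rw [spectrum.notMem_iff] at hns
  obtain ⟨y, hy⟩ := hns.exists_right_inv
  have hy2 : f = y := by
    ext z
    have h1 := congrArg (fun t : S => (t : C(K, ℂ)) z) hy
    simp [hx0z] at h1
    rw [hf]
    exact inv_eq_of_mul_eq_one_right h1
  rw [hy2]
  exact y.2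

lemma dbar_hol {f : ℂ → ℂ} {z : ℂ} (hf : DifferentiableAt ℂ f z) : dbar f z = 0 := by
  have h1 := (hasFDerivAt_real_of_complex hf.hasDerivAt).fderiv
  rw [dbar, h1]
  simp
  ring_nf
  simp

lemma hull_facts {A K : Set ℂ} (hA : IsOpen A) (hAb : Bornology.IsBounded A) (hAc : IsPreconnected Aᶜ)
    (hK : IsCompact K) (hKA : K ⊆ A) : ∃ X : Set ℂ, IsOpen X ∧ IsCompact Xᶜ ∧ K ⊆ Xᶜ ∧ Xᶜ ⊆ A ∧
      ∀ ζ ∈ X, ¬ Bornology.IsBounded (connectedComponentIn Kᶜ ζ) := by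
  have hne : (Aᶜ).Nonempty := by
    rw [nonempty_compl]; rintro rfl
    exact NormedSpace.unbounded_univ ℂ ℂ hAb
  obtain ⟨ζ0, h0⟩ := hne
  have hs : Aᶜ ⊆ Kᶜ := compl_subset_compl.2 hKA
  have hsub : Aᶜ ⊆ connectedComponentIn Kᶜ ζ0 := hAc.subset_connectedComponentIn h0 hs
  have hX : IsOpen (connectedComponentIn Kᶜ ζ0) := hK.isClosed.isOpen_compl.connectedComponentIn
  have hXA : (connectedComponentIn Kᶜ ζ0)ᶜ ⊆ A := compl_subset_comm.1 hsub
  refine ⟨_, hX, ?_, ?_, hXA, ?_⟩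
  · exact Metric.isCompact_of_isClosed_isBounded hX.isClosed_compl (hAb.subset hXA)
  · intro z hz h; exact connectedComponentIn_subset _ _ h hz
  · intro ζ hζ hb
    rw [connectedComponentIn_eq hζ] at hsub
    have := (hAb.union (hb.subset hsub))
    rw [union_compl_self] at this
    exact NormedSpace.unbounded_univ ℂ ℂ this

lemma runge {A K : Set ℂ} (hA : IsOpen A) (hAb : Bornology.IsBounded A) (hAc : IsPreconnected Aᶜ)
    (hK : IsCompact K) (hKA : K ⊆ A) {g : ℂ → ℂ} (hg : DifferentiableOn ℂ g A) {ε : ℝ} (hε : 0 < ε) :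
    ∃ p : Polynomial ℂ, ∀ z ∈ K, ‖p.eval z - g z‖ < ε := by
  haveI : CompactSpace K := isCompact_iff_compactSpace.1 hK
  obtain ⟨X, hXo, hXc, hKX, hXA, hXu⟩ := hull_facts hA hAb hAc hK hKA
  obtain ⟨χ, hχ, hχc, hχA, -, -, hχ1⟩ := exists_bump hXc hA hXA
  set b0 : ℂ → ℂ := fun z => (χ z : ℂ) * g z with hb0
  set b : ℂ → ℂ := A.indicator b0 with hb
  have hz0 : ∀ z ∈ A, z ∉ tsupport χ → b0 z = 0 := fun z _ hz => by
    simp [hb0, image_eq_zero_of_notMem_tsupport hz]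
  have hgA : AnalyticOnNhd ℂ g A := hg.analyticOnNhd hA
  have hbc : ContDiff ℝ 1 b := by
    refine zext_contDiff hA hχc.isCompact ?_ hχA hz0
    intro z hz
    have h1 : ContDiffAt ℝ 1 (fun z => (χ z : ℂ)) z :=
      Complex.ofRealCLM.contDiff.contDiffAt.comp z (hχ.of_le (by simp)).contDiffAt
    exact (h1.mul (contDiffAt_real_of_hol (hgA z hz))).contDiffWithinAt
  have hbs : HasCompactSupport b := hχc.isCompact.of_isClosed_subset (isClosed_tsupport _)
    (zext_tsupport hχc.isCompact hz0)
  -- near the hull b is g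
  have hbg : ∀ z ∈ Xᶜ, b =ᶠ[𝓝 z] g := by
    intro z hz
    have h1 := (eventually_nhdsSet_iff_forall.1 hχ1) z hz
    filter_upwards [h1, hA.mem_nhds (hXA hz)] with w hw hwA
    simp [hb, hb0, hwA, hw]
  have hdb0 : ∀ z ∈ Xᶜ, dbar b =ᶠ[𝓝 z] fun _ => 0 := by
    intro z hz
    have h1 := (hbg z hz).eventuallyEq_nhds
    filter_upwards [h1, hA.mem_nhds (hXA hz)] with w hw hwA
    have : dbar b w = dbar g w := by unfold dbar; rw [hw.fderiv_eq]
    rw [this]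
    exact dbar_hol (hg.differentiableAt (hA.mem_nhds hwA))
  have hdbc : Continuous (dbar b) := by
    have := hbc.continuous_fderiv one_ne_zero
    unfold dbar
    fun_prop
  have hdbs : ∀ z, z ∉ tsupport b → dbar b z = 0 := by
    intro z hz
    have : fderiv ℝ b z = 0 := image_eq_zero_of_notMem_tsupport fun h => hz (tsupport_fderiv_subset ℝ h)
    simp [dbar, this]
  -- kernel
  have hjc : Continuous fun p : ℂ × K => dbar b p.1 * (p.1 - p.2)⁻¹ := by
    rw [continuous_iff_continuousAt]
    rintro ⟨ζ, z⟩
    by_cases hζ : ζ ∈ X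
    · have hne : ζ - z ≠ 0 := fun h => (hKX z.2) (by rw [← sub_eq_zero.1 h]; exact hζ)
      refine ContinuousAt.mul (hdbc.comp continuous_fst).continuousAt ?_
      exact ContinuousAt.inv₀ (by fun_prop) hne
    · have h1 : ∀ᶠ p : ℂ × K in 𝓝 (ζ, z), dbar b p.1 = 0 := by
        have h0 : ∀ᶠ w in 𝓝 ζ, dbar b w = 0 := hdb0 ζ hζ
        exact (continuous_fst.tendsto (ζ, z)).eventually h0
      have h2 : (fun p : ℂ × K => dbar b p.1 * (p.1 - p.2)⁻¹) =ᶠ[𝓝 (ζ, z)] fun _ => 0 := by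
        filter_upwards [h1] with p hp; rw [hp, zero_mul]
      exact continuousAt_const.congr h2.symm
  let Φ : C(ℂ, C(K, ℂ)) := ContinuousMap.curry ⟨_, hjc⟩
  have hΦ : ∀ ζ z, Φ ζ z = dbar b ζ * (ζ - z)⁻¹ := fun ζ z => rfl
  set S := (polynomialFunctions K).topologicalClosure with hS
  have hcl : IsClosed (S : Set C(K, ℂ)) := Subalgebra.isClosed_topologicalClosure _
  have hΦS : ∀ ζ, Φ ζ ∈ S := by
    intro ζ
    by_cases hζ : ζ ∈ X
    · have hcf : Continuous fun z : K => (ζ - z)⁻¹ := by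
        refine Continuous.inv₀ (by fun_prop) fun z h => (hKX z.2) (by rw [← sub_eq_zero.1 h]; exact hζ)
      have h1 := inv_mem_poly (fun h => hKX h hζ) (hXu ζ hζ) (f := ⟨_, hcf⟩) (fun z => rfl)
      have : Φ ζ = dbar b ζ • (⟨_, hcf⟩ : C(K, ℂ)) := by
        ext z; rw [hΦ]; rfl
      rw [this]
      exact S.smul_mem h1 _
    · have : Φ ζ = 0 := by
        ext z; rw [hΦ, (hdb0 ζ hζ).self_of_nhds, zero_mul]; rfl
      rw [this]; exact S.zero_mem
  have hΦs : HasCompactSupport Φ := by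
    refine hbs.mono' ?_
    intro ζ hζ
    by_contra h
    apply hζ
    ext z; rw [hΦ, hdbs ζ h, zero_mul]; rfl
  have hΦi : Integrable Φ := Φ.continuous.integrable_of_hasCompactSupport hΦs
  have hIntg : (∫ ζ, Φ ζ) ∈ S := by
    have hsub : ∫ ζ, Φ ζ = ∫ ζ in tsupport Φ, Φ ζ :=
      (setIntegral_tsupport (F := Φ)).symm
    obtain ⟨R, hR⟩ := hΦs.isCompact.isBounded.subset_closedBall 0
    have hsub : ∫ ζ in closedBall 0 (max R 1), Φ ζ = ∫ ζ, Φ ζ := by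
      refine setIntegral_eq_integral_of_forall_compl_eq_zero fun ζ hζ => ?_
      exact image_eq_zero_of_notMem_tsupport fun h => hζ (closedBall_subset_closedBall (le_max_left _ _) (hR h))
    rw [← hsub]
    haveI : IsFiniteMeasure (volume.restrict (closedBall (0:ℂ) (max R 1))) :=
      ⟨by rw [Measure.restrict_apply_univ]; exact (isCompact_closedBall _ _).measure_lt_top⟩
    haveI : NeZero (volume.restrict (closedBall (0:ℂ) (max R 1))) := ⟨by
      rw [Ne, Measure.restrict_eq_zero]
      exact (measure_closedBall_pos _ _ (lt_max_of_lt_right one_pos)).ne'⟩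
    rw [← measure_smul_average]
    have hconv : Convex ℝ (S : Set C(K, ℂ)) := (S.toSubmodule.restrictScalars ℝ).convex
    have h1 := hconv.average_mem (μ := volume.restrict (closedBall (0:ℂ) (max R 1))) hcl (ae_of_all _ hΦS) hΦi.integrableOn
    exact (S.toSubmodule.restrictScalars ℝ).smul_mem _ h1
  have hval : ∀ z : K, (∫ ζ, Φ ζ) z = - π * g z := by
    intro z
    have e1 : (∫ ζ, Φ ζ) z = ∫ ζ, Φ ζ z :=
      ((ContinuousMap.evalCLM ℂ z : C(K, ℂ) →L[ℂ] ℂ).integral_comp_comm hΦi).symm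
    have h1 := cauchy_pompeiu (b := fun w => b (w + z)) (hbc.comp (by fun_prop))
      (hbs.comp_homeomorph (Homeomorph.addRight (z:ℂ)))
    have h2 : ∀ w, dbar (fun w => b (w + z)) w = dbar b (w + z) := fun w => by
      unfold dbar; rw [fderiv_comp_add_right]
    have h3 : ∫ w, dbar (fun w => b (w + z)) w / w = ∫ ζ, dbar b ζ * (ζ - z)⁻¹ := by
      rw [← integral_add_right_eq_self (fun ζ => dbar b ζ * (ζ - z)⁻¹) (z:ℂ)]
      congr 1; ext w; rw [h2, add_sub_cancel_right]; rfl
    rw [e1]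
    simp_rw [hΦ]
    rw [← h3, h1, zero_add, (hbg z (hKX z.2)).self_of_nhds]
  -- approximate
  have hmem : (-(π:ℂ)⁻¹) • (∫ ζ, Φ ζ) ∈ S := S.smul_mem hIntg _
  have hmem' : (-(π:ℂ)⁻¹) • (∫ ζ, Φ ζ) ∈ closure (polynomialFunctions K : Set C(K, ℂ)) := hmem
  obtain ⟨q, hq, hd⟩ := Metric.mem_closure_iff.1 hmem' ε hε
  rw [polynomialFunctions_coe] at hq
  obtain ⟨p, rfl⟩ := hq
  refine ⟨p, fun z hz => ?_⟩
  have h4 := (ContinuousMap.dist_lt_iff hε).1 hd ⟨z, hz⟩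
  rw [dist_comm, dist_eq_norm, ContinuousMap.smul_apply, hval] at h4
  have hpi : (π:ℂ) ≠ 0 := by exact_mod_cast Real.pi_ne_zero
  have e5 : (-(π:ℂ)⁻¹) • (-(π:ℂ) * g z) = g z := by rw [smul_eq_mul]; field_simp
  rw [e5] at h4
  simpa using h4

lemma exists_primitive {A : Set ℂ} (hA : IsOpen A) (hAb : Bornology.IsBounded A) (hAc : IsPreconnected Aᶜ)
    {g : ℂ → ℂ} (hg : DifferentiableOn ℂ g A) : ∃ G : ℂ → ℂ, ∀ z ∈ A, HasDerivAt G (g z) z := by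
  have hne : (Aᶜ).Nonempty := by
    rw [nonempty_compl]; rintro rfl
    exact NormedSpace.unbounded_univ ℂ ℂ hAb
  obtain ⟨R, hR⟩ := hAb.subset_ball 0
  set Kn : ℕ → Set ℂ := fun n => {z | z ∈ closedBall (0:ℂ) R ∧ 1 / ((n:ℝ) + 1) ≤ infDist z Aᶜ} with hKn
  have hKc : ∀ n, IsCompact (Kn n) := fun n => by
    refine (isCompact_closedBall (0:ℂ) R).of_isClosed_subset ?_ (fun z hz => hz.1)
    exact isClosed_closedBall.inter (isClosed_le continuous_const (continuous_infDist_pt _))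
  have hKA : ∀ n, Kn n ⊆ A := fun n z hz => by
    by_contra h
    have h1 := hz.2
    rw [infDist_zero_of_mem (show z ∈ Aᶜ from h)] at h1
    have : (0:ℝ) < 1 / ((n:ℝ) + 1) := by positivity
    linarith
  have hp : ∀ n, ∃ p : Polynomial ℂ, ∀ z ∈ Kn n, ‖p.eval z - g z‖ < 1 / ((n:ℝ) + 1) := fun n =>
    runge hA hAb hAc (hKc n) (hKA n) hg (by positivity)
  choose p hp using hp
  have hG : ∀ n, ∃ G : ℂ → ℂ, ∀ z ∈ ball (0:ℂ) R, HasDerivAt G ((p n).eval z) z := fun n =>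
    exists_prim_ball (p n).differentiable.differentiableOn
  choose Gn hGn using hG
  -- local uniform convergence
  have hloc : ∀ z ∈ A, ∃ ρ > 0, ball z ρ ⊆ A ∧
      TendstoUniformlyOn (fun n w => (p n).eval w) g atTop (ball z ρ) := by
    intro z hz
    have hd : 0 < infDist z Aᶜ := (hA.isClosed_compl.notMem_iff_infDist_pos hne).1 (by simpa using hz)
    set d := infDist z Aᶜ with hdd
    have hw : ∀ w ∈ ball z (d / 2), d / 2 ≤ infDist w Aᶜ := fun w hw => by
      have h1 : d ≤ infDist w Aᶜ + dist z w := infDist_le_infDist_add_dist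
      rw [mem_ball, dist_comm] at hw
      linarith
    have hwA : ball z (d / 2) ⊆ A := fun w hw' => by
      by_contra h
      have := hw w hw'
      rw [infDist_zero_of_mem (show w ∈ Aᶜ from h)] at this
      linarith
    refine ⟨d / 2, half_pos hd, hwA, ?_⟩
    rw [Metric.tendstoUniformlyOn_iff]
    intro ε hε
    have t := tendsto_one_div_add_atTop_nhds_zero_nat (𝕜 := ℝ)
    filter_upwards [t.eventually_lt_const hε, t.eventually_lt_const (half_pos hd)] with n h1 h2 w hw'
    rw [dist_comm, dist_eq_norm]
    refine (hp n w ⟨ball_subset_closedBall (hR (hwA hw')), ?_⟩).trans h1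
    exact h2.le.trans (hw w hw')
  classical
  let bp : Set ℂ → ℂ := fun S => if h : S.Nonempty then h.some else 0
  let β : ℂ → ℂ := fun z => bp (connectedComponentIn A z)
  have hβ : ∀ z ∈ A, β z ∈ connectedComponentIn A z := fun z hz => by
    have : (connectedComponentIn A z).Nonempty := ⟨z, mem_connectedComponentIn hz⟩
    simp only [β, bp, this, dif_pos]
    exact this.some_mem
  have hβc : ∀ z w, w ∈ connectedComponentIn A z → β w = β z := fun z w hw => by
    simp only [β, connectedComponentIn_eq hw]
  set H : ℕ → ℂ → ℂ := fun n z => Gn n z - Gn n (β z) with hH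
  have hder : ∀ n, ∀ z ∈ A, HasDerivAt (H n) ((p n).eval z) z := fun n z hz => by
    have h1 : H n =ᶠ[𝓝 z] fun w => Gn n w - Gn n (β z) := by
      filter_upwards [hA.connectedComponentIn.mem_nhds (mem_connectedComponentIn hz)] with w hw
      simp only [hH]; rw [hβc z w hw]
    exact ((hGn n z (hR hz)).sub_const _).congr_of_eventuallyEq h1
  have hprop : ∀ z ∈ A, ∃ ρ > 0, ball z ρ ⊆ A ∧
      TendstoUniformlyOn (fun n w => (p n).eval w) g atTop (ball z ρ) ∧
      ∀ w1 ∈ ball z ρ, ∀ w2 ∈ ball z ρ, Cauchy (map (fun n => H n w1) atTop) → Cauchy (map (fun n => H n w2) atTop) := by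
    intro z hz
    obtain ⟨ρ, hρ, hρA, hu⟩ := hloc z hz
    refine ⟨ρ, hρ, hρA, hu, fun w1 h1 w2 h2 hc => ?_⟩
    refine cauchy_map_of_uniformCauchySeqOn_fderiv (𝕜 := ℂ) isOpen_ball (convex_ball z ρ).isPreconnected
      (f := H) (f' := fun n w => ContinuousLinearMap.toSpanSingleton ℂ ((p n).eval w)) ?_
      (fun n y hy => (hder n y (hρA hy)).hasFDerivAt) h1 h2 hc
    rw [Metric.uniformCauchySeqOn_iff]
    intro ε hε
    obtain ⟨N, hN⟩ := Metric.uniformCauchySeqOn_iff.1 hu.uniformCauchySeqOn ε hε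
    refine ⟨N, fun m hm n hn x hx => ?_⟩
    have e1 := hN m hm n hn x hx
    rw [dist_eq_norm] at e1 ⊢
    have : ContinuousLinearMap.toSpanSingleton ℂ ((p m).eval x) - ContinuousLinearMap.toSpanSingleton ℂ ((p n).eval x)
        = ContinuousLinearMap.toSpanSingleton ℂ ((p m).eval x - (p n).eval x) := by
      ext; simp
    rw [this, ContinuousLinearMap.norm_toSpanSingleton]
    exact e1
  have hcau : ∀ z ∈ A, Cauchy (map (fun n => H n z) atTop) := by
    intro z hz
    set O := connectedComponentIn A z with hO
    have hOo : IsOpen O := hA.connectedComponentIn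
    have hOA : O ⊆ A := connectedComponentIn_subset _ _
    by_contra hbad
    set T1 := {w | w ∈ O ∧ Cauchy (map (fun n => H n w) atTop)} with hT1
    set T2 := {w | w ∈ O ∧ ¬ Cauchy (map (fun n => H n w) atTop)} with hT2
    have ho1 : IsOpen T1 := by
      rw [isOpen_iff_mem_nhds]
      rintro w ⟨hw, hc⟩
      obtain ⟨ρ, hρ, -, -, hpr⟩ := hprop w (hOA hw)
      filter_upwards [hOo.mem_nhds hw, ball_mem_nhds w hρ] with y hy hyb
      exact ⟨hy, hpr w (mem_ball_self hρ) y hyb hc⟩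
    have ho2 : IsOpen T2 := by
      rw [isOpen_iff_mem_nhds]
      rintro w ⟨hw, hc⟩
      obtain ⟨ρ, hρ, -, -, hpr⟩ := hprop w (hOA hw)
      filter_upwards [hOo.mem_nhds hw, ball_mem_nhds w hρ] with y hy hyb
      exact ⟨hy, fun h => hc (hpr y hyb w (mem_ball_self hρ) h)⟩
    have hb1 : β z ∈ T1 := by
      refine ⟨hβ z hz, ?_⟩
      have : (fun n => H n (β z)) = fun _ => (0:ℂ) := by
        ext n; simp only [hH]; rw [hβc z (β z) (hβ z hz), sub_self]
      rw [this]
      exact (tendsto_const_nhds (x := (0:ℂ)) (f := (atTop : Filter ℕ))).cauchy_map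
    have hpc : IsPreconnected O := isPreconnected_connectedComponentIn
    obtain ⟨y, -, hy1, hy2⟩ := hpc T1 T2 ho1 ho2 (fun w hw => by
      by_cases h : Cauchy (map (fun n => H n w) atTop)
      · exact Or.inl ⟨hw, h⟩
      · exact Or.inr ⟨hw, h⟩) ⟨β z, hβ z hz, hb1⟩ ⟨z, mem_connectedComponentIn hz, mem_connectedComponentIn hz, hbad⟩
    exact hy2.2 hy1.2
  have hlim : ∀ z, ∃ l, z ∈ A → Tendsto (fun n => H n z) atTop (𝓝 l) := by
    intro z
    by_cases hz : z ∈ A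
    · obtain ⟨l, hl⟩ := CompleteSpace.complete (hcau z hz)
      exact ⟨l, fun _ => hl⟩
    · exact ⟨0, fun h => absurd h hz⟩
  choose G hGl using hlim
  refine ⟨G, fun z hz => ?_⟩
  obtain ⟨ρ, hρ, hρA, hu, -⟩ := hprop z hz
  exact hasDerivAt_of_tendstoLocallyUniformlyOn isOpen_ball hu.tendstoLocallyUniformlyOn
    (Eventually.of_forall fun n w hw => hder n w (hρA hw)) (fun w hw => hGl w (hρA hw)) (mem_ball_self hρ)

end MF

namespace MF

open Set Filter Topology Complex Metric
open scoped Manifold ContDiff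


lemma deriv_eq_of_re {F : ℂ → ℂ} {h : ℂ → ℝ} {z : ℂ} (hF : DifferentiableAt ℂ F z)
    (hh : h =ᶠ[𝓝 z] fun w => (F w).re) :
    HasFDerivAt h (Complex.reCLM.comp ((ContinuousLinearMap.toSpanSingleton ℂ (deriv F z)).restrictScalars ℝ)) z ∧
    deriv F z = (fderiv ℝ h z 1 : ℂ) - I * (fderiv ℝ h z I : ℂ) := by
  have h1 := (Complex.reCLM.hasFDerivAt).comp z (hasFDerivAt_real_of_complex hF.hasDerivAt)
  have h2 : HasFDerivAt h (Complex.reCLM.comp ((ContinuousLinearMap.toSpanSingleton ℂ (deriv F z)).restrictScalars ℝ)) z :=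
    h1.congr_of_eventuallyEq hh
  refine ⟨h2, ?_⟩
  rw [h2.fderiv]
  apply Complex.ext <;> simp

lemma exists_G {A : Set ℂ} (hA : IsOpen A) (hAb : Bornology.IsBounded A) (hAc : IsPreconnected Aᶜ) {h : ℂ → ℝ}
    (hh : ∀ z ∈ A, ∃ F : ℂ → ℂ, AnalyticAt ℂ F z ∧ h =ᶠ[𝓝 z] fun w => (F w).re) :
    ContDiffOn ℝ 2 h A ∧ (∀ z ∈ A, lapl h z = 0) ∧
    ∃ G : ℂ → ℂ, DifferentiableOn ℂ G A ∧ ∀ z ∈ A, ‖deriv G z‖ ^ 2 = Real.exp (h z) := by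
  have hc2 : ContDiffOn ℝ 2 h A := by
    intro z hz
    obtain ⟨F, hF, hFh⟩ := hh z hz
    have h1 : ContDiffAt ℝ 2 (fun w => (F w).re) z :=
      Complex.reCLM.contDiff.contDiffAt.comp z (contDiffAt_real_of_hol hF)
    exact (h1.congr_of_eventuallyEq hFh).contDiffWithinAt
  have hl0 : ∀ z ∈ A, lapl h z = 0 := by
    intro z hz
    obtain ⟨F, hF, hFh⟩ := hh z hz
    rw [lapl_congr hFh, lapl_re hF]
  refine ⟨hc2, hl0, ?_⟩
  set g : ℂ → ℂ := fun z => (fderiv ℝ h z 1 : ℂ) - I * (fderiv ℝ h z I : ℂ) with hg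
  have hgF : ∀ z ∈ A, ∀ F : ℂ → ℂ, AnalyticAt ℂ F z → h =ᶠ[𝓝 z] (fun w => (F w).re) → g =ᶠ[𝓝 z] deriv F := by
    intro z hz F hF hFh
    filter_upwards [hF.eventually_analyticAt, hFh.eventuallyEq_nhds] with w hw hw2
    exact (deriv_eq_of_re hw.differentiableAt hw2).2.symm
  have hgd : DifferentiableOn ℂ g A := by
    intro z hz
    obtain ⟨F, hF, hFh⟩ := hh z hz
    exact (hF.deriv.differentiableAt.congr_of_eventuallyEq (hgF z hz F hF hFh)).differentiableWithinAt
  obtain ⟨k, hk⟩ := exists_primitive hA hAb hAc hgd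
  set k' : ℂ → ℂ := fun z => k z + ((h z - (k z).re : ℝ) : ℂ) with hk'
  have hkd : ∀ z ∈ A, HasDerivAt k' (g z) z := by
    intro z hz
    obtain ⟨ρ, hρ, hρA⟩ := Metric.isOpen_iff.1 hA z hz
    have hder : ∀ w ∈ ball z ρ, HasFDerivAt (fun w => h w - (k w).re) (0 : ℂ →L[ℝ] ℝ) w := by
      intro w hw
      have hwA := hρA hw
      obtain ⟨F, hF, hFh⟩ := hh w hwA
      have h1 := (deriv_eq_of_re hF.differentiableAt hFh)
      have h2 := (Complex.reCLM.hasFDerivAt).comp w (hasFDerivAt_real_of_complex (hk w hwA))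
      have h3 := h1.1.sub h2
      have e : g w = deriv F w := h1.2.symm
      rw [e, sub_self] at h3
      exact h3
    have hconst : ∀ w ∈ ball z ρ, h w - (k w).re = h z - (k z).re := by
      intro w hw
      refine (convex_ball z ρ).is_const_of_fderivWithin_eq_zero (𝕜 := ℝ) (f := fun w => h w - (k w).re) ?_ ?_ hw (mem_ball_self hρ)
      · exact fun y hy => (hder y hy).differentiableAt.differentiableWithinAt
      · intro y hy
        rw [fderivWithin_of_isOpen isOpen_ball hy]; exact (hder y hy).fderiv
    have he : k' =ᶠ[𝓝 z] fun w => k w + ((h z - (k z).re : ℝ) : ℂ) := by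
      filter_upwards [ball_mem_nhds z hρ] with w hw
      simp only [hk']; rw [hconst w hw]
    exact ((hk z hz).add_const _).congr_of_eventuallyEq he
  have hek : ∀ z ∈ A, HasDerivAt (fun w => Complex.exp (k' w / 2)) (Complex.exp (k' z / 2) * (g z / 2)) z :=
    fun z hz => ((hkd z hz).div_const 2).cexp
  obtain ⟨G, hG⟩ := exists_primitive hA hAb hAc (g := fun w => Complex.exp (k' w / 2))
    (fun z hz => (hek z hz).differentiableAt.differentiableWithinAt)
  refine ⟨G, fun z hz => (hG z hz).differentiableAt.differentiableWithinAt, fun z hz => ?_⟩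
  rw [(hG z hz).deriv, Complex.norm_exp, ← Real.exp_nat_mul]
  congr 1
  have : (k' z / 2).re = h z / 2 := by
    have : (k' z / 2).re = (k' z).re / 2 := by simp
    rw [this]; simp [hk']
  rw [this]; push_cast; ring

lemma bol_arith {a m d E L κ p : ℝ} (hp : 0 < p) (ha : 0 ≤ a) (hE : 0 ≤ E)
    (h1 : m - a ≤ κ * m ^ 2 / (8 * p)) (h2 : a - E * d ≤ √(a / p) / 2 * (√E * L)) :
    m * (8 * p - κ * m) / 2 ≤ E * (L ^ 2 + 8 * p * d) := by
  have h3 : 8 * p * (m - a) ≤ κ * m ^ 2 := by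
    have := mul_le_mul_of_nonneg_left h1 (by positivity : (0:ℝ) ≤ 8 * p)
    rw [show 8 * p * (κ * m ^ 2 / (8 * p)) = κ * m ^ 2 by field_simp] at this
    exact this
  set x := √(a / p) with hx
  have hx2 : x ^ 2 * p = a := by rw [hx, Real.sq_sqrt (by positivity)]; field_simp
  set y := √E with hy
  have hy2 : y ^ 2 = E := Real.sq_sqrt hE
  have h4 : a ≤ E * d + x * y * L / 2 := by linarith
  -- x y L/2 ≤ p x^2/2 + y^2 L^2/(8 * p)
  have h5 : 0 ≤ (2 * p * x - y * L) ^ 2 := sq_nonneg _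
  have h6 : (2 * p * x - y * L) ^ 2 = 4 * p * (x ^ 2 * p) - 4 * p * (x * y * L) + y ^ 2 * L ^ 2 := by ring
  rw [h6, hx2, hy2] at h5
  have h7 := mul_le_mul_of_nonneg_left h4 (by positivity : (0:ℝ) ≤ 8 * p)
  nlinarith

lemma bol {A : Set ℂ} (hA : IsOpen A) (hAb : Bornology.IsBounded A) (hAc : IsPreconnected Aᶜ) {W φ : ℂ → ℝ}
    {κ C Λ κ1 B t t' ε : ℝ} (hW : ContDiffOn ℝ 2 W A) (hφ : ContDiffOn ℝ 2 φ A) (htt : t < t')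
    (hφt : ∀ z ∈ A, t < φ z) (hK : ∀ s1 > t, IsCompact {z ∈ A | s1 ≤ φ z}) (hB : ∀ z ∈ A, φ z - t ≤ B)
    (hWB : ∀ z ∈ A, W z ≤ B)
    (hφl : ∀ z ∈ A, κ1 ≤ - lapl φ z) (hΛ : ∀ z ∈ A, |lapl W z| ≤ Λ) (hC0 : 0 ≤ C) (hC : Λ ≤ C * κ1)
    (hκ : 0 < κ) (hWl : ∀ z ∈ A, -lapl W z ≤ κ * Real.exp (W z)) (c : Chi t t' ε) :
    (∫ z in A, Real.exp (W z)) * (8 * π - κ * ∫ z in A, Real.exp (W z)) / 2 ≤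
      Real.exp (C * (t' - t)) * ((∫ z, ‖fderiv ℝ (cut A φ c) z‖ * Real.exp (W z / 2)) ^ 2 +
        8 * π * ((∫ z in A, Real.exp (W z)) - ∫ z in A, c.χ (φ z) * Real.exp (W z))) := by
  have hat : ∀ {f : ℂ → ℝ}, ContDiffOn ℝ 2 f A → ∀ z ∈ A, ContDiffAt ℝ 2 f z := fun hf z hz =>
    hf.contDiffAt (hA.mem_nhds hz)
  have hψ : ContDiffOn ℝ 2 (fun z => φ z - t) A := hφ.sub contDiffOn_const
  have hψl : ∀ z ∈ A, lapl (fun z => φ z - t) z = lapl φ z := fun z hz => by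
    rw [lapl_sub (hat hφ z hz) contDiffAt_const, lapl_const, sub_zero]
  have hCψ : ContDiffOn ℝ 2 (fun z => C * (φ z - t)) A := contDiffOn_const.mul hψ
  have hCψl : ∀ z ∈ A, lapl (fun z => C * (φ z - t)) z = C * lapl φ z := fun z hz => by
    rw [lapl_const_mul _ (hat hψ z hz), hψl z hz]
  have hbd : ∀ z ∈ A, Λ ≤ - (C * lapl φ z) := fun z hz => by
    have := mul_le_mul_of_nonneg_left (hφl z hz) hC0
    linarith
  obtain ⟨h, hhb, hhF⟩ := perron hA (u := fun z => W z - C * (φ z - t)) (v := fun z => W z + C * (φ z - t))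
    (hW.sub hCψ) (hW.add hCψ)
    (fun z hz => by
      rw [lapl_sub (hat hW z hz) (hat hCψ z hz), hCψl z hz]
      have := (abs_le.1 (hΛ z hz)).1
      linarith [hbd z hz])
    (fun z hz => by
      rw [lapl_add (hat hW z hz) (hat hCψ z hz), hCψl z hz]
      have := (abs_le.1 (hΛ z hz)).2
      linarith [hbd z hz])
    (fun z hz => by
      have := mul_nonneg hC0 (sub_nonneg.2 (hφt z hz).le)
      linarith)
  obtain ⟨hh2, hhl, G, hG, hGh⟩ := exists_G hA hAb hAc hhF
  have hvA : volume A < ⊤ := hAb.measure_lt_top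
  have hbi : ∀ {f : ℂ → ℝ} (R : ℝ), ContinuousOn f A → (∀ z ∈ A, |f z| ≤ R) → IntegrableOn f A := by
    intro f R hf hR
    haveI : IsFiniteMeasure (volume.restrict A) := ⟨by rw [Measure.restrict_apply_univ]; exact hvA⟩
    refine Integrable.of_bound (hf.aestronglyMeasurable hA.measurableSet) R ?_
    exact (ae_restrict_iff' hA.measurableSet).2 (ae_of_all _ fun z hz => hR z hz)
  have iW : IntegrableOn (fun z => Real.exp (W z)) A := by
    refine hbi (Real.exp B) hW.continuousOn.rexp fun z hz => ?_
    rw [abs_of_pos (Real.exp_pos _)]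
    exact Real.exp_le_exp.2 (hWB z hz)
  have ih : IntegrableOn (fun z => Real.exp (h z)) A := by
    refine hbi (Real.exp (B + C * B)) hh2.continuousOn.rexp fun z hz => ?_
    rw [abs_of_pos (Real.exp_pos _)]
    refine Real.exp_le_exp.2 ((hhb z hz).2.trans ?_)
    exact add_le_add (hWB z hz) (mul_le_mul_of_nonneg_left (hB z hz) hC0)
  have il : IntegrableOn (lapl W) A := hbi Λ (cont_lapl hA hW) hΛ
  have hcomp : ∀ s > 0, IsCompact {z ∈ A | s ≤ W z - h z} := by
    intro s hs
    -- W - h ≤ C (φ - t)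
    have hδ : ∃ δ > 0, C * δ ≤ s / 2 := by
      refine ⟨s / (2 * (C + 1)), by positivity, ?_⟩
      rw [mul_div_assoc', div_le_div_iff₀ (by positivity) (by norm_num)]
      nlinarith
    obtain ⟨δ, hδ0, hδ⟩ := hδ
    have hKδ := hK (t + δ) (by linarith)
    have hsub : {z ∈ A | s ≤ W z - h z} ⊆ {z ∈ A | t + δ ≤ φ z} := by
      rintro z ⟨hz, hzs⟩
      refine ⟨hz, ?_⟩
      by_contra hlt
      push Not at hlt
      have h1 := (hhb z hz).1
      have h2 : C * (φ z - t) ≤ C * δ := mul_le_mul_of_nonneg_left (by linarith) hC0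
      linarith
    have hcont : ContinuousOn (fun z => W z - h z) {z ∈ A | t + δ ≤ φ z} :=
      (hW.continuousOn.sub hh2.continuousOn).mono fun z hz => hz.1
    have h3 := hcont.preimage_isClosed_of_isClosed hKδ.isClosed (isClosed_Ici (a := s))
    have h4 : {z ∈ A | s ≤ W z - h z} = {z ∈ A | t + δ ≤ φ z} ∩ (fun z => W z - h z) ⁻¹' Ici s := by
      ext z
      constructor
      · intro hz; exact ⟨hsub hz, hz.2⟩
      · intro hz; exact ⟨hz.1.1, hz.2⟩
    rw [h4]
    exact hKδ.of_isClosed_subset h3 inter_subset_left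
  have hband := bandle hA hW hh2 hhl hG hGh hcomp hκ ih iW il hWl
  set f := cut A φ c with hf
  have hfc : ContDiff ℝ 1 f := cut_contDiff hA hφ hK c
  have hfs : HasCompactSupport f := cut_compact hK c
  have hfts : tsupport f ⊆ A := (cut_tsupport hK c).trans fun z hz => hz.1
  have hfA : ∀ z ∈ A, f z = c.χ (φ z) := fun z hz => by simp [hf, cut, hz]
  have hfA0 : ∀ z, z ∉ A → f z = 0 := fun z hz => by simp [hf, cut, hz]
  have hG2 : ∀ z ∈ A, ‖deriv G z‖ = Real.exp (h z / 2) := fun z hz => by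
    have h1 := hGh z hz
    rw [show Real.exp (h z) = Real.exp (h z / 2) ^ 2 by rw [← Real.exp_nat_mul]; congr 1; push_cast; ring] at h1
    exact (pow_left_inj₀ (norm_nonneg _) (Real.exp_pos _).le two_ne_zero).1 h1
  have hiso := isop hA hG hfc hfs hfts (fun z => cut_nonneg c z) (a := ∫ z in A, Real.exp (h z)) (by
    have e1 : ∫ z in tsupport f, ‖deriv G z‖ ^ 2 = ∫ z in tsupport f, Real.exp (h z) :=
      setIntegral_congr_fun (isClosed_tsupport f).measurableSet fun z hz => hGh z (hfts hz)
    rw [e1]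
    exact setIntegral_mono_set ih (ae_of_all _ fun z => (Real.exp_pos _).le) hfts.eventuallyLE)
  have hE0 : 0 ≤ C * (t' - t) := mul_nonneg hC0 (by linarith)
  have hEs : √(Real.exp (C * (t' - t))) = Real.exp (C * (t' - t) / 2) := by
    rw [show Real.exp (C * (t' - t)) = Real.exp (C * (t' - t) / 2) ^ 2 by
      rw [← Real.exp_nat_mul]; congr 1; push_cast; ring, Real.sqrt_sq (Real.exp_pos _).le]
  have hnear : ∀ z ∈ A, φ z < t' → h z ≤ C * (t' - t) + W z := fun z hz hlt => by
    have h1 := (hhb z hz).2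
    have h2 : C * (φ z - t) ≤ C * (t' - t) := mul_le_mul_of_nonneg_left (by linarith) hC0
    linarith
  have hfd0 : ∀ z, z ∉ tsupport f → fderiv ℝ f z = 0 := fun z hz =>
    image_eq_zero_of_notMem_tsupport fun h => hz (tsupport_fderiv_subset ℝ h)
  have hgrad : ∫ z, ‖fderiv ℝ f z‖ * ‖deriv G z‖ ≤ Real.exp (C * (t' - t) / 2) * ∫ z, ‖fderiv ℝ f z‖ * Real.exp (W z / 2) := by
    rw [← integral_const_mul]
    have hci : ∀ {g : ℂ → ℝ}, ContinuousOn g A → Integrable fun z => ‖fderiv ℝ f z‖ * g z := by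
      intro g hg
      have hon : IntegrableOn (fun z => ‖fderiv ℝ f z‖ * g z) (tsupport f) := by
        refine ContinuousOn.integrableOn_compact hfs.isCompact ?_
        exact ((hfc.continuous_fderiv one_ne_zero).norm.continuousOn).mul (hg.mono hfts)
      refine (integrableOn_iff_integrable_of_support_subset ?_).1 hon
      intro z hz
      by_contra hzt
      exact hz (by simp [hfd0 z hzt])
    have hg1 : ContinuousOn (fun z => Real.exp (W z / 2)) A := (hW.continuousOn.div_const 2).rexp
    have hg2 : ContinuousOn (fun z => ‖deriv G z‖) A :=
      ((hh2.continuousOn.div_const 2).rexp).congr hG2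
    refine integral_mono (hci hg2) ((hci hg1).const_mul _) fun z => ?_
    show ‖fderiv ℝ f z‖ * ‖deriv G z‖ ≤ Real.exp (C * (t' - t) / 2) * (‖fderiv ℝ f z‖ * Real.exp (W z / 2))
    by_cases hz : z ∈ A
    · by_cases hzt : φ z < t'
      · rw [hG2 z hz, mul_left_comm, ← Real.exp_add]
        refine mul_le_mul_of_nonneg_left (Real.exp_le_exp.2 ?_) (norm_nonneg _)
        linarith [hnear z hz hzt]
      · rw [hf, cut_fderiv hA hφ c hz, c.off _ (not_lt.1 hzt)]; simp
    · rw [hf, cut_fderiv_off hK c hz]; simp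
  have hχc : Continuous c.χ := (chi_contDiff c).continuous
  have hχφ : ContinuousOn (fun z => c.χ (φ z)) A := hχc.comp_continuousOn hφ.continuousOn
  have hfi : ∀ {g : ℂ → ℝ}, ContinuousOn g A → IntegrableOn g A → IntegrableOn (fun z => c.χ (φ z) * g z) A := by
    intro g hgc hg
    refine Integrable.mono hg ((hχφ.mul hgc).aestronglyMeasurable hA.measurableSet) (ae_of_all _ fun z => ?_)
    rw [norm_mul]
    refine mul_le_of_le_one_left (norm_nonneg _) ?_
    rw [Real.norm_eq_abs, abs_of_nonneg (c.nonneg _)]; exact c.le_one _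
  have hleft : ∫ z, f z * ‖deriv G z‖ ^ 2 = ∫ z in A, c.χ (φ z) * Real.exp (h z) := by
    rw [← setIntegral_eq_integral_of_forall_compl_eq_zero (s := A) (fun z hz => by rw [hfA0 z hz, zero_mul])]
    exact setIntegral_congr_fun hA.measurableSet fun z hz => by rw [hfA z hz, hGh z hz]
  have i1 := hfi hh2.continuousOn.rexp ih
  have i2 := hfi hW.continuousOn.rexp iW
  have hrest : (∫ z in A, Real.exp (h z)) - (∫ z in A, c.χ (φ z) * Real.exp (h z)) ≤
      Real.exp (C * (t' - t)) * ((∫ z in A, Real.exp (W z)) - ∫ z in A, c.χ (φ z) * Real.exp (W z)) := by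
    rw [← integral_sub ih i1, ← integral_sub iW i2, ← integral_const_mul]
    refine setIntegral_mono_on (ih.sub i1) ((iW.sub i2).const_mul _) hA.measurableSet fun z hz => ?_
    show Real.exp (h z) - c.χ (φ z) * Real.exp (h z) ≤ Real.exp (C * (t' - t)) * (Real.exp (W z) - c.χ (φ z) * Real.exp (W z))
    by_cases hzt : φ z < t'
    · have h1 : Real.exp (h z) ≤ Real.exp (C * (t' - t)) * Real.exp (W z) := by
        rw [← Real.exp_add]; exact Real.exp_le_exp.2 (hnear z hz hzt)
      have h2 := mul_le_mul_of_nonneg_left h1 (sub_nonneg.2 (c.le_one (φ z)))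
      linarith
    · rw [c.one _ (not_lt.1 hzt)]; simp
  refine bol_arith Real.pi_pos (integral_nonneg fun z => (Real.exp_pos _).le) (Real.exp_pos _).le hband ?_
  rw [hEs]
  have h5 : √((∫ z in A, Real.exp (h z)) / π) / 2 * ∫ z, ‖fderiv ℝ f z‖ * ‖deriv G z‖ ≤ _ :=
    mul_le_mul_of_nonneg_left hgrad (by positivity)
  rw [hleft] at hiso
  linarith

end MF

namespace MF

open Set Filter Topology Complex Metric
open scoped Manifold ContDiff


lemma telescope2 {F a : ℝ → ℝ} {T0 S C ε0 : ℝ} (hS : T0 ≤ S) (hε : 0 < ε0) (hC : 0 ≤ C) (e : ℝ → ℝ)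
    (he : Tendsto (fun x => e x / x) (𝓝[>] 0) (𝓝 0)) (hac : ContinuousOn a (Icc T0 S)) (haa : ∀ s s', s ≤ s' → a s' ≤ a s)
    (h : ∀ s s', T0 ≤ s → s < s' → s' ≤ S → s' - s ≤ ε0 →
      F s - F s' ≥ -(e (s' - s)) - C * (s' - s) * (a s - a s') - C * (a s - a s') ^ 2) : F S ≤ F T0 := by
  have huc := isCompact_Icc.uniformContinuousOn_of_continuous hac
  rw [Metric.uniformContinuousOn_iff] at huc
  have key : ∀ ρ > 0, F S + C * ρ * a S ≤ F T0 + C * ρ * a T0 := by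
    intro ρ hρ
    obtain ⟨ε1, hε1, hu⟩ := huc ρ hρ
    have := telescope (F := fun x => F (T0 + x) + C * ρ * a (T0 + x)) (a := fun x => a (T0 + x)) (S := S - T0) (C := C)
      (ε0 := min ε0 (ε1 / 2)) (by linarith) (lt_min hε (half_pos hε1)) e he ?_
    · simpa using this
    intro s s' hs hss hs' hd
    have h1 := h (T0 + s) (T0 + s') (by linarith) (by linarith) (by linarith) (by
      have := hd.trans (min_le_left _ _); linarith)
    have hd2 := hd.trans (min_le_right _ _)
    have h2 := hu (T0 + s) ⟨by linarith, by linarith⟩ (T0 + s') ⟨by linarith, by linarith⟩ (by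
      rw [Real.dist_eq, abs_lt]; constructor <;> linarith)
    have h3 := haa (T0 + s) (T0 + s') (by linarith)
    rw [Real.dist_eq, abs_of_nonneg (by linarith)] at h2
    rw [add_sub_add_left_eq_sub] at h1
    have h4 : C * (a (T0 + s) - a (T0 + s')) ^ 2 ≤ C * ρ * (a (T0 + s) - a (T0 + s')) := by
      rw [sq, ← mul_assoc]
      exact mul_le_mul_of_nonneg_right (mul_le_mul_of_nonneg_left h2.le hC) (by linarith)
    linarith
  have t1 : Tendsto (fun ρ => F S + C * ρ * a S) (𝓝[>] 0) (𝓝 (F S)) := by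
    have : ContinuousAt (fun ρ => F S + C * ρ * a S) 0 := by fun_prop
    simpa [ContinuousAt] using this.tendsto.mono_left (nhdsWithin_le_nhds (s := Ioi 0))
  have t2 : Tendsto (fun ρ => F T0 + C * ρ * a T0) (𝓝[>] 0) (𝓝 (F T0)) := by
    have : ContinuousAt (fun ρ => F T0 + C * ρ * a T0) 0 := by fun_prop
    simpa [ContinuousAt] using this.tendsto.mono_left (nhdsWithin_le_nhds (s := Ioi 0))
  exact le_of_tendsto_of_tendsto t1 t2 (by filter_upwards [self_mem_nhdsWithin] with ρ hρ using key ρ hρ)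

set_option maxHeartbeats 1000000 in
lemma sci_arith {m M Δ D ε E E' κ K C2 m0 M0 Ē γ p : ℝ} (hp : 0 < p) (hε : 0 < ε) (hε1 : ε ≤ 1)
    (hK : K ≤ 1 + C2 * ε) (hC2 : 0 ≤ C2) (hΔ : 0 ≤ Δ) (hm : 0 ≤ m) (hmm0 : m ≤ m0) (hmM : m ≤ M) (hMM0 : M ≤ M0)
    (hm8 : m ≤ 8 * p) (hE : 1 ≤ E) (hEE : E ≤ Ē) (hE' : E' ≤ E * (1 + ε + ε ^ 2)) (hEE' : E ≤ E')
    (hD1 : E * Δ ≤ D) (hD2 : D ≤ E' * Δ) (hγ0 : 0 ≤ γ) (hγ : γ ≤ (1 - κ) * m ^ 2)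
    (hi : m * (8 * p - κ * m) / 2 * ε ≤ K * ((1 + ε) * (M - m) * Δ + 8 * p * ε * Δ)) :
    (E * (m * (8 * p - m)) - M * (8 * p - M)) -
      (E' * ((m - Δ) * (8 * p - (m - Δ))) - (M - D) * (8 * p - (M - D))) ≥
      γ * ε - Ē * (8 * p * m0) * ε ^ 2 - Ē * (2 * (1 + 2 * C2) * M0 + 16 * p * (1 + C2) + 4 * m0) * ε * D - D ^ 2 := by
  have hDΔ : Δ ≤ D := (le_mul_of_one_le_left hΔ hE).trans hD1
  have hD0 : 0 ≤ D := hΔ.trans hDΔ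
  set X := (M - m) * Δ with hX
  have hX0 : 0 ≤ X := mul_nonneg (by linarith) hΔ
  have hXM : X ≤ M0 * Δ := mul_le_mul_of_nonneg_right (by linarith) hΔ
  have hεΔ : 0 ≤ ε * Δ := by positivity
  -- (1)
  have s1 : K * ((1 + ε) * X + 8 * p * ε * Δ) ≤ (1 + C2 * ε) * ((1 + ε) * X + 8 * p * ε * Δ) := by
    refine mul_le_mul_of_nonneg_right hK ?_
    positivity
  have s2 : (1 + C2 * ε) * (1 + ε) * X ≤ X + (1 + 2 * C2) * ε * (M0 * Δ) := by
    have a1 : (1 + C2 * ε) * (1 + ε) ≤ 1 + (1 + 2 * C2) * ε := by nlinarith [mul_nonneg hC2 hε.le, mul_nonneg (mul_nonneg hC2 hε.le) (sub_nonneg.2 hε1)]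
    have a2 := mul_le_mul_of_nonneg_right a1 hX0
    have a3 : (1 + 2 * C2) * ε * X ≤ (1 + 2 * C2) * ε * (M0 * Δ) := mul_le_mul_of_nonneg_left hXM (by positivity)
    linarith
  have s3 : (1 + C2 * ε) * (8 * p * ε * Δ) ≤ (1 + C2) * (8 * p * ε * Δ) := by
    refine mul_le_mul_of_nonneg_right ?_ (by positivity)
    nlinarith
  have hi' : m * (8 * p - κ * m) / 2 * ε ≤ K * ((1 + ε) * X + 8 * p * ε * Δ) := by
    rw [hX, ← mul_assoc]; exact hi
  have s4 : ε * (m * (8 * p - κ * m)) - (2 * (1 + 2 * C2) * M0 + 16 * p * (1 + C2)) * (ε * Δ) ≤ 2 * X := by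
    have e1 : (1 + C2 * ε) * ((1 + ε) * X + 8 * p * ε * Δ) = (1 + C2 * ε) * (1 + ε) * X + (1 + C2 * ε) * (8 * p * ε * Δ) := by ring
    have : m * (8 * p - κ * m) / 2 * ε ≤ X + (1 + 2 * C2) * ε * (M0 * Δ) + (1 + C2) * (8 * p * ε * Δ) := by linarith
    linarith
  have hE0 : 0 ≤ E := by linarith
  -- (2) identity
  have e2 : (E * (m * (8 * p - m)) - M * (8 * p - M)) -
      (E' * ((m - Δ) * (8 * p - (m - Δ))) - (M - D) * (8 * p - (M - D))) =
      -(E' - E) * (m * (8 * p - m)) + 8 * p * (E' * Δ - D) + (E' * Δ ^ 2) + 2 * (M * D - m * (E' * Δ)) - D ^ 2 := by ring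
  rw [e2]
  have b1 : (E' - E) ≤ E * (ε + ε ^ 2) := by linarith
  have b2 : (E' - E) * (m * (8 * p - m)) ≤ E * (ε + ε ^ 2) * (m * (8 * p - m)) :=
    mul_le_mul_of_nonneg_right b1 (mul_nonneg hm (by linarith))
  have b3 : 0 ≤ 8 * p * (E' * Δ - D) := mul_nonneg (by positivity) (by linarith)
  have b4 : 0 ≤ E' * Δ ^ 2 := mul_nonneg (by linarith) (sq_nonneg _)
  have b5 : M * (E * Δ) ≤ M * D := mul_le_mul_of_nonneg_left hD1 (by linarith)
  have b6 : m * (E' * Δ) ≤ m * (E * Δ) + 2 * m * (E * (ε * Δ)) := by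
    have : E' ≤ E + 2 * (E * ε) := by nlinarith [mul_nonneg hE0 (mul_nonneg hε.le (sub_nonneg.2 hε1))]
    have h2 := mul_le_mul_of_nonneg_left (mul_le_mul_of_nonneg_right this hΔ) hm
    linarith
  have b7 : E * (2 * X) ≥ E * (ε * (m * (8 * p - κ * m)) - (2 * (1 + 2 * C2) * M0 + 16 * p * (1 + C2)) * (ε * Δ)) :=
    mul_le_mul_of_nonneg_left s4 hE0
  -- (3) collect
  have c1 : E * (ε * m * (8 * p - κ * m)) - E * (ε * (m * (8 * p - m))) = E * ε * ((1 - κ) * m ^ 2) := by ring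
  have c2 : γ * ε ≤ E * ε * ((1 - κ) * m ^ 2) := by
    have a1 : γ * ε ≤ ((1 - κ) * m ^ 2) * ε := mul_le_mul_of_nonneg_right hγ hε.le
    have a2 : 1 * (((1 - κ) * m ^ 2) * ε) ≤ E * (((1 - κ) * m ^ 2) * ε) :=
      mul_le_mul_of_nonneg_right hE (mul_nonneg (hγ0.trans hγ) hε.le)
    linarith
  have c3 : E * ε ^ 2 * (m * (8 * p - m)) ≤ Ē * (8 * p * m0) * ε ^ 2 := by
    have a1 : m * (8 * p - m) ≤ 8 * p * m0 := by
      have q1 := mul_le_mul_of_nonneg_left hmm0 (by positivity : (0:ℝ) ≤ 8 * p)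
      have q2 := mul_nonneg hm hm
      linarith
    have a2 : E * (m * (8 * p - m)) ≤ Ē * (8 * p * m0) :=
      mul_le_mul hEE a1 (mul_nonneg hm (by linarith)) (by linarith)
    have := mul_le_mul_of_nonneg_right a2 (sq_nonneg ε)
    linarith
  have hM0 : 0 ≤ M0 := by linarith
  have hm0 : 0 ≤ m0 := by linarith
  set Q := 2 * (1 + 2 * C2) * M0 + 16 * p * (1 + C2) with hQ
  have hQ0 : 0 ≤ Q := by positivity
  have c4 : E * (Q * (ε * Δ)) + 4 * m * (E * (ε * Δ)) ≤ Ē * (Q + 4 * m0) * ε * D := by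
    have a1 : (Q + 4 * m) ≤ (Q + 4 * m0) := by linarith
    have a2 : E * (Q + 4 * m) ≤ Ē * (Q + 4 * m0) := mul_le_mul hEE a1 (by positivity) (by linarith)
    have a3 : ε * Δ ≤ ε * D := mul_le_mul_of_nonneg_left hDΔ hε.le
    have a4 := mul_le_mul a2 a3 hεΔ (mul_nonneg (by linarith) (by positivity))
    linarith
  have e3 : E * (2 * X) = 2 * (M * (E * Δ)) - 2 * (m * (E * Δ)) := by rw [hX]; ring
  have e4 : E * (ε + ε ^ 2) * (m * (8 * p - m)) = E * (ε * (m * (8 * p - m))) + E * ε ^ 2 * (m * (8 * p - m)) := by ring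
  have e5 : E * (ε * (m * (8 * p - κ * m)) - Q * (ε * Δ)) = E * (ε * m * (8 * p - κ * m)) - E * (Q * (ε * Δ)) := by ring
  linarith

end MF

namespace MF

open Set Filter Topology Complex Metric
open scoped Manifold ContDiff


lemma closed_component {K : Set ℂ} (hK : IsClosed K) (z : ℂ) : IsClosed (connectedComponentIn K z) := by
  by_cases hz : z ∈ K
  · refine isClosed_of_closure_subset ?_
    refine (isPreconnected_connectedComponentIn.closure).subset_connectedComponentIn
      (subset_closure (mem_connectedComponentIn hz)) ?_
    exact closure_minimal (connectedComponentIn_subset _ _) hK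
  · rw [connectedComponentIn_eq_empty hz]; exact isClosed_empty

lemma superlevel_compl {C : Set ℂ} (hC : IsOpen C) (hCb : Bornology.IsBounded C) (hCc : IsPreconnected Cᶜ)
    {φ : ℂ → ℝ} (hφ : ContDiff ℝ 2 φ) (hl : ∀ z ∈ C, lapl φ z < 0) {t : ℝ} :
    IsPreconnected {z ∈ C | t < φ z}ᶜ := by
  set A := {z ∈ C | t < φ z} with hA
  have hAo : IsOpen A := hC.inter (isOpen_lt continuous_const hφ.continuous)
  have hne : (Cᶜ).Nonempty := by
    rw [nonempty_compl]; rintro rfl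
    exact NormedSpace.unbounded_univ ℂ ℂ hCb
  obtain ⟨ζ0, h0⟩ := hne
  have hsub : Cᶜ ⊆ Aᶜ := compl_subset_compl.2 fun z hz => hz.1
  set X := connectedComponentIn Aᶜ ζ0 with hX
  have hCX : Cᶜ ⊆ X := hCc.subset_connectedComponentIn h0 hsub
  have hXA : X ⊆ Aᶜ := connectedComponentIn_subset _ _
  have hXc : IsClosed X := closed_component hAo.isClosed_compl _
  have hOC : Xᶜ ⊆ C := compl_subset_comm.1 hCX
  have hOo : IsOpen Xᶜ := hXc.isOpen_compl
  have hfr : ∀ z ∈ frontier Xᶜ, t ≤ φ z := by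
    intro z hz
    by_contra hlt
    push Not at hlt
    rw [frontier_compl] at hz
    have hzX : z ∈ X := hXc.frontier_subset hz
    have hev : {w | φ w < t} ∈ 𝓝 z := (isOpen_lt hφ.continuous continuous_const).mem_nhds hlt
    obtain ⟨ρ, hρ, hρs⟩ := Metric.mem_nhds_iff.1 hev
    have h1 : ball z ρ ⊆ Aᶜ := fun w hw hwA => by
      have h3 : φ w < t := hρs hw
      exact lt_asymm h3 hwA.2
    have h2 : ball z ρ ⊆ X := by
      have := (convex_ball z ρ).isPreconnected.subset_connectedComponentIn (mem_ball_self hρ) h1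
      rwa [← connectedComponentIn_eq hzX] at this
    have h3 : z ∈ interior X := mem_interior_iff_mem_nhds.2 (Filter.mem_of_superset (ball_mem_nhds z hρ) h2)
    exact hz.2 h3
  have hge : ∀ z ∈ Xᶜ, t ≤ φ z := min_principle hOo (hCb.subset hOC) hφ.continuous.continuousOn hφ.contDiffOn
    (fun z hz => (hl z (hOC hz)).le) hfr
  have hXe : X = Aᶜ := by
    refine subset_antisymm hXA ?_
    rw [compl_subset_comm]
    intro z hz
    refine ⟨hOC hz, lt_of_le_of_ne (hge z hz) fun he => ?_⟩
    have hmin : IsLocalMin φ z := by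
      filter_upwards [hOo.mem_nhds hz] with w hw
      rw [← he]; exact hge w hw
    have h1 := second_nonneg_of_min hφ.contDiffAt hmin 1
    have h2 := second_nonneg_of_min hφ.contDiffAt hmin I
    have h3 := hl z (hOC hz)
    unfold lapl at h3
    linarith
  rw [← hXe]
  exact isPreconnected_connectedComponentIn

lemma cont_level {C : Set ℂ} (hC : IsOpen C) {φ f : ℂ → ℝ} (hφ : ContDiff ℝ 2 φ) (hl : ∀ z ∈ C, lapl φ z < 0)
    (hf : Continuous f) (hfi : IntegrableOn f C) :
    Continuous fun s => ∫ z in {z ∈ C | s < φ z}, f z := by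
  have hm : ∀ s, MeasurableSet {z | s < φ z} := fun s => (isOpen_lt continuous_const hφ.continuous).measurableSet
  have e : ∀ s, ∫ z in {z ∈ C | s < φ z}, f z = ∫ z in C, {z | s < φ z}.indicator f z := fun s => by
    rw [setIntegral_indicator (hm s)]; rfl
  simp_rw [e]
  rw [continuous_iff_continuousAt]
  intro s0
  refine continuousAt_of_dominated (bound := fun z => ‖f z‖) (Eventually.of_forall fun s =>
    (hf.aestronglyMeasurable.indicator (hm s))) (Eventually.of_forall fun s => ae_of_all _ fun z => ?_) hfi.norm ?_
  · exact norm_indicator_le_norm_self _ _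
  · rw [ae_restrict_iff' hC.measurableSet]
    have hn := level_null hC hφ.contDiffOn s0
    filter_upwards [measure_eq_zero_iff_ae_notMem.1 hn] with z hz hzC
    have hne : φ z ≠ s0 := fun h => hz ⟨hzC, h, (hl z hzC).ne⟩
    rcases lt_or_gt_of_ne hne with h | h
    · have : (fun s => {z | s < φ z}.indicator f z) =ᶠ[𝓝 s0] fun _ => 0 := by
        filter_upwards [lt_mem_nhds h] with s hs
        exact indicator_of_notMem (s := {z | s < φ z}) (fun h' : s < φ z => lt_asymm h' hs) f
      exact continuousAt_const.congr this.symm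
    · have : (fun s => {z | s < φ z}.indicator f z) =ᶠ[𝓝 s0] fun _ => f z := by
        filter_upwards [gt_mem_nhds h] with s hs
        exact indicator_of_mem (s := {z | s < φ z}) (show z ∈ {z | s < φ z} from hs) f
      exact continuousAt_const.congr this.symm

/-- one step of the comparison argument -/
lemma sci_step {C : Set ℂ} (hC : IsOpen C) (hCb : Bornology.IsBounded C) (hCc : IsPreconnected Cᶜ)
    {W φ : ℂ → ℝ} {κ : ℝ} (hW : ContDiff ℝ 2 W) (hφ : ContDiff ℝ 2 φ) (hpos : ∀ z ∈ C, 0 < φ z)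
    (hfr : ∀ z ∈ frontier C, φ z = 0) (hl : ∀ z ∈ C, - lapl φ z = Real.exp (W z + φ z) - Real.exp (W z))
    (hκ : 0 < κ) (hWl : ∀ z ∈ C, -lapl W z ≤ κ * Real.exp (W z)) {τ : ℝ} (hτ : 0 < τ) :
    ∃ C1 : ℝ, 0 ≤ C1 ∧ ∀ s s', τ ≤ s → s < s' → 
      (∫ z in {z ∈ C | s < φ z}, Real.exp (W z)) * (8 * π - κ * ∫ z in {z ∈ C | s < φ z}, Real.exp (W z)) / 2 * (s' - s) ≤
      Real.exp (C1 * (s' - s)) * ((1 + (s' - s)) * ((∫ z in {z ∈ C | s < φ z}, Real.exp (W z + φ z)) -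
        ∫ z in {z ∈ C | s < φ z}, Real.exp (W z)) * ((∫ z in {z ∈ C | s < φ z}, Real.exp (W z)) -
        ∫ z in {z ∈ C | s' < φ z}, Real.exp (W z)) + 8 * π * (s' - s) * ((∫ z in {z ∈ C | s < φ z}, Real.exp (W z)) -
        ∫ z in {z ∈ C | s' < φ z}, Real.exp (W z))) := by
  have hcl : IsCompact (closure C) := hCb.isCompact_closure
  have hbdd : ∀ f : ℂ → ℝ, Continuous f → ∃ B, ∀ z ∈ C, |f z| ≤ B := fun f hf => by
    obtain ⟨B, hB⟩ := hcl.exists_bound_of_continuousOn hf.continuousOn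
    exact ⟨B, fun z hz => hB z (subset_closure hz)⟩
  obtain ⟨B1, hB1⟩ := hbdd W hW.continuous
  obtain ⟨B2, hB2⟩ := hbdd φ hφ.continuous
  obtain ⟨Λ, hΛ⟩ := hbdd (lapl W) (by
    have := cont_lapl isOpen_univ hW.contDiffOn
    exact continuousOn_univ.1 this)
  set κ1 := Real.exp (-B1) * (Real.exp τ - 1) with hκ1
  have hκ1p : 0 < κ1 := mul_pos (Real.exp_pos _) (by linarith [Real.one_lt_exp_iff.2 hτ])
  have hlneg : ∀ z ∈ C, lapl φ z < 0 := fun z hz => by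
    have h1 := hl z hz
    have h2 := Real.exp_lt_exp.2 (show W z < W z + φ z by linarith [hpos z hz])
    linarith
  refine ⟨|Λ| / κ1, by positivity, ?_⟩
  intro s s' hs hss
  set A := {z ∈ C | s < φ z} with hA
  have hAC : A ⊆ C := fun z hz => hz.1
  have hAo : IsOpen A := hC.inter (isOpen_lt continuous_const hφ.continuous)
  have hAb := hCb.subset hAC
  obtain ⟨c⟩ := exists_chi hss (sub_pos.2 hss)
  have hK : ∀ s1 > s, IsCompact {z ∈ A | s1 ≤ φ z} := by
    intro s1 hs1
    have : {z ∈ A | s1 ≤ φ z} = closure C ∩ {z | s1 ≤ φ z} := by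
      ext z
      constructor
      · rintro ⟨hz, h⟩; exact ⟨subset_closure hz.1, h⟩
      · rintro ⟨hz, h⟩
        have h' : s1 ≤ φ z := h
        have hzC : z ∈ C := by
          by_contra hn
          have := hfr z ⟨hz, fun hi => hn (interior_subset hi)⟩
          linarith
        exact ⟨⟨hzC, by linarith⟩, h⟩
    rw [this]
    exact hcl.inter_right (isClosed_le continuous_const hφ.continuous)
  have hlow : ∀ z ∈ A, κ1 ≤ - lapl φ z := by
    intro z hz
    rw [hl z hz.1, Real.exp_add, ← mul_sub_one]
    have h1 := (abs_le.1 (hB1 z hz.1)).1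
    have h2 := hz.2
    refine mul_le_mul (Real.exp_le_exp.2 h1) (by linarith [Real.exp_le_exp.2 (hs.trans h2.le)])
      (by linarith [Real.one_lt_exp_iff.2 hτ]) (Real.exp_pos _).le
  have hbol := bol hAo hAb (superlevel_compl hC hCb hCc hφ hlneg) hW.contDiffOn hφ.contDiffOn hss (fun z hz => hz.2) hK
    (B := max B1 B2) (fun z hz => by
      have := (le_abs_self _).trans (hB2 z hz.1)
      have := le_max_right B1 B2
      linarith) (fun z hz => ((le_abs_self _).trans (hB1 z hz.1)).trans (le_max_left _ _)) hlow
    (fun z hz => hΛ z hz.1) (C := |Λ| / κ1) (by positivity) (by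
      rw [div_mul_cancel₀ _ hκ1p.ne']; exact le_abs_self _) hκ (fun z hz => hWl z hz.1) c
  have hIntg : ∀ f : ℂ → ℝ, Continuous f → IntegrableOn f C := fun f hf =>
    (hf.continuousOn.integrableOn_compact hcl).mono_set subset_closure
  have iW := hIntg _ hW.continuous.rexp
  have iV := hIntg (fun z => Real.exp (W z + φ z)) (hW.continuous.add hφ.continuous).rexp
  have hen := energy hAo hφ.contDiffOn hK c hss (sub_pos.2 hss) (g := fun z => Real.exp (W z / 2))
    (by have := hW.continuous; fun_prop) (fun z _ => (Real.exp_pos _).le) (by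
      have := hW.continuous
      exact (hIntg _ (by fun_prop)).mono_set fun z hz => hz.1.1)
  have e2 : ∀ z, Real.exp (W z / 2) ^ 2 = Real.exp (W z) := fun z => by
    rw [← Real.exp_nat_mul]; congr 1; push_cast; ring
  simp_rw [e2] at hen
  set m := ∫ z in A, Real.exp (W z) with hm
  set M := ∫ z in A, Real.exp (W z + φ z) with hM
  set m' := ∫ z in {z ∈ C | s' < φ z}, Real.exp (W z) with hm'
  set L := ∫ z, ‖fderiv ℝ (cut A φ c) z‖ * Real.exp (W z / 2) with hL
  have hA' : {z ∈ C | s' < φ z} ⊆ A := fun z hz => ⟨hz.1, hss.trans hz.2⟩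
  have hA'o : IsOpen {z ∈ C | s' < φ z} := hC.inter (isOpen_lt continuous_const hφ.continuous)
  -- first factor
  have f1 : ∫ z in A, c.χ (φ z) * (-lapl φ z) ≤ M - m := by
    rw [hM, hm, ← integral_sub (iV.mono_set hAC) (iW.mono_set hAC)]
    have hlc : Continuous (lapl φ) := continuousOn_univ.1 (cont_lapl isOpen_univ hφ.contDiffOn)
    have hχc : Continuous c.χ := (chi_contDiff c).continuous
    refine setIntegral_mono_on ((hIntg _ ((hχc.comp hφ.continuous).mul hlc.neg)).mono_set hAC)
      ((iV.mono_set hAC).sub (iW.mono_set hAC)) hAo.measurableSet fun z hz => ?_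
    simp only [← hl z hz.1]
    exact mul_le_of_le_one_left (by linarith [hlneg z hz.1]) (c.le_one _)
  have hd : m - m' = ∫ z in A \ {z ∈ C | s' < φ z}, Real.exp (W z) := by
    rw [setIntegral_sdiff hA'o.measurableSet (iW.mono_set hAC) hA']
  have f2 : ∫ z in {z ∈ A | s < φ z ∧ φ z < s'}, Real.exp (W z) ≤ m - m' := by
    rw [hd]
    refine setIntegral_mono_set ((iW.mono_set hAC).mono_set sdiff_subset) (ae_of_all _ fun z => (Real.exp_pos _).le) ?_
    refine HasSubset.Subset.eventuallyLE fun z hz => ⟨hz.1, fun h => ?_⟩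
    exact lt_asymm h.2 hz.2.2
  have f3 : m - ∫ z in A, c.χ (φ z) * Real.exp (W z) ≤ m - m' := by
    have hχc : Continuous c.χ := (chi_contDiff c).continuous
    have i1 : IntegrableOn (fun z => c.χ (φ z) * Real.exp (W z)) A :=
      (hIntg _ ((hχc.comp hφ.continuous).mul hW.continuous.rexp)).mono_set hAC
    have : m' ≤ ∫ z in A, c.χ (φ z) * Real.exp (W z) := by
      have h1 : m' = ∫ z in {z ∈ C | s' < φ z}, c.χ (φ z) * Real.exp (W z) :=
        setIntegral_congr_fun hA'o.measurableSet fun z hz => by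
          rw [c.one _ hz.2.le, one_mul]
      rw [h1]
      exact setIntegral_mono_set i1 (ae_of_all _ fun z => mul_nonneg (c.nonneg _) (Real.exp_pos _).le) hA'.eventuallyLE
    linarith
  have hΔ0 : 0 ≤ m - m' := by rw [hd]; exact integral_nonneg fun z => (Real.exp_pos _).le
  have hMm : 0 ≤ M - m := by
    refine le_trans ?_ f1
    exact setIntegral_nonneg hAo.measurableSet fun z hz => mul_nonneg (c.nonneg _) (by linarith [hlneg z hz.1])
  have hε := sub_pos.2 hss
  set ε := s' - s with hεd
  have g1 : L ^ 2 ≤ (M - m) * ((1 + ε) / ε * (m - m')) := by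
    refine hen.trans ?_
    refine mul_le_mul f1 (mul_le_mul_of_nonneg_left f2 (by positivity)) ?_ hMm
    refine mul_nonneg (by positivity) (integral_nonneg fun z => (Real.exp_pos _).le)
  have g2 : L ^ 2 * ε ≤ (1 + ε) * (M - m) * (m - m') := by
    have := mul_le_mul_of_nonneg_right g1 hε.le
    refine this.trans (le_of_eq ?_)
    field_simp
  have g3 := mul_le_mul_of_nonneg_right hbol hε.le
  refine g3.trans ?_
  rw [mul_assoc]
  refine mul_le_mul_of_nonneg_left ?_ (Real.exp_pos _).le
  have g4 := mul_le_mul_of_nonneg_left f3 (by positivity : (0:ℝ) ≤ 8 * π * ε)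
  linarith

end MF

namespace MF

open Set Filter Topology Complex Metric
open scoped Manifold ContDiff


theorem sci {C : Set ℂ} (hC : IsOpen C) (hCb : Bornology.IsBounded C) (hCc : IsPreconnected Cᶜ) (hCn : C.Nonempty)
    {W φ : ℂ → ℝ} {κ : ℝ} (hW : ContDiff ℝ 2 W) (hφ : ContDiff ℝ 2 φ) (hpos : ∀ z ∈ C, 0 < φ z)
    (hfr : ∀ z ∈ frontier C, φ z = 0) (hl : ∀ z ∈ C, - lapl φ z = Real.exp (W z + φ z) - Real.exp (W z))
    (hκ : 0 < κ) (hκ1 : κ < 1) (hWl : ∀ z ∈ C, -lapl W z ≤ κ * Real.exp (W z)) :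
    8 * π < (∫ z in C, Real.exp (W z)) + ∫ z in C, Real.exp (W z + φ z) := by
  by_contra hcon
  push Not at hcon
  have hcl : IsCompact (closure C) := hCb.isCompact_closure
  have hIntg : ∀ f : ℂ → ℝ, Continuous f → IntegrableOn f C := fun f hf =>
    (hf.continuousOn.integrableOn_compact hcl).mono_set subset_closure
  have cW := hW.continuous.rexp
  have cV : Continuous fun z => Real.exp (W z + φ z) := (hW.continuous.add hφ.continuous).rexp
  have iW := hIntg _ cW
  have iV := hIntg _ cV
  have hlneg : ∀ z ∈ C, lapl φ z < 0 := fun z hz => by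
    have h1 := hl z hz
    have h2 := Real.exp_lt_exp.2 (show W z < W z + φ z by linarith [hpos z hz])
    linarith
  have hAo : ∀ s, IsOpen {z ∈ C | s < φ z} := fun s => hC.inter (isOpen_lt continuous_const hφ.continuous)
  have hAC : ∀ s, {z ∈ C | s < φ z} ⊆ C := fun s z hz => hz.1
  set m : ℝ → ℝ := fun s => ∫ z in {z ∈ C | s < φ z}, Real.exp (W z) with hm
  set M : ℝ → ℝ := fun s => ∫ z in {z ∈ C | s < φ z}, Real.exp (W z + φ z) with hM
  have hmc : Continuous m := cont_level hC hφ hlneg cW iW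
  have hMc : Continuous M := cont_level hC hφ hlneg cV iV
  have h00 : {z ∈ C | 0 < φ z} = C := by ext z; exact ⟨fun h => h.1, fun h => ⟨h, hpos z h⟩⟩
  have hm0 : m 0 = ∫ z in C, Real.exp (W z) := by simp only [hm, h00]
  have hM0 : M 0 = ∫ z in C, Real.exp (W z + φ z) := by simp only [hM, h00]
  rw [← hm0, ← hM0] at hcon
  have hsub : ∀ s s', s ≤ s' → {z ∈ C | s' < φ z} ⊆ {z ∈ C | s < φ z} := fun s s' h z hz => ⟨hz.1, h.trans_lt hz.2⟩
  have hma : ∀ s s', s ≤ s' → m s' ≤ m s := fun s s' h =>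
    setIntegral_mono_set (iW.mono_set (hAC s)) (ae_of_all _ fun z => (Real.exp_pos _).le) (hsub s s' h).eventuallyLE
  have hMa : ∀ s s', s ≤ s' → M s' ≤ M s := fun s s' h =>
    setIntegral_mono_set (iV.mono_set (hAC s)) (ae_of_all _ fun z => (Real.exp_pos _).le) (hsub s s' h).eventuallyLE
  have hmn : ∀ s, 0 ≤ m s := fun s => integral_nonneg fun z => (Real.exp_pos _).le
  have hmM : ∀ s, m s ≤ M s := fun s =>
    setIntegral_mono_on (iW.mono_set (hAC s)) (iV.mono_set (hAC s)) (hAo s).measurableSet fun z hz =>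
      Real.exp_le_exp.2 (by linarith [hpos z hz.1])
  have hD : ∀ s s', s ≤ s' → Real.exp s * (m s - m s') ≤ M s - M s' ∧ M s - M s' ≤ Real.exp s' * (m s - m s') := by
    intro s s' h
    have e1 : m s - m s' = ∫ z in {z ∈ C | s < φ z} \ {z ∈ C | s' < φ z}, Real.exp (W z) := by
      rw [setIntegral_sdiff (hAo s').measurableSet (iW.mono_set (hAC s)) (hsub s s' h)]
    have e2 : M s - M s' = ∫ z in {z ∈ C | s < φ z} \ {z ∈ C | s' < φ z}, Real.exp (W z + φ z) := by
      rw [setIntegral_sdiff (hAo s').measurableSet (iV.mono_set (hAC s)) (hsub s s' h)]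
    have hms := (hAo s).measurableSet.diff (hAo s').measurableSet
    have i1 : IntegrableOn (fun z => Real.exp (W z)) ({z ∈ C | s < φ z} \ {z ∈ C | s' < φ z}) :=
      iW.mono_set fun z hz => hz.1.1
    have i2 : IntegrableOn (fun z => Real.exp (W z + φ z)) ({z ∈ C | s < φ z} \ {z ∈ C | s' < φ z}) :=
      iV.mono_set fun z hz => hz.1.1
    rw [e1, e2, ← integral_const_mul, ← integral_const_mul]
    constructor
    · refine setIntegral_mono_on (i1.const_mul _) i2 hms fun z hz => ?_
      rw [← Real.exp_add]
      exact Real.exp_le_exp.2 (by linarith [hz.1.2])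
    · refine setIntegral_mono_on i2 (i1.const_mul _) hms fun z hz => ?_
      rw [← Real.exp_add]
      refine Real.exp_le_exp.2 ?_
      have : φ z ≤ s' := by
        by_contra hn; push Not at hn
        exact hz.2 ⟨hz.1.1, hn⟩
      linarith
  obtain ⟨B2, hB2⟩ := hcl.exists_bound_of_continuousOn hφ.continuous.continuousOn
  obtain ⟨z0, hz0⟩ := hCn
  set s0 := φ z0 / 2 with hs0
  have hs0p : 0 < s0 := half_pos (hpos z0 hz0)
  set T := max B2 s0 + 1 with hT
  have hs0T : s0 ≤ T := by have := le_max_right B2 s0; linarith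
  have hempty : {z ∈ C | T < φ z} = ∅ := by
    ext z
    simp only [mem_setOf_eq, mem_empty_iff_false, iff_false, not_and, not_lt]
    intro hz
    have h1 := (le_abs_self _).trans (hB2 z (subset_closure hz))
    have := le_max_left B2 s0
    linarith
  have hmT : m T = 0 := by simp only [hm, hempty]; simp
  have hMT : M T = 0 := by simp only [hM, hempty]; simp
  have hms0 : 0 < m s0 := by
    have hne : (volume {z ∈ C | s0 < φ z}) ≠ 0 :=
      ((hAo s0).measure_pos volume ⟨z0, hz0, by linarith [hpos z0 hz0]⟩).ne'
    simp only [hm]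
    rw [setIntegral_pos_iff_support_of_nonneg_ae (ae_of_all _ fun z => (Real.exp_pos _).le) (iW.mono_set (hAC s0))]
    have : Function.support (fun z => Real.exp (W z)) = univ := by
      ext z; simp [(Real.exp_pos (W z)).ne']
    rw [this, univ_inter]
    exact pos_iff_ne_zero.2 hne
  set Gf : ℝ → ℝ := fun s => Real.exp s * (m s * (8 * π - m s)) - M s * (8 * π - M s) with hGf
  have hGc : Continuous Gf := by fun_prop
  have main : ∀ τ > 0, ∀ T0 S γ, τ ≤ T0 → T0 ≤ S → S ≤ T → 0 ≤ γ → γ ≤ (1 - κ) * m S ^ 2 →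
      Gf S + γ * (S - T0) ≤ Gf T0 := by
    intro τ hτ T0 S γ hτT hTS hST hγ hγS
    obtain ⟨C1, hC1, hstep⟩ := sci_step hC hCb hCc hW hφ hpos hfr hl hκ hWl hτ
    set C2 := C1 * Real.exp C1 with hC2
    have hC20 : 0 ≤ C2 := mul_nonneg hC1 (Real.exp_pos _).le
    set Q := Real.exp T * (2 * (1 + 2 * C2) * M 0 + 16 * π * (1 + C2) + 4 * m 0) with hQ
    have hQ0 : 0 ≤ Q := by
      have := hmn 0
      have := (hmn 0).trans (hmM 0)
      positivity
    have key := telescope2 (F := fun s => Gf s + γ * s) (a := M) (C := Q + 1) (T0 := T0) (S := S) (ε0 := 1) hTS one_pos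
      (by linarith) (fun x => Real.exp T * (8 * π * m 0) * x ^ 2) ?_ hMc.continuousOn hMa ?_
    · have : Gf S + γ * S ≤ Gf T0 + γ * T0 := key
      linarith
    · have : Tendsto (fun x : ℝ => Real.exp T * (8 * π * m 0) * x) (𝓝[>] 0) (𝓝 0) := by
        have h1 : Continuous fun x : ℝ => Real.exp T * (8 * π * m 0) * x := by fun_prop
        have h2 := h1.tendsto 0
        rw [mul_zero] at h2
        exact h2.mono_left nhdsWithin_le_nhds
      refine this.congr' ?_
      filter_upwards [self_mem_nhdsWithin] with x hx
      have hx0 : x ≠ 0 := (ne_of_gt hx)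
      field_simp
    · intro s s' hs hss hs' hd
      have hε := sub_pos.2 hss
      have hs_pos : 0 ≤ s := by linarith
      have h1 := hstep s s' (by linarith) hss
      have hKb : Real.exp (C1 * (s' - s)) ≤ 1 + C2 * (s' - s) := by
        have hx0 : 0 ≤ C1 * (s' - s) := mul_nonneg hC1 hε.le
        have hx1 : C1 * (s' - s) ≤ C1 := mul_le_of_le_one_right hC1 hd
        have a1 := Real.add_one_le_exp (-(C1 * (s' - s)))
        have a2 := mul_le_mul_of_nonneg_right a1 (Real.exp_pos (C1 * (s' - s))).le
        rw [← Real.exp_add, neg_add_cancel, Real.exp_zero] at a2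
        have a3 : C1 * (s' - s) * Real.exp (C1 * (s' - s)) ≤ C1 * (s' - s) * Real.exp C1 :=
          mul_le_mul_of_nonneg_left (Real.exp_le_exp.2 hx1) hx0
        rw [hC2]
        linarith
      have hexp : Real.exp s' ≤ Real.exp s * (1 + (s' - s) + (s' - s) ^ 2) := by
        have a1 := exp_sub_le hε hd
        have a2 : Real.exp s' = Real.exp s * Real.exp (s' - s) := by rw [← Real.exp_add]; congr 1; ring
        rw [a2]
        exact mul_le_mul_of_nonneg_left a1 (Real.exp_pos _).le
      have h8 : m s ≤ 8 * π := by
        have := hma 0 s hs_pos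
        have := (hmn 0).trans (hmM 0)
        linarith
      have hss' := hD s s' hss.le
      have hmS : m S ≤ m s := hma s S (by linarith)
      have hγs : γ ≤ (1 - κ) * m s ^ 2 := hγS.trans
        (mul_le_mul_of_nonneg_left (pow_le_pow_left₀ (hmn S) hmS 2) (by linarith))
      have ha := sci_arith (m := m s) (M := M s) (Δ := m s - m s') (D := M s - M s') (ε := s' - s)
        (E := Real.exp s) (E' := Real.exp s') (κ := κ) (K := Real.exp (C1 * (s' - s))) (C2 := C2) (m0 := m 0) (M0 := M 0)
        (Ē := Real.exp T) (γ := γ) Real.pi_pos hε hd hKb hC20 (by linarith [hma s s' hss.le]) (hmn s) (hma 0 s hs_pos)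
        (hmM s) (hMa 0 s hs_pos) h8 (Real.one_le_exp hs_pos) (Real.exp_le_exp.2 (by linarith)) hexp
        (Real.exp_le_exp.2 hss.le) hss'.1 hss'.2 hγ hγs h1
      rw [sub_sub_cancel, sub_sub_cancel, ← hQ] at ha
      simp only [hGf]
      have hd0 : 0 ≤ M s - M s' := by linarith [hMa s s' hss.le]
      have p1 : 0 ≤ (s' - s) * (M s - M s') := mul_nonneg hε.le hd0
      have p2 : 0 ≤ Q * (M s - M s') ^ 2 := by positivity
      linarith
  have hγ : 0 < (1 - κ) * m s0 ^ 2 := mul_pos (by linarith) (by positivity)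
  have hlow : ∀ τ, 0 < τ → τ ≤ s0 → (1 - κ) * m s0 ^ 2 * (s0 - τ) ≤ Gf τ := by
    intro τ hτ hτs
    have h1 := main τ hτ τ s0 _ le_rfl hτs hs0T hγ.le le_rfl
    have h2 := main τ hτ s0 T 0 hτs hs0T le_rfl le_rfl (by rw [hmT]; simp)
    have h3 : Gf T = 0 := by simp only [hGf, hmT, hMT]; ring
    linarith
  have hlim : (1 - κ) * m s0 ^ 2 * (s0 - 0) ≤ Gf 0 := by
    have t1 : Tendsto (fun τ => (1 - κ) * m s0 ^ 2 * (s0 - τ)) (𝓝[>] 0) (𝓝 ((1 - κ) * m s0 ^ 2 * (s0 - 0))) := by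
      have : Continuous fun τ => (1 - κ) * m s0 ^ 2 * (s0 - τ) := by fun_prop
      exact (this.tendsto 0).mono_left nhdsWithin_le_nhds
    have t2 : Tendsto Gf (𝓝[>] 0) (𝓝 (Gf 0)) := (hGc.tendsto 0).mono_left nhdsWithin_le_nhds
    refine le_of_tendsto_of_tendsto t1 t2 ?_
    filter_upwards [Ioo_mem_nhdsGT hs0p] with τ hτ
    exact hlow τ hτ.1 hτ.2.le
  have hfin : Gf 0 = -((M 0 - m 0) * (8 * π - (m 0 + M 0))) := by
    simp only [hGf, Real.exp_zero]; ring
  have h5 : 0 ≤ (M 0 - m 0) * (8 * π - (m 0 + M 0)) := mul_nonneg (by linarith [hmM 0]) (by linarith)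
  have h6 : 0 < (1 - κ) * m s0 ^ 2 * (s0 - 0) := mul_pos hγ (by linarith)
  linarith

end MF

namespace MF

open Set Filter Topology Complex Metric
open scoped Manifold ContDiff


lemma area_lower {C : Set ℂ} (hC : IsOpen C) (hCb : Bornology.IsBounded C) (hCn : C.Nonempty)
    {φ : ℂ → ℝ} {c : ℝ} (hφ : ContDiff ℝ 2 φ) (hpos : ∀ z ∈ C, 0 < φ z)
    (hfr : ∀ z ∈ frontier C, φ z = 0) (hc : 0 < c) (hl : ∀ z ∈ C, - lapl φ z ≤ c * φ z) :
    2 * π ≤ c * volume.real C := by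
  have hcl : IsCompact (closure C) := hCb.isCompact_closure
  have hIntg : ∀ f : ℂ → ℝ, Continuous f → IntegrableOn f C := fun f hf =>
    (hf.continuousOn.integrableOn_compact hcl).mono_set subset_closure
  have hCfin : volume C ≠ ⊤ := hCb.measure_lt_top.ne
  have hC0 : 0 < volume.real C := ENNReal.toReal_pos (hC.measure_pos volume hCn).ne' hCfin
  have cφ := hφ.continuous
  have hI : 0 < ∫ z in C, φ z := by
    rw [setIntegral_pos_iff_support_of_nonneg_ae ((ae_restrict_iff' hC.measurableSet).2
      (ae_of_all _ fun z hz => (hpos z hz).le)) (hIntg _ cφ)]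
    have : Function.support φ ∩ C = C := by
      ext z; exact ⟨fun h => h.2, fun h => ⟨(hpos z h).ne', h⟩⟩
    rw [this]
    exact hC.measure_pos volume hCn
  set m : ℝ → ℝ := fun d => ∫ z in C, Real.exp (d * φ z) with hm
  have hmc : Continuous m := by
    have h1 : Continuous fun p : ℝ × ℂ => Real.exp (p.1 * φ p.2) := by fun_prop
    have h2 : m = fun d => ∫ z in closure C, (C.indicator (fun z => Real.exp (d * φ z))) z := by
      ext d
      rw [setIntegral_indicator hC.measurableSet, inter_eq_right.2 subset_closure]
    obtain ⟨B, hB⟩ := hcl.exists_bound_of_continuousOn cφ.continuousOn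
    rw [continuous_iff_continuousAt]
    intro d0
    refine continuousAt_of_dominated (bound := fun _ => Real.exp ((|d0| + 1) * |B|)) ?_ ?_ ?_ ?_
    · exact Eventually.of_forall fun d => (hIntg _ (by fun_prop : Continuous fun z => Real.exp (d * φ z))).aestronglyMeasurable
    · filter_upwards [ball_mem_nhds d0 one_pos] with d hd
      refine (ae_restrict_iff' hC.measurableSet).2 (ae_of_all _ fun z hz => ?_)
      rw [Real.norm_eq_abs, abs_of_pos (Real.exp_pos _)]
      refine Real.exp_le_exp.2 ((le_abs_self _).trans ?_)
      rw [abs_mul]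
      have h3 : |d| ≤ |d0| + 1 := by
        rw [mem_ball, Real.dist_eq] at hd
        have := abs_sub_abs_le_abs_sub d d0
        linarith
      have h4 : |φ z| ≤ |B| := (hB z (subset_closure hz)).trans (le_abs_self _)
      exact mul_le_mul h3 h4 (abs_nonneg _) (by positivity)
    · exact integrableOn_const hCfin
    · refine ae_of_all _ fun z => ?_
      fun_prop
  have hm0 : m 0 = volume.real C := by simp [hm]
  have hmlow : ∀ d, volume.real C + d * ∫ z in C, φ z ≤ m d := by
    intro d
    have h1 : volume.real C + d * ∫ z in C, φ z = ∫ z in C, (1 + d * φ z) := by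
      have i1 : IntegrableOn (fun z => d * φ z) C := (hIntg _ cφ).const_mul d
      have i0 : IntegrableOn (fun _ : ℂ => (1:ℝ)) C := hIntg _ continuous_const
      rw [integral_add i0 i1, integral_const_mul]
      simp
    rw [h1]
    refine setIntegral_mono_on (hIntg _ (by fun_prop)) (hIntg _ (by fun_prop)) hC.measurableSet fun z hz => ?_
    rw [add_comm]
    exact Real.add_one_le_exp _
  set d1 := volume.real C / ∫ z in C, φ z with hd1
  have hd1p : 0 < d1 := div_pos hC0 hI
  have hmd1 : 2 * volume.real C ≤ m d1 := by
    have := hmlow d1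
    rw [hd1, div_mul_cancel₀ _ hI.ne'] at this
    rw [hd1]; linarith
  obtain ⟨d, hd, hmd⟩ : ∃ d ∈ Icc 0 d1, m d = 2 * volume.real C := by
    have := intermediate_value_Icc hd1p.le hmc.continuousOn
    exact this ⟨by rw [hm0]; linarith, hmd1⟩
  have hd0 : 0 ≤ d := hd.1
  have hW : ContDiff ℝ 2 (fun z => d * φ z) := contDiff_const.mul hφ
  have hb := bandle (A := C) (W := fun z => d * φ z) (h := fun _ => 0) (G := fun z => z) (κ := c) hC hW.contDiffOn
    contDiffOn_const (fun z _ => lapl_const 0 z) differentiableOn_id (fun z _ => by simp) ?_ hc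
    (by simpa using hCfin.lt_top)
    (hIntg _ (by fun_prop)) (hIntg _ (continuousOn_univ.1 (cont_lapl isOpen_univ hW.contDiffOn))) ?_
  · have h1 : (∫ z in C, Real.exp (d * φ z)) = 2 * volume.real C := hmd
    rw [h1] at hb
    simp only [Real.exp_zero, integral_const, smul_eq_mul, mul_one] at hb
    have h2 : (volume.restrict C).real univ = volume.real C := by simp
    rw [h2, le_div_iff₀ (by positivity)] at hb
    have h3 : volume.real C * (2 * π) ≤ volume.real C * (c * volume.real C) := by linarith
    exact le_of_mul_le_mul_left h3 hC0
  · intro s hs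
    have : {z ∈ C | s ≤ d * φ z - 0} = closure C ∩ {z | s ≤ d * φ z} := by
      ext z
      simp only [sub_zero]
      constructor
      · rintro ⟨hz, h⟩; exact ⟨subset_closure hz, h⟩
      · rintro ⟨hz, h⟩
        refine ⟨?_, h⟩
        by_contra hn
        have h1 := hfr z ⟨hz, fun hi => hn (interior_subset hi)⟩
        have h2 : s ≤ d * φ z := h
        rw [h1, mul_zero] at h2
        linarith
    rw [this]
    exact hcl.inter_right (isClosed_le continuous_const (by fun_prop))
  · intro z hz
    rw [lapl_const_mul _ hφ.contDiffAt]
    have h1 := mul_le_mul_of_nonneg_left (hl z hz) hd0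
    have h2 := Real.add_one_le_exp (d * φ z)
    have h3 := mul_le_mul_of_nonneg_left h2 hc.le
    linarith

lemma strong_min {φ : ℂ → ℝ} (hφ : ContDiff ℝ 2 φ) {z1 : ℂ} {ρ : ℝ} (hl : ∀ z ∈ ball z1 ρ, lapl φ z ≤ 0)
    (hnn : ∀ z ∈ ball z1 ρ, 0 ≤ φ z) (h0 : φ z1 = 0) : ∀ z ∈ ball z1 ρ, φ z = 0 := by
  have hcav : ∀ r, 0 < r → r < ρ → circleAverage φ z1 r ≤ 0 := by
    intro r hr hrρ
    have h1 := pmod_le hr (A := ball z1 ρ) (closedBall_subset_ball hrρ) (SH_of_lapl isOpen_ball hφ.contDiffOn hl) z1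
    rw [h0] at h1
    refine le_trans (le_of_eq ?_) h1
    rw [pmod, if_pos (mem_ball_self hr), PI, ← circleAverage_map_add_const]
    refine circleAverage_congr_sphere fun w hw => ?_
    have hw0 : w ≠ 0 := by
      rintro rfl
      rw [mem_sphere, dist_self, abs_of_pos hr] at hw
      linarith
    simp [herglotzRieszKernel_def, hw0]
  intro z hz
  by_cases hzz : z = z1
  · rw [hzz, h0]
  set r := ‖z - z1‖ with hr
  have hr0 : 0 < r := norm_pos_iff.2 (sub_ne_zero.2 hzz)
  have hrρ : r < ρ := by rwa [mem_ball, dist_eq_norm] at hz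
  have h1 := hcav r hr0 hrρ
  have hmem : ∀ t, circleMap z1 r t ∈ ball z1 ρ := fun t => by
    rw [mem_ball, dist_eq_norm]
    simpa [circleMap, abs_of_pos hr0] using hrρ
  refine le_antisymm ?_ (hnn z hz)
  by_contra hcon
  push Not at hcon
  obtain ⟨t, ht, htz⟩ : z ∈ circleMap z1 r '' Ioc 0 (2 * π) := by
    rw [image_circleMap_Ioc]
    rw [mem_sphere, dist_eq_norm, abs_of_pos hr0]
  rw [circleAverage_def] at h1
  have h2 : 0 < ∫ t in (0:ℝ)..2 * π, φ (circleMap z1 r t) := by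
    refine intervalIntegral.integral_pos (by positivity) ?_ (fun t _ => hnn _ (hmem t))
      ⟨t, Ioc_subset_Icc_self ht, by rw [htz]; exact hcon⟩
    exact (hφ.continuous.comp (continuous_circleMap z1 r)).continuousOn
  have h3 : 0 < (2 * π)⁻¹ • ∫ t in (0:ℝ)..2 * π, φ (circleMap z1 r t) := smul_pos (by positivity) h2
  linarith

end MF

namespace MF

open Set Filter Topology Complex Metric
open scoped Manifold ContDiff


def dd (φ : ℂ → ℝ) (z : ℂ) : ℂ := ((fderiv ℝ φ z 1 : ℝ) - I * (fderiv ℝ φ z I : ℝ)) / 2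

lemma dd_contDiff {φ : ℂ → ℝ} (hφ : ContDiff ℝ 2 φ) : ContDiff ℝ 1 (dd φ) := by
  have h : ∀ v : ℂ, ContDiff ℝ 1 (fun z => ((fderiv ℝ φ z v : ℝ) : ℂ)) := fun v =>
    ofRealCLM.contDiff.comp (contDiffOn_univ.1 (diff_fderiv_apply isOpen_univ hφ.contDiffOn v))
  exact ((h 1).sub (contDiff_const.mul (h I))).div_const 2

lemma dbar_dd {φ : ℂ → ℝ} (hφ : ContDiff ℝ 2 φ) (z : ℂ) : dbar (dd φ) z = (lapl φ z : ℂ) / 4 := by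
  have h1 : DifferentiableAt ℝ (fderiv ℝ φ) z :=
    (hφ.contDiffAt.fderiv_right (m := 1) (by norm_num)).differentiableAt one_ne_zero
  have h : ∀ v : ℂ, HasFDerivAt (fun w => fderiv ℝ φ w v) ((fderiv ℝ (fderiv ℝ φ) z).flip v) z := by
    intro v
    have := h1.hasFDerivAt.clm_apply (hasFDerivAt_const v z)
    exact this.congr_fderiv (by ext x; simp)
  have hc : ∀ v : ℂ, HasFDerivAt (fun w => ((fderiv ℝ φ w v : ℝ) : ℂ)) (ofRealCLM.comp ((fderiv ℝ (fderiv ℝ φ) z).flip v)) z :=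
    fun v => ofRealCLM.hasFDerivAt.comp z (h v)
  have e : HasFDerivAt (dd φ) ((2:ℂ)⁻¹ • ((ofRealCLM.comp ((fderiv ℝ (fderiv ℝ φ) z).flip 1)) - I • (ofRealCLM.comp ((fderiv ℝ (fderiv ℝ φ) z).flip I)))) z := by
    have := ((hc 1).sub ((hc I).const_mul I)).const_mul (2:ℂ)⁻¹
    refine this.congr_of_eventuallyEq (Eventually.of_forall fun w => ?_)
    simp only [dd, Pi.sub_apply]; ring
  have hs : fderiv ℝ (fderiv ℝ φ) z 1 I = fderiv ℝ (fderiv ℝ φ) z I 1 :=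
    (hφ.contDiffAt.isSymmSndFDerivAt (by simp)) 1 I
  rw [dbar, e.fderiv, lapl_eq2 hφ.contDiffAt]
  simp [hs]
  linear_combination (-(1/4:ℂ)) * (fderiv ℝ (fderiv ℝ φ) z I I : ℂ) * I_sq

lemma fderiv_dd (φ : ℂ → ℝ) (z v : ℂ) : fderiv ℝ φ z v = 2 * (dd φ z * v).re := by
  rw [clm_real_apply]
  simp [dd, Complex.div_re, Complex.div_im, Complex.normSq]
  ring

lemma norm_fderiv_le_dd (φ : ℂ → ℝ) (z : ℂ) : ‖fderiv ℝ φ z‖ ≤ 2 * ‖dd φ z‖ := by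
  refine ContinuousLinearMap.opNorm_le_bound _ (by positivity) fun v => ?_
  rw [fderiv_dd, Real.norm_eq_abs, abs_mul, abs_two, mul_assoc, ← norm_mul]
  exact mul_le_mul_of_nonneg_left (abs_re_le_norm _) (by norm_num)

lemma pow_bound {ψ : ℂ → ℝ} (hψ : Differentiable ℝ ψ) (h0 : ψ 0 = 0) {R A : ℝ} (hA : 0 ≤ A) {m : ℕ}
    (h : ∀ z ∈ ball (0:ℂ) R, ‖dd ψ z‖ ≤ A * ‖z‖ ^ m) : ∀ z ∈ ball (0:ℂ) R, |ψ z| ≤ 2 * A * ‖z‖ ^ (m + 1) := by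
  intro z hz
  have hz' : ‖z‖ < R := by simpa using hz
  have h1 : ∀ x ∈ closedBall (0:ℂ) ‖z‖, ‖fderiv ℝ ψ x‖ ≤ 2 * (A * ‖z‖ ^ m) := by
    intro x hx
    have hx' : ‖x‖ ≤ ‖z‖ := by simpa using hx
    refine (norm_fderiv_le_dd ψ x).trans (mul_le_mul_of_nonneg_left ((h x (by simpa using hx'.trans_lt hz')).trans ?_) (by norm_num))
    gcongr
  have h2 := (convex_closedBall (0:ℂ) ‖z‖).norm_image_sub_le_of_norm_fderiv_le (𝕜 := ℝ) (fun x _ => hψ x) h1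
    (mem_closedBall_self (norm_nonneg z)) (by simp : z ∈ closedBall (0:ℂ) ‖z‖)
  rw [h0, sub_zero, sub_zero, Real.norm_eq_abs] at h2
  calc _ ≤ _ := h2
    _ = _ := by ring

lemma exists_inv_bound : ∃ C : ℝ, 0 < C ∧ ∀ z : ℂ, ‖z‖ ≤ 1 →
    Integrable (fun w => (ball (0:ℂ) 2).indicator (fun w => ‖w - z‖⁻¹) w) ∧
    ∫ w, (ball (0:ℂ) 2).indicator (fun w => ‖w - z‖⁻¹) w ≤ C := by
  have hli : IntegrableOn (fun w : ℂ => ‖w‖⁻¹) (closedBall 0 3) := by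
    have := (locInt_inv.integrableOn_isCompact (isCompact_closedBall 0 3)).norm
    simpa [IntegrableOn] using this
  have hli2 : Integrable (fun w => (closedBall (0:ℂ) 3).indicator (fun w => ‖w‖⁻¹) w) :=
    (integrable_indicator_iff measurableSet_closedBall).2 hli
  refine ⟨(∫ w, (closedBall (0:ℂ) 3).indicator (fun w => ‖w‖⁻¹) w) + 1, ?_, fun z hz => ?_⟩
  · have : 0 ≤ ∫ w, (closedBall (0:ℂ) 3).indicator (fun w => ‖w‖⁻¹) w :=
      integral_nonneg fun w => indicator_nonneg (fun _ _ => by positivity) _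
    linarith
  have hsh := hli2.comp_sub_right z
  have hle : ∀ w, (ball (0:ℂ) 2).indicator (fun w => ‖w - z‖⁻¹) w ≤ (closedBall (0:ℂ) 3).indicator (fun w => ‖w‖⁻¹) (w - z) := by
    intro w
    by_cases hw : w ∈ ball (0:ℂ) 2
    · have h3 : w - z ∈ closedBall (0:ℂ) 3 := by
        simp only [mem_ball, dist_zero_right, mem_closedBall] at *
        exact (norm_sub_le _ _).trans (by linarith)
      rw [indicator_of_mem hw, indicator_of_mem h3]
    · rw [indicator_of_notMem hw]
      exact indicator_nonneg (fun _ _ => by positivity) _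
  have hIntg : Integrable (fun w => (ball (0:ℂ) 2).indicator (fun w => ‖w - z‖⁻¹) w) := by
    refine hsh.mono' ?_ (ae_of_all _ fun w => ?_)
    · exact ((by fun_prop : Measurable fun w : ℂ => ‖w - z‖⁻¹).indicator measurableSet_ball).aestronglyMeasurable
    · rw [Real.norm_of_nonneg (indicator_nonneg (fun _ _ => by positivity) _)]
      exact hle w
  refine ⟨hIntg, ?_⟩
  have := integral_mono hIntg hsh hle
  rw [integral_sub_right_eq_self (fun w => (closedBall (0:ℂ) 3).indicator (fun w => ‖w‖⁻¹) w) z] at this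
  linarith

lemma T_step {D : ℂ → ℂ} (hD : Continuous D) (hDs : ∀ w ∉ ball (0:ℂ) 2, D w = 0) {B R C : ℝ} (hB : 0 ≤ B) (hR : 0 < R)
    {n : ℕ} (hb : ∀ w, ‖D w‖ ≤ B * (‖w‖ / R) ^ (n + 1)) {z : ℂ}
    (hz : Integrable (fun w => (ball (0:ℂ) 2).indicator (fun w => ‖w - z‖⁻¹) w))
    (hzC : ∫ w, (ball (0:ℂ) 2).indicator (fun w => ‖w - z‖⁻¹) w ≤ C) :
    (∫ w, D w / (w ^ n * (w - z))) = (∫ w, D w / w ^ (n+1)) + z * ∫ w, D w / (w ^ (n+1) * (w - z)) ∧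
    ‖∫ w, D w / (w ^ (n+1) * (w - z))‖ ≤ B / R ^ (n+1) * C := by
  have hq : ∀ w, ‖D w / w ^ (n+1)‖ ≤ B / R ^ (n+1) * (ball (0:ℂ) 2).indicator (fun _ => 1) w := by
    intro w
    by_cases hw : w ∈ ball (0:ℂ) 2
    · rw [indicator_of_mem hw, mul_one, norm_div, norm_pow]
      by_cases h0 : w = 0
      · subst h0; simp; positivity
      · rw [div_le_iff₀ (pow_pos (norm_pos_iff.2 h0) _)]
        refine (hb w).trans (le_of_eq ?_)
        rw [div_pow]; ring
    · simp [hDs w hw, hw]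
  have i0 : Integrable (fun w => D w / w ^ (n+1)) := by
    refine Integrable.mono' (g := fun w => B / R ^ (n+1) * (ball (0:ℂ) 2).indicator (fun _ => (1:ℝ)) w) ?_ ?_ (ae_of_all _ hq)
    · exact ((integrable_indicator_iff measurableSet_ball).2 (integrableOn_const measure_ball_lt_top.ne)).const_mul _
    · exact (hD.measurable.div (by fun_prop)).aestronglyMeasurable
  have hq1 : ∀ w, ‖D w / (w ^ (n+1) * (w - z))‖ ≤ B / R ^ (n+1) * (ball (0:ℂ) 2).indicator (fun w => ‖w - z‖⁻¹) w := by
    intro w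
    have := hq w
    rw [← div_div, norm_div]
    by_cases hw : w ∈ ball (0:ℂ) 2
    · rw [indicator_of_mem hw] at *
      rw [mul_one] at this
      exact mul_le_mul_of_nonneg_right this (by positivity)
    · simp [hDs w hw, hw]
  have ig := hz.const_mul (B / R ^ (n+1))
  have i1 : Integrable (fun w => D w / (w ^ (n+1) * (w - z))) :=
    Integrable.mono' ig (hD.measurable.div (by fun_prop)).aestronglyMeasurable (ae_of_all _ hq1)
  constructor
  · rw [← integral_const_mul, ← integral_add i0 (i1.const_mul z)]
    refine integral_congr_ae ?_
    have h1 : ∀ᵐ w : ℂ, w ≠ 0 := by simp [ae_iff, measure_singleton]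
    have h2 : ∀ᵐ w : ℂ, w ≠ z := by simp [ae_iff, measure_singleton]
    filter_upwards [h1, h2] with w h1 h2
    have h3 : w - z ≠ 0 := sub_ne_zero.2 h2
    field_simp
    ring
  · refine (norm_integral_le_of_norm_le ig (ae_of_all _ hq1)).trans ?_
    rw [integral_const_mul]
    exact mul_le_mul_of_nonneg_left hzC (by positivity)

theorem local0 {φ : ℂ → ℝ} (hφ : ContDiff ℝ 2 φ) {K R0 : ℝ} (hR0 : 0 < R0) (hK0 : 0 ≤ K)
    (hK : ∀ z ∈ ball (0:ℂ) R0, |lapl φ z| ≤ K * |φ z|) (h0 : φ 0 = 0) :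
    (∀ᶠ z in 𝓝 (0:ℂ), φ z = 0) ∨ ∃ n : ℕ, ∃ c : ℂ, c ≠ 0 ∧ ∃ M r : ℝ, 0 ≤ M ∧ 0 < r ∧ ∀ z ∈ ball (0:ℂ) r,
      ‖dd φ z - c * z ^ n‖ ≤ M * ‖z‖ ^ (n + 1) ∧
      |φ z - (2 * c / (n + 1) * z ^ (n + 1)).re| ≤ M * ‖z‖ ^ (n + 2) := by
  obtain ⟨C, hC, hCb⟩ := exists_inv_bound
  obtain ⟨R, hR, hRR, hR1, hRK⟩ : ∃ R : ℝ, 0 < R ∧ R ≤ R0 ∧ R ≤ 1 ∧ K * C * R ≤ 1 := by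
    refine ⟨min R0 (1 / (K * C + 1)), lt_min hR0 (by positivity), min_le_left _ _,
      (min_le_right _ _).trans ?_, ?_⟩
    · rw [div_le_one (by positivity)]
      have : 0 ≤ K * C := by positivity
      linarith
    · have h1 : min R0 (1 / (K * C + 1)) ≤ 1 / (K * C + 1) := min_le_right _ _
      have h2 : K * C * (1 / (K * C + 1)) ≤ 1 := by
        rw [mul_one_div, div_le_one (by positivity)]; linarith
      exact (mul_le_mul_of_nonneg_left h1 (by positivity)).trans h2
  obtain ⟨χ, hχ, hχs, hχt, -, -, hχ1⟩ := exists_bump (isCompact_closedBall (0:ℂ) R) (isOpen_ball (x := (0:ℂ)) (ε := 2))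
    (closedBall_subset_ball (by linarith))
  have hfC := dd_contDiff hφ
  set F : ℂ → ℂ := fun z => (χ z : ℂ) * dd φ z with hF
  have hFC : ContDiff ℝ 1 F := (ofRealCLM.contDiff.comp (hχ.of_le (by exact_mod_cast le_top))).mul hfC
  have hFs : HasCompactSupport F := (hχs.comp_left (g := fun x : ℝ => (x:ℂ)) (by simp)).mul_right
  have hFt : tsupport F ⊆ ball (0:ℂ) 2 := by
    refine (closure_mono ?_).trans hχt
    intro z hz hz0
    exact hz (by simp [hF, hz0])
  have hdc : ∀ v, Continuous fun z => fderiv ℝ F z v := fun v => (hFC.continuous_fderiv one_ne_zero).clm_apply continuous_const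
  set D : ℂ → ℂ := dbar F with hDdef
  have hD : Continuous D := by
    have := ((hdc 1).add ((continuous_const (y := I)).mul (hdc I))).div_const (2:ℂ)
    exact this
  have hDs : ∀ w ∉ ball (0:ℂ) 2, D w = 0 := by
    intro w hw
    have h1 : fderiv ℝ F w = 0 := by
      by_contra h
      exact hw (hFt (support_fderiv_subset ℝ h))
    simp [hDdef, dbar, h1]
  have hFe : ∀ z ∈ closedBall (0:ℂ) R, F =ᶠ[𝓝 z] dd φ := by
    intro z hz
    filter_upwards [eventually_nhdsSet_iff_forall.1 hχ1 z hz] with w hw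
    simp [hF, hw]
  have hFz : ∀ z ∈ closedBall (0:ℂ) R, F z = dd φ z := fun z hz => (hFe z hz).self_of_nhds
  have hDl : ∀ z ∈ ball (0:ℂ) R, ‖D z‖ ≤ K / 4 * |φ z| := by
    intro z hz
    have h1 : D z = (lapl φ z : ℂ) / 4 := by
      rw [← dbar_dd hφ, hDdef, dbar, dbar, (hFe z (ball_subset_closedBall hz)).fderiv_eq]
    rw [h1, norm_div, Complex.norm_real, Real.norm_eq_abs]
    have := hK z (ball_subset_ball hRR hz)
    norm_num
    linarith
  have hP : ∀ z, F z = -(1 / π) * ∫ w, D w / (w - z) := by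
    intro z
    have h1 := cauchy_pompeiu (b := fun w => F (w + z)) (hFC.comp (by fun_prop))
      (hFs.comp_homeomorph (Homeomorph.addRight (z:ℂ)))
    have h2 : ∀ w, dbar (fun w => F (w + z)) w = D (w + z) := fun w => by
      rw [hDdef]; unfold dbar; rw [fderiv_comp_add_right]
    have h3 : ∫ w, dbar (fun w => F (w + z)) w / w = ∫ ζ, D ζ / (ζ - z) := by
      rw [← integral_add_right_eq_self (fun ζ => D ζ / (ζ - z)) (z:ℂ)]
      congr 1; ext w; rw [h2, add_sub_cancel_right]
    rw [h3, zero_add] at h1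
    rw [h1]
    have : (π : ℂ) ≠ 0 := by exact_mod_cast Real.pi_ne_zero
    field_simp
  -- constants
  obtain ⟨M0, hM0⟩ := hD.bounded_above_of_compact_support (HasCompactSupport.of_support_subset_isCompact (isCompact_closedBall (0:ℂ) 2)
    (fun w hw => by
      by_contra h
      exact hw (hDs w fun h' => h (ball_subset_closedBall h'))))
  have hM0' : 0 ≤ M0 := (norm_nonneg _).trans (hM0 0)
  obtain ⟨L, hL⟩ := (isCompact_closedBall (0:ℂ) R).exists_bound_of_continuousOn hfC.continuous.continuousOn
  have hL0 : 0 ≤ L := (norm_nonneg _).trans (hL 0 (by simp [hR.le]))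
  have hdiff : Differentiable ℝ φ := hφ.differentiable (by norm_num)
  have hlip : ∀ z ∈ ball (0:ℂ) R, |φ z| ≤ 2 * L * ‖z‖ ^ (0 + 1) :=
    pow_bound hdiff h0 hL0 (fun z hz => by simpa using hL z (ball_subset_closedBall hz))
  set B : ℝ := M0 + K * L with hBdef
  have hB : 0 ≤ B := by positivity
  have hout : ∀ n : ℕ, ∀ w ∉ ball (0:ℂ) R, ‖D w‖ ≤ B * (‖w‖ / R) ^ n := by
    intro n w hw
    have h1 : 1 ≤ ‖w‖ / R := by
      rw [le_div_iff₀ hR]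
      simp at hw; linarith
    have h2 : M0 ≤ B := by rw [hBdef]; have : 0 ≤ K * L := by positivity
                           linarith
    calc ‖D w‖ ≤ B * 1 := by rw [mul_one]; exact (hM0 w).trans h2
      _ ≤ _ := mul_le_mul_of_nonneg_left (one_le_pow₀ h1) hB
  let Q : ℕ → Prop := fun n => (∀ w, ‖D w‖ ≤ B * (‖w‖ / R) ^ (n + 1)) ∧
    ∀ z : ℂ, ‖z‖ ≤ 1 → F z = -(1 / π) * z ^ n * ∫ w, D w / (w ^ n * (w - z))
  have hpi : ‖(-(1 / π) : ℂ)‖ ≤ 1 := by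
    have : ((-(1 / π) : ℝ) : ℂ) = (-(1 / π) : ℂ) := by push_cast; rfl
    rw [← this, Complex.norm_real, norm_neg, Real.norm_of_nonneg (by positivity), div_le_one Real.pi_pos]
    linarith [Real.two_le_pi]
  have hQ0 : Q 0 := by
    refine ⟨fun w => ?_, fun z _ => by simpa using hP z⟩
    by_cases hw : w ∈ ball (0:ℂ) R
    · refine (hDl w hw).trans ?_
      have h1 := mul_le_mul_of_nonneg_left (hlip w hw) (by positivity : 0 ≤ K / 4)
      refine h1.trans ?_
      rw [zero_add, pow_one, pow_one]
      have h2 : ‖w‖ ≤ ‖w‖ / R := by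
        rw [le_div_iff₀ hR]; exact mul_le_of_le_one_right (norm_nonneg _) hR1
      have h3 : K / 4 * (2 * L * ‖w‖) = (K * L / 2) * ‖w‖ := by ring
      rw [h3]
      refine mul_le_mul ?_ h2 (norm_nonneg _) hB
      rw [hBdef]
      have : 0 ≤ K * L := by positivity
      linarith
    · exact hout _ w hw
  have hstep : ∀ n, Q n → ∀ z : ℂ, ‖z‖ ≤ 1 → ∃ S : ℂ, ‖S‖ ≤ B / R ^ (n+1) * C ∧
      F z = (-(1 / π) * ∫ w, D w / w ^ (n+1)) * z ^ n + z ^ (n+1) * S ∧ S = -(1 / π) * ∫ w, D w / (w ^ (n+1) * (w - z)) := by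
    intro n hQ z hz
    obtain ⟨h1, h2⟩ := T_step hD hDs hB hR hQ.1 (hCb z hz).1 (hCb z hz).2
    refine ⟨_, ?_, ?_, rfl⟩
    · rw [norm_mul]
      calc _ ≤ 1 * (B / R ^ (n+1) * C) := mul_le_mul hpi h2 (norm_nonneg _) zero_le_one
        _ = _ := one_mul _
    · rw [hQ.2 z hz, h1]; ring
  by_cases hall : ∀ n, Q n → (-(1 / π) * ∫ w, D w / w ^ (n+1) : ℂ) = 0
  · left
    have hphi : ∀ n, Q n → ∀ z ∈ ball (0:ℂ) R, |φ z| ≤ 2 * (B / R ^ (n+1) * C) * ‖z‖ ^ (n + 1 + 1) := by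
      intro n hQ
      refine pow_bound hdiff h0 (by positivity) fun z hz => ?_
      have hz1 : ‖z‖ ≤ 1 := by simp at hz; linarith
      obtain ⟨S, hS, hS2, -⟩ := hstep n hQ z hz1
      rw [hall n hQ, zero_mul, zero_add] at hS2
      rw [← hFz z (ball_subset_closedBall hz), hS2, norm_mul, norm_pow, mul_comm]
      exact mul_le_mul_of_nonneg_right hS (by positivity)
    have hQall : ∀ n, Q n := by
      intro n
      induction n with
      | zero => exact hQ0
      | succ n ih =>
        refine ⟨fun w => ?_, fun z hz => ?_⟩
        · by_cases hw : w ∈ ball (0:ℂ) R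
          · refine (hDl w hw).trans ?_
            refine (mul_le_mul_of_nonneg_left (hphi n ih w hw) (by positivity : 0 ≤ K / 4)).trans ?_
            have e : K / 4 * (2 * (B / R ^ (n+1) * C) * ‖w‖ ^ (n + 1 + 1)) = (K * C * R) / 2 * (B * (‖w‖ / R) ^ (n + 1 + 1)) := by
              rw [div_pow]; field_simp; ring
            rw [e]
            refine mul_le_of_le_one_left (by positivity) (by linarith)
          · exact hout _ w hw
        · obtain ⟨S, -, hS2, hS3⟩ := hstep n ih z hz
          rw [hall n ih, zero_mul, zero_add] at hS2
          rw [hS2, hS3]; ring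
    filter_upwards [ball_mem_nhds (0:ℂ) hR] with z hz
    have hzR : ‖z‖ / R < 1 := by
      rw [div_lt_one hR]; simpa using hz
    have h1 : ∀ n : ℕ, |φ z| ≤ 2 * B * C * ‖z‖ * (‖z‖ / R) ^ (n + 1) := by
      intro n
      refine (hphi n (hQall n) z hz).trans (le_of_eq ?_)
      rw [div_pow]; ring
    have h2 : Tendsto (fun n : ℕ => 2 * B * C * ‖z‖ * (‖z‖ / R) ^ (n + 1)) atTop (𝓝 (2 * B * C * ‖z‖ * 0)) :=
      ((tendsto_pow_atTop_nhds_zero_of_lt_one (by positivity) hzR).comp (tendsto_add_atTop_nat 1)).const_mul _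
    rw [mul_zero] at h2
    exact abs_nonpos_iff.1 (ge_of_tendsto' h2 h1)
  · right
    push Not at hall
    obtain ⟨n, hQ, hc⟩ := hall
    set c : ℂ := -(1 / π) * ∫ w, D w / w ^ (n+1) with hcdef
    have hA : ∀ z ∈ ball (0:ℂ) R, ‖dd φ z - c * z ^ n‖ ≤ (B / R ^ (n+1) * C) * ‖z‖ ^ (n + 1) := by
      intro z hz
      have hz1 : ‖z‖ ≤ 1 := by simp at hz; linarith
      obtain ⟨S, hS, hS2, -⟩ := hstep n hQ z hz1
      rw [← hFz z (ball_subset_closedBall hz), hS2, add_sub_cancel_left, norm_mul, norm_pow, mul_comm]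
      exact mul_le_mul_of_nonneg_right hS (by positivity)
    set ψ : ℂ → ℝ := fun z => φ z - (2 * c / (n + 1) * z ^ (n + 1)).re with hψ
    have hn : ((n : ℂ) + 1) ≠ 0 := by exact_mod_cast Nat.succ_ne_zero n
    have hder : ∀ z, HasFDerivAt (fun z : ℂ => (2 * c / (n + 1) * z ^ (n + 1)).re)
        (reCLM.comp ((ContinuousLinearMap.toSpanSingleton ℂ (2 * c * z ^ n)).restrictScalars ℝ)) z := by
      intro z
      have h1 : HasDerivAt (fun z : ℂ => 2 * c / (n + 1) * z ^ (n + 1)) (2 * c * z ^ n) z := by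
        have := (hasDerivAt_pow (n + 1) z).const_mul (2 * c / (n + 1))
        refine this.congr_deriv ?_
        push_cast
        field_simp
      exact reCLM.hasFDerivAt.comp z (hasFDerivAt_real_of_complex h1)
    have hdψ : ∀ z, dd ψ z = dd φ z - c * z ^ n := by
      intro z
      have e1 : fderiv ℝ ψ z = _ := ((hdiff z).hasFDerivAt.sub (hder z)).fderiv
      simp only [dd]
      rw [e1]
      apply Complex.ext <;> simp [Complex.div_re, Complex.div_im, Complex.normSq] <;> ring
    have hψd : Differentiable ℝ ψ := fun z => ((hdiff z).hasFDerivAt.sub (hder z)).differentiableAt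
    have hψ0 : ψ 0 = 0 := by simp [hψ, h0]
    have hB2 := pow_bound hψd hψ0 (R := R) (A := B / R ^ (n+1) * C) (m := n + 1) (by positivity)
      (fun z hz => by rw [hdψ]; exact hA z hz)
    refine ⟨n, c, hc, 2 * (B / R ^ (n+1) * C), R, by positivity, hR, fun z hz => ⟨(hA z hz).trans ?_, hB2 z hz⟩⟩
    have : 0 ≤ (B / R ^ (n+1) * C) * ‖z‖ ^ (n + 1) := by positivity
    linarith

end MF

namespace MF

open Set Filter Topology Complex Metric
open scoped Manifold ContDiff


lemma lapl_shift (φ : ℂ → ℝ) (a z : ℂ) : lapl (fun w => φ (w + a)) z = lapl φ (z + a) := by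
  have h : ∀ v : ℂ, (fun w => fderiv ℝ (fun w => φ (w + a)) w v) = fun w => (fun w => fderiv ℝ φ w v) (w + a) := by
    intro v; ext w; rw [fderiv_comp_add_right]
  simp only [lapl]
  rw [h, h]
  have h2 : ∀ v : ℂ, fderiv ℝ (fun w => (fun w => fderiv ℝ φ w v) (w + a)) z = fderiv ℝ (fun w => fderiv ℝ φ w v) (z + a) :=
    fun v => by rw [fderiv_comp_add_right (f := fun w => fderiv ℝ φ w v)]
  rw [h2, h2]

lemma dd_shift (φ : ℂ → ℝ) (a z : ℂ) : dd (fun w => φ (w + a)) z = dd φ (z + a) := by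
  simp only [dd]; rw [fderiv_comp_add_right]

theorem ucont {φ : ℂ → ℝ} (hφ : ContDiff ℝ 2 φ) {Ω : Set ℂ} (hΩ : IsOpen Ω) (hΩc : IsPreconnected Ω) {K : ℝ} (hK0 : 0 ≤ K)
    (hK : ∀ z ∈ Ω, |lapl φ z| ≤ K * |φ z|) {z0 : ℂ} (hz0 : z0 ∈ Ω) (h0 : ∀ᶠ z in 𝓝 z0, φ z = 0) :
    ∀ z ∈ Ω, φ z = 0 := by
  set S : Set ℂ := {z | ∀ᶠ w in 𝓝 z, φ w = 0} with hS
  have hSo : IsOpen S := isOpen_setOf_eventually_nhds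
  have hsub : Ω ⊆ S := by
    refine hΩc.subset_of_closure_inter_subset hSo ⟨z0, hz0, h0⟩ ?_
    rintro z1 ⟨hz1, hz1Ω⟩
    have hz1' : φ z1 = 0 := by
      have hcl : IsClosed {z | φ z = 0} := isClosed_eq hφ.continuous continuous_const
      exact closure_minimal (fun z (hz : z ∈ S) => hz.self_of_nhds) hcl hz1
    obtain ⟨R0, hR0, hR0s⟩ := Metric.isOpen_iff.1 hΩ z1 hz1Ω
    have hsh : ContDiff ℝ 2 fun w => φ (w + z1) := hφ.comp (by fun_prop)
    rcases local0 hsh hR0 hK0 (fun z hz => by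
        rw [lapl_shift]; exact hK _ (hR0s (by simpa using hz))) (by simpa using hz1') with h | ⟨n, c, hc, M, r, hM, hr, h⟩
    · have h2 : Tendsto (fun z => z - z1) (𝓝 z1) (𝓝 0) := by
        have : Continuous fun z : ℂ => z - z1 := by fun_prop
        simpa using this.tendsto z1
      filter_upwards [h2.eventually h] with z hz
      simpa using hz
    · exfalso
      have hcn : 0 < ‖c‖ := norm_pos_iff.2 hc
      set ρ := min r (‖c‖ / (2 * (M + 1))) with hρ
      have hρ0 : 0 < ρ := lt_min hr (by positivity)
      obtain ⟨y, hyb, hyS⟩ := mem_closure_iff.1 hz1 (ball z1 ρ) isOpen_ball (mem_ball_self hρ0)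
      obtain ⟨y, ⟨hyb, hyS⟩, hy1⟩ : ∃ y, y ∈ ball z1 ρ ∩ S ∧ y ≠ z1 := by
        by_cases hyz : y = z1
        · have hO : IsOpen (ball z1 ρ ∩ S) := isOpen_ball.inter hSo
          obtain ⟨ε, hε, hεs⟩ := Metric.isOpen_iff.1 hO y ⟨hyb, hyS⟩
          refine ⟨y + (ε / 2 : ℝ), hεs ?_, ?_⟩
          · rw [mem_ball, dist_eq_norm, add_sub_cancel_left, Complex.norm_real, Real.norm_of_nonneg (by positivity)]
            linarith
          · rw [hyz]; intro h
            have h' : ((ε / 2 : ℝ) : ℂ) = 0 := by simpa using h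
            have : ε / 2 = 0 := by exact_mod_cast h'
            linarith
        · exact ⟨y, ⟨hyb, hyS⟩, hyz⟩
      have hynorm : ‖y - z1‖ < ρ := by rwa [mem_ball, dist_eq_norm] at hyb
      have h3 := (h (y - z1) (by simpa using hynorm.trans_le (min_le_left _ _))).1
      have hd : dd (fun w => φ (w + z1)) (y - z1) = 0 := by
        rw [dd_shift, sub_add_cancel]
        have : φ =ᶠ[𝓝 y] fun _ => 0 := hyS
        simp [dd, this.fderiv_eq]
      rw [hd, zero_sub, norm_neg, norm_mul, norm_pow, pow_succ, ← mul_assoc, mul_right_comm] at h3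
      have hp : 0 < ‖y - z1‖ := norm_pos_iff.2 (sub_ne_zero.2 hy1)
      have h4 : ‖c‖ ≤ M * ‖y - z1‖ := le_of_mul_le_mul_right h3 (pow_pos hp n)
      have h5 : ‖y - z1‖ < ‖c‖ / (2 * (M + 1)) := hynorm.trans_le (min_le_right _ _)
      rw [lt_div_iff₀ (by positivity)] at h5
      nlinarith
  intro z hz
  exact (hsub hz).self_of_nhds

lemma ext_conn : IsPreconnected (ball (0:ℂ) 1)ᶜ := by
  have h1 : IsPreconnected (sphere (0:ℂ) 1) := isPreconnected_sphere (by simp [Complex.rank_real_complex]) _ _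
  have h2 : IsPreconnected (Ici (1:ℝ)) := isPreconnected_Ici
  have h3 := (h1.prod h2).image (fun p : ℂ × ℝ => (p.2 : ℂ) * p.1) (by fun_prop)
  convert h3 using 1
  ext z
  simp only [mem_compl_iff, mem_ball, dist_zero_right, not_lt, mem_image, mem_prod, mem_sphere, mem_Ici, Prod.exists]
  constructor
  · intro hz
    have : (‖z‖ : ℂ) ≠ 0 := by
      have : ‖z‖ ≠ 0 := by linarith
      exact_mod_cast this
    refine ⟨z / ‖z‖, ‖z‖, ⟨?_, hz⟩, by field_simp⟩
    rw [norm_div, Complex.norm_real, norm_norm, div_self (by linarith)]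
  · rintro ⟨a, b, ⟨ha, hb⟩, rfl⟩
    rw [norm_mul, ha, mul_one, Complex.norm_real]
    exact hb.trans (le_abs_self b)

def hull (C : Set ℂ) : Set ℂ := (connectedComponentIn Cᶜ 2)ᶜ

lemma hull_open {C : Set ℂ} (hC : IsOpen C) : IsOpen (hull C) := (closed_component hC.isClosed_compl _).isOpen_compl

lemma subset_hull (C : Set ℂ) : C ⊆ hull C := fun _ hz hn => connectedComponentIn_subset _ _ hn hz

lemma two_notMem : (2:ℂ) ∈ (ball (0:ℂ) 1)ᶜ := by simp

lemma hull_subset_ball {C : Set ℂ} (hC : C ⊆ ball (0:ℂ) 1) : hull C ⊆ ball (0:ℂ) 1 := by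
  have := ext_conn.subset_connectedComponentIn two_notMem (compl_subset_compl.2 hC)
  rw [hull, compl_subset_comm]; exact this

lemma comp_touch {D : Set ℂ} (hD : IsOpen D) (hDn : D.Nonempty) {x : ℂ} (hx : x ∉ D) :
    (connectedComponentIn Dᶜ x ∩ closure D).Nonempty := by
  by_contra hne
  rw [not_nonempty_iff_eq_empty] at hne
  set H := connectedComponentIn Dᶜ x with hH
  have hHc : IsClosed H := closed_component hD.isClosed_compl _
  have hxH : x ∈ H := mem_connectedComponentIn hx
  have hHo : IsOpen H := by
    rw [Metric.isOpen_iff]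
    intro y hy
    have hyn : y ∉ closure D := fun h => by
      have : y ∈ H ∩ closure D := ⟨hy, h⟩
      rw [hne] at this; exact this
    obtain ⟨ρ, hρ, hρs⟩ := Metric.isOpen_iff.1 isClosed_closure.isOpen_compl y hyn
    refine ⟨ρ, hρ, ?_⟩
    have := (convex_ball y ρ).isPreconnected.subset_connectedComponentIn (mem_ball_self hρ)
      (hρs.trans (compl_subset_compl.2 subset_closure))
    rwa [← connectedComponentIn_eq hy] at this
  have := IsClopen.eq_univ ⟨hHc, hHo⟩ ⟨x, hxH⟩
  obtain ⟨d, hd⟩ := hDn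
  exact connectedComponentIn_subset Dᶜ x (by rw [← hH, this]; trivial) hd

lemma comp_union {D : Set ℂ} (hD : IsOpen D) (hDn : D.Nonempty) (hDc : IsPreconnected D) {x : ℂ} (hx : x ∉ D) :
    IsPreconnected (connectedComponentIn Dᶜ x ∪ D) := by
  obtain ⟨p, hp, hpD⟩ := comp_touch hD hDn hx
  have h1 : IsPreconnected (insert p D) :=
    hDc.subset_closure (subset_insert _ _) (insert_subset hpD subset_closure)
  have h2 := isPreconnected_connectedComponentIn.union p hp (mem_insert p D) h1
  rwa [union_insert, insert_eq_of_mem (mem_union_left D hp)] at h2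

lemma hull_preconnected {D : Set ℂ} (hD : IsOpen D) (hDn : D.Nonempty) (hDc : IsPreconnected D) :
    IsPreconnected (hull D) := by
  obtain ⟨d, hd⟩ := hDn
  refine isPreconnected_of_forall d fun y hy => ?_
  by_cases hyD : y ∈ D
  · exact ⟨D, subset_hull D, hd, hyD, hDc⟩
  · refine ⟨_, union_subset ?_ (subset_hull D), Or.inr hd, Or.inl (mem_connectedComponentIn hyD), comp_union hD ⟨d, hd⟩ hDc hyD⟩
    intro w hw hw2
    apply hy
    rw [connectedComponentIn_eq hw2, ← connectedComponentIn_eq hw]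
    exact mem_connectedComponentIn hyD

lemma hull_nested {D D' : Set ℂ} (hD : IsOpen D) (hDn : D.Nonempty) (hDc : IsPreconnected D) (hDb : D ⊆ ball (0:ℂ) 1)
    (hDc' : IsPreconnected D') (hdis : Disjoint D D')
    {x : ℂ} (hx : x ∈ D') (hxh : x ∈ hull D) : hull D' ⊆ hull D ∧ Disjoint D (hull D') := by
  have h2 : (2:ℂ) ∉ D := fun h => two_notMem (hDb h)
  have hsub : D' ⊆ hull D := by
    intro y hy hy2
    have h3 := hDc'.subset_connectedComponentIn hy (subset_compl_iff_disjoint_left.2 hdis)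
    rw [← connectedComponentIn_eq hy2] at h3
    exact hxh (h3 hx)
  have hU : connectedComponentIn Dᶜ 2 ∪ D ⊆ connectedComponentIn D'ᶜ 2 := by
    refine (comp_union hD hDn hDc h2).subset_connectedComponentIn (Or.inl (mem_connectedComponentIn h2)) ?_
    rintro z (hz | hz) hz'
    · exact hsub hz' hz
    · exact hdis.le_bot ⟨hz, hz'⟩
  refine ⟨compl_subset_compl.2 (subset_union_left.trans hU), ?_⟩
  rw [Set.disjoint_left]
  intro z hz hzh
  exact hzh (hU (Or.inr hz))

lemma hull_disjoint {D D' : Set ℂ} (hD : IsOpen D) (hDn : D.Nonempty) (hDc : IsPreconnected D)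
    (h1 : Disjoint D' (hull D)) (h2 : Disjoint D (hull D')) : Disjoint (hull D) (hull D') := by
  rw [Set.disjoint_left]
  intro x hx hx'
  have hxD : x ∉ D := fun h => h2.le_bot ⟨h, hx'⟩
  obtain ⟨d, hd⟩ := hDn
  have hdX : d ∈ connectedComponentIn D'ᶜ 2 := by
    by_contra h; exact h2.le_bot ⟨hd, h⟩
  have h3 : connectedComponentIn Dᶜ x ∪ D ⊆ connectedComponentIn D'ᶜ d := by
    refine (comp_union hD ⟨d, hd⟩ hDc hxD).subset_connectedComponentIn (Or.inr hd) ?_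
    rintro z (hz | hz) hz'
    · refine h1.le_bot ⟨hz', fun hz2 => hx ?_⟩
      rw [connectedComponentIn_eq hz2, ← connectedComponentIn_eq hz]
      exact mem_connectedComponentIn hxD
    · exact h2.le_bot ⟨hz, subset_hull _ hz'⟩
  rw [← connectedComponentIn_eq hdX] at h3
  exact hx' (h3 (Or.inl (mem_connectedComponentIn hxD)))

lemma hull_neg {C : Set ℂ} (hC : C ⊆ ball (0:ℂ) 1) : hull (Neg.neg ⁻¹' C) = Neg.neg ⁻¹' hull C := by
  have h2 : (2:ℂ) ∈ Cᶜ := fun h => two_notMem (hC h)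
  have hm2 : (-2:ℂ) ∈ connectedComponentIn Cᶜ 2 :=
    ext_conn.subset_connectedComponentIn two_notMem (compl_subset_compl.2 hC) (by simp)
  have hm2' : (-2:ℂ) ∈ Cᶜ := connectedComponentIn_subset _ _ hm2
  have h := (Homeomorph.neg ℂ).image_connectedComponentIn hm2'
  rw [← connectedComponentIn_eq hm2] at h
  simp only [Homeomorph.coe_neg, image_neg_eq_neg, neg_neg] at h
  rw [hull, hull, preimage_compl]
  congr 1
  have e : (Neg.neg ⁻¹' C)ᶜ = -Cᶜ := by ext z; simp
  rw [e, ← h]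
  rfl

end MF

namespace MF

open Set Filter Topology Complex Metric
open scoped Manifold ContDiff


structure Nod (φ : ℂ → ℝ) (c0 : ℝ) : Prop where
  smooth : ContDiff ℝ 2 φ
  odd : ∀ z, φ (-z) = - φ z
  bd : ∀ z, ‖z‖ = 1 → φ z = 0
  c0pos : 0 < c0
  sup : ∀ z ∈ ball (0:ℂ) 1, 0 ≤ φ z → lapl φ z ≤ 0
  sub : ∀ z ∈ ball (0:ℂ) 1, 0 < φ z → - lapl φ z ≤ c0 * φ z

def ng (φ : ℂ → ℝ) : ℂ → ℝ := fun z => φ (-z)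

lemma ng_ng (φ : ℂ → ℝ) : ng (ng φ) = φ := by ext z; simp [ng]

lemma lapl_ng {φ : ℂ → ℝ} (hφ : ContDiff ℝ 2 φ) (z : ℂ) : lapl (ng φ) z = lapl φ (-z) := by
  have := lapl_comp (f := φ) (g := fun w => -w) (z := z) (by fun_prop) hφ.contDiffAt
  have hd : deriv (fun w : ℂ => -w) z = -1 := by simp
  rw [hd] at this
  have e : ng φ = fun w => φ (-w) := rfl
  rw [e]; simpa using this

lemma Nod.neg {φ : ℂ → ℝ} {c0 : ℝ} (h : Nod φ c0) : Nod (ng φ) c0 where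
  smooth := h.smooth.comp contDiff_neg
  odd z := h.odd (-z)
  bd z hz := h.bd _ (by rwa [norm_neg])
  c0pos := h.c0pos
  sup z hz hp := by rw [lapl_ng h.smooth]; exact h.sup _ (by simpa using hz) hp
  sub z hz hp := by rw [lapl_ng h.smooth]; exact h.sub _ (by simpa using hz) hp

def ps (φ : ℂ → ℝ) : Set ℂ := {z | z ∈ ball (0:ℂ) 1 ∧ 0 < φ z}

def IsN (φ : ℂ → ℝ) (C : Set ℂ) : Prop := ∃ z ∈ ps φ, C = connectedComponentIn (ps φ) z

lemma ps_open {φ : ℂ → ℝ} (hφ : Continuous φ) : IsOpen (ps φ) :=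
  isOpen_ball.inter (isOpen_lt continuous_const hφ)

lemma IsN.isOpen {φ : ℂ → ℝ} {C : Set ℂ} (h : IsN φ C) (hφ : Continuous φ) : IsOpen C := by
  obtain ⟨z, hz, rfl⟩ := h; exact (ps_open hφ).connectedComponentIn

lemma IsN.conn {φ : ℂ → ℝ} {C : Set ℂ} (h : IsN φ C) : IsPreconnected C := by
  obtain ⟨z, hz, rfl⟩ := h; exact isPreconnected_connectedComponentIn

lemma IsN.nonempty {φ : ℂ → ℝ} {C : Set ℂ} (h : IsN φ C) : C.Nonempty := by
  obtain ⟨z, hz, rfl⟩ := h; exact ⟨z, mem_connectedComponentIn hz⟩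

lemma IsN.sub_ps {φ : ℂ → ℝ} {C : Set ℂ} (h : IsN φ C) : C ⊆ ps φ := by
  obtain ⟨z, hz, rfl⟩ := h; exact connectedComponentIn_subset _ _

lemma IsN.sub_ball {φ : ℂ → ℝ} {C : Set ℂ} (h : IsN φ C) : C ⊆ ball (0:ℂ) 1 := fun z hz => (h.sub_ps hz).1

lemma IsN.bdd {φ : ℂ → ℝ} {C : Set ℂ} (h : IsN φ C) : Bornology.IsBounded C := isBounded_ball.subset h.sub_ball

lemma IsN.eq_of_mem {φ : ℂ → ℝ} {C : Set ℂ} (h : IsN φ C) {w : ℂ} (hw : w ∈ C) : C = connectedComponentIn (ps φ) w := by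
  obtain ⟨z, hz, rfl⟩ := h; exact connectedComponentIn_eq hw

lemma IsN.sub_of_conn {φ : ℂ → ℝ} {C S : Set ℂ} (h : IsN φ C) (hS : IsPreconnected S) (hSp : S ⊆ ps φ) {w : ℂ} (hw : w ∈ C)
    (hwS : w ∈ S) : S ⊆ C := by
  rw [h.eq_of_mem hw]; exact hS.subset_connectedComponentIn hwS hSp

lemma IsN.frontier {φ : ℂ → ℝ} {c0 : ℝ} {C : Set ℂ} (h : IsN φ C) (N : Nod φ c0) : ∀ z ∈ frontier C, φ z = 0 := by
  intro z hz
  have hc := N.smooth.continuous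
  have hCo := h.isOpen hc
  have h0 : 0 ≤ φ z := by
    have hcl : IsClosed {z | 0 ≤ φ z} := isClosed_le continuous_const hc
    exact closure_minimal (fun z hz => (h.sub_ps hz).2.le) hcl hz.1
  have hzn : ‖z‖ ≤ 1 := by
    have : z ∈ closedBall (0:ℂ) 1 := closure_minimal (h.sub_ball.trans ball_subset_closedBall) isClosed_closedBall hz.1
    simpa using this
  by_contra hne
  have hpos : 0 < φ z := lt_of_le_of_ne h0 (Ne.symm hne)
  have hz1 : ‖z‖ < 1 := lt_of_le_of_ne hzn fun h1 => hne (N.bd z h1)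
  have hzp : z ∈ ps φ := ⟨by simpa using hz1, hpos⟩
  obtain ⟨ρ, hρ, hρs⟩ := Metric.isOpen_iff.1 (ps_open hc) z hzp
  obtain ⟨y, hy1, hy2⟩ := mem_closure_iff.1 hz.1 (ball z ρ) isOpen_ball (mem_ball_self hρ)
  have := h.sub_of_conn (convex_ball z ρ).isPreconnected hρs hy2 hy1 (mem_ball_self hρ)
  exact hz.2 (by rwa [hCo.interior_eq])

lemma IsN.area {φ : ℂ → ℝ} {c0 : ℝ} {C : Set ℂ} (h : IsN φ C) (N : Nod φ c0) : 2 * π / c0 ≤ volume.real C := by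
  have := area_lower (h.isOpen N.smooth.continuous) h.bdd h.nonempty N.smooth (fun z hz => (h.sub_ps hz).2) (h.frontier N)
    N.c0pos (fun z hz => N.sub z (h.sub_ball hz) (h.sub_ps hz).2)
  rw [div_le_iff₀ N.c0pos]; linarith

lemma IsN.neg {φ : ℂ → ℝ} {C : Set ℂ} (h : IsN φ C) : IsN (ng φ) (Neg.neg ⁻¹' C) := by
  obtain ⟨z, hz, rfl⟩ := h
  refine ⟨-z, ⟨by simpa using hz.1, by simpa [ng] using hz.2⟩, ?_⟩
  have h1 := (Homeomorph.neg ℂ).image_connectedComponentIn hz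
  simp only [Homeomorph.coe_neg, image_neg_eq_neg] at h1
  have e : ps (ng φ) = - ps φ := by
    ext w; simp [ps, ng]
  rw [e, ← h1]; rfl

lemma IsN.disj {φ : ℂ → ℝ} {C C' : Set ℂ} (h : IsN φ C) (h' : IsN φ C') (hne : C ≠ C') : Disjoint C C' := by
  rw [Set.disjoint_left]
  intro z hz hz'
  exact hne ((h.eq_of_mem hz).trans (h'.eq_of_mem hz').symm)

lemma IsN.disj_neg {φ : ℂ → ℝ} {c0 : ℝ} (N : Nod φ c0) {C C' : Set ℂ} (h : IsN φ C) (h' : IsN (ng φ) C') : Disjoint C C' := by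
  rw [Set.disjoint_left]
  intro z hz hz'
  have h1 := (h.sub_ps hz).2
  have h2 : 0 < φ (-z) := (h'.sub_ps hz').2
  rw [N.odd] at h2
  linarith

def IsN2 (φ : ℂ → ℝ) (C : Set ℂ) : Prop := IsN φ C ∨ IsN (ng φ) C

lemma IsN2.symm {φ : ℂ → ℝ} {C : Set ℂ} (h : IsN2 φ C) : IsN2 (ng φ) C := by
  rcases h with h | h
  · right; rwa [ng_ng]
  · left; exact h

lemma IsN2.disj {φ : ℂ → ℝ} {c0 : ℝ} (N : Nod φ c0) {C C' : Set ℂ} (h : IsN2 φ C) (h' : IsN2 φ C') (hne : C ≠ C') :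
    Disjoint C C' := by
  rcases h with h | h <;> rcases h' with h' | h'
  · exact h.disj h' hne
  · exact IsN.disj_neg N h h'
  · exact (IsN.disj_neg N h' h).symm
  · exact h.disj h' hne

lemma hull_vol_lt {φ ψ : ℂ → ℝ} {c0 : ℝ} (N : Nod φ c0) {C D : Set ℂ} (h : IsN φ C) (h' : IsN ψ D) (hd : Disjoint C D)
    {x : ℂ} (hx : x ∈ D) (hxC : x ∈ hull C) : hull D ⊆ hull C ∧ volume.real (hull D) + 2 * π / c0 ≤ volume.real (hull C) := by
  have hCo := h.isOpen N.smooth.continuous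
  obtain ⟨h1, h2⟩ := hull_nested hCo h.nonempty h.conn h.sub_ball h'.conn hd hx hxC
  refine ⟨h1, ?_⟩
  have hfin : volume (hull C) ≠ ⊤ := ((measure_mono (hull_subset_ball h.sub_ball)).trans_lt measure_ball_lt_top).ne
  have h3 : volume.real (hull D ∪ C) = volume.real (hull D) + volume.real C := by
    refine measureReal_union h2.symm hCo.measurableSet ?_ ?_
    · exact ((measure_mono h1).trans_lt hfin.lt_top).ne
    · exact ((measure_mono (subset_hull C)).trans_lt hfin.lt_top).ne
  have h4 : volume.real (hull D ∪ C) ≤ volume.real (hull C) := measureReal_mono (union_subset h1 (subset_hull C)) hfin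
  have := h.area N
  linarith

lemma zero_notMem_hull {φ : ℂ → ℝ} {c0 : ℝ} (N : Nod φ c0) {C : Set ℂ} (h : IsN φ C) : (0:ℂ) ∉ hull C := by
  have hvol : volume.real (hull (Neg.neg ⁻¹' C)) = volume.real (hull C) := by
    rw [hull_neg h.sub_ball]
    simp only [Measure.real]
    congr 1
    exact (Measure.measurePreserving_neg (volume : Measure ℂ)).measure_preimage (hull_open (h.isOpen N.smooth.continuous)).measurableSet.nullMeasurableSet
  have hp : 0 < 2 * π / c0 := div_pos (by positivity) N.c0pos
  have hd := IsN.disj_neg N h h.neg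
  have h1 : Disjoint (Neg.neg ⁻¹' C) (hull C) := by
    rw [Set.disjoint_left]
    intro x hx hx'
    have := (hull_vol_lt N h h.neg hd hx hx').2
    linarith
  have h2 : Disjoint C (hull (Neg.neg ⁻¹' C)) := by
    rw [Set.disjoint_left]
    intro x hx hx'
    have := (hull_vol_lt N.neg h.neg h hd.symm hx hx').2
    linarith
  have h3 := hull_disjoint (h.isOpen N.smooth.continuous) h.nonempty h.conn h1 h2
  intro h0
  refine h3.le_bot ⟨h0, ?_⟩
  rw [hull_neg h.sub_ball]
  simpa using h0

lemma IsN2.zero {φ : ℂ → ℝ} {c0 : ℝ} (N : Nod φ c0) {C : Set ℂ} (h : IsN2 φ C) : (0:ℂ) ∉ hull C := by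
  rcases h with h | h
  · exact zero_notMem_hull N h
  · exact zero_notMem_hull N.neg h

lemma IsN2.basic {φ : ℂ → ℝ} {c0 : ℝ} (N : Nod φ c0) {C : Set ℂ} (h : IsN2 φ C) :
    IsOpen C ∧ C.Nonempty ∧ IsPreconnected C ∧ C ⊆ ball (0:ℂ) 1 := by
  rcases h with h | h
  · exact ⟨h.isOpen N.smooth.continuous, h.nonempty, h.conn, h.sub_ball⟩
  · exact ⟨h.isOpen N.neg.smooth.continuous, h.nonempty, h.conn, h.sub_ball⟩

lemma IsN2.hull_disj {φ : ℂ → ℝ} {c0 : ℝ} (N : Nod φ c0) {C C' : Set ℂ} (h : IsN2 φ C) (h' : IsN2 φ C') (hne : C ≠ C')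
    (h0 : (0:ℂ) ∈ closure C) (h0' : (0:ℂ) ∈ closure C') : Disjoint (hull C) (hull C') := by
  have key : ∀ D D', IsN2 φ D → IsN2 φ D' → Disjoint D D' → (0:ℂ) ∈ closure D' → Disjoint D' (hull D) := by
    intro D D' hD hD' hdis h0
    rw [Set.disjoint_left]
    intro x hx hxD
    obtain ⟨o, n, c, b⟩ := hD.basic N
    obtain ⟨o', n', c', b'⟩ := hD'.basic N
    have hxD' : x ∉ D := fun hh => hdis.le_bot ⟨hh, hx⟩
    have h1 : closure D' ⊆ connectedComponentIn Dᶜ x :=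
      closure_minimal (c'.subset_connectedComponentIn hx (subset_compl_iff_disjoint_left.2 hdis)) (closed_component o.isClosed_compl _)
    refine hD.zero N fun h2 => ?_
    apply hxD
    have h3 := h1 h0
    rw [connectedComponentIn_eq h2, ← connectedComponentIn_eq h3]
    exact mem_connectedComponentIn hxD'
  have hd := IsN2.disj N h h' hne
  obtain ⟨o, n, c, b⟩ := h.basic N
  exact hull_disjoint o n c (key C C' h h' hd h0') (key C' C h' h hd.symm h0)

lemma sc_of_nonneg {φ : ℂ → ℝ} {c0 : ℝ} (N : Nod φ c0) {C : Set ℂ} (h : IsN φ C) (hnn : ∀ z ∈ hull C, 0 ≤ φ z) :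
    IsPreconnected Cᶜ := by
  have hc := N.smooth.continuous
  have hCo := h.isOpen hc
  have hHo := hull_open hCo
  have hHb := hull_subset_ball h.sub_ball
  have hHc := hull_preconnected hCo h.nonempty h.conn
  have hpos : hull C ⊆ {z | 0 < φ z} := by
    have hop : IsOpen {z : ℂ | 0 < φ z} := isOpen_lt continuous_const hc
    obtain ⟨d, hd⟩ := h.nonempty
    by_contra hns
    obtain ⟨y, hy, hyn⟩ := not_subset.1 hns
    have hy0 : φ y = 0 := le_antisymm (not_lt.1 hyn) (hnn y hy)
    set Z : Set ℂ := {z | z ∈ hull C ∧ φ z = 0} with hZ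
    have hZo : IsOpen Z := by
      rw [Metric.isOpen_iff]
      rintro z ⟨hz, hz0⟩
      obtain ⟨ρ, hρ, hρs⟩ := Metric.isOpen_iff.1 hHo z hz
      refine ⟨ρ, hρ, fun w hw => ⟨hρs hw, ?_⟩⟩
      exact strong_min N.smooth (fun w hw => N.sup w (hHb (hρs hw)) (hnn w (hρs hw))) (fun w hw => hnn w (hρs hw)) hz0 w hw
    obtain ⟨x, hx, hx1, hx2⟩ := hHc Z {z | 0 < φ z} hZo hop (fun z hz => by
        rcases (hnn z hz).eq_or_lt with h0 | h0
        · exact Or.inl ⟨hz, h0.symm⟩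
        · exact Or.inr h0) ⟨y, hy, hy, hy0⟩ ⟨d, subset_hull C hd, (h.sub_ps hd).2⟩
    have : 0 < φ x := hx2
    rw [hx1.2] at this
    exact lt_irrefl _ this
  have heq : hull C = C := by
    refine Subset.antisymm ?_ (subset_hull C)
    obtain ⟨d, hd⟩ := h.nonempty
    exact h.sub_of_conn hHc (fun z hz => ⟨hHb hz, hpos hz⟩) hd (subset_hull C hd)
  rw [← heq, hull, compl_compl]
  exact isPreconnected_connectedComponentIn

lemma exists_sc {c0 : ℝ} (k : ℕ) : ∀ {φ : ℂ → ℝ}, Nod φ c0 → ∀ {C : Set ℂ}, IsN φ C →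
    volume.real (hull C) < k * (2 * π / c0) → ∃ D, IsN2 φ D ∧ D ⊆ hull C ∧ IsPreconnected Dᶜ := by
  induction k with
  | zero =>
    intro φ N C h hv
    have : 0 ≤ volume.real (hull C) := measureReal_nonneg
    norm_num at hv
    linarith
  | succ k ih =>
    intro φ N C h hv
    by_cases hnn : ∀ z ∈ hull C, 0 ≤ φ z
    · exact ⟨C, Or.inl h, subset_hull C, sc_of_nonneg N h hnn⟩
    · push Not at hnn
      obtain ⟨z, hz, hzn⟩ := hnn
      have hzp : z ∈ ps (ng φ) := ⟨hull_subset_ball h.sub_ball hz, by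
        change 0 < φ (-z)
        rw [N.odd]; linarith⟩
      have hD : IsN (ng φ) (connectedComponentIn (ps (ng φ)) z) := ⟨z, hzp, rfl⟩
      obtain ⟨h1, h2⟩ := hull_vol_lt N h hD (IsN.disj_neg N h hD) (mem_connectedComponentIn hzp) hz
      obtain ⟨D, hD1, hD2, hD3⟩ := ih N.neg hD (by push_cast at hv; linarith)
      exact ⟨D, by have := hD1.symm; rwa [ng_ng] at this, hD2.trans h1, hD3⟩

lemma IsN2.exists_sc {φ : ℂ → ℝ} {c0 : ℝ} (N : Nod φ c0) {C : Set ℂ} (h : IsN2 φ C) :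
    ∃ D, IsN2 φ D ∧ D ⊆ hull C ∧ IsPreconnected Dᶜ := by
  have hp : 0 < 2 * π / c0 := div_pos (by positivity) N.c0pos
  obtain ⟨k, hk⟩ := exists_nat_gt (volume.real (hull C) / (2 * π / c0))
  rw [div_lt_iff₀ hp] at hk
  rcases h with h | h
  · exact MF.exists_sc k N h hk
  · obtain ⟨D, h1, h2, h3⟩ := MF.exists_sc k N.neg h hk
    exact ⟨D, by have := h1.symm; rwa [ng_ng] at this, h2, h3⟩

theorem unique_comp {φ ρ : ℂ → ℝ} {c0 : ℝ} (N : Nod φ c0) (hρ : Continuous ρ) (hρ0 : ∀ z, 0 ≤ ρ z)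
    (hm : ∀ C, IsN2 φ C → IsPreconnected Cᶜ → 8 * π < ∫ z in C, ρ z) (ht : ∫ z in ball (0:ℂ) 1, ρ z ≤ 32 * π)
    {C1 C2 : Set ℂ} (h1 : IsN φ C1) (h2 : IsN φ C2) (h01 : (0:ℂ) ∈ closure C1) (h02 : (0:ℂ) ∈ closure C2) : C1 = C2 := by
  by_contra hne
  have hcn : ∀ C : Set ℂ, (0:ℂ) ∈ closure C → (0:ℂ) ∈ closure (Neg.neg ⁻¹' C) := by
    intro C hC
    have : closure (Neg.neg ⁻¹' C) = Neg.neg ⁻¹' closure C := ((Homeomorph.neg ℂ).preimage_closure C).symm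
    rw [this]; simpa using hC
  have h3 := h1.neg
  have h4 := h2.neg
  have n14 : ∀ A B, IsN φ A → IsN (ng φ) B → A ≠ B := by
    intro A B hA hB e
    have := IsN.disj_neg N hA hB
    rw [← e] at this
    exact hA.nonempty.ne_empty (disjoint_self.1 this)
  have n34 : Neg.neg ⁻¹' C1 ≠ (Neg.neg ⁻¹' C2 : Set ℂ) := by
    intro e
    apply hne
    have := congrArg (fun S : Set ℂ => Neg.neg ⁻¹' S) e
    simpa [preimage_preimage] using this
  have d12 := IsN2.hull_disj N (Or.inl h1) (Or.inl h2) hne h01 h02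
  have d13 := IsN2.hull_disj N (Or.inl h1) (Or.inr h3) (n14 _ _ h1 h3) h01 (hcn _ h01)
  have d14 := IsN2.hull_disj N (Or.inl h1) (Or.inr h4) (n14 _ _ h1 h4) h01 (hcn _ h02)
  have d23 := IsN2.hull_disj N (Or.inl h2) (Or.inr h3) (n14 _ _ h2 h3) h02 (hcn _ h01)
  have d24 := IsN2.hull_disj N (Or.inl h2) (Or.inr h4) (n14 _ _ h2 h4) h02 (hcn _ h02)
  have d34 := IsN2.hull_disj N (Or.inr h3) (Or.inr h4) n34 (hcn _ h01) (hcn _ h02)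
  obtain ⟨D1, a1, b1, e1⟩ := IsN2.exists_sc N (Or.inl h1)
  obtain ⟨D2, a2, b2, e2⟩ := IsN2.exists_sc N (Or.inl h2)
  obtain ⟨D3, a3, b3, e3⟩ := IsN2.exists_sc N (Or.inr h3)
  obtain ⟨D4, a4, b4, e4⟩ := IsN2.exists_sc N (Or.inr h4)
  have m1 := hm D1 a1 e1
  have m2 := hm D2 a2 e2
  have m3 := hm D3 a3 e3
  have m4 := hm D4 a4 e4
  have hI : IntegrableOn ρ (ball (0:ℂ) 1) := (hρ.continuousOn.integrableOn_compact (isCompact_closedBall (0:ℂ) 1)).mono_set ball_subset_closedBall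
  have ms : ∀ D, IsN2 φ D → MeasurableSet D ∧ IntegrableOn ρ D ∧ D ⊆ ball (0:ℂ) 1 := fun D hD => by
    obtain ⟨o, -, -, b⟩ := hD.basic N
    exact ⟨o.measurableSet, hI.mono_set b, b⟩
  obtain ⟨x1, y1, w1⟩ := ms D1 a1
  obtain ⟨x2, y2, w2⟩ := ms D2 a2
  obtain ⟨x3, y3, w3⟩ := ms D3 a3
  obtain ⟨x4, y4, w4⟩ := ms D4 a4
  have u12 := setIntegral_union (d12.mono b1 b2) x2 y1 y2
  have u34 := setIntegral_union (d34.mono b3 b4) x4 y3 y4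
  have u : ∫ z in (D1 ∪ D2) ∪ (D3 ∪ D4), ρ z = (∫ z in D1 ∪ D2, ρ z) + ∫ z in D3 ∪ D4, ρ z :=
    setIntegral_union (disjoint_union_left.2 ⟨disjoint_union_right.2 ⟨d13.mono b1 b3, d14.mono b1 b4⟩,
      disjoint_union_right.2 ⟨d23.mono b2 b3, d24.mono b2 b4⟩⟩) (x3.union x4) (y1.union y2) (y3.union y4)
  have hle : ∫ z in (D1 ∪ D2) ∪ (D3 ∪ D4), ρ z ≤ ∫ z in ball (0:ℂ) 1, ρ z :=
    setIntegral_mono_set hI (ae_of_all _ hρ0) (ae_of_all _ (union_subset (union_subset w1 w2) (union_subset w3 w4)))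
  linarith

end MF

namespace MF

open Set Filter Topology Complex Metric
open scoped Manifold ContDiff

/-! P19: a planar winding argument -/

lemma inc_eq {f g : ℝ → ℂ} {c : ℂ} (hf : ContinuousOn f (Icc 0 1)) (hg : ContinuousOn g (Icc 0 1))
    (h : ∀ t ∈ Icc (0:ℝ) 1, Complex.exp (f t) = c * Complex.exp (g t)) : f 1 - f 0 = g 1 - g 0 := by
  have hc : Complex.exp (f 0 - g 0) = c := by
    rw [Complex.exp_sub, h 0 (by simp)]; field_simp [Complex.exp_ne_zero]
  let F : Icc (0:ℝ) 1 → ℂ := fun t => f t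
  let G : Icc (0:ℝ) 1 → ℂ := fun t => g t + (f 0 - g 0)
  have hF : Continuous F := continuousOn_iff_continuous_restrict.1 hf
  have hG : Continuous G := (continuousOn_iff_continuous_restrict.1 hg).add continuous_const
  haveI : PreconnectedSpace (Icc (0:ℝ) 1) := Subtype.preconnectedSpace isPreconnected_Icc
  have := Complex.isCoveringMap_exp.eq_of_comp_eq hF hG (by
    funext t
    apply Subtype.ext
    simp only [Function.comp, F, G]
    rw [h t t.2, Complex.exp_add, hc, mul_comm]) ⟨0, by simp⟩ (by simp [F, G])
  have h1 := congrFun this ⟨1, by simp⟩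
  simp only [F, G] at h1
  rw [h1]; ring

lemma inc_seg {f : ℝ → ℂ} {a b : ℂ} (ha : a ≠ 0) (hf : ContinuousOn f (Icc 0 1))
    (h : ∀ t ∈ Icc (0:ℝ) 1, Complex.exp (f t) = (1 - t) * a + t * b) (hb : b / a ∈ slitPlane) :
    f 1 - f 0 = Complex.log (b / a) := by
  have hs : ∀ t ∈ Icc (0:ℝ) 1, (1 - t : ℂ) + t * (b / a) ∈ slitPlane := by
    intro t ht
    have := starConvex_one_slitPlane hb (sub_nonneg.2 ht.2) ht.1 (by ring)
    simpa using this
  have := inc_eq (f := f) (g := fun t : ℝ => Complex.log ((1 - t : ℂ) + t * (b / a))) (c := a) hf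
    (ContinuousOn.clog (by fun_prop) hs) (by
      intro t ht
      rw [Complex.exp_log (slitPlane_ne_zero (hs t ht)), h t ht]
      field_simp)
  simpa using this

lemma oct_lift {g : ℝ × ℝ → ℂ} (hg : Continuous g)
    (h0 : ∀ x y : ℝ, |x| ≤ 3/2 → |y| ≤ 3/2 → |x| + |y| ≤ 2 → g (x, y) ≠ 0) :
    ∃ L : ℝ × ℝ → ℂ, Continuous L ∧
      ∀ x y : ℝ, |x| ≤ 3/2 → |y| ≤ 3/2 → |x| + |y| ≤ 2 → Complex.exp (L (x, y)) = g (x, y) := by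
  let m : ℝ × ℝ → ℝ := fun p => max 1 (max (max (2/3 * |p.1|) (2/3 * |p.2|)) ((|p.1| + |p.2|) / 2))
  have hm : Continuous m := by fun_prop
  have hm1 : ∀ p, 1 ≤ m p := fun p => le_max_left _ _
  have hm0 : ∀ p, m p ≠ 0 := fun p => by linarith [hm1 p] |> fun h : 0 < m p => h.ne'
  let r : ℝ × ℝ → ℝ × ℝ := fun p => (p.1 / m p, p.2 / m p)
  have hr : Continuous r := (continuous_fst.div hm hm0).prodMk (continuous_snd.div hm hm0)
  have hne : ∀ p, g (r p) ≠ 0 := by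
    intro p
    have hp : 0 < m p := by linarith [hm1 p]
    have e1 : 2/3 * |p.1| ≤ m p := le_trans (le_max_left _ _) (le_trans (le_max_left _ _) (le_max_right _ _))
    have e2 : 2/3 * |p.2| ≤ m p := le_trans (le_max_right _ _) (le_trans (le_max_left _ _) (le_max_right _ _))
    have e3 : (|p.1| + |p.2|) / 2 ≤ m p := le_trans (le_max_right _ _) (le_max_right _ _)
    apply h0
    · rw [abs_div, abs_of_pos hp, div_le_iff₀ hp]; linarith
    · rw [abs_div, abs_of_pos hp, div_le_iff₀ hp]; linarith
    · rw [abs_div, abs_div, abs_of_pos hp, ← add_div, div_le_iff₀ hp]; linarith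
  let G : C(ℝ × ℝ, {z : ℂ // z ≠ 0}) := ⟨fun p => ⟨g (r p), hne p⟩, by fun_prop⟩
  obtain ⟨L, ⟨-, hL⟩, -⟩ := Complex.isCoveringMap_exp.existsUnique_continuousMap_lifts (A := ℝ × ℝ) G (a₀ := 0) (e₀ := Complex.log (g (r 0)))
    (Subtype.ext (Complex.exp_log (hne 0)))
  refine ⟨L, L.continuous, fun x y hx hy hxy => ?_⟩
  have h1 := congrArg Subtype.val (congrFun hL (x, y))
  have h2 : m (x, y) = 1 := by
    apply max_eq_left
    refine max_le (max_le ?_ ?_) ?_ <;> simp only <;> linarith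
  have h3 : r (x, y) = (x, y) := by simp only [r, h2, div_one]
  have h4 : Complex.exp (L (x, y)) = g (r (x, y)) := h1
  rw [h4, h3]

theorem winding {γ η : ℝ → ℂ} (hγ : Continuous γ) (hη : Continuous η) {S0 S1 T0 T1 : ℂ}
    (hS0 : S0 ≠ 0) (hS1 : S1 ≠ 0) (hT0 : T0 ≠ 0) (hT1 : T1 ≠ 0)
    (g0 : ∀ s ∈ Icc (0:ℝ) 1, γ s = s * S0) (g1 : ∀ s ∈ Icc (2:ℝ) 3, γ s = (3 - s) * S1)
    (e0 : ∀ s ∈ Icc (0:ℝ) 1, η s = s * T0) (e1 : ∀ s ∈ Icc (2:ℝ) 3, η s = (3 - s) * T1)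
    (hne : ∀ s ∈ Ioo (0:ℝ) 3, ∀ t ∈ Ioo (0:ℝ) 3, γ s ≠ η t)
    (hγ0 : ∀ s ∈ Ioo (0:ℝ) 3, γ s ≠ 0) (hη0 : ∀ s ∈ Ioo (0:ℝ) 3, η s ≠ 0)
    (h1 : -T0 / S0 ∈ slitPlane) (h2 : S0 / -T1 ∈ slitPlane) (h3 : -T1 / S1 ∈ slitPlane) (h4 : S1 / -T0 ∈ slitPlane) :
    Complex.log (-T0 / S0) + Complex.log (S0 / -T1) + Complex.log (-T1 / S1) + Complex.log (S1 / -T0) = 0 := by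
  have z0 : γ 0 = 0 := by rw [g0 0 (by simp)]; simp
  have z3 : γ 3 = 0 := by rw [g1 3 (by norm_num)]; simp
  have w0 : η 0 = 0 := by rw [e0 0 (by simp)]; simp
  have w3 : η 3 = 0 := by rw [e1 3 (by norm_num)]; simp
  obtain ⟨L, hL, hE⟩ := oct_lift (g := fun p => γ (p.1 + 3/2) - η (p.2 + 3/2)) (by fun_prop) (by
    intro x y hx hy hxy
    simp only
    rw [abs_le] at hx hy
    rw [sub_ne_zero]
    have hq1 := le_abs_self x
    have hq2 := neg_abs_le x
    have hq3 := le_abs_self y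
    have hq4 := neg_abs_le y
    rcases eq_or_lt_of_le hx.1 with a | a
    · rw [← a, show (-(3/2:ℝ)) + 3/2 = 0 by norm_num, z0]
      exact (hη0 _ ⟨by linarith, by linarith⟩).symm
    rcases eq_or_lt_of_le hx.2 with b | b
    · rw [b, show (3/2:ℝ) + 3/2 = 3 by norm_num, z3]
      exact (hη0 _ ⟨by linarith, by linarith⟩).symm
    rcases eq_or_lt_of_le hy.1 with c | c
    · rw [← c, show (-(3/2:ℝ)) + 3/2 = 0 by norm_num, w0]
      exact (hγ0 _ ⟨by linarith, by linarith⟩)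
    rcases eq_or_lt_of_le hy.2 with d | d
    · rw [d, show (3/2:ℝ) + 3/2 = 3 by norm_num, w3]
      exact (hγ0 _ ⟨by linarith, by linarith⟩)
    exact hne _ ⟨by linarith, by linarith⟩ _ ⟨by linarith, by linarith⟩)
  let M : ℝ → ℝ → ℂ := fun s t => L (s - 3/2, t - 3/2)
  have hM : ∀ s t : ℝ, 0 ≤ s → s ≤ 3 → 0 ≤ t → t ≤ 3 → 1 ≤ s + t → s + t ≤ 5 → s - t ≤ 2 → t - s ≤ 2 →
      Complex.exp (M s t) = γ s - η t := by
    intro s t a1 a2 a3 a4 a5 a6 a7 a8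
    have := hE (s - 3/2) (t - 3/2) (by rw [abs_le]; constructor <;> linarith) (by rw [abs_le]; constructor <;> linarith)
      (by rcases abs_cases (s - 3/2) with q | q <;> rcases abs_cases (t - 3/2) with q' | q' <;> linarith)
    simpa [M] using this
  have cM : ∀ f g : ℝ → ℝ, Continuous f → Continuous g → Continuous fun u => M (f u) (g u) := by
    intro f g hf hg
    exact hL.comp (by fun_prop)
  have i1 := inc_seg (f := fun u => M (1 - u) u) (a := S0) (b := -T0) hS0 (cM _ _ (by fun_prop) (by fun_prop)).continuousOn (by
    intro u hu
    obtain ⟨u0, u1⟩ := hu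
    rw [hM _ _ (by linarith) (by linarith) (by linarith) (by linarith) (by linarith) (by linarith) (by linarith) (by linarith),
      g0 _ ⟨by linarith, by linarith⟩, e0 _ ⟨by linarith, by linarith⟩]
    push_cast; ring) h1
  have i2 := inc_seg (f := fun u => M u (2 + u)) (a := -T1) (b := S0) (neg_ne_zero.2 hT1) (cM _ _ (by fun_prop) (by fun_prop)).continuousOn (by
    intro u hu
    obtain ⟨u0, u1⟩ := hu
    rw [hM _ _ (by linarith) (by linarith) (by linarith) (by linarith) (by linarith) (by linarith) (by linarith) (by linarith),
      g0 _ ⟨by linarith, by linarith⟩, e1 _ ⟨by linarith, by linarith⟩]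
    push_cast; ring) h2
  have i3 := inc_seg (f := fun u => M (2 + u) (3 - u)) (a := S1) (b := -T1) hS1 (cM _ _ (by fun_prop) (by fun_prop)).continuousOn (by
    intro u hu
    obtain ⟨u0, u1⟩ := hu
    rw [hM _ _ (by linarith) (by linarith) (by linarith) (by linarith) (by linarith) (by linarith) (by linarith) (by linarith),
      g1 _ ⟨by linarith, by linarith⟩, e1 _ ⟨by linarith, by linarith⟩]
    push_cast; ring) h3
  have i4 := inc_seg (f := fun u => M (3 - u) (1 - u)) (a := -T0) (b := S1) (neg_ne_zero.2 hT0) (cM _ _ (by fun_prop) (by fun_prop)).continuousOn (by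
    intro u hu
    obtain ⟨u0, u1⟩ := hu
    rw [hM _ _ (by linarith) (by linarith) (by linarith) (by linarith) (by linarith) (by linarith) (by linarith) (by linarith),
      g1 _ ⟨by linarith, by linarith⟩, e0 _ ⟨by linarith, by linarith⟩]
    push_cast; ring) h4
  have j1 := inc_eq (f := fun u => M 0 (1 + u)) (g := fun u => M 3 (1 + u)) (c := 1) (cM _ _ (by fun_prop) (by fun_prop)).continuousOn
    (cM _ _ (by fun_prop) (by fun_prop)).continuousOn (by
    intro u hu
    obtain ⟨u0, u1⟩ := hu
    rw [hM _ _ (by linarith) (by linarith) (by linarith) (by linarith) (by linarith) (by linarith) (by linarith) (by linarith),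
      hM _ _ (by linarith) (by linarith) (by linarith) (by linarith) (by linarith) (by linarith) (by linarith) (by linarith), z0, z3, one_mul])
  have j2 := inc_eq (f := fun u => M (1 + u) 0) (g := fun u => M (1 + u) 3) (c := 1) (cM _ _ (by fun_prop) (by fun_prop)).continuousOn
    (cM _ _ (by fun_prop) (by fun_prop)).continuousOn (by
    intro u hu
    obtain ⟨u0, u1⟩ := hu
    rw [hM _ _ (by linarith) (by linarith) (by linarith) (by linarith) (by linarith) (by linarith) (by linarith) (by linarith),
      hM _ _ (by linarith) (by linarith) (by linarith) (by linarith) (by linarith) (by linarith) (by linarith) (by linarith), w0, w3, one_mul])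
  rw [← i1, ← i2, ← i3, ← i4]
  norm_num at j1 j2 ⊢
  linear_combination -j1 + j2

end MF

namespace MF

open Set Filter Topology Complex Metric
open scoped Manifold ContDiff

/-! P20: no branching at the origin -/

lemma exists_arc {C : Set ℂ} (hC : IsOpen C) (hCc : IsPreconnected C) {P Q : ℂ}
    (hP : ∀ t ∈ Ioc (0:ℝ) 1, (t:ℂ) * P ∈ C) (hQ : ∀ t ∈ Ioc (0:ℝ) 1, (t:ℂ) * Q ∈ C) :
    ∃ γ : ℝ → ℂ, Continuous γ ∧ (∀ s ∈ Icc (0:ℝ) 1, γ s = s * P) ∧ (∀ s ∈ Icc (2:ℝ) 3, γ s = (3 - s) * Q) ∧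
      ∀ s ∈ Ioo (0:ℝ) 3, γ s ∈ C := by
  have hP1 : P ∈ C := by simpa using hP 1 (by simp)
  have hQ1 : Q ∈ C := by simpa using hQ 1 (by simp)
  have hpc : IsPathConnected C := (hC.isConnected_iff_isPathConnected).1 ⟨⟨P, hP1⟩, hCc⟩
  obtain ⟨p, hp⟩ := hpc.joinedIn P hP1 Q hQ1
  refine ⟨fun s => if s ≤ 1 then s * P else if s ≤ 2 then p.extend (s - 1) else (3 - s) * Q, ?_, ?_, ?_, ?_⟩
  · apply Continuous.if_le (by fun_prop) _ continuous_id continuous_const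
    · intro s hs
      simp only [id] at hs
      subst hs
      norm_num
    · apply Continuous.if_le (p.continuous_extend.comp (by fun_prop)) (by fun_prop) continuous_id continuous_const
      intro s hs
      simp only [id] at hs
      subst hs
      norm_num
  · intro s hs
    simp [hs.2]
  · intro s hs
    have h1 : ¬ s ≤ 1 := by linarith [hs.1]
    simp only [h1, if_false]
    rcases eq_or_lt_of_le hs.1 with h | h
    · subst h; norm_num
    · rw [if_neg (not_le.2 h)]
  · intro s hs
    simp only
    split_ifs with h1 h2
    · exact hP s ⟨hs.1, h1⟩
    · rw [Path.extend_apply p ⟨by linarith, by linarith⟩]; exact hp _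
    · have := hQ (3 - s) ⟨by linarith [hs.2], by linarith⟩
      push_cast at this; exact this

lemma ray_pos {φ : ℂ → ℝ} {A : ℂ} {k : ℕ} {M r : ℝ} (hA : A ≠ 0) (hM : 0 ≤ M) (hr : 0 < r)
    (he : ∀ z ∈ ball (0:ℂ) r, |φ z - (A * z ^ k).re| ≤ M * ‖z‖ ^ (k + 1)) :
    ∃ r0 : ℝ, 0 < r0 ∧ r0 < 1 ∧ ∀ a : ℂ, ‖a‖ = 1 → ∀ t ∈ Ioc (0:ℝ) 1, ∀ σ : ℝ, A * a ^ k = (σ * ‖A‖ : ℝ) → |σ| = 1 →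
      0 < σ * φ (t * (r0 * a)) := by
  have hA' : 0 < ‖A‖ := norm_pos_iff.2 hA
  have hq : 0 < ‖A‖ / (M + 1) := by positivity
  refine ⟨min (min (r / 2) (1 / 2)) (‖A‖ / (M + 1)), by positivity, ?_, ?_⟩
  · exact lt_of_le_of_lt ((min_le_left _ _).trans (min_le_right _ _)) (by norm_num)
  set r0 := min (min (r / 2) (1 / 2)) (‖A‖ / (M + 1)) with hr0
  have h0 : 0 < r0 := by positivity
  have h1 : r0 ≤ r / 2 := (min_le_left _ _).trans (min_le_left _ _)
  have h2 : r0 ≤ ‖A‖ / (M + 1) := min_le_right _ _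
  intro a ha t ht σ hσ hσ1
  have hn : ‖(t:ℂ) * (r0 * a)‖ = t * r0 := by
    rw [norm_mul, norm_mul, ha, Complex.norm_real, Complex.norm_real, Real.norm_of_nonneg ht.1.le, Real.norm_of_nonneg h0.le, mul_one]
  have htr : 0 < t * r0 := mul_pos ht.1 h0
  have htr2 : t * r0 ≤ r0 := by nlinarith [ht.2]
  have h3 := he ((t:ℂ) * (r0 * a)) (by rw [mem_ball_zero_iff, hn]; linarith)
  rw [hn] at h3
  have h4 : A * ((t:ℂ) * (r0 * a)) ^ k = (((t * r0) ^ k * (σ * ‖A‖) : ℝ) : ℂ) := by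
    have : A * ((t:ℂ) * (r0 * a)) ^ k = (t * r0) ^ k * (A * a ^ k) := by ring
    rw [this, hσ]; push_cast; ring
  rw [h4, Complex.ofReal_re] at h3
  have h5 : M * (t * r0) < ‖A‖ := by
    rw [le_div_iff₀ (by positivity)] at h2
    nlinarith
  have h6 : 0 < (t * r0) ^ k := by positivity
  have h7 : M * (t * r0) ^ (k + 1) < (t * r0) ^ k * ‖A‖ := by
    rw [pow_succ]; nlinarith
  rw [abs_le] at h3
  have h8 : σ = 1 ∨ σ = -1 := (abs_eq (by norm_num)).1 hσ1
  rcases h8 with h | h <;> subst h <;> nlinarith [h3.1, h3.2]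

lemma log_expI {θ : ℝ} (h1 : -π < θ) (h2 : θ < π) : Complex.log (Complex.exp (θ * I)) = θ * I ∧ Complex.exp (θ * I) ∈ slitPlane := by
  have h := Complex.log_exp (x := θ * I) (by simpa using h1) (by simpa using h2.le)
  refine ⟨h, ?_⟩
  rw [Complex.mem_slitPlane_iff_arg]
  refine ⟨?_, Complex.exp_ne_zero _⟩
  rw [← Complex.log_im, h]
  simpa using h2.ne

theorem no_branch {φ : ℂ → ℝ} {c0 : ℝ} (N : Nod φ c0)
    (hu : ∀ C1 C2, IsN φ C1 → IsN φ C2 → (0:ℂ) ∈ closure C1 → (0:ℂ) ∈ closure C2 → C1 = C2)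
    {A : ℂ} {k : ℕ} {M r : ℝ} (hk : 2 ≤ k) (hA : A ≠ 0) (hM : 0 ≤ M) (hr : 0 < r)
    (he : ∀ z ∈ ball (0:ℂ) r, |φ z - (A * z ^ k).re| ≤ M * ‖z‖ ^ (k + 1)) : False := by
  obtain ⟨r0, hr0, hr01, hray⟩ := ray_pos hA hM hr he
  have hk0 : (k:ℝ) ≠ 0 := by positivity
  have hkC : (k:ℂ) ≠ 0 := by exact_mod_cast hk0
  have hr0C : (r0:ℂ) ≠ 0 := by exact_mod_cast hr0.ne'
  let a : ℝ → ℂ := fun j => Complex.exp (((j * π - arg A) / k : ℝ) * I)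
  have ha : ∀ j, ‖a j‖ = 1 := fun j => Complex.norm_exp_ofReal_mul_I _
  have hak : ∀ j, A * a j ^ k = ‖A‖ * Complex.exp ((j * π : ℝ) * I) := by
    intro j
    have e1 : a j ^ k = Complex.exp ((j * π : ℝ) * I) * Complex.exp (-(arg A * I)) := by
      simp only [a]
      rw [← Complex.exp_nat_mul, ← Complex.exp_add]
      congr 1
      push_cast
      field_simp
      ring
    rw [e1]
    have e3 := Complex.norm_mul_exp_arg_mul_I A
    have e2 : Complex.exp (arg A * I) * Complex.exp (-(arg A * I)) = 1 := by rw [← Complex.exp_add]; simp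
    linear_combination (‖A‖ * Complex.exp ((j * π : ℝ) * I)) * e2 - Complex.exp ((j * π : ℝ) * I) * Complex.exp (-(arg A * I)) * e3
  have x0 : Complex.exp (((0:ℝ) * π : ℝ) * I) = 1 := by simp
  have x1 : Complex.exp (((1:ℝ) * π : ℝ) * I) = -1 := by simp
  have x2 : Complex.exp (((2:ℝ) * π : ℝ) * I) = 1 := by push_cast; simp
  have x3 : Complex.exp (((-1:ℝ) * π : ℝ) * I) = -1 := by
    push_cast
    rw [show (-1 * (π:ℂ)) * I = -(π * I) by ring, Complex.exp_neg]; simp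
  have s0 : ∀ t ∈ Ioc (0:ℝ) 1, 0 < φ (t * (r0 * a 0)) := fun t ht => by
    simpa using hray (a 0) (ha 0) t ht 1 (by rw [hak, x0]; simp) (by simp)
  have s2 : ∀ t ∈ Ioc (0:ℝ) 1, 0 < φ (t * (r0 * a 2)) := fun t ht => by
    simpa using hray (a 2) (ha 2) t ht 1 (by rw [hak, x2]; simp) (by simp)
  have s1 : ∀ t ∈ Ioc (0:ℝ) 1, 0 < φ (t * -(r0 * a 1)) := fun t ht => by
    have := hray (a 1) (ha 1) t ht (-1) (by rw [hak, x1]; simp) (by simp)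
    rw [mul_neg, N.odd]; linarith
  have s3 : ∀ t ∈ Ioc (0:ℝ) 1, 0 < φ (t * -(r0 * a (-1))) := fun t ht => by
    have := hray (a (-1)) (ha (-1)) t ht (-1) (by rw [hak, x3]; simp) (by simp)
    rw [mul_neg, N.odd]; linarith
  have hr0n : ∀ j, ‖(r0:ℂ) * a j‖ < 1 := by
    intro j
    rw [norm_mul, ha, mul_one, Complex.norm_real, Real.norm_of_nonneg hr0.le]; exact hr01
  have key : ∀ w : ℂ, ‖w‖ < 1 → (∀ t ∈ Ioc (0:ℝ) 1, 0 < φ (t * w)) →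
      ∃ C, IsN φ C ∧ (0:ℂ) ∈ closure C ∧ ∀ t ∈ Ioc (0:ℝ) 1, (t:ℂ) * w ∈ C := by
    intro w hw hpos
    have hin : ∀ t ∈ Ioc (0:ℝ) 1, (t:ℂ) * w ∈ ps φ := by
      intro t ht
      refine ⟨?_, hpos t ht⟩
      rw [mem_ball_zero_iff, norm_mul, Complex.norm_real, Real.norm_of_nonneg ht.1.le]
      nlinarith [norm_nonneg w, ht.2]
    have hw1 : w ∈ ps φ := by simpa using hin 1 (by simp)
    have hC : IsN φ (connectedComponentIn (ps φ) w) := ⟨w, hw1, rfl⟩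
    have hconn : IsPreconnected ((fun t : ℝ => (t:ℂ) * w) '' Ioc 0 1) :=
      isPreconnected_Ioc.image _ (by fun_prop)
    have hsub : (fun t : ℝ => (t:ℂ) * w) '' Ioc 0 1 ⊆ connectedComponentIn (ps φ) w :=
      hC.sub_of_conn hconn (by rintro _ ⟨t, ht, rfl⟩; exact hin t ht) (mem_connectedComponentIn hw1)
        ⟨1, by simp, by simp⟩
    refine ⟨_, hC, ?_, fun t ht => hsub ⟨t, ht, rfl⟩⟩
    have h1 : (fun t : ℝ => (t:ℂ) * w) 0 ∈ closure ((fun t : ℝ => (t:ℂ) * w) '' Ioc 0 1) := by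
      apply image_closure_subset_closure_image (by fun_prop)
      refine ⟨0, ?_, rfl⟩
      rw [closure_Ioc (by norm_num)]; simp
    simpa using closure_mono hsub h1
  obtain ⟨C, hC, hC0, hm0⟩ := key _ (hr0n 0) s0
  have key2 : ∀ w : ℂ, ‖w‖ < 1 → (∀ t ∈ Ioc (0:ℝ) 1, 0 < φ (t * w)) → ∀ t ∈ Ioc (0:ℝ) 1, (t:ℂ) * w ∈ C := by
    intro w hw hpos
    obtain ⟨C', hC', hC0', hm'⟩ := key w hw hpos
    rwa [hu C C' hC hC' hC0 hC0']
  have hm2 := key2 _ (hr0n 2) s2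
  have hm1 := key2 _ (by rw [norm_neg]; exact hr0n 1) s1
  have hm3 := key2 _ (by rw [norm_neg]; exact hr0n (-1)) s3
  have hCo := hC.isOpen N.smooth.continuous
  obtain ⟨γ, hγ, g0, g1, hγC⟩ := exists_arc hCo hC.conn hm0 hm2
  obtain ⟨η, hη, e0, e1, hηC⟩ := exists_arc hCo hC.conn hm1 hm3
  have hφ0 : φ 0 = 0 := by
    have := N.odd 0
    rw [neg_zero] at this; linarith
  have hCp : ∀ z ∈ C, 0 < φ z := fun z hz => (hC.sub_ps hz).2
  have hdiv : ∀ i j : ℝ, a i / a j = Complex.exp (((i - j) * π / k : ℝ) * I) := by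
    intro i j
    simp only [a]
    rw [← Complex.exp_sub]
    congr 1
    push_cast; field_simp; ring
  have hnegexp : ∀ x : ℝ, -Complex.exp (x * I) = Complex.exp ((x - π : ℝ) * I) := by
    intro x
    push_cast
    rw [sub_mul, Complex.exp_sub, Complex.exp_pi_mul_I, div_neg, div_one]
  have hnegexp2 : ∀ x : ℝ, -Complex.exp (x * I) = Complex.exp ((x + π : ℝ) * I) := by
    intro x
    push_cast
    rw [add_mul, Complex.exp_add, Complex.exp_pi_mul_I, mul_neg_one]
  have hane : ∀ j, a j ≠ 0 := fun j => Complex.exp_ne_zero _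
  have hk2 : (2:ℝ) ≤ k := by exact_mod_cast hk
  have hpi := Real.pi_pos
  have hpk : 0 < π / k := by positivity
  have hpk2 : π / k ≤ π / 2 := div_le_div_of_nonneg_left hpi.le (by norm_num) hk2
  have d1 : -(r0 * a 1) / (r0 * a 0) = Complex.exp ((π / k - π : ℝ) * I) := by
    rw [neg_div, mul_div_mul_left _ _ hr0C, hdiv, ← hnegexp]
    congr 4; push_cast; ring
  have d2 : (r0 * a 0) / -(r0 * a (-1)) = Complex.exp ((π / k - π : ℝ) * I) := by
    rw [div_neg, mul_div_mul_left _ _ hr0C, hdiv, ← hnegexp]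
    congr 4; push_cast; ring
  have d3 : -(r0 * a (-1)) / (r0 * a 2) = Complex.exp ((π - 3 * (π / k) : ℝ) * I) := by
    rw [neg_div, mul_div_mul_left _ _ hr0C, hdiv, hnegexp2]
    congr 3; ring
  have d4 : (r0 * a 2) / -(r0 * a 1) = Complex.exp ((π / k - π : ℝ) * I) := by
    rw [div_neg, mul_div_mul_left _ _ hr0C, hdiv, ← hnegexp]
    congr 4; push_cast; ring
  have l1 := log_expI (θ := π / k - π) (by linarith) (by linarith)
  have l3 := log_expI (θ := π - 3 * (π / k)) (by linarith) (by linarith)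
  have hfin := winding (γ := γ) (η := fun t => -η t) hγ hη.neg (S0 := r0 * a 0) (S1 := r0 * a 2) (T0 := r0 * a 1) (T1 := r0 * a (-1))
    (mul_ne_zero hr0C (hane _)) (mul_ne_zero hr0C (hane _)) (mul_ne_zero hr0C (hane _)) (mul_ne_zero hr0C (hane _))
    g0 g1 (fun s hs => by rw [e0 s hs]; ring) (fun s hs => by rw [e1 s hs]; ring)
    (fun s hs t ht h => by
      have h1 := hCp _ (hγC s hs)
      have h2 := hCp _ (hηC t ht)
      rw [h, N.odd] at h1; linarith)
    (fun s hs h => by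
      have h1 := hCp _ (hγC s hs)
      rw [h] at h1; linarith)
    (fun s hs h => by
      have h1 := hCp _ (hηC s hs)
      rw [neg_eq_zero.1 h] at h1; linarith)
    (by rw [d1]; exact l1.2) (by rw [d2]; exact l1.2) (by rw [d3]; exact l3.2) (by rw [d4]; exact l1.2)
  rw [d1, d2, d3, d4, l1.1, l3.1] at hfin
  have := congrArg Complex.im hfin
  simp only [Complex.add_im, Complex.im_ofReal_mul, Complex.I_im, Complex.zero_im] at this
  linarith

end MF

namespace MF

open Set Filter Topology Complex Metric
open scoped Manifold ContDiff

/-! P21: integrals over the unit disk -/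

lemma ball_polar {f : ℂ → ℝ} :
    ∫ z in ball (0:ℂ) 1, f z = ∫ p in Ioo (0:ℝ) 1 ×ˢ Ioo (-π) π, p.1 * f (pol p) := by
  rw [← integral_indicator measurableSet_ball, polar_integral]
  rw [← integral_indicator (measurableSet_Ioi.prod measurableSet_Ioo),
    ← integral_indicator (measurableSet_Ioo.prod measurableSet_Ioo)]
  congr 1
  ext p
  have hi : (ball (0:ℂ) 1).indicator f (pol p) = if |p.1| < 1 then f (pol p) else 0 := by
    by_cases h : |p.1| < 1
    · rw [if_pos h, indicator_of_mem (by rwa [mem_ball_zero_iff, norm_pol])]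
    · rw [if_neg h, indicator_of_notMem (by rwa [mem_ball_zero_iff, norm_pol])]
  classical
  rw [indicator_apply, hi, indicator_apply]
  simp only [mem_prod, mem_Ioi, mem_Ioo, smul_eq_mul]
  by_cases h0 : 0 < p.1
  · rw [abs_of_pos h0]
    by_cases h1 : p.1 < 1 <;> by_cases h2 : -π < p.2 ∧ p.2 < π <;> simp [h0, h1, h2]
  · simp [h0]

lemma rect_integrable {F : ℝ × ℝ → ℝ} (hF : Continuous F) : IntegrableOn F (Ioo (0:ℝ) 1 ×ˢ Ioo (-π) π) :=
  (hF.continuousOn.integrableOn_compact (isCompact_Icc.prod isCompact_Icc)).mono_set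
    (prod_mono Ioo_subset_Icc_self Ioo_subset_Icc_self)

lemma rect_int1 {F : ℝ × ℝ → ℝ} (hF : Continuous F) : ∫ p in Ioo (0:ℝ) 1 ×ˢ Ioo (-π) π, F p =
    ∫ r in Ioo (0:ℝ) 1, ∫ θ in Ioo (-π) π, F (r, θ) := by
  have := rect_integrable hF
  rw [Measure.volume_eq_prod] at this ⊢
  exact setIntegral_prod _ this

lemma rect_int2 {F : ℝ × ℝ → ℝ} (hF : Continuous F) : ∫ p in Ioo (0:ℝ) 1 ×ˢ Ioo (-π) π, F p =
    ∫ θ in Ioo (-π) π, ∫ r in Ioo (0:ℝ) 1, F (r, θ) := by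
  have := rect_integrable hF
  rw [rect_int1 hF]
  apply integral_integral_swap (f := fun r θ => F (r, θ))
  rw [IntegrableOn, Measure.volume_eq_prod, ← Measure.prod_restrict] at this
  exact this

lemma trace_rot (B : ℂ →L[ℝ] ℂ →L[ℝ] ℝ) {e : ℂ} (he : ‖e‖ = 1) :
    B e e + B (I * e) (I * e) = B 1 1 + B I I := by
  have hb : ∀ x y : ℂ, B x y = x.re * (y.re * B 1 1 + y.im * B 1 I) + x.im * (y.re * B I 1 + y.im * B I I) := by
    intro x y
    have h1 := clm_real_apply (B.flip y) x
    simp only [ContinuousLinearMap.flip_apply] at h1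
    rw [h1, clm_real_apply (B 1) y, clm_real_apply (B I) y]
  have hn : e.re ^ 2 + e.im ^ 2 = 1 := by
    have := Complex.sq_norm e
    rw [he, Complex.normSq_apply] at this; linarith
  rw [hb e e, hb (I * e) (I * e)]
  simp only [Complex.mul_re, Complex.mul_im, Complex.I_re, Complex.I_im]
  linear_combination (B 1 1 + B I I) * hn

lemma norm_expI (θ : ℝ) : ‖Complex.exp (θ * I)‖ = 1 := Complex.norm_exp_ofReal_mul_I θ

lemma hasDerivAt_expI (θ : ℝ) : HasDerivAt (fun t : ℝ => Complex.exp (t * I)) (I * Complex.exp (θ * I)) θ := by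
  have := hasDerivAt_pol_th 1 θ
  simpa [pol] using this

theorem int_lapl {U : ℂ → ℝ} (hU : ContDiff ℝ 2 U) :
    ∫ z in ball (0:ℂ) 1, lapl U z = ∫ θ in Ioo (-π) π, fderiv ℝ U (Complex.exp (θ * I)) (Complex.exp (θ * I)) := by
  have hU1 : ContDiff ℝ 1 (fderiv ℝ U) := hU.fderiv_right (by norm_num)
  have c1 : Continuous (fderiv ℝ U) := hU1.continuous
  have c2 : Continuous (fderiv ℝ (fderiv ℝ U)) := hU1.continuous_fderiv one_ne_zero
  have hd : ∀ z, HasFDerivAt (fderiv ℝ U) (fderiv ℝ (fderiv ℝ U) z) z := fun z =>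
    (hU1.differentiable one_ne_zero z).hasFDerivAt
  let F1 : ℝ × ℝ → ℝ := fun p => fderiv ℝ U (pol p) (Complex.exp (p.2 * I)) +
    p.1 * fderiv ℝ (fderiv ℝ U) (pol p) (Complex.exp (p.2 * I)) (Complex.exp (p.2 * I))
  let F2 : ℝ × ℝ → ℝ := fun p => fderiv ℝ U (pol p) (I * (I * Complex.exp (p.2 * I))) +
    p.1 * fderiv ℝ (fderiv ℝ U) (pol p) (I * Complex.exp (p.2 * I)) (I * Complex.exp (p.2 * I))
  have cF1 : Continuous F1 := by
    refine ((c1.comp continuous_pol).clm_apply (by fun_prop)).add (continuous_fst.mul ?_)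
    exact ((c2.comp continuous_pol).clm_apply (by fun_prop)).clm_apply (by fun_prop)
  have cF2 : Continuous F2 := by
    refine ((c1.comp continuous_pol).clm_apply (by fun_prop)).add (continuous_fst.mul ?_)
    exact ((c2.comp continuous_pol).clm_apply (by fun_prop)).clm_apply (by fun_prop)
  have hsum : ∀ p : ℝ × ℝ, p.1 * lapl U (pol p) = F1 p + F2 p := by
    intro p
    have h1 := trace_rot (fderiv ℝ (fderiv ℝ U) (pol p)) (norm_expI p.2)
    rw [lapl_eq2 hU.contDiffAt, ← h1]
    have h2 : I * (I * Complex.exp (p.2 * I)) = - Complex.exp (p.2 * I) := by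
      rw [← mul_assoc, Complex.I_mul_I, neg_one_mul]
    simp only [F1, F2, h2, map_neg]
    ring
  rw [ball_polar]
  simp_rw [hsum]
  rw [integral_add (rect_integrable cF1) (rect_integrable cF2), rect_int1 cF2, rect_int2 cF1]
  have z2 : ∀ r : ℝ, ∫ θ in Ioo (-π) π, F2 (r, θ) = 0 := by
    intro r
    apply integral_circle_deriv (g := fun θ => fderiv ℝ U (pol (r, θ)) (I * Complex.exp (θ * I)))
    · intro θ
      have h1 := (hd (pol (r, θ))).comp_hasDerivAt θ (hasDerivAt_pol_th r θ)
      have h2 := h1.clm_apply ((hasDerivAt_expI θ).const_mul I)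
      refine h2.congr_deriv ?_
      simp only [F2, Function.comp]
      have : (r:ℂ) * (I * Complex.exp (θ * I)) = r • (I * Complex.exp (θ * I)) := by simp
      rw [this, map_smul]
      simp; ring
    · exact cF2.comp (by fun_prop)
    · simp only [pol_neg_pi]
      have : Complex.exp (((-π : ℝ) : ℂ) * I) = Complex.exp ((π : ℝ) * I) := by
        have := pol_neg_pi 1
        simpa [pol] using this
      rw [this]
  have z1 : ∀ θ : ℝ, ∫ r in Ioo (0:ℝ) 1, F1 (r, θ) = fderiv ℝ U (Complex.exp (θ * I)) (Complex.exp (θ * I)) := by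
    intro θ
    have hD : ∀ r : ℝ, HasDerivAt (fun r : ℝ => r * fderiv ℝ U (pol (r, θ)) (Complex.exp (θ * I))) (F1 (r, θ)) r := by
      intro r
      have h1 := (hd (pol (r, θ))).comp_hasDerivAt r (hasDerivAt_pol_r r θ)
      have h2 := (hasDerivAt_id r).mul (h1.clm_apply (hasDerivAt_const r (Complex.exp (θ * I))))
      refine h2.congr_deriv ?_
      simp [F1]
    rw [← integral_Ioc_eq_integral_Ioo, ← intervalIntegral.integral_of_le zero_le_one,
      intervalIntegral.integral_eq_sub_of_hasDerivAt (fun r _ => hD r)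
        ((cF1.comp (by fun_prop : Continuous fun r : ℝ => (r, θ))).intervalIntegrable _ _)]
    simp [pol]
  simp [z1, z2]

theorem int_lapl_zero {U : ℂ → ℝ} (hU : ContDiff ℝ 2 U) (ha : ∀ z : ℂ, z ≠ 0 → U (-(1 / (starRingEnd ℂ) z)) = U z) :
    ∫ z in ball (0:ℂ) 1, lapl U z = 0 := by
  rw [int_lapl hU]
  have hd : ∀ z, HasFDerivAt U (fderiv ℝ U z) z := fun z => (hU.differentiable two_ne_zero z).hasFDerivAt
  let f : ℝ → ℝ := fun θ => fderiv ℝ U (Complex.exp (θ * I)) (Complex.exp (θ * I))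
  have hf : Continuous f := by
    refine Continuous.clm_apply ((hU.continuous_fderiv two_ne_zero).comp (by fun_prop)) (by fun_prop)
  have hodd : ∀ e : ℂ, ‖e‖ = 1 → fderiv ℝ U (-e) (-e) = - fderiv ℝ U e e := by
    intro e he
    have hee : e * (starRingEnd ℂ) e = 1 := by rw [Complex.mul_conj, Complex.normSq_eq_norm_sq, he]; simp
    have hce : (starRingEnd ℂ) e ≠ 0 := fun h => by rw [h, mul_zero] at hee; exact zero_ne_one hee
    have h1 : HasDerivAt (fun t : ℝ => U (t * e)) (fderiv ℝ U e e) 1 := by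
      have a1 : HasDerivAt (fun t : ℝ => (t:ℂ) * e) e 1 := by
        simpa using (Complex.ofRealCLM.hasDerivAt (x := (1:ℝ))).mul_const e
      have a2 : HasFDerivAt U (fderiv ℝ U e) (((1:ℝ):ℂ) * e) := by simpa using hd e
      exact a2.comp_hasDerivAt (1:ℝ) a1
    have h2 : HasDerivAt (fun t : ℝ => U (-((t⁻¹ : ℝ) * e))) (fderiv ℝ U (-e) e) 1 := by
      have a0 : HasDerivAt (fun t : ℝ => t⁻¹) (-1) 1 := by simpa using hasDerivAt_inv (one_ne_zero (α := ℝ))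
      have a1 : HasDerivAt (fun t : ℝ => -(((t⁻¹ : ℝ) : ℂ) * e)) e 1 := by
        have := (a0.ofReal_comp.mul_const e).neg
        exact this.congr_deriv (by simp)
      have a2 : HasFDerivAt U (fderiv ℝ U (-e)) (-(((1:ℝ)⁻¹ : ℝ) * e)) := by simpa using hd (-e)
      exact a2.comp_hasDerivAt (1:ℝ) a1
    have h3 : (fun t : ℝ => U (t * e)) =ᶠ[𝓝 1] (fun t : ℝ => U (-((t⁻¹ : ℝ) * e))) := by
      filter_upwards [eventually_ne_nhds (one_ne_zero (α := ℝ))] with t ht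
      have htC : (t:ℂ) ≠ 0 := by exact_mod_cast ht
      rw [← ha (t * e) (mul_ne_zero htC (left_ne_zero_of_mul_eq_one hee))]
      congr 2
      rw [map_mul, Complex.conj_ofReal]
      push_cast
      field_simp
      linear_combination -hee
    have h4 := h1.unique (h2.congr_of_eventuallyEq h3)
    rw [map_neg, h4]
  have hfo : ∀ θ, f (θ + π) = - f θ := by
    intro θ
    have : Complex.exp (((θ + π : ℝ) : ℂ) * I) = - Complex.exp (θ * I) := by
      push_cast
      rw [add_mul, Complex.exp_add, Complex.exp_pi_mul_I, mul_neg_one]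
    simp only [f, this]
    exact hodd _ (norm_expI θ)
  have hpi : -π ≤ π := by linarith [Real.pi_pos]
  rw [← integral_Ioc_eq_integral_Ioo, ← intervalIntegral.integral_of_le hpi]
  change ∫ θ in (-π)..π, f θ = 0
  rw [← intervalIntegral.integral_add_adjacent_intervals (hf.intervalIntegrable (-π) 0) (hf.intervalIntegrable 0 π)]
  have := intervalIntegral.integral_comp_add_right (a := -π) (b := 0) f π
  simp only [hfo, neg_add_cancel, zero_add] at this
  rw [← this, intervalIntegral.integral_neg]
  ring

lemma int_D : ∫ z in ball (0:ℂ) 1, 1 / (1 + ‖z‖ ^ 2) ^ 2 = π / 2 := by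
  rw [ball_polar]
  have hc : Continuous fun p : ℝ × ℝ => p.1 * (1 / (1 + ‖pol p‖ ^ 2) ^ 2) := by
    apply continuous_fst.mul
    apply continuous_const.div (by have := continuous_pol; fun_prop)
    intro p; positivity
  rw [rect_int2 hc]
  have : ∀ θ : ℝ, ∫ r in Ioo (0:ℝ) 1, r * (1 / (1 + ‖pol (r, θ)‖ ^ 2) ^ 2) = 1 / 4 := by
    intro θ
    simp only [norm_pol, sq_abs]
    have hD : ∀ r : ℝ, HasDerivAt (fun r : ℝ => -(1/2) * (1 + r ^ 2)⁻¹) (r * (1 / (1 + r ^ 2) ^ 2)) r := by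
      intro r
      have h0 : (1 + r ^ 2) ≠ 0 := by positivity
      have h1 : HasDerivAt (fun r : ℝ => 1 + r ^ 2) (2 * r) r := by
        simpa using ((hasDerivAt_id r).pow 2).const_add 1
      have h2 := (h1.inv h0).const_mul (-(1/2) : ℝ)
      refine h2.congr_deriv ?_
      field_simp
    rw [← integral_Ioc_eq_integral_Ioo, ← intervalIntegral.integral_of_le zero_le_one,
      intervalIntegral.integral_eq_sub_of_hasDerivAt (fun r _ => hD r)
        (Continuous.intervalIntegrable (by
          apply continuous_id.mul
          exact continuous_const.div (by fun_prop) (fun r => by positivity)) _ _)]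
    norm_num
  simp only [this]
  simp
  rw [max_eq_left (by linarith [Real.pi_pos])]
  ring

lemma contDiff_logD : ContDiff ℝ 2 (fun z : ℂ => Real.log (1 + ‖z‖ ^ 2)) :=
  (contDiff_const.add contDiff_normSq).log (fun z => by positivity)

lemma lapl_logD (z : ℂ) : lapl (fun z : ℂ => Real.log (1 + ‖z‖ ^ 2)) z = 4 / (1 + ‖z‖ ^ 2) ^ 2 := by
  have hD : ∀ w : ℂ, (1 + w.re ^ 2 + w.im ^ 2) ≠ 0 := fun w => by positivity
  have hn : ∀ w : ℂ, ‖w‖ ^ 2 = w.re ^ 2 + w.im ^ 2 := by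
    intro w; rw [Complex.sq_norm, Complex.normSq_apply]; ring
  have hre : ∀ w : ℂ, HasFDerivAt (fun w : ℂ => w.re) Complex.reCLM w := fun w => Complex.reCLM.hasFDerivAt
  have him : ∀ w : ℂ, HasFDerivAt (fun w : ℂ => w.im) Complex.imCLM w := fun w => Complex.imCLM.hasFDerivAt
  have hDd : ∀ w : ℂ, HasFDerivAt (fun w : ℂ => 1 + w.re ^ 2 + w.im ^ 2) ((2 * w.re) • Complex.reCLM + (2 * w.im) • Complex.imCLM) w := by
    intro w
    exact ((((hre w).pow 2).const_add 1).add ((him w).pow 2)).congr_fderiv (by ext x; simp)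
  have e0 : (fun z : ℂ => Real.log (1 + ‖z‖ ^ 2)) = fun z : ℂ => Real.log (1 + z.re ^ 2 + z.im ^ 2) := by
    ext w; rw [hn, add_assoc]
  have h1 : ∀ w v : ℂ, fderiv ℝ (fun z : ℂ => Real.log (1 + z.re ^ 2 + z.im ^ 2)) w v =
      (2 * w.re * v.re + 2 * w.im * v.im) / (1 + w.re ^ 2 + w.im ^ 2) := by
    intro w v
    have e2 := (hDd w).log (hD w)
    have e3 : fderiv ℝ (fun z : ℂ => Real.log (1 + z.re ^ 2 + z.im ^ 2)) w = _ := e2.fderiv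
    rw [e3]
    simp; ring
  rw [lapl, e0]
  simp only [h1]
  simp only [Complex.one_re, Complex.one_im, Complex.I_re, Complex.I_im, mul_one, mul_zero, add_zero, zero_add]
  have h2 : fderiv ℝ (fun w : ℂ => 2 * w.re / (1 + w.re ^ 2 + w.im ^ 2)) z 1 =
      (2 * (1 + z.re ^ 2 + z.im ^ 2) - 4 * z.re ^ 2) / (1 + z.re ^ 2 + z.im ^ 2) ^ 2 := by
    have e2 := (((hre z).const_mul 2).mul ((hasDerivAt_inv (hD z)).comp_hasFDerivAt z (hDd z)))
    have e3 : fderiv ℝ (fun w : ℂ => 2 * w.re / (1 + w.re ^ 2 + w.im ^ 2)) z = _ := e2.fderiv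
    rw [e3]
    have := hD z
    simp
    field_simp
    ring
  have h3 : fderiv ℝ (fun w : ℂ => 2 * w.im / (1 + w.re ^ 2 + w.im ^ 2)) z I =
      (2 * (1 + z.re ^ 2 + z.im ^ 2) - 4 * z.im ^ 2) / (1 + z.re ^ 2 + z.im ^ 2) ^ 2 := by
    have e2 := (((him z).const_mul 2).mul ((hasDerivAt_inv (hD z)).comp_hasFDerivAt z (hDd z)))
    have e3 : fderiv ℝ (fun w : ℂ => 2 * w.im / (1 + w.re ^ 2 + w.im ^ 2)) z = _ := e2.fderiv
    rw [e3]
    have := hD z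
    simp
    field_simp
    ring
  rw [h2, h3, hn, ← add_assoc, ← add_div]
  congr 1
  ring

end MF

namespace MF

open Set Filter Topology Complex Metric
open scoped Manifold ContDiff

/-! P22: the theorem in the unit disk -/

lemma exp_sub_le_mul {a b B : ℝ} (ha : a ≤ B) (hb : b ≤ B) : |Real.exp a - Real.exp b| ≤ Real.exp B * |a - b| := by
  have key : ∀ a b : ℝ, a ≤ B → b ≤ a → |Real.exp a - Real.exp b| ≤ Real.exp B * |a - b| := by
    intro a b ha hba
    rw [abs_of_nonneg (sub_nonneg.2 (Real.exp_le_exp.2 hba)), abs_of_nonneg (sub_nonneg.2 hba)]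
    have h1 : Real.exp b = Real.exp a * Real.exp (b - a) := by rw [← Real.exp_add]; ring_nf
    have h2 := Real.add_one_le_exp (b - a)
    have h3 := Real.exp_le_exp.2 ha
    have h4 := Real.exp_pos a
    rw [h1]
    nlinarith [mul_le_mul_of_nonneg_right h3 (sub_nonneg.2 hba)]
  rcases le_total b a with h | h
  · exact key a b ha h
  · rw [abs_sub_comm, abs_sub_comm a b]; exact key b a hb h

theorem disk_main {U : ℂ → ℝ} {lam : ℝ} (hU : ContDiff ℝ 2 U) (h2 : 2 < lam) (h8 : lam ≤ 8)
    (heq : ∀ z, lapl U z = 4 * lam * (1 - Real.exp (U z)) / (1 + ‖z‖ ^ 2) ^ 2)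
    (ha : ∀ z : ℂ, z ≠ 0 → U (-(1 / (starRingEnd ℂ) z)) = U z) (hg : fderiv ℝ U 0 = 0) :
    ∀ z : ℂ, ‖z‖ < 1 → U (-z) = U z := by
  have hl0 : 0 < lam := by linarith
  have hn : ContDiff ℝ 2 (ng U) := hU.comp contDiff_neg
  have hngeq : ∀ z, lapl (ng U) z = 4 * lam * (1 - Real.exp (ng U z)) / (1 + ‖z‖ ^ 2) ^ 2 := by
    intro z; rw [lapl_ng hU, heq, norm_neg]; rfl
  let V : ℂ → ℝ := fun z => Real.log (4 * lam) + -2 * Real.log (1 + ‖z‖ ^ 2)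
  have hV : ContDiff ℝ 2 V := contDiff_const.add (contDiff_const.mul contDiff_logD)
  have hVl : ∀ z, lapl V z = -8 / (1 + ‖z‖ ^ 2) ^ 2 := by
    intro z
    rw [lapl_add contDiffAt_const (contDiffAt_const.mul contDiff_logD.contDiffAt), lapl_const,
      lapl_const_mul _ contDiff_logD.contDiffAt, lapl_logD]
    ring
  have hVe : ∀ z, Real.exp (V z) = 4 * lam / (1 + ‖z‖ ^ 2) ^ 2 := by
    intro z
    have hp : 0 < 1 + ‖z‖ ^ 2 := by positivity
    simp only [V]
    rw [Real.exp_add, Real.exp_log (by positivity), show -2 * Real.log (1 + ‖z‖ ^ 2) = -(Real.log (1 + ‖z‖ ^ 2) + Real.log (1 + ‖z‖ ^ 2)) by ring,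
      Real.exp_neg, Real.exp_add, Real.exp_log hp]
    field_simp
  have hVneg : ∀ z, V (-z) = V z := by intro z; simp [V]
  let W2 : ℂ → ℝ := fun z => U z + V z
  let W1 : ℂ → ℝ := fun z => ng U z + V z
  have hW2 : ContDiff ℝ 2 W2 := hU.add hV
  have hW1 : ContDiff ℝ 2 W1 := hn.add hV
  have hW2e : ∀ z, Real.exp (W2 z) = 4 * lam * Real.exp (U z) / (1 + ‖z‖ ^ 2) ^ 2 := by
    intro z; simp only [W2]; rw [Real.exp_add, hVe]; ring
  have hW1e : ∀ z, Real.exp (W1 z) = 4 * lam * Real.exp (ng U z) / (1 + ‖z‖ ^ 2) ^ 2 := by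
    intro z; simp only [W1]; rw [Real.exp_add, hVe]; ring
  let φ : ℂ → ℝ := fun z => U z - ng U z
  have hφ : ContDiff ℝ 2 φ := hU.sub hn
  have hφl : ∀ z, -lapl φ z = Real.exp (W2 z) - Real.exp (W1 z) := by
    intro z
    rw [lapl_sub hU.contDiffAt hn.contDiffAt, heq, hngeq, hW2e, hW1e]
    ring
  obtain ⟨B, hB⟩ := (isCompact_closedBall (0:ℂ) 1).exists_bound_of_continuousOn hU.continuous.continuousOn
  have hB1 : ∀ z ∈ ball (0:ℂ) 1, U z ≤ B := fun z hz => (le_abs_self _).trans (hB z (ball_subset_closedBall hz))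
  have hB2 : ∀ z ∈ ball (0:ℂ) 1, ng U z ≤ B := fun z hz => hB1 (-z) (by simpa using hz)
  have hDpos : ∀ z : ℂ, 1 ≤ (1 + ‖z‖ ^ 2) ^ 2 := fun z => by nlinarith [sq_nonneg ‖z‖]
  have hD4 : ∀ z ∈ ball (0:ℂ) 1, (1 + ‖z‖ ^ 2) ^ 2 ≤ 4 := fun z hz => by
    rw [mem_ball_zero_iff] at hz
    have h := norm_nonneg z
    have : ‖z‖ ^ 2 ≤ 1 := by nlinarith
    nlinarith [sq_nonneg ‖z‖]
  set E := Real.exp B with hE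
  have hE0 : 0 < E := Real.exp_pos B
  set c0 := 4 * lam * E with hc0
  have hc0p : 0 < c0 := by positivity
  have hlip : ∀ z ∈ ball (0:ℂ) 1, |lapl φ z| ≤ c0 * |φ z| := by
    intro z hz
    rw [← abs_neg, hφl, hW2e, hW1e, ← sub_div, ← mul_sub, abs_div, abs_mul, abs_of_pos (by positivity : 0 < 4 * lam),
      abs_of_pos (by linarith [hDpos z] : 0 < (1 + ‖z‖ ^ 2) ^ 2)]
    have h := exp_sub_le_mul (hB1 z hz) (hB2 z hz)
    refine (div_le_self (by positivity) (hDpos z)).trans ?_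
    calc 4 * lam * |Real.exp (U z) - Real.exp (ng U z)| ≤ 4 * lam * (Real.exp B * |U z - ng U z|) := by gcongr
      _ = c0 * |φ z| := by simp only [hc0, hE, φ]; ring
  have hodd : ∀ z, φ (-z) = - φ z := by intro z; simp [φ, ng]
  have hsup : ∀ z, 0 ≤ φ z → lapl φ z ≤ 0 := by
    intro z hz
    have h1 : ng U z ≤ U z := sub_nonneg.1 hz
    have h2 : Real.exp (W1 z) ≤ Real.exp (W2 z) := Real.exp_le_exp.2 (by simp only [W1, W2]; linarith)
    linarith [hφl z]
  have N : Nod φ c0 := by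
    refine ⟨hφ, hodd, ?_, hc0p, fun z _ => hsup z, ?_⟩
    · intro z hz
      have hz0 : z ≠ 0 := fun h => by rw [h] at hz; simp at hz
      have h := ha z hz0
      have h1 : 1 / (starRingEnd ℂ) z = z := by
        have hee : z * (starRingEnd ℂ) z = 1 := by rw [Complex.mul_conj, Complex.normSq_eq_norm_sq, hz]; simp
        rw [eq_comm, eq_div_iff (right_ne_zero_of_mul_eq_one hee)]; exact hee
      rw [h1] at h
      simp only [φ, ng]; rw [h]; ring
    · intro z hz hp
      have := hlip z hz
      rw [abs_of_pos hp] at this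
      exact (neg_le_abs _).trans this
  have hWbound : ∀ (X : ℂ → ℝ) (W : ℂ → ℝ), ContDiff ℝ 2 X → (∀ z, lapl X z = 4 * lam * (1 - Real.exp (X z)) / (1 + ‖z‖ ^ 2) ^ 2) →
      (∀ z ∈ ball (0:ℂ) 1, X z ≤ B) → (W = fun z => X z + V z) → ∀ z ∈ ball (0:ℂ) 1,
      - lapl W z ≤ (1 - (lam - 2) / (c0 + lam)) * Real.exp (W z) := by
    intro X W hX hXl hXB hW z hz
    have e1 : Real.exp (W z) = 4 * lam * Real.exp (X z) / (1 + ‖z‖ ^ 2) ^ 2 := by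
      rw [hW, Real.exp_add, hVe]; ring
    have e2 : - lapl W z = Real.exp (W z) - 4 * (lam - 2) / (1 + ‖z‖ ^ 2) ^ 2 := by
      rw [e1, hW, lapl_add hX.contDiffAt hV.contDiffAt, hXl, hVl]
      ring
    have hD0 : 0 < (1 + ‖z‖ ^ 2) ^ 2 := by linarith [hDpos z]
    have e3 : lam - 2 ≤ 4 * (lam - 2) / (1 + ‖z‖ ^ 2) ^ 2 := by
      rw [le_div_iff₀ hD0]; nlinarith [hD4 z hz]
    have e4 : Real.exp (W z) ≤ c0 := by
      rw [e1]
      refine (div_le_self (by positivity) (hDpos z)).trans ?_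
      have := Real.exp_le_exp.2 (hXB z hz)
      simp only [hc0, hE]; gcongr
    have e5 : (lam - 2) / (c0 + lam) * Real.exp (W z) ≤ lam - 2 := by
      rw [div_mul_eq_mul_div, div_le_iff₀ (by positivity)]
      nlinarith
    rw [e2]; linarith
  have hκ0 : 0 < 1 - (lam - 2) / (c0 + lam) := by
    rw [sub_pos, div_lt_one (by positivity)]; linarith
  have hκ1 : 1 - (lam - 2) / (c0 + lam) < 1 := by
    have : 0 < (lam - 2) / (c0 + lam) := div_pos (by linarith) (by positivity)
    linarith
  have cW1 : Continuous fun z => Real.exp (W1 z) := Real.continuous_exp.comp hW1.continuous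
  have cW2 : Continuous fun z => Real.exp (W2 z) := Real.continuous_exp.comp hW2.continuous
  have hIntg : ∀ {f : ℂ → ℝ}, Continuous f → ∀ {C : Set ℂ}, C ⊆ ball (0:ℂ) 1 → IntegrableOn f C := by
    intro f hf C hC
    exact (hf.continuousOn.integrableOn_compact (isCompact_closedBall (0:ℂ) 1)).mono_set (hC.trans ball_subset_closedBall)
  have hm : ∀ C, IsN2 φ C → IsPreconnected Cᶜ → 8 * π < ∫ z in C, (Real.exp (W1 z) + Real.exp (W2 z)) := by
    intro C hC hCc
    have hb : C ⊆ ball (0:ℂ) 1 := (IsN2.basic N hC).2.2.2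
    rw [integral_add (hIntg cW1 hb) (hIntg cW2 hb)]
    rcases hC with hC | hC
    · have h12 : ∀ z, W1 z + φ z = W2 z := by intro z; simp only [W1, W2, φ]; ring
      have := sci (hC.isOpen N.smooth.continuous) hC.bdd hCc hC.nonempty hW1 hφ (fun z hz => (hC.sub_ps hz).2) (hC.frontier N)
        (fun z _ => by rw [h12]; exact hφl z) hκ0 hκ1 (fun z hz => hWbound (ng U) W1 hn hngeq hB2 rfl z (hb hz))
      simp only [h12] at this
      exact this
    · have h12 : ∀ z, W2 z + ng φ z = W1 z := by intro z; simp only [W1, W2, φ, ng]; rw [neg_neg]; ring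
      have := sci (hC.isOpen N.neg.smooth.continuous) hC.bdd hCc hC.nonempty hW2 N.neg.smooth (fun z hz => (hC.sub_ps hz).2) (hC.frontier N.neg)
        (fun z _ => by
          have hng : ng φ = fun z => -1 * φ z := by ext z; simp only [ng]; rw [hodd]; ring
          rw [h12, hng, lapl_const_mul _ hφ.contDiffAt]; linarith [hφl z]) hκ0 hκ1 (fun z hz => hWbound U W2 hU heq hB1 rfl z (hb hz))
      simp only [h12] at this
      linarith
  have ht : ∫ z in ball (0:ℂ) 1, (Real.exp (W1 z) + Real.exp (W2 z)) ≤ 32 * π := by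
    rw [integral_add (hIntg cW1 subset_rfl) (hIntg cW2 subset_rfl)]
    have hcD : Continuous fun z : ℂ => 1 / (1 + ‖z‖ ^ 2) ^ 2 :=
      continuous_const.div (by fun_prop) (fun z => by positivity)
    have e1 : ∫ z in ball (0:ℂ) 1, Real.exp (W2 z) = 2 * π * lam := by
      have q1 : ∀ z, Real.exp (W2 z) = 4 * lam * (1 / (1 + ‖z‖ ^ 2) ^ 2) - lapl U z := by
        intro z; rw [hW2e, heq]; ring
      have cl : Continuous (lapl U) := by
        have := cont_lapl isOpen_univ hU.contDiffOn
        exact continuousOn_univ.1 this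
      simp_rw [q1]
      rw [integral_sub ((hIntg hcD subset_rfl).const_mul _) (hIntg cl subset_rfl), integral_const_mul, int_D, int_lapl_zero hU ha]
      ring
    have e2 : ∫ z in ball (0:ℂ) 1, Real.exp (W1 z) = ∫ z in ball (0:ℂ) 1, Real.exp (W2 z) := by
      have q1 : ∀ z, W1 z = W2 (-z) := by intro z; simp only [W1, W2, ng]; rw [hVneg]
      simp_rw [q1]
      rw [← integral_indicator measurableSet_ball, ← integral_indicator measurableSet_ball,
        ← integral_neg_eq_self (fun z => (ball (0:ℂ) 1).indicator (fun z => Real.exp (W2 z)) z)]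
      congr 1
      ext z
      by_cases hz : z ∈ ball (0:ℂ) 1
      · rw [indicator_of_mem hz, indicator_of_mem (by simpa using hz)]
      · rw [indicator_of_notMem hz, indicator_of_notMem (by simpa using hz)]
    rw [e2, e1]
    nlinarith [Real.pi_pos]
  have hφ0 : φ 0 = 0 := by simp [φ, ng]
  rcases local0 hφ one_pos hc0p.le hlip hφ0 with hz | ⟨n, c, hc, M, r, hM, hr, hloc⟩
  · intro z hz1
    have := ucont hφ isOpen_ball (convex_ball (0:ℂ) 1).isPreconnected hc0p.le hlip (z0 := 0) (by simp) hz z (by simpa using hz1)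
    simp only [φ, ng] at this
    linarith
  · exfalso
    have hnn : n ≠ 0 := by
      intro h
      subst h
      have h1 := (hloc 0 (by simpa using hr)).1
      have h3 : fderiv ℝ φ 0 = 0 := by
        have a1 : HasFDerivAt U (0 : ℂ →L[ℝ] ℝ) 0 := by
          rw [← hg]; exact (hU.differentiable two_ne_zero 0).hasFDerivAt
        have a2 : HasFDerivAt (ng U) (0 : ℂ →L[ℝ] ℝ) 0 := by
          have b1 : HasFDerivAt U (0 : ℂ →L[ℝ] ℝ) (-(0:ℂ)) := by rw [neg_zero]; exact a1
          have := b1.comp (0:ℂ) (hasFDerivAt_id (𝕜 := ℝ) (0:ℂ)).neg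
          rw [ContinuousLinearMap.zero_comp] at this
          exact this
        have a3 := a1.sub a2
        rw [sub_zero] at a3
        exact a3.fderiv
      have h2 : dd φ 0 = 0 := by simp [dd, h3]
      rw [h2] at h1
      simp at h1
      exact hc h1
    refine no_branch N (fun C1 C2 a b c d => unique_comp N (cW1.add cW2) (fun z => add_nonneg (Real.exp_nonneg _) (Real.exp_nonneg _)) hm ht a b c d)
      (A := 2 * c / (n + 1)) (k := n + 1) (M := M) (r := r) (by omega) ?_ hM hr ?_
    · have : (n + 1 : ℂ) ≠ 0 := by exact_mod_cast Nat.succ_ne_zero n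
      exact div_ne_zero (mul_ne_zero two_ne_zero hc) this
    · intro z hz
      exact (hloc z hz).2

end MF

namespace MF

open Set Filter Topology Complex Metric
open scoped Manifold ContDiff

/-! P23: stereographic charts -/

lemma chart_lapl {w : ℝ × ℝ → ℝ} (hw : ContDiff ℝ 2 w) {ε : ℝ} (hε : ε ^ 2 = 1) :
    ContDiff ℝ 2 (fun z : ℂ => w (z.re, ε * z.im)) ∧
    (∀ z : ℂ, lapl (fun z : ℂ => w (z.re, ε * z.im)) z = lap w (z.re, ε * z.im)) ∧
    (∀ z : ℂ, fderiv ℝ w (z.re, ε * z.im) = 0 → fderiv ℝ (fun z : ℂ => w (z.re, ε * z.im)) z = 0) := by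
  let e : ℂ →L[ℝ] ℝ × ℝ := Complex.reCLM.prod (ε • Complex.imCLM)
  have he : ∀ z : ℂ, e z = (z.re, ε * z.im) := by intro z; simp [e]
  have hF : (fun z : ℂ => w (z.re, ε * z.im)) = fun z => w (e z) := by ext z; rw [he]
  have hw1 : ContDiff ℝ 1 (fderiv ℝ w) := hw.fderiv_right (by norm_num)
  have hd : ∀ z, fderiv ℝ (fun z => w (e z)) z = (fderiv ℝ w (e z)).comp e := by
    intro z
    exact ((hw.differentiable two_ne_zero (e z)).hasFDerivAt.comp z e.hasFDerivAt).fderiv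
  refine ⟨?_, ?_, ?_⟩
  · rw [hF]; exact hw.comp e.contDiff
  · intro z
    rw [hF, ← he, lap, iteratedFDeriv_two_apply, iteratedFDeriv_two_apply, lapl]
    have h1 : ∀ v x : ℂ, fderiv ℝ (fun y => fderiv ℝ (fun z => w (e z)) y v) z x = fderiv ℝ (fderiv ℝ w) (e z) (e x) (e v) := by
      intro v x
      have h2 : (fun y => fderiv ℝ (fun z => w (e z)) y v) = fun y => fderiv ℝ w (e y) (e v) := by
        ext y; rw [hd]; rfl
      have h3 := (((hw1.differentiable one_ne_zero (e z)).hasFDerivAt.comp z e.hasFDerivAt).clm_apply (hasFDerivAt_const (e v) z))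
      rw [h2]
      have e3 : fderiv ℝ (fun y => fderiv ℝ w (e y) (e v)) z = _ := h3.fderiv
      rw [e3]; simp
    rw [h1, h1]
    have e1 : e 1 = (1, 0) := by rw [he]; simp
    have e2 : e I = ε • ((0:ℝ), (1:ℝ)) := by rw [he]; simp
    rw [e1, e2]
    simp only [map_smul, ContinuousLinearMap.smul_apply, smul_eq_mul]
    simp only [Matrix.cons_val_zero, Matrix.cons_val_one]
    rw [← mul_assoc, ← sq, hε, one_mul]
  · intro z hz
    rw [hF, hd, he, hz, ContinuousLinearMap.zero_comp]

def Sg (p q : ℂ) : Fin 3 → ℝ :=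
  ![2 * (p * (starRingEnd ℂ) q).re / (normSq p + normSq q), 2 * (p * (starRingEnd ℂ) q).im / (normSq p + normSq q),
    (normSq p - normSq q) / (normSq p + normSq q)]

lemma Sg_scale (p q : ℂ) {c : ℂ} (hc : c ≠ 0) : Sg (p * c) (q * c) = Sg p q := by
  have hc' : normSq c ≠ 0 := (normSq_pos.2 hc).ne'
  have h1 : p * c * (starRingEnd ℂ) (q * c) = (normSq c : ℝ) * (p * (starRingEnd ℂ) q) := by
    rw [map_mul, ← Complex.mul_conj]; ring
  simp only [Sg]
  rw [h1]
  simp only [map_mul, Complex.re_ofReal_mul, Complex.im_ofReal_mul, ← add_mul, ← sub_mul]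
  have h2 : ∀ t : ℝ, 2 * (normSq c * t) = 2 * t * normSq c := fun t => by ring
  rw [h2, h2, mul_div_mul_right _ _ hc', mul_div_mul_right _ _ hc', mul_div_mul_right _ _ hc']

lemma Sg_N (p : ℂ) {q : ℂ} (hq : q ≠ 0) : Sg p q = stereoN ((p / q).re, (p / q).im) := by
  have h : Sg p q = Sg (p / q) 1 := by
    rw [← Sg_scale (p / q) 1 hq, div_mul_cancel₀ _ hq, one_mul]
  rw [h]
  generalize p / q = y
  simp only [Sg, stereoN, map_one, mul_one, Complex.normSq_apply]
  have e : y.re * y.re + y.im * y.im + 1 = 1 + y.re ^ 2 + y.im ^ 2 := by ring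
  rw [e]
  congr 3
  ring_nf

lemma Sg_S {p : ℂ} (q : ℂ) (hp : p ≠ 0) : Sg p q = stereoS ((q / p).re, -1 * (q / p).im) := by
  have h : Sg p q = Sg 1 (q / p) := by
    rw [← Sg_scale 1 (q / p) hp, div_mul_cancel₀ _ hp, one_mul]
  rw [h]
  generalize q / p = y
  simp only [Sg, stereoS, map_one, one_mul, Complex.normSq_apply, Complex.conj_re, Complex.conj_im]
  have e : 1 + (y.re * y.re + y.im * y.im) = 1 + y.re ^ 2 + (-1 * y.im) ^ 2 := by ring
  rw [e, neg_one_mul]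
  congr 3
  ring_nf

lemma Sg_anti (p q : ℂ) : Sg (-(starRingEnd ℂ) q) ((starRingEnd ℂ) p) = - Sg p q := by
  have e : -(starRingEnd ℂ) q * p = -(p * (starRingEnd ℂ) q) := by ring
  ext j
  fin_cases j
  · simp [Sg, e, -neg_mul]
    ring
  · simp [Sg, e, -neg_mul]
    ring
  · simp [Sg]
    ring

lemma Sg_mem {p q : ℂ} (h : normSq p + normSq q ≠ 0) : Sg p q ∈ sphere3 := by
  have hn : (p * (starRingEnd ℂ) q).re ^ 2 + (p * (starRingEnd ℂ) q).im ^ 2 = normSq p * normSq q := by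
    have := Complex.normSq_apply (p * (starRingEnd ℂ) q)
    rw [map_mul, Complex.normSq_conj] at this
    rw [this]; ring
  simp only [sphere3, mem_setOf_eq, Sg, Matrix.cons_val_zero, Matrix.cons_val_one, Matrix.cons_val]
  rw [div_pow, div_pow, div_pow, ← add_div, ← add_div, div_eq_one_iff_eq (pow_ne_zero 2 h)]
  linear_combination 4 * hn

lemma exists_spin {x : Fin 3 → ℝ} (hx : x ∈ sphere3) :
    ∃ (a : ℝ) (b : ℂ), a ^ 2 + normSq b = 1 ∧ 2 * a * b.re = x 0 ∧ 2 * a * b.im = x 1 ∧ normSq b - a ^ 2 = x 2 ∧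
      (x = ![0, 0, 1] → a = 0 ∧ b = 1) ∧ (x ≠ ![0, 0, 1] → a ≠ 0 ∧ (b / a).re = x 0 / (1 - x 2) ∧ (b / a).im = x 1 / (1 - x 2)) := by
  have hx' : x 0 ^ 2 + x 1 ^ 2 + x 2 ^ 2 = 1 := hx
  by_cases h : x = ![0, 0, 1]
  · refine ⟨0, 1, by simp, ?_, ?_, ?_, fun _ => ⟨rfl, rfl⟩, fun h' => absurd h h'⟩ <;> rw [h] <;> simp
  · have h1 : x 2 < 1 := by
      by_contra hc
      push Not at hc
      apply h
      have e0 : x 0 = 0 := by nlinarith [sq_nonneg (x 0), sq_nonneg (x 1)]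
      have e1 : x 1 = 0 := by nlinarith [sq_nonneg (x 0), sq_nonneg (x 1)]
      have e2 : x 2 = 1 := by nlinarith [sq_nonneg (x 0), sq_nonneg (x 1)]
      ext j
      fin_cases j
      · exact e0
      · exact e1
      · exact e2
    set a := Real.sqrt ((1 - x 2) / 2) with ha
    have ha2 : a ^ 2 = (1 - x 2) / 2 := Real.sq_sqrt (by linarith)
    have ha0 : 0 < a := Real.sqrt_pos.2 (by linarith)
    have h12 : 1 - x 2 ≠ 0 := by linarith
    have hnb : normSq (⟨x 0 / (2 * a), x 1 / (2 * a)⟩ : ℂ) = (1 + x 2) / 2 := by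
      have e : normSq (⟨x 0 / (2 * a), x 1 / (2 * a)⟩ : ℂ) = (x 0 ^ 2 + x 1 ^ 2) / (4 * a ^ 2) := by
        rw [Complex.normSq_apply]; field_simp; ring
      rw [e, ha2, div_eq_div_iff (by linarith) (by norm_num)]
      linear_combination 2 * hx'
    refine ⟨a, ⟨x 0 / (2 * a), x 1 / (2 * a)⟩, ?_, ?_, ?_, ?_, fun h' => absurd h' h, fun _ => ⟨ha0.ne', ?_, ?_⟩⟩
    · rw [hnb, ha2]; ring
    · field_simp
    · field_simp
    · rw [hnb, ha2]; ring
    · rw [Complex.div_ofReal_re]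
      simp only
      rw [div_div, show 2 * a * a = 1 - x 2 by linear_combination 2 * ha2]
    · rw [Complex.div_ofReal_im]
      simp only
      rw [div_div, show 2 * a * a = 1 - x 2 by linear_combination 2 * ha2]

end MF

namespace MF

open Set Filter Topology Complex Metric
open scoped Manifold ContDiff


/-! P24: pulling back by a rotation -/

lemma chart_pull {F U : ℂ → ℝ} {lam : ℝ} (hF : ContDiff ℝ 2 F)
    (hl : ∀ w, lapl F w = 4 * lam * (1 - Real.exp (F w)) / (1 + ‖w‖ ^ 2) ^ 2)
    {g : ℂ → ℂ} {z q : ℂ} (hg : AnalyticAt ℂ g z) (hq : q ≠ 0) (hd : ‖deriv g z‖ = 1 / ‖q‖ ^ 2)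
    (hn : 1 + ‖g z‖ ^ 2 = (1 + ‖z‖ ^ 2) / ‖q‖ ^ 2) (hU : U =ᶠ[𝓝 z] fun w => F (g w)) :
    ContDiffAt ℝ 2 U z ∧ lapl U z = 4 * lam * (1 - Real.exp (U z)) / (1 + ‖z‖ ^ 2) ^ 2 := by
  constructor
  · refine ContDiffAt.congr_of_eventuallyEq ?_ hU
    exact hF.contDiffAt.comp z (contDiffAt_real_of_hol hg)
  · rw [lapl_congr hU, lapl_comp hg hF.contDiffAt, hl, hU.eq_of_nhds, hd, hn]
    have h1 : ‖q‖ ≠ 0 := norm_ne_zero_iff.2 hq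
    have h2 : (1 + ‖z‖ ^ 2) ≠ 0 := by positivity
    field_simp

def rp (a : ℝ) (b z : ℂ) : ℂ := a * z + b
def rq (a : ℝ) (b z : ℂ) : ℂ := a - (starRingEnd ℂ) b * z

lemma rnorm {a : ℝ} {b : ℂ} (h : a ^ 2 + normSq b = 1) (z : ℂ) :
    normSq (rp a b z) + normSq (rq a b z) = 1 + normSq z := by
  simp only [rp, rq, Complex.normSq_apply] at h ⊢
  simp
  linear_combination (1 + z.re * z.re + z.im * z.im) * h

lemma rdet {a : ℝ} {b : ℂ} (h : a ^ 2 + normSq b = 1) : (a : ℂ) * a + b * (starRingEnd ℂ) b = 1 := by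
  rw [Complex.mul_conj]
  have : ((a ^ 2 + normSq b : ℝ) : ℂ) = 1 := by rw [h]; simp
  rw [← this]; push_cast; ring

lemma rp_deriv (a : ℝ) (b z : ℂ) : HasDerivAt (rp a b) a z := by
  have := ((hasDerivAt_id z).const_mul (a : ℂ)).add_const b
  rw [mul_one] at this
  exact this

lemma rq_deriv (a : ℝ) (b z : ℂ) : HasDerivAt (rq a b) (-(starRingEnd ℂ) b) z := by
  have := ((hasDerivAt_id z).const_mul ((starRingEnd ℂ) b)).const_sub (a : ℂ)
  rw [mul_one] at this
  exact this

lemma rp_an (a : ℝ) (b z : ℂ) : AnalyticAt ℂ (rp a b) z :=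
  (analyticAt_const.mul analyticAt_id).add analyticAt_const

lemma rq_an (a : ℝ) (b z : ℂ) : AnalyticAt ℂ (rq a b) z :=
  analyticAt_const.sub (analyticAt_const.mul analyticAt_id)

lemma norm_quot {p q z : ℂ} (h : normSq p + normSq q = 1 + normSq z) (hq : q ≠ 0) :
    1 + ‖p / q‖ ^ 2 = (1 + ‖z‖ ^ 2) / ‖q‖ ^ 2 := by
  have h1 : ‖q‖ ≠ 0 := norm_ne_zero_iff.2 hq
  simp only [Complex.normSq_eq_norm_sq] at h
  rw [norm_div, ← h]
  field_simp
  ring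

lemma pull_all {lam : ℝ} {u : (Fin 3 → ℝ) → ℝ} (hu : IsMFSolution lam u) {a : ℝ} {b : ℂ}
    (h : a ^ 2 + normSq b = 1) :
    ContDiff ℝ 2 (fun z => u (Sg (rp a b z) (rq a b z))) ∧
    (∀ z, lapl (fun z => u (Sg (rp a b z) (rq a b z))) z =
      4 * lam * (1 - Real.exp (u (Sg (rp a b z) (rq a b z)))) / (1 + ‖z‖ ^ 2) ^ 2) := by
  obtain ⟨-, hN, hS, hlN, hlS⟩ := hu
  obtain ⟨cN, lN, -⟩ := chart_lapl hN (ε := 1) (by norm_num)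
  obtain ⟨cS, lS, -⟩ := chart_lapl hS (ε := -1) (by norm_num)
  have key : ∀ z, ContDiffAt ℝ 2 (fun z => u (Sg (rp a b z) (rq a b z))) z ∧
      lapl (fun z => u (Sg (rp a b z) (rq a b z))) z =
      4 * lam * (1 - Real.exp (u (Sg (rp a b z) (rq a b z)))) / (1 + ‖z‖ ^ 2) ^ 2 := by
    intro z
    have hsum := rnorm h z
    have hdet := rdet h
    by_cases hq : rq a b z = 0
    · have hp : rp a b z ≠ 0 := by
        intro hp
        rw [hp, hq] at hsum
        simp only [map_zero] at hsum
        have := normSq_nonneg z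
        linarith
      have hd : HasDerivAt (fun w => rq a b w / rp a b w) (-1 / rp a b z ^ 2) z := by
        have e : -1 = -(starRingEnd ℂ) b * rp a b z - rq a b z * a := by
          simp only [rp, rq]; linear_combination hdet
        rw [e]
        exact (rq_deriv a b z).div (rp_deriv a b z) hp
      refine chart_pull (g := fun w => rq a b w / rp a b w) (q := rp a b z) cS ?_ ((rq_an a b z).div (rp_an a b z) hp) hp ?_ ?_ ?_
      · intro w
        rw [lS, hlS]
        congr 2
        rw [← Complex.normSq_eq_norm_sq, Complex.normSq_apply]; ring
      · rw [hd.deriv]; simp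
      · exact norm_quot (by rw [add_comm]; exact hsum) hp
      · have := (rp_an a b z).continuousAt.eventually_ne hp
        filter_upwards [this] with w hw
        rw [Sg_S _ hw]
    · have hd : HasDerivAt (fun w => rp a b w / rq a b w) (1 / rq a b z ^ 2) z := by
        have e : 1 = a * rq a b z - rp a b z * -(starRingEnd ℂ) b := by
          simp only [rp, rq]; linear_combination -hdet
        rw [e]
        exact (rp_deriv a b z).div (rq_deriv a b z) hq
      refine chart_pull (g := fun w => rp a b w / rq a b w) (q := rq a b z) cN ?_ ((rp_an a b z).div (rq_an a b z) hq) hq ?_ ?_ ?_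
      · intro w
        rw [lN, hlN]
        congr 2
        rw [← Complex.normSq_eq_norm_sq, Complex.normSq_apply]; ring
      · rw [hd.deriv]; simp
      · exact norm_quot hsum hq
      · have := (rq_an a b z).continuousAt.eventually_ne hq
        filter_upwards [this] with w hw
        rw [Sg_N _ hw, one_mul]
  exact ⟨contDiff_iff_contDiffAt.2 fun z => (key z).1, fun z => (key z).2⟩

lemma pull_crit {lam : ℝ} {u : (Fin 3 → ℝ) → ℝ} (hu : IsMFSolution lam u) {a : ℝ} {b : ℂ} {P : Fin 3 → ℝ}
    (hcritN : P ≠ ![0, 0, 1] →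
      fderiv ℝ (fun y => u (stereoN y)) (P 0 / (1 - P 2), P 1 / (1 - P 2)) = 0)
    (hcritS : P = ![0, 0, 1] →
      fderiv ℝ (fun y => u (stereoS y)) (0, 0) = 0)
    (h1 : P = ![0, 0, 1] → a = 0 ∧ b = 1)
    (h2 : P ≠ ![0, 0, 1] → a ≠ 0 ∧ (b / a).re = P 0 / (1 - P 2) ∧ (b / a).im = P 1 / (1 - P 2)) :
    fderiv ℝ (fun z => u (Sg (rp a b z) (rq a b z))) 0 = 0 := by
  obtain ⟨-, hN, hS, hlN, hlS⟩ := hu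
  obtain ⟨cN, -, dN⟩ := chart_lapl hN (ε := 1) (by norm_num)
  obtain ⟨cS, -, dS⟩ := chart_lapl hS (ε := -1) (by norm_num)
  have gen : ∀ {F : ℂ → ℝ} {g : ℂ → ℂ}, ContDiff ℝ 2 F → AnalyticAt ℂ g 0 →
      (fun z => u (Sg (rp a b z) (rq a b z))) =ᶠ[𝓝 0] (fun w => F (g w)) → fderiv ℝ F (g 0) = 0 →
      fderiv ℝ (fun z => u (Sg (rp a b z) (rq a b z))) 0 = 0 := by
    intro F g hF hg he h0
    rw [he.fderiv_eq]
    have e2 := ((hF.differentiable two_ne_zero (g 0)).hasFDerivAt.comp (0:ℂ)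
      ((contDiffAt_real_of_hol (n := 1) hg).differentiableAt one_ne_zero).hasFDerivAt)
    have e3 : fderiv ℝ (fun w => F (g w)) 0 = _ := e2.fderiv
    rw [e3, h0, ContinuousLinearMap.zero_comp]
  by_cases hP : P = ![0, 0, 1]
  · obtain ⟨rfl, rfl⟩ := h1 hP
    have hp : rp 0 1 0 ≠ 0 := by simp [rp]
    refine gen (g := fun w => rq 0 1 w / rp 0 1 w) cS ((rq_an 0 1 0).div (rp_an 0 1 0) hp) ?_ ?_
    · have := (rp_an 0 1 0).continuousAt.eventually_ne hp
      filter_upwards [this] with w hw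
      rw [Sg_S _ hw]
    · apply dS
      simpa [rp, rq] using hcritS hP
  · obtain ⟨ha, e0, e1⟩ := h2 hP
    have hq : rq a b 0 ≠ 0 := by simpa [rq] using ha
    refine gen (g := fun w => rp a b w / rq a b w) cN ((rp_an a b 0).div (rq_an a b 0) hq) ?_ ?_
    · have := (rq_an a b 0).continuousAt.eventually_ne hq
      filter_upwards [this] with w hw
      rw [Sg_N _ hw, one_mul]
    · apply dN
      have e : rp a b 0 / rq a b 0 = b / a := by simp [rp, rq]
      rw [e, e0, e1, one_mul]
      exact hcritN hP

lemma Sg_antipode (a : ℝ) (b : ℂ) {z : ℂ} (hz : z ≠ 0) :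
    Sg (rp a b (-(1 / (starRingEnd ℂ) z))) (rq a b (-(1 / (starRingEnd ℂ) z))) = - Sg (rp a b z) (rq a b z) := by
  have hz' : (starRingEnd ℂ) z ≠ 0 := by simpa using hz
  rw [← Sg_anti, ← Sg_scale _ _ hz']
  congr 1
  · simp [rp, rq]; field_simp; ring
  · simp [rp, rq]; field_simp

lemma Sg_reflect {a : ℝ} {b : ℂ} (h : a ^ 2 + normSq b = 1) {P : Fin 3 → ℝ}
    (h0 : 2 * a * b.re = P 0) (h1 : 2 * a * b.im = P 1) (h2 : normSq b - a ^ 2 = P 2) (z : ℂ) :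
    (fun j => Sg (rp a b z) (rq a b z) j - 2 * (Sg (rp a b z) (rq a b z) 0 * P 0 + Sg (rp a b z) (rq a b z) 1 * P 1
      + Sg (rp a b z) (rq a b z) 2 * P 2) * P j) = - Sg (rp a b (-z)) (rq a b (-z)) := by
  have hs := rnorm h z
  have hs' := rnorm h (-z)
  rw [Complex.normSq_neg] at hs'
  have hpos : 1 + normSq z ≠ 0 := by have := normSq_nonneg z; positivity
  simp only [Sg, hs, hs']
  have hn := h
  rw [Complex.normSq_apply] at hn h2
  have hdot : 2 * (rp a b z * (starRingEnd ℂ) (rq a b z)).re * P 0 + 2 * (rp a b z * (starRingEnd ℂ) (rq a b z)).im * P 1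
      + (normSq (rp a b z) - normSq (rq a b z)) * P 2 = 1 - normSq z := by
    rw [← h0, ← h1, ← h2]
    simp only [rp, rq, Complex.normSq_apply]
    simp
    linear_combination (1 - z.re * z.re - z.im * z.im) * (a ^ 2 + (b.re * b.re + b.im * b.im) + 1) * hn
  have e0 : 2 * (rp a b z * (starRingEnd ℂ) (rq a b z)).re + 2 * (rp a b (-z) * (starRingEnd ℂ) (rq a b (-z))).re
      = 2 * (1 - normSq z) * P 0 := by
    rw [← h0]
    simp only [rp, rq, Complex.normSq_apply]
    simp
    ring
  have e1 : 2 * (rp a b z * (starRingEnd ℂ) (rq a b z)).im + 2 * (rp a b (-z) * (starRingEnd ℂ) (rq a b (-z))).im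
      = 2 * (1 - normSq z) * P 1 := by
    rw [← h1]
    simp only [rp, rq, Complex.normSq_apply]
    simp
    ring
  have e2 : (normSq (rp a b z) - normSq (rq a b z)) + (normSq (rp a b (-z)) - normSq (rq a b (-z)))
      = 2 * (1 - normSq z) * P 2 := by
    rw [← h2]
    simp only [rp, rq, Complex.normSq_apply]
    simp
    ring
  generalize (rp a b z * (starRingEnd ℂ) (rq a b z)).re = A0 at *
  generalize (rp a b z * (starRingEnd ℂ) (rq a b z)).im = A1 at *
  generalize (rp a b (-z) * (starRingEnd ℂ) (rq a b (-z))).re = B0 at *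
  generalize (rp a b (-z) * (starRingEnd ℂ) (rq a b (-z))).im = B1 at *
  generalize normSq (rp a b z) - normSq (rq a b z) = A2 at *
  generalize normSq (rp a b (-z)) - normSq (rq a b (-z)) = B2 at *
  ext j
  simp only [Matrix.cons_val_zero, Matrix.cons_val_one, Matrix.cons_val, Pi.neg_apply]
  have hd : 2 * A0 / (1 + normSq z) * P 0 + 2 * A1 / (1 + normSq z) * P 1 + A2 / (1 + normSq z) * P 2
      = (1 - normSq z) / (1 + normSq z) := by
    rw [← hdot]; ring
  rw [hd]
  fin_cases j
  · simp
    linear_combination (1 + normSq z)⁻¹ * e0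
  · simp
    linear_combination (1 + normSq z)⁻¹ * e1
  · simp
    linear_combination (1 + normSq z)⁻¹ * e2

lemma Sg_surj {a a' : ℝ} {b b' : ℂ} (h : a ^ 2 + normSq b = 1) {P x : Fin 3 → ℝ}
    (h0 : 2 * a * b.re = P 0) (h1 : 2 * a * b.im = P 1) (h2 : normSq b - a ^ 2 = P 2)
    (h' : a' ^ 2 + normSq b' = 1)
    (h0' : 2 * a' * b'.re = x 0) (h1' : 2 * a' * b'.im = x 1) (h2' : normSq b' - a' ^ 2 = x 2)
    (hpos : 0 < x 0 * P 0 + x 1 * P 1 + x 2 * P 2) :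
    ∃ z : ℂ, ‖z‖ < 1 ∧ Sg (rp a b z) (rq a b z) = x := by
  set w : ℂ := (starRingEnd ℂ) b * b' + a * a' with hw
  set v : ℂ := a * b' - b * a' with hv
  have hdot : x 0 * P 0 + x 1 * P 1 + x 2 * P 2 = normSq w - normSq v := by
    rw [← h0, ← h1, ← h2, ← h0', ← h1', ← h2', hw, hv]
    simp only [Complex.normSq_apply]
    simp
    ring
  have hlt : normSq v < normSq w := by linarith
  have hw0 : w ≠ 0 := by
    intro hc
    rw [hc, map_zero] at hlt
    exact absurd (normSq_nonneg v) (not_le.2 hlt)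
  have hdet := rdet h
  refine ⟨v / w, ?_, ?_⟩
  · rw [norm_div, div_lt_one (norm_pos_iff.2 hw0)]
    rw [Complex.normSq_eq_norm_sq, Complex.normSq_eq_norm_sq] at hlt
    exact lt_of_pow_lt_pow_left₀ 2 (norm_nonneg _) hlt
  · rw [← Sg_scale _ _ hw0]
    have e1 : rp a b (v / w) * w = b' := by
      rw [rp, add_mul, mul_assoc, div_mul_cancel₀ _ hw0, hv, hw]
      linear_combination b' * hdet
    have e2 : rq a b (v / w) * w = a' := by
      rw [rq, sub_mul, mul_assoc, div_mul_cancel₀ _ hw0, hv, hw]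
      linear_combination a' * hdet
    rw [e1, e2]
    have e3 : normSq b' + normSq (a' : ℂ) = 1 := by
      rw [Complex.normSq_ofReal, ← h']; ring
    ext j
    simp only [Sg, e3, div_one]
    fin_cases j
    · simp [← h0']; ring
    · simp [← h1']; ring
    · simp [← h2']; ring

theorem final
    (lam : ℝ) (hlam₁ : 2 < lam) (hlam₂ : lam ≤ 8)
    (u : (Fin 3 → ℝ) → ℝ) (hu : IsMFSolution lam u)
    (heven : ∀ x ∈ sphere3, u (-x) = u x)
    (P : Fin 3 → ℝ) (hP : P ∈ sphere3)
    (hcritN : P ≠ ![0, 0, 1] →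
      fderiv ℝ (fun y => u (stereoN y)) (P 0 / (1 - P 2), P 1 / (1 - P 2)) = 0)
    (hcritS : P = ![0, 0, 1] →
      fderiv ℝ (fun y => u (stereoS y)) (0, 0) = 0) :
    ∀ x ∈ sphere3,
      u (fun j => x j - 2 * (x 0 * P 0 + x 1 * P 1 + x 2 * P 2) * P j) = u x := by
  obtain ⟨a, b, h, h0, h1, h2, h3, h4⟩ := exists_spin hP
  have hmem : ∀ z, Sg (rp a b z) (rq a b z) ∈ sphere3 := by
    intro z
    apply Sg_mem
    rw [rnorm h]
    have := normSq_nonneg z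
    positivity
  obtain ⟨hc, hl⟩ := pull_all hu h
  have hcr := pull_crit hu hcritN hcritS h3 h4
  have main := disk_main hc hlam₁ hlam₂ hl (by
    intro z hz
    rw [Sg_antipode a b hz, heven _ (hmem z)]) hcr
  have pos : ∀ x ∈ sphere3, 0 < x 0 * P 0 + x 1 * P 1 + x 2 * P 2 →
      u (fun j => x j - 2 * (x 0 * P 0 + x 1 * P 1 + x 2 * P 2) * P j) = u x := by
    intro x hx hpos
    obtain ⟨a', b', h', h0', h1', h2', -, -⟩ := exists_spin hx
    obtain ⟨z, hz, rfl⟩ := Sg_surj h h0 h1 h2 h' h0' h1' h2' hpos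
    rw [Sg_reflect h h0 h1 h2 z, heven _ (hmem _)]
    exact main z hz
  intro x hx
  rcases lt_trichotomy (x 0 * P 0 + x 1 * P 1 + x 2 * P 2) 0 with hn | hn | hn
  · have hx1 : x 0 ^ 2 + x 1 ^ 2 + x 2 ^ 2 = 1 := hx
    have hP1 : P 0 ^ 2 + P 1 ^ 2 + P 2 ^ 2 = 1 := hP
    have hx' : -x ∈ sphere3 := by
      change (-x) 0 ^ 2 + (-x) 1 ^ 2 + (-x) 2 ^ 2 = 1
      simp only [Pi.neg_apply]; linear_combination hx1
    have := pos (-x) hx' (by simp only [Pi.neg_apply]; linarith)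
    rw [heven x hx] at this
    rw [← this]
    have hr : (fun j => x j - 2 * (x 0 * P 0 + x 1 * P 1 + x 2 * P 2) * P j) ∈ sphere3 := by
      change (x 0 - 2 * (x 0 * P 0 + x 1 * P 1 + x 2 * P 2) * P 0) ^ 2 + (x 1 - 2 * (x 0 * P 0 + x 1 * P 1 + x 2 * P 2) * P 1) ^ 2
        + (x 2 - 2 * (x 0 * P 0 + x 1 * P 1 + x 2 * P 2) * P 2) ^ 2 = 1
      linear_combination hx1 + 4 * (x 0 * P 0 + x 1 * P 1 + x 2 * P 2) ^ 2 * hP1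
    rw [← heven _ hr]
    congr 1
    ext j
    simp only [Pi.neg_apply]
    ring
  · congr 1
    ext j
    rw [hn]; ring
  · exact pos x hx hn

end MF

/-- If `2 < λ ≤ 8`, `u` is an even solution of the mean field equation on `S²`,
and `P ∈ S²` is a critical point of `u` (in the appropriate stereographic chart), then `u` is
evenly symmetric about the plane through the origin orthogonal to `P`. -/
theorem even_solution_symmetric_about_critical_plane
    (lam : ℝ) (hlam₁ : 2 < lam) (hlam₂ : lam ≤ 8)
    (u : (Fin 3 → ℝ) → ℝ) (hu : IsMFSolution lam u)
    (heven : ∀ x ∈ sphere3, u (-x) = u x)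
    (P : Fin 3 → ℝ) (hP : P ∈ sphere3)
    (hcritN : P ≠ ![0, 0, 1] →
      fderiv ℝ (fun y => u (stereoN y)) (P 0 / (1 - P 2), P 1 / (1 - P 2)) = 0)
    (hcritS : P = ![0, 0, 1] →
      fderiv ℝ (fun y => u (stereoS y)) (0, 0) = 0) :
    ∀ x ∈ sphere3,
      u (fun j => x j - 2 * (x 0 * P 0 + x 1 * P 1 + x 2 * P 2) * P j) = u x := by
  exact MF.final lam hlam₁ hlam₂ u hu heven P hP hcritN hcritS
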